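/- Let n ≥ 2 be an even integer. The complex vector space of all continuous, translation invariant, SU(n)-invariant valuations on the convex bodies of ℂⁿ is finite-dimensional, of dimension (n² + 3n + 10)/2. -/

import Mathlib

open MeasureTheory
open scoped ENNReal

noncomputable section

/-- `ℂⁿ`, regarded as a real inner product space via `Re⟨z,w⟫`. -/
abbrev Cn (n : ℕ) := EuclideanSpace ℂ (Fin n)

/-- `μ` is a valuation: it is finitely additive on convex bodies of `ℂⁿ`. -/
def IsValuation {n : ℕ} (μ : ConvexBody (Cn n) → ℂ) : Prop :=
  ∀ K L U I : ConvexBody (Cn n),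
    (U : Set (Cn n)) = (K : Set (Cn n)) ∪ (L : Set (Cn n)) →
    (I : Set (Cn n)) = (K : Set (Cn n)) ∩ (L : Set (Cn n)) →
    μ U + μ I = μ K + μ L

/-- `μ` is translation invariant. -/
def TranslationInvariant {n : ℕ} (μ : ConvexBody (Cn n) → ℂ) : Prop :=
  ∀ (x : Cn n) (K L : ConvexBody (Cn n)),
    (L : Set (Cn n)) = (fun y => x + y) '' (K : Set (Cn n)) → μ L = μ K

/-- `μ` is invariant under the special unitary group `SU(n)` acting on `ℂⁿ`. -/
def SUInvariant {n : ℕ} (μ : ConvexBody (Cn n) → ℂ) : Prop :=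
  ∀ g ∈ Matrix.specialUnitaryGroup (Fin n) ℂ, ∀ K L : ConvexBody (Cn n),
    (L : Set (Cn n)) = (Matrix.toEuclideanLin g) '' (K : Set (Cn n)) → μ L = μ K

/-- The space of continuous, translation invariant, `SU(n)`-invariant valuations on `ℂⁿ`,
as a complex vector space. -/
def SUValuations (n : ℕ) : Submodule ℂ (ConvexBody (Cn n) → ℂ) where
  carrier := {μ | IsValuation μ ∧ Continuous μ ∧ TranslationInvariant μ ∧ SUInvariant μ}
  add_mem' := by
    rintro μ ν ⟨h1, h2, h3, h4⟩ ⟨h1', h2', h3', h4'⟩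
    refine ⟨?_, h2.add h2', ?_, ?_⟩
    · intro K L U I hU hI
      have hμ := h1 K L U I hU hI
      have hν := h1' K L U I hU hI
      simp only [Pi.add_apply]
      linear_combination hμ + hν
    · intro x K L h
      simp [Pi.add_apply, h3 x K L h, h3' x K L h]
    · intro g hg K L h
      simp [Pi.add_apply, h4 g hg K L h, h4' g hg K L h]
  zero_mem' := ⟨fun K L U I _ _ => rfl, continuous_const, fun x K L _ => rfl,
    fun g hg K L _ => rfl⟩
  smul_mem' := by
    rintro c μ ⟨h1, h2, h3, h4⟩
    refine ⟨?_, h2.const_smul c, ?_, ?_⟩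
    · intro K L U I hU hI
      simp only [Pi.smul_apply, smul_eq_mul]
      linear_combination c * h1 K L U I hU hI
    · intro x K L h
      simp [Pi.smul_apply, h3 x K L h]
    · intro g hg K L h
      simp [Pi.smul_apply, h4 g hg K L h]

namespace CVal

open Set Filter Topology MeasureTheory
open scoped Pointwise SchwartzMap ContDiff

section

variable {E F : Type*} [NormedAddCommGroup E] [NormedSpace ℝ E]
  [NormedAddCommGroup F] [NormedSpace ℝ F]

/-- The image of a convex body under a continuous linear map. -/
def lmap (f : E →L[ℝ] F) (K : ConvexBody E) : ConvexBody F :=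
  ⟨f '' K, K.convex.is_linear_image f.isBoundedLinearMap.toIsLinearMap,
    K.isCompact.image f.continuous, K.nonempty.image _⟩

/-- The one-point body. -/
def pt (x : E) : ConvexBody E :=
  ⟨{x}, convex_singleton x, isCompact_singleton, singleton_nonempty x⟩

/-- The segment `[0, v]`. -/
def seg (v : E) : ConvexBody E :=
  ⟨(fun t : ℝ => t • v) '' Icc 0 1,
    (convex_Icc 0 1).is_linear_image (IsLinearMap.isLinearMap_smul' v),
    isCompact_Icc.image (by fun_prop), ⟨_, ⟨0, by simp, rfl⟩⟩⟩

theorem mem_lmap {f : E →L[ℝ] F} {K : ConvexBody E} {y : F} :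
    y ∈ lmap f K ↔ ∃ x ∈ K, f x = y := Iff.rfl

@[simp] theorem coe_lmap (f : E →L[ℝ] F) (K : ConvexBody E) :
    (lmap f K : Set F) = f '' K := rfl

@[simp] theorem coe_pt (x : E) : (pt x : Set E) = {x} := rfl

theorem mem_pt {x y : E} : y ∈ pt x ↔ y = x := Iff.rfl

theorem mem_seg {v x : E} : x ∈ seg v ↔ ∃ t : ℝ, (0 ≤ t ∧ t ≤ 1) ∧ t • v = x := Iff.rfl

theorem mem_add {K L : ConvexBody E} {x : E} :
    x ∈ K + L ↔ ∃ a ∈ K, ∃ b ∈ L, a + b = x := Set.mem_add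

theorem body_ext {K L : ConvexBody E} (h : ∀ x, x ∈ K ↔ x ∈ L) : K = L :=
  ConvexBody.ext (Set.ext h)

theorem mem_add_pt {K : ConvexBody E} {x y : E} : y ∈ K + pt x ↔ y - x ∈ K := by
  rw [mem_add]
  constructor
  · rintro ⟨a, ha, b, rfl, rfl⟩
    simpa using ha
  · exact fun h => ⟨_, h, x, rfl, by simp⟩

theorem pt_zero : pt (0 : E) = 0 := rfl

theorem lmap_add (f : E →L[ℝ] F) (K L : ConvexBody E) :
    lmap f (K + L) = lmap f K + lmap f L := by
  apply ConvexBody.ext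
  simp only [coe_lmap, ConvexBody.coe_add]
  exact Set.image_add f

theorem lmap_pt (f : E →L[ℝ] F) (x : E) : lmap f (pt x) = pt (f x) := by
  apply ConvexBody.ext; simp

theorem lmap_zero (f : E →L[ℝ] F) : lmap f 0 = 0 := by
  rw [← pt_zero, lmap_pt, map_zero]; rfl

theorem lmap_seg (f : E →L[ℝ] F) (v : E) : lmap f (seg v) = seg (f v) := by
  refine body_ext fun y => ?_
  simp only [mem_lmap, mem_seg]
  constructor
  · rintro ⟨x, ⟨t, ht, rfl⟩, rfl⟩
    exact ⟨t, ht, by simp⟩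
  · rintro ⟨t, ht, rfl⟩
    exact ⟨t • v, ⟨t, ht, rfl⟩, by simp⟩

theorem lmap_lmap {G : Type*} [NormedAddCommGroup G] [NormedSpace ℝ G] (g : F →L[ℝ] G)
    (f : E →L[ℝ] F) (K : ConvexBody E) : lmap g (lmap f K) = lmap (g.comp f) K := by
  apply ConvexBody.ext
  simp only [coe_lmap, Set.image_image]
  rfl

theorem seg_zero : seg (0 : E) = 0 := by
  refine body_ext fun y => ?_
  rw [mem_seg, ← pt_zero, mem_pt]
  exact ⟨by rintro ⟨t, -, rfl⟩; simp, by rintro rfl; exact ⟨0, by simp, by simp⟩⟩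

theorem seg_neg (v : E) : seg (-v) + pt v = seg v := by
  refine body_ext fun y => ?_
  rw [mem_add_pt, mem_seg, mem_seg]
  constructor
  · rintro ⟨t, ht, h⟩
    exact ⟨1 - t, ⟨by linarith [ht.2], by linarith [ht.1]⟩, by
      rw [eq_sub_iff_add_eq] at h; rw [← h]; module⟩
  · rintro ⟨t, ht, rfl⟩
    exact ⟨1 - t, ⟨by linarith [ht.2], by linarith [ht.1]⟩, by module⟩

theorem seg_add_smul (v : E) {s t : ℝ} (hs : 0 ≤ s) (ht : 0 ≤ t) :
    seg ((s + t) • v) = seg (s • v) + seg (t • v) := by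
  refine body_ext fun y => ?_
  simp only [mem_add, mem_seg]
  constructor
  · rintro ⟨a, ha, rfl⟩
    exact ⟨_, ⟨a, ha, rfl⟩, _, ⟨a, ha, rfl⟩, by module⟩
  · rintro ⟨_, ⟨a, ha, rfl⟩, _, ⟨b, hb, rfl⟩, rfl⟩
    rcases (add_nonneg hs ht).eq_or_lt with h | h
    · have h1 : s = 0 := by linarith
      have h2 : t = 0 := by linarith
      exact ⟨0, by simp, by simp [h1, h2]⟩
    · refine ⟨(a * s + b * t) / (s + t), ⟨by have := ha.1; have := hb.1; positivity, ?_⟩, ?_⟩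
      · rw [div_le_one h]
        nlinarith [ha.2, hb.2]
      · rw [smul_smul, div_mul_cancel₀ _ h.ne', add_smul, smul_smul, smul_smul]

/-! ### The Hausdorff metric -/

theorem dist_le_of {K L : ConvexBody E} {r : ℝ} (hr : 0 ≤ r)
    (h1 : ∀ x ∈ K, ∃ y ∈ L, ‖x - y‖ ≤ r) (h2 : ∀ y ∈ L, ∃ x ∈ K, ‖x - y‖ ≤ r) :
    dist K L ≤ r := by
  rw [← ConvexBody.hausdorffDist_coe]
  refine Metric.hausdorffDist_le_of_mem_dist hr ?_ ?_
  · intro x hx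
    obtain ⟨y, hy, h⟩ := h1 x hx
    exact ⟨y, hy, by rwa [dist_eq_norm]⟩
  · intro y hy
    obtain ⟨x, hx, h⟩ := h2 y hy
    exact ⟨x, hx, by rwa [dist_comm, dist_eq_norm]⟩

theorem exists_norm_sub_le (K L : ConvexBody E) {x : E} (hx : x ∈ K) :
    ∃ y ∈ L, ‖x - y‖ ≤ dist K L := by
  obtain ⟨y, hy, h⟩ := L.isCompact.exists_infDist_eq_dist L.nonempty x
  refine ⟨y, hy, ?_⟩
  rw [← dist_eq_norm, ← h, ← ConvexBody.hausdorffDist_coe]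
  exact Metric.infDist_le_hausdorffDist_of_mem hx ConvexBody.hausdorffEDist_ne_top

theorem exists_norm_sub_le' (K L : ConvexBody E) {y : E} (hy : y ∈ L) :
    ∃ x ∈ K, ‖x - y‖ ≤ dist K L := by
  obtain ⟨x, hx, h⟩ := exists_norm_sub_le L K hy
  exact ⟨x, hx, by rwa [norm_sub_rev, dist_comm]⟩

theorem dist_add_add_le (K L K' L' : ConvexBody E) :
    dist (K + L) (K' + L') ≤ dist K K' + dist L L' := by
  refine dist_le_of (by positivity) ?_ ?_
  · rintro x ⟨a, ha, b, hb, rfl⟩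
    obtain ⟨a', ha', h1⟩ := exists_norm_sub_le K K' ha
    obtain ⟨b', hb', h2⟩ := exists_norm_sub_le L L' hb
    refine ⟨a' + b', mem_add.2 ⟨a', ha', b', hb', rfl⟩, ?_⟩
    calc ‖a + b - (a' + b')‖ = ‖(a - a') + (b - b')‖ := by congr 1; abel
      _ ≤ _ := (norm_add_le _ _).trans (add_le_add h1 h2)
  · rintro x ⟨a, ha, b, hb, rfl⟩
    obtain ⟨a', ha', h1⟩ := exists_norm_sub_le' K K' ha
    obtain ⟨b', hb', h2⟩ := exists_norm_sub_le' L L' hb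
    refine ⟨a' + b', mem_add.2 ⟨a', ha', b', hb', rfl⟩, ?_⟩
    calc ‖a' + b' - (a + b)‖ = ‖(a' - a) + (b' - b)‖ := by congr 1; abel
      _ ≤ _ := (norm_add_le _ _).trans (add_le_add h1 h2)

instance : ContinuousAdd (ConvexBody E) where
  continuous_add := by
    refine LipschitzWith.continuous (K := 2) (LipschitzWith.of_dist_le_mul fun p q => ?_)
    refine (dist_add_add_le _ _ _ _).trans ?_
    have h1 : dist p.1 q.1 ≤ dist p q := le_max_left _ _
    have h2 : dist p.2 q.2 ≤ dist p q := le_max_right _ _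
    push_cast
    linarith

theorem exists_bound (K : ConvexBody E) : ∃ R > 0, ∀ x ∈ K, ‖x‖ ≤ R := by
  obtain ⟨R, hR, h⟩ := K.isBounded.exists_pos_norm_le
  exact ⟨R, hR, h⟩

theorem dist_lmap_lmap_le (f g : E →L[ℝ] F) (K L : ConvexBody E) {R : ℝ}
    (hR : ∀ x ∈ L, ‖x‖ ≤ R) :
    dist (lmap f K) (lmap g L) ≤ ‖f‖ * dist K L + ‖f - g‖ * R := by
  have hR0 : 0 ≤ R := by
    obtain ⟨x, hx⟩ := L.nonempty
    exact (norm_nonneg x).trans (hR x hx)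
  have key : ∀ x, ∀ y ∈ L, ‖x - y‖ ≤ dist K L →
      ‖f x - g y‖ ≤ ‖f‖ * dist K L + ‖f - g‖ * R := by
    intro x y hy h
    calc ‖f x - g y‖ = ‖f (x - y) + (f - g) y‖ := by simp
      _ ≤ ‖f (x - y)‖ + ‖(f - g) y‖ := norm_add_le _ _
      _ ≤ _ := add_le_add
        ((f.le_opNorm _).trans (mul_le_mul_of_nonneg_left h (norm_nonneg _)))
        (((f - g).le_opNorm _).trans (mul_le_mul_of_nonneg_left (hR y hy) (norm_nonneg _)))
  refine dist_le_of (by positivity) ?_ ?_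
  · rintro _ ⟨x, hx, rfl⟩
    obtain ⟨y, hy, h⟩ := exists_norm_sub_le K L hx
    exact ⟨g y, ⟨y, hy, rfl⟩, key x y hy h⟩
  · rintro _ ⟨y, hy, rfl⟩
    obtain ⟨x, hx, h⟩ := exists_norm_sub_le' K L hy
    exact ⟨f x, ⟨x, hx, rfl⟩, key x y hy h⟩

theorem continuous_lmap_uncurry :
    Continuous fun p : (E →L[ℝ] F) × ConvexBody E => lmap p.1 p.2 := by
  rw [continuous_iff_continuousAt]
  rintro ⟨g, L⟩
  obtain ⟨R, -, hR⟩ := exists_bound L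
  rw [ContinuousAt, tendsto_iff_dist_tendsto_zero]
  refine squeeze_zero (fun _ => dist_nonneg) (fun p => dist_lmap_lmap_le p.1 g p.2 L hR) ?_
  have : Continuous fun p : (E →L[ℝ] F) × ConvexBody E =>
      ‖p.1‖ * dist p.2 L + ‖p.1 - g‖ * R := by fun_prop
  simpa using this.tendsto (g, L)

theorem continuous_lmap (f : E →L[ℝ] F) : Continuous (lmap f) :=
  continuous_lmap_uncurry.comp (by fun_prop : Continuous fun K : ConvexBody E => (f, K))

theorem continuous_seg : Continuous (seg : E → ConvexBody E) := by
  have h : (seg : E → ConvexBody E) =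
      fun v => lmap (ContinuousLinearMap.toSpanSingleton ℝ v) (seg (1 : ℝ)) := by
    funext v
    rw [lmap_seg]; simp
  rw [h]
  refine continuous_lmap_uncurry.comp (Continuous.prodMk ?_ continuous_const)
  exact (ContinuousLinearMap.toSpanSingletonCLE (𝕜 := ℝ) (E := E)).continuous

/-! ### Valuations -/

/-- Continuous translation invariant valuations. -/
structure IsVal (μ : ConvexBody E → ℂ) : Prop where
  union : ∀ K L U I : ConvexBody E, (U : Set E) = (K : Set E) ∪ L → (I : Set E) = (K : Set E) ∩ L →
    μ U + μ I = μ K + μ L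
  cont : Continuous μ
  trans : ∀ (x : E) (K : ConvexBody E), μ (K + pt x) = μ K

theorem exists_mem_inter {K L U : ConvexBody E} (hU : (U : Set E) = (K : Set E) ∪ L) {k l : E}
    (hk : k ∈ K) (hl : l ∈ L) : ∃ t : ℝ, 0 ≤ t ∧ t ≤ 1 ∧
      (1 - t) • k + t • l ∈ K ∧ (1 - t) • k + t • l ∈ L := by
  let f : ℝ → E := fun t => (1 - t) • k + t • l
  have hf : Continuous f := by fun_prop
  have hsub : ∀ t ∈ Icc (0 : ℝ) 1, f t ∈ (K : Set E) ∪ L := by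
    intro t ht
    rw [← hU]
    refine U.convex ?_ ?_ (by linarith [ht.2]) ht.1 (by ring)
    · rw [hU]; exact Or.inl hk
    · rw [hU]; exact Or.inr hl
  have := isPreconnected_closed_iff.1 (isPreconnected_Icc (a := (0 : ℝ)) (b := 1))
    (f ⁻¹' K) (f ⁻¹' L) (K.isClosed.preimage hf) (L.isClosed.preimage hf) hsub
    ⟨0, by simp, by simpa [f] using hk⟩ ⟨1, by simp, by simpa [f] using hl⟩
  obtain ⟨t, ht, h1, h2⟩ := this
  exact ⟨t, ht.1, ht.2, h1, h2⟩

theorem coe_lmap_inter {K L U I : ConvexBody E} (hU : (U : Set E) = (K : Set E) ∪ L)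
    (hI : (I : Set E) = (K : Set E) ∩ L) (f : E →L[ℝ] F) :
    (lmap f I : Set F) = (lmap f K : Set F) ∩ lmap f L := by
  apply Subset.antisymm
  · rintro _ ⟨x, hx, rfl⟩
    rw [hI] at hx
    exact ⟨⟨x, hx.1, rfl⟩, ⟨x, hx.2, rfl⟩⟩
  · rintro _ ⟨⟨k, hk, rfl⟩, ⟨l, hl, h⟩⟩
    obtain ⟨t, -, -, h1, h2⟩ := exists_mem_inter hU hk hl
    refine ⟨_, by rw [hI]; exact ⟨h1, h2⟩, ?_⟩
    simp only [map_add, map_smul, h]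
    module

theorem coe_add_inter {K L U I : ConvexBody E} (hU : (U : Set E) = (K : Set E) ∪ L)
    (hI : (I : Set E) = (K : Set E) ∩ L) (Z : ConvexBody E) :
    ((I + Z : ConvexBody E) : Set E) = ((K + Z : ConvexBody E) : Set E) ∩ (L + Z : ConvexBody E) := by
  apply Subset.antisymm
  · rintro _ ⟨x, hx, z, hz, rfl⟩
    rw [hI] at hx
    exact ⟨⟨x, hx.1, z, hz, rfl⟩, ⟨x, hx.2, z, hz, rfl⟩⟩
  · rintro _ ⟨⟨k, hk, z, hz, rfl⟩, ⟨l, hl, z', hz', h⟩⟩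
    obtain ⟨t, h0, h1, h2, h3⟩ := exists_mem_inter hU hk hl
    refine ⟨_, by rw [hI]; exact ⟨h2, h3⟩, _,
      Z.convex hz hz' (sub_nonneg.2 h1) h0 (by ring), ?_⟩
    have h' : l + z' = k + z := h
    calc (1 - t) • k + t • l + ((1 - t) • z + t • z') = (1 - t) • (k + z) + t • (l + z') := by
          module
      _ = k + z := by rw [h']; module

namespace IsVal

variable {μ ν : ConvexBody E → ℂ}

theorem add (hμ : IsVal μ) (hν : IsVal ν) : IsVal fun K => μ K + ν K where
  union K L U I hU hI := by
    linear_combination hμ.union K L U I hU hI + hν.union K L U I hU hI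
  cont := hμ.cont.add hν.cont
  trans x K := by rw [hμ.trans, hν.trans]

theorem const_mul (hμ : IsVal μ) (c : ℂ) : IsVal fun K => c * μ K where
  union K L U I hU hI := by
    linear_combination c * hμ.union K L U I hU hI
  cont := hμ.cont.const_mul c
  trans x K := by rw [hμ.trans]

theorem sub (hμ : IsVal μ) (hν : IsVal ν) : IsVal fun K => μ K - ν K := by
  simpa [sub_eq_add_neg] using hμ.add (hν.const_mul (-1))

theorem sum {ι : Type*} (s : Finset ι) {μ : ι → ConvexBody E → ℂ} (h : ∀ i ∈ s, IsVal (μ i)) :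
    IsVal fun K => ∑ i ∈ s, μ i K where
  union K L U I hU hI := by
    rw [← Finset.sum_add_distrib, ← Finset.sum_add_distrib]
    exact Finset.sum_congr rfl fun i hi => (h i hi).union K L U I hU hI
  cont := continuous_finsetSum _ fun i hi => (h i hi).cont
  trans x K := Finset.sum_congr rfl fun i hi => (h i hi).trans x K

theorem comp_lmap {μ : ConvexBody F → ℂ} (hμ : IsVal μ) (f : E →L[ℝ] F) :
    IsVal fun K => μ (lmap f K) where
  union K L U I hU hI := by
    refine hμ.union _ _ _ _ ?_ (coe_lmap_inter hU hI f)
    rw [coe_lmap, hU, image_union]; rfl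
  cont := hμ.cont.comp (continuous_lmap f)
  trans x K := by rw [lmap_add, lmap_pt, hμ.trans]

theorem comp_add (hμ : IsVal μ) (Z : ConvexBody E) : IsVal fun K => μ (K + Z) where
  union K L U I hU hI := by
    refine hμ.union _ _ _ _ ?_ (coe_add_inter hU hI Z)
    rw [ConvexBody.coe_add, hU, Set.union_add]; rfl
  cont := hμ.cont.comp (by fun_prop)
  trans x K := by rw [add_right_comm, hμ.trans]

end IsVal

/-- The difference operator `D_v μ (K) = μ (K + [0,v]) - μ K`. -/
def D (v : E) (μ : ConvexBody E → ℂ) : ConvexBody E → ℂ := fun K => μ (K + seg v) - μ K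

theorem IsVal.diff {μ : ConvexBody E → ℂ} (hμ : IsVal μ) (v : E) : IsVal (D v μ) :=
  (hμ.comp_add _).sub hμ

theorem D_comm (v w : E) (μ : ConvexBody E → ℂ) : D v (D w μ) = D w (D v μ) := by
  funext K
  simp only [D]
  rw [add_right_comm]
  ring

theorem D_zero_left (μ : ConvexBody E → ℂ) : D 0 μ = 0 := by
  funext K; simp [D, seg_zero]

theorem additive_of_nonneg {φ : ℝ → ℂ} (hc : Continuous φ)
    (h : ∀ s t, 0 ≤ s → 0 ≤ t → φ (s + t) = φ s + φ t) {t : ℝ} (ht : 0 ≤ t) : φ t = t * φ 1 := by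
  have h0 : φ 0 = 0 := by simpa using h 0 0 le_rfl le_rfl
  let Φ : ℝ →+ ℂ :=
    { toFun := fun t => φ (max t 0) - φ (max (-t) 0)
      map_zero' := by simp
      map_add' := by
        intro s t
        have e : max (s + t) 0 + (max (-s) 0 + max (-t) 0) =
            max (-(s + t)) 0 + (max s 0 + max t 0) := by
          have := max_zero_sub_max_neg_zero_eq_self (s + t)
          have := max_zero_sub_max_neg_zero_eq_self s
          have := max_zero_sub_max_neg_zero_eq_self t
          linarith
        have e' := congrArg φ e
        rw [h _ _ (by positivity) (by positivity), h _ _ (by positivity) (by positivity),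
          h _ _ (by positivity) (by positivity), h _ _ (by positivity) (by positivity)] at e'
        linear_combination e' }
  have hΦ : Continuous Φ := by
    change Continuous fun t => φ (max t 0) - φ (max (-t) 0)
    fun_prop
  have := map_real_smul Φ hΦ t 1
  simpa [Φ, ht, h0] using this

section

variable {μ : ConvexBody E → ℂ}

theorem seg_union (K : ConvexBody E) (v : E) {s t : ℝ} (hs : 0 ≤ s) (ht : 0 ≤ t) :
    ((K + seg ((s + t) • v) : ConvexBody E) : Set E) =
      ((K + seg (s • v) : ConvexBody E) : Set E) ∪ (K + seg (t • v) + pt (s • v) : ConvexBody E) ∧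
    ((K + pt (s • v) : ConvexBody E) : Set E) =
      ((K + seg (s • v) : ConvexBody E) : Set E) ∩ (K + seg (t • v) + pt (s • v) : ConvexBody E) := by
  constructor
  · ext x
    change x ∈ K + seg ((s + t) • v) ↔ x ∈ K + seg (s • v) ∨ x ∈ K + seg (t • v) + pt (s • v)
    rw [mem_add_pt]
    constructor
    · rintro ⟨k, hk, _, ⟨a, ha, rfl⟩, rfl⟩
      simp only [smul_smul]
      rcases le_total (a * (s + t)) s with h | h
      · left
        rcases hs.eq_or_lt with h0 | h0
        · subst h0
          have : a * (0 + t) = 0 := le_antisymm h (mul_nonneg ha.1 (by linarith))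
          exact mem_add.2 ⟨k, hk, 0, ⟨0, by simp, by simp⟩, by rw [this]; simp⟩
        · refine mem_add.2 ⟨k, hk, _, ⟨a * (s + t) / s, ⟨by have := ha.1; positivity, ?_⟩, rfl⟩, ?_⟩
          · rwa [div_le_one h0]
          · simp only [smul_smul]
            rw [div_mul_cancel₀ _ h0.ne']
      · right
        rcases ht.eq_or_lt with h0 | h0
        · subst h0
          have : a * (s + 0) = s := le_antisymm (by nlinarith [ha.2]) h
          exact mem_add.2 ⟨k, hk, 0, ⟨0, by simp, by simp⟩, by rw [this]; simp⟩
        · refine mem_add.2 ⟨k, hk, _, ⟨(a * (s + t) - s) / t,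
            ⟨div_nonneg (by linarith) ht, ?_⟩, rfl⟩, ?_⟩
          · rw [div_le_one h0]; nlinarith [ha.2]
          · simp only [smul_smul]
            rw [div_mul_cancel₀ _ h0.ne']
            module
    · rintro (⟨k, hk, z, hz, rfl⟩ | ⟨k, hk, z, hz, h⟩)
      · refine mem_add.2 ⟨k, hk, z, ?_, rfl⟩
        rw [seg_add_smul v hs ht]
        exact mem_add.2 ⟨z, hz, 0, ⟨0, by simp, by simp⟩, by simp⟩
      · refine mem_add.2 ⟨k, hk, z + s • v, ?_, ?_⟩
        · rw [seg_add_smul v hs ht]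
          exact mem_add.2 ⟨s • v, ⟨1, by simp, by simp⟩, z, hz, by abel⟩
        · rw [eq_sub_iff_add_eq] at h
          rw [← h]
          change _ = k + z + s • v
          abel
  · apply Subset.antisymm
    · intro x hx
      rw [SetLike.mem_coe, mem_add_pt] at hx
      refine ⟨mem_add.2 ⟨_, hx, s • v, ⟨1, by simp, by simp⟩, by simp⟩, ?_⟩
      rw [SetLike.mem_coe, mem_add_pt]
      exact mem_add.2 ⟨_, hx, 0, ⟨0, by simp, by simp⟩, by simp⟩
    · rintro x ⟨⟨k, hk, _, ⟨a, ha, rfl⟩, rfl⟩, hx⟩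
      rw [SetLike.mem_coe, mem_add_pt] at hx
      obtain ⟨l, hl, _, ⟨b, hb, rfl⟩, h⟩ := hx
      simp only [smul_smul] at h ⊢
      rw [SetLike.mem_coe, mem_add_pt]
      have e1 : 0 ≤ s - a * s := by nlinarith [ha.2]
      have e2 : 0 ≤ b * t := mul_nonneg hb.1 ht
      have hl' : l = k + (a * s - s - b * t) • v := by
        rw [eq_sub_iff_add_eq] at h
        have : l = l + (b * t) • v + s • v - (b * t) • v - s • v := by abel
        rw [this, h]; module
      rw [show k + (a * s) • v - s • v = k + (-(s - a * s)) • v by module]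
      rw [show a * s - s - b * t = -((s - a * s) + b * t) by ring] at hl'
      generalize s - a * s = p at *
      generalize b * t = q at *
      rcases (add_nonneg e1 e2).eq_or_lt with h0 | h0
      · have : p = 0 := by linarith
        rw [this]; simpa using hk
      · have := K.convex hk hl (a := q / (p + q)) (b := p / (p + q)) (by positivity)
          (by positivity) (by field_simp; ring)
        rw [← SetLike.mem_coe]
        convert this using 1
        rw [hl', smul_add, smul_smul, ← add_assoc, ← add_smul]
        have e3 : q / (p + q) + p / (p + q) = 1 := by field_simp; ring
        have e4 : p / (p + q) * -(p + q) = -p := by field_simp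
        rw [e3, e4, one_smul]

theorem IsVal.apply_add_seg (hμ : IsVal μ) (K : ConvexBody E) (v : E) {t : ℝ} (ht : 0 ≤ t) :
    μ (K + seg (t • v)) = μ K + t * D v μ K := by
  have := additive_of_nonneg (φ := fun t : ℝ => μ (K + seg (t • v)) - μ K) ?_ ?_ ht
  · simp only [one_smul] at this
    rw [D, ← this]; ring
  · have := continuous_seg (E := E)
    have := hμ.cont
    fun_prop
  · intro s t hs ht
    obtain ⟨h1, h2⟩ := seg_union K v hs ht
    have := hμ.union _ _ _ _ h1 h2
    rw [hμ.trans, hμ.trans] at this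
    linear_combination this

theorem IsVal.D_neg (hμ : IsVal μ) (v : E) : D (-v) μ = D v μ := by
  funext K
  simp only [D]
  rw [← hμ.trans v (K + seg (-v)), add_assoc, seg_neg]

theorem IsVal.D_smul_of_nonneg (hμ : IsVal μ) (v : E) {t : ℝ} (ht : 0 ≤ t) :
    D (t • v) μ = fun K => (t : ℂ) * D v μ K := by
  funext K
  have := hμ.apply_add_seg K v ht
  simp only [D] at *
  rw [this]; ring

theorem IsVal.D_smul (hμ : IsVal μ) (v : E) (t : ℝ) :
    D (t • v) μ = fun K => ((|t| : ℝ) : ℂ) * D v μ K := by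
  rcases le_total 0 t with h | h
  · rw [hμ.D_smul_of_nonneg v h, abs_of_nonneg h]
  · rw [← hμ.D_neg, ← neg_smul, hμ.D_smul_of_nonneg v (neg_nonneg.2 h), abs_of_nonpos h]

end

end

section

variable {E F : Type*} [NormedAddCommGroup E] [NormedSpace ℝ E]
  [NormedAddCommGroup F] [NormedSpace ℝ F]

/-- The intersection of a convex body with a closed convex set. -/
def inter (K : ConvexBody E) (S : Set E) (hS : Convex ℝ S) (hc : IsClosed S)
    (hne : ((K : Set E) ∩ S).Nonempty) : ConvexBody E :=
  ⟨K ∩ S, K.convex.inter hS, K.isCompact.inter_right hc, hne⟩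

theorem convex_le (a : E →L[ℝ] ℝ) (c : ℝ) : Convex ℝ {x | a x ≤ c} :=
  convex_halfSpace_le a.isBoundedLinearMap.toIsLinearMap c

theorem convex_ge (a : E →L[ℝ] ℝ) (c : ℝ) : Convex ℝ {x | c ≤ a x} :=
  convex_halfSpace_ge a.isBoundedLinearMap.toIsLinearMap c

theorem isClosed_le' (a : E →L[ℝ] ℝ) (c : ℝ) : IsClosed {x | a x ≤ c} :=
  isClosed_le a.continuous continuous_const

theorem isClosed_ge' (a : E →L[ℝ] ℝ) (c : ℝ) : IsClosed {x | c ≤ a x} :=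
  isClosed_le continuous_const a.continuous

theorem mem_add_seg_smul {K : ConvexBody E} {v : E} {s : ℝ} (hs : 0 ≤ s) {x : E} :
    x ∈ K + seg (s • v) ↔ ∃ k ∈ K, ∃ t, 0 ≤ t ∧ t ≤ s ∧ k + t • v = x := by
  rw [mem_add]
  constructor
  · rintro ⟨k, hk, _, ⟨t, ht, rfl⟩, rfl⟩
    exact ⟨k, hk, t * s, mul_nonneg ht.1 hs, by nlinarith [ht.2], by simp [smul_smul]⟩
  · rintro ⟨k, hk, t, h0, h1, rfl⟩
    rcases hs.eq_or_lt with h | h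
    · have : t = 0 := by linarith
      exact ⟨k, hk, 0, ⟨0, by simp, by simp⟩, by simp [this]⟩
    · refine ⟨k, hk, t • v, ⟨t / s, ⟨by positivity, by rwa [div_le_one h]⟩, ?_⟩, rfl⟩
      simp only [smul_smul]
      rw [div_mul_cancel₀ _ h.ne']

theorem mem_add_seg {K : ConvexBody E} {v : E} {x : E} :
    x ∈ K + seg v ↔ ∃ k ∈ K, ∃ t : ℝ, 0 ≤ t ∧ t ≤ 1 ∧ k + t • v = x := by
  simpa using mem_add_seg_smul (K := K) (v := v) (x := x) zero_le_one

/-- The projection along `v` onto the kernel of `a` (when `a v = 1`). -/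
def proj (a : E →L[ℝ] ℝ) (v : E) : E →L[ℝ] E :=
  ContinuousLinearMap.id ℝ E - a.smulRight v

theorem proj_apply (a : E →L[ℝ] ℝ) (v x : E) : proj a v x = x - a x • v := rfl

section

variable {μ : ConvexBody E → ℂ}

theorem IsVal.D_flat (hμ : IsVal μ) {a : E →L[ℝ] ℝ} {v : E} (hv : a v = 1) {W : ConvexBody E}
    {c : ℝ} (h1 : ∀ x ∈ W, a x ≤ c) (h2 : ∀ x ∈ W, x + (c - a x) • v ∈ W) :
    D v μ W = D v μ (lmap (proj a v) W) := by
  set P := lmap (proj a v) W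
  have hP : ∀ x, x ∈ P + pt (c • v) ↔ ∃ w ∈ W, x = w + (c - a w) • v := by
    intro x
    rw [mem_add_pt]
    constructor
    · rintro ⟨w, hw, h⟩
      refine ⟨w, hw, ?_⟩
      rw [proj_apply, eq_sub_iff_add_eq] at h
      rw [← h]; module
    · rintro ⟨w, hw, rfl⟩
      exact ⟨w, hw, by rw [proj_apply]; module⟩
  have hU : ((W + seg v : ConvexBody E) : Set E) =
      (W : Set E) ∪ (P + pt (c • v) + seg v : ConvexBody E) := by
    ext x
    change x ∈ W + seg v ↔ x ∈ W ∨ x ∈ P + pt (c • v) + seg v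
    simp only [mem_add_seg]
    constructor
    · rintro ⟨w, hw, t, h0, ht, rfl⟩
      rcases le_total (a w + t) c with h | h
      · left
        rcases h0.eq_or_lt with h' | h'
        · simpa [← h'] using hw
        · have hcw : 0 < c - a w := by linarith
          have := W.convex hw (h2 w hw) (a := 1 - t / (c - a w)) (b := t / (c - a w))
            (by rw [sub_nonneg, div_le_one hcw]; linarith) (by positivity) (by ring)
          rw [← SetLike.mem_coe]
          convert this using 1
          rw [smul_add, smul_smul, div_mul_cancel₀ _ hcw.ne']
          module
      · right
        refine ⟨_, (hP _).2 ⟨w, hw, rfl⟩, a w + t - c, by linarith, by linarith [h1 w hw], ?_⟩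
        module
    · rintro (hx | ⟨k, hk, t, h0, ht, rfl⟩)
      · exact ⟨x, hx, 0, le_rfl, zero_le_one, by simp⟩
      · obtain ⟨w, hw, rfl⟩ := (hP k).1 hk
        exact ⟨_, h2 w hw, t, h0, ht, rfl⟩
  have hI : ((P + pt (c • v) : ConvexBody E) : Set E) =
      (W : Set E) ∩ (P + pt (c • v) + seg v : ConvexBody E) := by
    ext x
    change x ∈ P + pt (c • v) ↔ x ∈ W ∧ x ∈ P + pt (c • v) + seg v
    rw [mem_add_seg]
    constructor
    · intro hx
      refine ⟨?_, x, hx, 0, le_rfl, zero_le_one, by simp⟩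
      obtain ⟨w, hw, rfl⟩ := (hP x).1 hx
      exact h2 w hw
    · rintro ⟨hx, k, hk, t, h0, -, rfl⟩
      obtain ⟨w, hw, rfl⟩ := (hP k).1 hk
      have := h1 _ hx
      simp only [map_add, map_smul, hv, smul_eq_mul, mul_one] at this
      have : t = 0 := by linarith
      simpa [this] using hk
  have e := hμ.union _ _ _ _ hU hI
  rw [hμ.trans, add_right_comm, hμ.trans] at e
  simp only [D]
  linear_combination e

/-- `D_v μ` only depends on the projection of the body along `v`. -/
theorem IsVal.D_proj (hμ : IsVal μ) {a : E →L[ℝ] ℝ} {v : E} (hv : a v = 1) (K : ConvexBody E) :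
    D v μ K = D v μ (lmap (proj a v) K) := by
  obtain ⟨R, hR0, hR⟩ := exists_bound K
  obtain ⟨M, hM0, hM⟩ : ∃ M : ℝ, 0 ≤ M ∧ ∀ x ∈ K, |a x| ≤ M :=
    ⟨‖a‖ * R, by positivity, fun x hx => (a.le_opNorm x).trans
      (mul_le_mul_of_nonneg_left (hR x hx) (norm_nonneg _))⟩
  have hM1 : ∀ x ∈ K, a x ≤ M := fun x hx => (abs_le.1 (hM x hx)).2
  have hM2 : ∀ x ∈ K, -M ≤ a x := fun x hx => (abs_le.1 (hM x hx)).1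
  have h2M : 0 ≤ 2 * M := by positivity
  have hax : ∀ k t, a (k + t • v) = a k + t := by intro k t; simp [hv]
  set T := K + seg ((2 * M) • v) with hT
  have hTmem : ∀ k ∈ K, k + (M - a k) • v ∈ T := fun k hk =>
    (mem_add_seg_smul h2M).2 ⟨k, hk, M - a k, by linarith [hM1 k hk], by linarith [hM2 k hk], rfl⟩
  obtain ⟨k₀, hk₀⟩ := K.nonempty
  set A := inter T _ (convex_le a M) (isClosed_le' a M)
    ⟨_, hTmem k₀ hk₀, by rw [mem_ofPred_eq, hax]; linarith⟩
  set B := inter T _ (convex_ge a M) (isClosed_ge' a M)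
    ⟨_, hTmem k₀ hk₀, by rw [mem_ofPred_eq, hax]; linarith⟩
  set P := lmap (proj a v) K
  have hP : ∀ x, x ∈ P + pt (M • v) ↔ ∃ w ∈ K, x = w + (M - a w) • v := by
    intro x
    rw [mem_add_pt]
    constructor
    · rintro ⟨w, hw, h⟩
      refine ⟨w, hw, ?_⟩
      rw [proj_apply, eq_sub_iff_add_eq] at h
      rw [← h]; module
    · rintro ⟨w, hw, rfl⟩
      exact ⟨w, hw, by rw [proj_apply]; module⟩
  have hI : ∀ Z : ConvexBody E, (∀ x ∈ Z, ∃ b ∈ B, ∃ t : ℝ, 0 ≤ t ∧ b + t • v = x) → B ≤ Z →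
      ((P + pt (M • v) : ConvexBody E) : Set E) = (A : Set E) ∩ Z := by
    intro Z hZ hBZ
    ext x
    change x ∈ P + pt (M • v) ↔ x ∈ A ∧ x ∈ Z
    rw [hP]
    constructor
    · rintro ⟨w, hw, rfl⟩
      exact ⟨⟨hTmem w hw, by rw [mem_ofPred_eq, hax]; linarith⟩,
        hBZ ⟨hTmem w hw, by rw [mem_ofPred_eq, hax]; linarith⟩⟩
    · rintro ⟨⟨hx, hxM⟩, hxZ⟩
      obtain ⟨b, ⟨-, hb⟩, t, ht, rfl⟩ := hZ _ hxZ
      rw [mem_ofPred_eq, hax] at hxM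
      obtain ⟨k, hk, t', h0, h1, h⟩ := (mem_add_seg_smul h2M).1 hx
      have e := congrArg a h
      rw [hax, hax] at e
      refine ⟨k, hk, ?_⟩
      rw [← h]
      congr 2
      have : M ≤ a b := hb
      linarith
  have hTB : ((T : ConvexBody E) : Set E) = (A : Set E) ∪ B := by
    ext x
    constructor
    · intro hx
      rcases le_total (a x) M with h | h
      · exact Or.inl ⟨hx, h⟩
      · exact Or.inr ⟨hx, h⟩
    · rintro (h | h)
      · exact h.1
      · exact h.1
  have hTB' : ((K + seg ((2 * M + 1) • v) : ConvexBody E) : Set E) =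
      (A : Set E) ∪ (B + seg v : ConvexBody E) := by
    ext x
    change x ∈ K + seg _ ↔ x ∈ A ∨ x ∈ B + seg v
    rw [mem_add_seg_smul (by positivity), mem_add_seg]
    constructor
    · rintro ⟨k, hk, t, h0, h1, rfl⟩
      rcases le_total t (2 * M) with h | h
      · have hT : k + t • v ∈ T := (mem_add_seg_smul h2M).2 ⟨k, hk, t, h0, h, rfl⟩
        rcases le_total (a (k + t • v)) M with h | h
        · exact Or.inl ⟨hT, h⟩
        · exact Or.inr ⟨_, ⟨hT, h⟩, 0, le_rfl, zero_le_one, by simp⟩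
      · right
        refine ⟨k + (2 * M) • v, ⟨(mem_add_seg_smul h2M).2 ⟨k, hk, 2 * M, h2M, le_rfl, rfl⟩, ?_⟩,
          t - 2 * M, by linarith, by linarith, by module⟩
        rw [mem_ofPred_eq, hax]
        linarith [hM2 k hk]
    · rintro (⟨hx, -⟩ | ⟨_, ⟨hx, -⟩, t, h0, h1, rfl⟩)
      · obtain ⟨k, hk, t, h0, h1, h⟩ := (mem_add_seg_smul h2M).1 hx
        exact ⟨k, hk, t, h0, by linarith, h⟩
      · obtain ⟨k, hk, t', h0', h1', rfl⟩ := (mem_add_seg_smul h2M).1 hx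
        exact ⟨k, hk, t' + t, by linarith, by linarith, by module⟩
  have e1 := hμ.union _ _ _ _ hTB (hI B (fun x hx => ⟨x, hx, 0, le_rfl, by simp⟩) le_rfl)
  have e2 := hμ.union _ _ _ _ hTB' (hI (B + seg v)
    (fun x hx => by
      obtain ⟨b, hb, t, ht, -, h⟩ := mem_add_seg.1 hx
      exact ⟨b, hb, t, ht, h⟩)
    (fun x hx => mem_add_seg.2 ⟨x, hx, 0, le_rfl, zero_le_one, by simp⟩))
  rw [hμ.apply_add_seg K v (by positivity)] at e2
  rw [hT, hμ.apply_add_seg K v h2M] at e1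
  have e3 : D v μ K = D v μ B := by
    have : D v μ B = μ (B + seg v) - μ B := rfl
    rw [this]
    push_cast at e1 e2
    linear_combination e2 - e1
  have hlow : D (-v) μ B = D (-v) μ (lmap (proj (-a) (-v)) B) := by
    refine hμ.D_flat (by simp [hv]) (c := -M) (fun x hx => ?_) (fun x hx => ?_)
    · have : M ≤ a x := hx.2
      simpa using this
    · obtain ⟨k, hk, t, h0, h1, rfl⟩ := (mem_add_seg_smul h2M).1 hx.1
      have : M ≤ a (k + t • v) := hx.2
      rw [hax] at this
      have e : k + t • v + (-M - (-a) (k + t • v)) • -v = k + (M - a k) • v := by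
        rw [neg_apply, hax]; module
      rw [e]
      exact ⟨hTmem k hk, by rw [mem_ofPred_eq, hax]; linarith⟩
  rw [hμ.D_neg] at hlow
  rw [e3, hlow]
  congr 1
  refine body_ext fun x => ?_
  simp only [P, mem_lmap, proj_apply]
  constructor
  · rintro ⟨y, hy, rfl⟩
    obtain ⟨k, hk, t, h0, h1, rfl⟩ := (mem_add_seg_smul h2M).1 hy.1
    refine ⟨k, hk, ?_⟩
    rw [neg_apply, hax]; module
  · rintro ⟨k, hk, rfl⟩
    refine ⟨_, ⟨hTmem k hk, by rw [mem_ofPred_eq, hax]; linarith⟩, ?_⟩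
    rw [neg_apply, hax]; module

theorem IsVal.D_congr (hμ : IsVal μ) {v : E} {K L : ConvexBody E}
    (h : ∀ a : E →L[ℝ] ℝ, a v = 1 → lmap (proj a v) K = lmap (proj a v) L) :
    D v μ K = D v μ L := by
  by_cases hv : v = 0
  · subst hv; rw [D_zero_left]; rfl
  · obtain ⟨a, ha⟩ := SeparatingDual.exists_eq_one (R := ℝ) hv
    rw [hμ.D_proj ha K, hμ.D_proj ha L, h a ha]

theorem IsVal.D_shear (hμ : IsVal μ) (v w : E) (s : ℝ) :
    D (v + s • w) (D w μ) = D v (D w μ) := by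
  funext K
  change D w μ (K + seg (v + s • w)) - D w μ K = D w μ (K + seg v) - D w μ K
  rw [hμ.D_congr (K := K + seg (v + s • w)) (L := K + seg v)]
  intro a ha
  rw [lmap_add, lmap_add, lmap_seg, lmap_seg]
  congr 2
  simp only [proj_apply, map_add, map_smul, ha]
  module

end

/-- Iterated differences. -/
def DL (l : List E) (μ : ConvexBody E → ℂ) : ConvexBody E → ℂ := l.foldr D μ

@[simp] theorem DL_nil (μ : ConvexBody E → ℂ) : DL [] μ = μ := rfl

@[simp] theorem DL_cons (x : E) (l : List E) (μ : ConvexBody E → ℂ) :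
    DL (x :: l) μ = D x (DL l μ) := rfl

theorem DL_append (l l' : List E) (μ : ConvexBody E → ℂ) :
    DL (l ++ l') μ = DL l (DL l' μ) := List.foldr_append

theorem DL_perm {l l' : List E} (h : l.Perm l') (μ : ConvexBody E → ℂ) : DL l μ = DL l' μ :=
  have : LeftCommutative (D : E → (ConvexBody E → ℂ) → ConvexBody E → ℂ) := ⟨D_comm⟩
  h.foldr_eq μ

theorem D_const_mul (v : E) (c : ℂ) (μ : ConvexBody E → ℂ) :
    D v (fun K => c * μ K) = fun K => c * D v μ K := by
  funext K; simp only [D]; ring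

theorem DL_const_mul (l : List E) (c : ℂ) (μ : ConvexBody E → ℂ) :
    DL l (fun K => c * μ K) = fun K => c * DL l μ K := by
  induction l with
  | nil => rfl
  | cons x l ih => rw [DL_cons, ih, D_const_mul]; rfl

theorem D_add (v : E) (μ ν : ConvexBody E → ℂ) :
    D v (fun K => μ K + ν K) = fun K => D v μ K + D v ν K := by
  funext K; simp only [D]; ring

theorem DL_add (l : List E) (μ ν : ConvexBody E → ℂ) :
    DL l (fun K => μ K + ν K) = fun K => DL l μ K + DL l ν K := by
  induction l with
  | nil => rfl
  | cons x l ih => rw [DL_cons, ih, D_add]; rfl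

theorem DL_sub (l : List E) (μ ν : ConvexBody E → ℂ) :
    DL l (fun K => μ K - ν K) = fun K => DL l μ K - DL l ν K := by
  have h : (fun K => μ K - ν K) = fun K => μ K + (-1) * ν K := by funext K; ring
  rw [h, DL_add, DL_const_mul]
  funext K; ring

theorem DL_sum {ι : Type*} (s : Finset ι) (l : List E) (μ : ι → ConvexBody E → ℂ) :
    DL l (fun K => ∑ i ∈ s, μ i K) = fun K => ∑ i ∈ s, DL l (μ i) K := by
  induction l with
  | nil => rfl
  | cons x l ih =>
    rw [DL_cons, ih]
    funext K
    simp only [D, DL_cons, Finset.sum_sub_distrib]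

theorem DL_lmap (f : E →L[ℝ] F) (l : List E) (μ : ConvexBody F → ℂ) (K : ConvexBody E) :
    DL l (fun K => μ (lmap f K)) K = DL (l.map f) μ (lmap f K) := by
  induction l generalizing K with
  | nil => rfl
  | cons x l ih =>
    simp only [DL_cons, List.map_cons, D, ih, lmap_add, lmap_seg]

section

variable {μ : ConvexBody E → ℂ}

theorem IsVal.DL (hμ : IsVal μ) (l : List E) : IsVal (DL l μ) := by
  induction l with
  | nil => exact hμ
  | cons x l ih => exact ih.diff x

/-- The real span of the entries of a list. -/
def spanL (l : List E) : Submodule ℝ E := Submodule.span ℝ {x | x ∈ l}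

theorem mem_spanL_cons {x y : E} {l : List E} :
    x ∈ spanL (y :: l) ↔ ∃ a : ℝ, ∃ z ∈ spanL l, x = a • y + z := by
  rw [spanL, spanL, ← Submodule.mem_span_insert]
  have : {x | x ∈ y :: l} = insert y {x | x ∈ l} := by ext; simp
  rw [this]

theorem spanL_perm {l l' : List E} (h : l.Perm l') : spanL l = spanL l' := by
  rw [spanL, spanL]
  congr 1
  ext x
  exact h.mem_iff

theorem spanL_nil : spanL ([] : List E) = ⊥ := by simp [spanL]

theorem mem_spanL {x : E} {l : List E} (h : x ∈ l) : x ∈ spanL l := Submodule.subset_span h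

theorem IsVal.D_add_span (hμ : IsVal μ) {l : List E} {z : E} (hz : z ∈ spanL l) (x : E) :
    D (x + z) (CVal.DL l μ) = D x (CVal.DL l μ) := by
  induction l generalizing z x with
  | nil =>
    rw [spanL_nil, Submodule.mem_bot] at hz
    rw [hz, add_zero]
  | cons y l ih =>
    obtain ⟨a, z', hz', rfl⟩ := mem_spanL_cons.1 hz
    rw [DL_cons, show x + (a • y + z') = x + z' + a • y by abel, (hμ.DL l).D_shear, D_comm,
      ih hz', D_comm]

theorem IsVal.D_of_mem_span (hμ : IsVal μ) {l : List E} {z : E} (hz : z ∈ spanL l) :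
    D z (CVal.DL l μ) = 0 := by
  rw [← zero_add z, hμ.D_add_span hz, D_zero_left]

theorem exists_perm_of_mem_spanL {l : List E} {x : E} (hx : x ∈ spanL l) (h0 : x ≠ 0) :
    ∃ y r, l.Perm (y :: r) ∧ ∃ a : ℝ, a ≠ 0 ∧ ∃ z ∈ spanL r, x = a • y + z := by
  induction l with
  | nil => rw [spanL_nil, Submodule.mem_bot] at hx; exact absurd hx h0
  | cons y l ih =>
    obtain ⟨a, z, hz, rfl⟩ := mem_spanL_cons.1 hx
    by_cases ha : a = 0
    · subst ha
      rw [zero_smul, zero_add] at ih h0 ⊢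
      obtain ⟨y', r, hp, a', ha', z', hz', h⟩ := ih hz
      refine ⟨y', y :: r, (hp.cons y).trans (List.Perm.swap _ _ _), a', ha', z', ?_, h⟩
      exact mem_spanL_cons.2 ⟨0, z', hz', by simp⟩
    · exact ⟨y, l, List.Perm.refl _, a, ha, z, hz, rfl⟩

/-- Up to a factor, iterated differences only depend on the span of the vectors. -/
theorem IsVal.exchange (hμ : IsVal μ) : ∀ (n : ℕ) (l l₂ : List E), l.length = n → l₂.length = n →
    (∀ x ∈ l, x ∈ spanL l₂) → ∃ c : ℂ, CVal.DL l μ = fun K => c * CVal.DL l₂ μ K := by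
  intro n
  induction n with
  | zero =>
    intro l l₂ h1 h2 _
    rw [List.length_eq_zero_iff] at h1 h2
    subst h1 h2
    exact ⟨1, by simp⟩
  | succ n ih =>
    intro l l₂ h1 h2 h
    obtain ⟨x, l', rfl⟩ := List.exists_cons_of_length_eq_add_one h1
    by_cases hx0 : x = 0
    · subst hx0
      exact ⟨0, by rw [DL_cons, D_zero_left]; funext K; simp⟩
    obtain ⟨y, r, hp, a, ha, z, hz, hxy⟩ :=
      exists_perm_of_mem_spanL (h x List.mem_cons_self) hx0
    have hr : r.length = n := by
      have := hp.length_eq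
      simp only [h2, List.length_cons] at this
      omega
    have key : ∀ l₀ : List E, (∀ w ∈ l₀, w ∈ spanL l₂) → ∃ l₁ : List E, l₁.length = l₀.length ∧
        (∀ w ∈ l₁, w ∈ spanL r) ∧ D x (CVal.DL l₀ μ) = D x (CVal.DL l₁ μ) := by
      intro l₀
      induction l₀ with
      | nil => exact fun _ => ⟨[], rfl, by simp, rfl⟩
      | cons w l₀ ih' =>
        intro hw
        obtain ⟨l₁, e1, e2, e3⟩ := ih' fun w hw' => hw w (List.mem_cons_of_mem _ hw')
        have hw1 := hw w List.mem_cons_self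
        rw [spanL_perm hp] at hw1
        obtain ⟨b, z', hz', hwz⟩ := mem_spanL_cons.1 hw1
        refine ⟨(z' - (b / a) • z) :: l₁, by simp [e1], ?_, ?_⟩
        · intro u hu
          rcases List.mem_cons.1 hu with rfl | hu
          · exact sub_mem hz' (Submodule.smul_mem _ _ hz)
          · exact e2 u hu
        · rw [DL_cons, DL_cons, D_comm, e3, D_comm x]
          have : w = z' - (b / a) • z + (b / a) • x := by
            rw [hwz, hxy, smul_add, smul_smul, div_mul_cancel₀ _ ha]; abel
          rw [this, (hμ.DL l₁).D_shear]
    obtain ⟨l₁, e1, e2, e3⟩ := key l' fun w hw => h w (List.mem_cons_of_mem _ hw)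
    obtain ⟨c, hc⟩ := ih l₁ r (by rw [e1]; simpa using h1) hr e2
    refine ⟨c * (|a| : ℝ), ?_⟩
    rw [DL_cons, e3, hc, D_const_mul, DL_perm hp, DL_cons, hxy, hμ.D_add_span hz,
      (hμ.DL r).D_smul]
    funext K; ring

end

end

section

variable {E : Type*} [NormedAddCommGroup E] [InnerProductSpace ℝ E]

/-- The support function of a convex body. -/
def supp (K : ConvexBody E) (w : E) : ℝ := sSup ((fun x => inner ℝ w x) '' (K : Set E))

theorem exists_eq_supp (K : ConvexBody E) (w : E) :
    ∃ x ∈ K, inner ℝ w x = supp K w ∧ ∀ y ∈ K, inner ℝ w y ≤ inner ℝ w x := by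
  obtain ⟨x, hx, h1, h2⟩ := K.isCompact.exists_sSup_image_eq_and_ge K.nonempty
    (f := fun x => inner ℝ w x) (by fun_prop)
  exact ⟨x, hx, h1.symm, h2⟩

theorem le_supp {K : ConvexBody E} {x : E} (hx : x ∈ K) (w : E) : inner ℝ w x ≤ supp K w := by
  obtain ⟨y, -, h1, h2⟩ := exists_eq_supp K w
  rw [← h1]; exact h2 x hx

theorem supp_le {K : ConvexBody E} {w : E} {c : ℝ} (h : ∀ x ∈ K, inner ℝ w x ≤ c) :
    supp K w ≤ c := by
  obtain ⟨y, hy, h1, -⟩ := exists_eq_supp K w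
  rw [← h1]; exact h y hy

theorem supp_add (K L : ConvexBody E) (w : E) : supp (K + L) w = supp K w + supp L w := by
  apply le_antisymm
  · refine supp_le ?_
    rintro _ ⟨a, ha, b, hb, rfl⟩
    rw [inner_add_right]
    exact add_le_add (le_supp ha w) (le_supp hb w)
  · obtain ⟨a, ha, h1, -⟩ := exists_eq_supp K w
    obtain ⟨b, hb, h2, -⟩ := exists_eq_supp L w
    rw [← h1, ← h2, ← inner_add_right]
    exact le_supp (mem_add.2 ⟨a, ha, b, hb, rfl⟩) w

theorem supp_pt (x w : E) : supp (pt x) w = inner ℝ w x :=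
  le_antisymm (supp_le (by rintro y rfl; exact le_rfl)) (le_supp rfl w)

theorem supp_zero (w : E) : supp (0 : ConvexBody E) w = 0 := by
  rw [← pt_zero, supp_pt, inner_zero_right]

theorem supp_seg (v w : E) : supp (seg v) w = max 0 (inner ℝ w v) := by
  apply le_antisymm
  · refine supp_le ?_
    rintro _ ⟨t, ht, rfl⟩
    rw [inner_smul_right]
    rcases le_total 0 (inner ℝ w v) with h | h
    · rw [max_eq_right h]; nlinarith [ht.2]
    · rw [max_eq_left h]; nlinarith [ht.1]
  · refine max_le ?_ ?_
    · have := le_supp (K := seg v) (x := 0) ⟨0, by simp, by simp⟩ w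
      rwa [inner_zero_right] at this
    · exact le_supp (K := seg v) (x := v) ⟨1, by simp, by simp⟩ w

theorem supp_smul_of_nonneg (K : ConvexBody E) (w : E) {t : ℝ} (ht : 0 ≤ t) :
    supp K (t • w) = t * supp K w := by
  apply le_antisymm
  · refine supp_le fun x hx => ?_
    rw [real_inner_smul_left]
    exact mul_le_mul_of_nonneg_left (le_supp hx w) ht
  · obtain ⟨a, ha, h1, -⟩ := exists_eq_supp K w
    rw [← h1, ← real_inner_smul_left]
    exact le_supp ha _

theorem supp_add_le (K : ConvexBody E) (v w : E) : supp K (v + w) ≤ supp K v + supp K w := by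
  refine supp_le fun x hx => ?_
  rw [inner_add_left]
  exact add_le_add (le_supp hx v) (le_supp hx w)

theorem supp_le_add_dist (K L : ConvexBody E) (w : E) :
    supp K w ≤ supp L w + dist K L * ‖w‖ := by
  refine supp_le fun x hx => ?_
  obtain ⟨y, hy, h⟩ := exists_norm_sub_le K L hx
  have h1 : inner ℝ w (x - y) ≤ ‖w‖ * ‖x - y‖ := real_inner_le_norm _ _
  have h2 := le_supp hy w
  rw [inner_sub_right] at h1
  nlinarith [norm_nonneg w]

theorem abs_supp_sub_le (K L : ConvexBody E) (w : E) :
    |supp K w - supp L w| ≤ dist K L * ‖w‖ := by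
  rw [abs_le]
  have h1 := supp_le_add_dist K L w
  have h2 := supp_le_add_dist L K w
  rw [dist_comm] at h2
  constructor <;> linarith

theorem abs_supp_le {K : ConvexBody E} {R : ℝ} (hR : ∀ x ∈ K, ‖x‖ ≤ R) (w : E) :
    |supp K w| ≤ R * ‖w‖ := by
  obtain ⟨x, hx, h1, -⟩ := exists_eq_supp K w
  rw [← h1, mul_comm]
  exact (abs_real_inner_le_norm _ _).trans (mul_le_mul_of_nonneg_left (hR x hx) (norm_nonneg _))

theorem supp_sub_le (K : ConvexBody E) {R : ℝ} (hR : ∀ x ∈ K, ‖x‖ ≤ R) (v w : E) :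
    |supp K v - supp K w| ≤ R * ‖v - w‖ := by
  have h1 := supp_add_le K (v - w) w
  have h2 := supp_add_le K (w - v) v
  rw [sub_add_cancel] at h1 h2
  have h3 := (abs_le.1 (abs_supp_le hR (v - w))).2
  have h4 := (abs_le.1 (abs_supp_le hR (w - v))).2
  rw [norm_sub_rev w v] at h4
  rw [abs_le]; constructor <;> linarith

theorem continuous_supp (K : ConvexBody E) : Continuous (supp K) := by
  obtain ⟨R, hR0, hR⟩ := exists_bound K
  refine LipschitzWith.continuous (K := ⟨R, hR0.le⟩) (LipschitzWith.of_dist_le_mul fun v w => ?_)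
  rw [Real.dist_eq, dist_eq_norm]
  exact supp_sub_le K hR v w

section

theorem exists_normal (L : ConvexBody E) (x : E) :
    ∃ y ∈ L, supp L (x - y) = inner ℝ (x - y) y := by
  obtain ⟨y, hy, h⟩ := exists_norm_eq_iInf_of_complete_convex L.nonempty
    L.isCompact.isComplete L.convex x
  rw [norm_eq_iInf_iff_real_inner_le_zero L.convex hy] at h
  refine ⟨y, hy, le_antisymm (supp_le fun z hz => ?_) (le_supp hy _)⟩
  have := h z hz
  rw [inner_sub_right] at this
  linarith

theorem dist_le_of_supp {K L : ConvexBody E} {r : ℝ} (hr : 0 ≤ r)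
    (h : ∀ w, |supp K w - supp L w| ≤ r * ‖w‖) : dist K L ≤ r := by
  have key : ∀ {K L : ConvexBody E}, (∀ w, |supp K w - supp L w| ≤ r * ‖w‖) →
      ∀ x ∈ K, ∃ y ∈ L, ‖x - y‖ ≤ r := by
    intro K L h x hx
    obtain ⟨y, hy, e⟩ := exists_normal L x
    refine ⟨y, hy, ?_⟩
    have h1 := (abs_le.1 (h (x - y))).2
    have h2 := le_supp hx (x - y)
    have h3 : ‖x - y‖ * ‖x - y‖ = inner ℝ (x - y) x - inner ℝ (x - y) y := by
      rw [← inner_sub_right, real_inner_self_eq_norm_mul_norm]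
    by_contra! h4
    nlinarith [norm_nonneg (x - y)]
  refine dist_le_of hr (key h) fun y hy => ?_
  obtain ⟨x, hx, h'⟩ := key (K := L) (L := K) (fun w => by rw [abs_sub_comm]; exact h w) y hy
  exact ⟨x, hx, by rwa [norm_sub_rev]⟩

theorem le_of_supp_le {K L : ConvexBody E} (h : ∀ w, supp K w ≤ supp L w) : K ≤ L := by
  intro x hx
  obtain ⟨y, hy, e⟩ := exists_normal L x
  have h1 := h (x - y)
  have h2 := le_supp hx (x - y)
  have h3 : ‖x - y‖ * ‖x - y‖ = inner ℝ (x - y) x - inner ℝ (x - y) y := by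
    rw [← inner_sub_right, real_inner_self_eq_norm_mul_norm]
  have h4 : ‖x - y‖ = 0 := by nlinarith [norm_nonneg (x - y)]
  rw [norm_eq_zero, sub_eq_zero] at h4
  rwa [h4]

theorem ext_supp {K L : ConvexBody E} (h : ∀ w, supp K w = supp L w) : K = L :=
  le_antisymm (le_of_supp_le fun w => (h w).le) (le_of_supp_le fun w => (h w).ge)

theorem mem_of_inner_le {K : ConvexBody E} {x : E} (h : ∀ w, inner ℝ w x ≤ supp K w) : x ∈ K := by
  have : pt x ≤ K := le_of_supp_le fun w => by rw [supp_pt]; exact h w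
  exact this rfl

end

section

variable [FiniteDimensional ℝ E]

/-- A sublinear function is the support function of a convex body. -/
theorem exists_body (h : E → ℝ) (h1 : ∀ t : ℝ, 0 < t → ∀ w, h (t • w) = t * h w)
    (h2 : ∀ v w, h (v + w) ≤ h v + h w) {C : ℝ} (hC : ∀ w, |h w| ≤ C * ‖w‖) :
    ∃ K : ConvexBody E, ∀ w, supp K w = h w := by
  have h0 : h 0 = 0 := by simpa using hC 0
  have key : ∀ w₀, ∃ x : E, (∀ w, inner ℝ w x ≤ h w) ∧ inner ℝ w₀ x = h w₀ := by
    intro w₀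
    by_cases hw : w₀ = 0
    · subst hw
      obtain ⟨g, -, hg⟩ := exists_extension_of_le_sublinear (⟨⊥, 0⟩ : E →ₗ.[ℝ] ℝ) h h1 h2 (by
        rintro ⟨x, hx⟩
        simp only [Submodule.mem_bot] at hx
        subst hx
        exact h0.ge)
      refine ⟨(InnerProductSpace.toDual ℝ E).symm (LinearMap.toContinuousLinearMap g),
        fun w => ?_, by simp [h0]⟩
      rw [real_inner_comm, InnerProductSpace.toDual_symm_apply]
      exact hg w
    · obtain ⟨g, hg1, hg⟩ := exists_extension_of_le_sublinear
        (LinearPMap.mkSpanSingleton w₀ (h w₀) hw) h h1 h2 (by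
        rintro ⟨x, hx⟩
        obtain ⟨t, rfl⟩ := Submodule.mem_span_singleton.1 hx
        rw [show LinearPMap.mkSpanSingleton w₀ (h w₀) hw ⟨t • w₀, hx⟩ = t • h w₀ from
          LinearPMap.mkSpanSingleton'_apply _ _ _ _ _]
        rcases lt_trichotomy t 0 with ht | ht | ht
        · have e1 := h2 (t • w₀) ((-t) • w₀)
          rw [h1 (-t) (by linarith), ← add_smul, add_neg_cancel, zero_smul, h0] at e1
          simp only [smul_eq_mul]; linarith
        · subst ht; simp [h0]
        · rw [h1 t ht]; rfl)
      refine ⟨(InnerProductSpace.toDual ℝ E).symm (LinearMap.toContinuousLinearMap g),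
        fun w => ?_, ?_⟩
      · rw [real_inner_comm, InnerProductSpace.toDual_symm_apply]
        exact hg w
      · rw [real_inner_comm, InnerProductSpace.toDual_symm_apply]
        have := hg1 ⟨w₀, Submodule.mem_span_singleton_self w₀⟩
        simp only [LinearMap.coe_toContinuousLinearMap'] at this ⊢
        rw [this]
        exact LinearPMap.mkSpanSingleton_apply ℝ ℝ hw (h w₀)
  have hcl : IsClosed {x : E | ∀ w, inner ℝ w x ≤ h w} := by
    rw [Set.ofPred_forall]
    exact isClosed_iInter fun w => isClosed_le (by fun_prop) continuous_const
  have hb : {x : E | ∀ w, inner ℝ w x ≤ h w} ⊆ Metric.closedBall 0 (max C 0) := by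
    intro x hx
    rw [mem_closedBall_zero_iff]
    have e1 := hx x
    rw [real_inner_self_eq_norm_mul_norm] at e1
    have e2 := (abs_le.1 (hC x)).2
    rcases (norm_nonneg x).eq_or_lt with h4 | h4
    · rw [← h4]; exact le_max_right _ _
    · exact le_max_of_le_left (le_of_mul_le_mul_right (e1.trans e2) h4)
  obtain ⟨x₀, hx₀, -⟩ := key 0
  refine ⟨⟨{x : E | ∀ w, inner ℝ w x ≤ h w}, ?_,
    Metric.isCompact_of_isClosed_isBounded hcl (Metric.isBounded_closedBall.subset hb),
    ⟨x₀, hx₀⟩⟩, fun w => ?_⟩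
  · intro x hx y hy a b ha hb hab w
    rw [inner_add_right, inner_smul_right, inner_smul_right]
    have := hx w
    have := hy w
    calc _ ≤ a * h w + b * h w := by gcongr
      _ = h w := by rw [← add_mul, hab, one_mul]
  · obtain ⟨x, hx, hxw⟩ := key w
    refine le_antisymm (supp_le fun y hy => hy w) ?_
    rw [← hxw]
    refine le_supp ?_ w
    exact hx

end

end

section

variable {E : Type*} [NormedAddCommGroup E] [InnerProductSpace ℝ E]

/-- The zonotope spanned by a list of vectors. -/
def zon (l : List E) : ConvexBody E := (l.map seg).sum

theorem zon_nil : zon ([] : List E) = 0 := rfl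

theorem zon_cons (x : E) (l : List E) : zon (x :: l) = seg x + zon l := by
  simp [zon]

theorem supp_zon (l : List E) (w : E) :
    supp (zon l) w = (l.map fun v => max 0 (inner ℝ w v)).sum := by
  induction l with
  | nil => exact supp_zero w
  | cons x l ih => rw [zon_cons, supp_add, ih, supp_seg, List.map_cons, List.sum_cons]

variable [FiniteDimensional ℝ E] [MeasurableSpace E] [BorelSpace E]

omit [FiniteDimensional ℝ E] [BorelSpace E] in
theorem integrable_max_inner {m : Measure E} (hm : Integrable (fun x : E => x) m) (w : E) :
    Integrable (fun x => max 0 (inner ℝ w x)) m := by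
  have h : Integrable (fun x : E => inner ℝ w x) m := hm.const_inner w
  simpa [max_comm] using h.pos_part

omit [BorelSpace E] in
theorem exists_zonoid {m : Measure E} (hm : Integrable (fun x : E => x) m) :
    ∃ Z : ConvexBody E, ∀ w, supp Z w = ∫ x, max 0 (inner ℝ w x) ∂m := by
  refine exists_body _ (C := ∫ x, ‖x‖ ∂m) ?_ ?_ ?_
  · intro t ht w
    rw [← integral_const_mul]
    congr 1; ext x
    rw [real_inner_smul_left, mul_max_of_nonneg _ _ ht.le, mul_zero]
  · intro v w
    rw [← integral_add (integrable_max_inner hm v) (integrable_max_inner hm w)]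
    refine integral_mono (integrable_max_inner hm _)
      ((integrable_max_inner hm v).add (integrable_max_inner hm w)) fun x => ?_
    rw [inner_add_left]
    exact max_le (by positivity) (add_le_add (le_max_right _ _) (le_max_right _ _))
  · intro w
    rw [← Real.norm_eq_abs, ← integral_mul_const]
    refine (norm_integral_le_integral_norm _).trans ?_
    refine integral_mono (integrable_max_inner hm _).norm (hm.norm.mul_const _) fun x => ?_
    simp only [Real.norm_eq_abs]
    rw [abs_of_nonneg (le_max_left _ _)]
    refine max_le (by positivity) ?_
    rw [mul_comm]
    exact real_inner_le_norm _ _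

omit [MeasurableSpace E] [BorelSpace E] in
theorem bound_of_homogeneous {A : E → ℂ} (hA : Continuous A)
    (hA1 : ∀ t : ℝ, 0 ≤ t → ∀ v, A (t • v) = t * A v) : ∃ C, 0 ≤ C ∧ ∀ v, ‖A v‖ ≤ C * ‖v‖ := by
  obtain ⟨C, hC⟩ := (isCompact_closedBall (0 : E) 1).exists_bound_of_continuousOn hA.continuousOn
  refine ⟨C, (norm_nonneg _).trans (hC 0 (by simp)), fun v => ?_⟩
  rcases eq_or_ne v 0 with rfl | hv
  · have := hA1 0 le_rfl 0
    simp only [zero_smul, Complex.ofReal_zero, zero_mul] at this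
    simp [this]
  · have h0 : 0 < ‖v‖ := norm_pos_iff.2 hv
    have h1 := hC (‖v‖⁻¹ • v) (by simp [norm_smul, h0.ne'])
    have h2 := hA1 ‖v‖ h0.le (‖v‖⁻¹ • v)
    rw [smul_smul, mul_inv_cancel₀ h0.ne', one_smul] at h2
    rw [h2, norm_mul, Complex.norm_real, norm_norm, mul_comm]
    gcongr

/-- A continuous functional which is additive over the segments of a zonotope is given on zonoids
by integration. -/
theorem zonoid_integral {A : E → ℂ} (hA : Continuous A)
    (hA1 : ∀ t : ℝ, 0 ≤ t → ∀ v, A (t • v) = t * A v) {Φ : ConvexBody E → ℂ} (hΦ : Continuous Φ)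
    (hΦA : ∀ l : List E, Φ (zon l) = (l.map A).sum) {m : Measure E} [IsFiniteMeasure m]
    (hm : Integrable (fun x : E => x) m) {Z : ConvexBody E}
    (hZ : ∀ w, supp Z w = ∫ x, max 0 (inner ℝ w x) ∂m) : Φ Z = ∫ x, A x ∂m := by
  have : ProperSpace E := FiniteDimensional.proper ℝ E
  obtain ⟨C, hC0, hC⟩ := bound_of_homogeneous hA hA1
  let f₁ : E → C(Metric.closedBall (0 : E) 1, ℝ) := fun x =>
    ⟨fun w => max 0 (inner ℝ (w : E) x), by fun_prop⟩
  have hf₁ : Continuous f₁ := by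
    refine ContinuousMap.continuous_of_continuous_uncurry _ ?_
    change Continuous fun p : E × Metric.closedBall (0 : E) 1 => max 0 (inner ℝ (p.2 : E) p.1)
    fun_prop
  let f : E → C(Metric.closedBall (0 : E) 1, ℝ) × ℂ := fun x => (f₁ x, A x)
  have hf : Continuous f := hf₁.prodMk hA
  have hfh : ∀ t : ℝ, 0 ≤ t → ∀ v, f (t • v) = t • f v := by
    intro t ht v
    refine Prod.ext ?_ ?_
    · ext w
      simp only [f, f₁, ContinuousMap.coe_mk, Prod.smul_fst, ContinuousMap.smul_apply, smul_eq_mul]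
      rw [inner_smul_right, mul_max_of_nonneg _ _ ht, mul_zero]
    · simp [f, hA1 t ht]
  have hfn : ∀ x, ‖f x‖ ≤ max 1 C * ‖x‖ := by
    intro x
    refine max_le ?_ ?_
    · rw [ContinuousMap.norm_le _ (by positivity)]
      intro w
      simp only [f, f₁, ContinuousMap.coe_mk, Real.norm_eq_abs]
      rw [abs_of_nonneg (le_max_left _ _)]
      refine max_le (by positivity) ((real_inner_le_norm _ _).trans ?_)
      have := mem_closedBall_zero_iff.1 w.2
      gcongr
      exact this.trans (le_max_left _ _)
    · exact (hC x).trans (by gcongr; exact le_max_right _ _)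
  have hfi : Integrable f m := by
    refine Integrable.mono' (hm.norm.const_mul (max 1 C)) hf.aestronglyMeasurable ?_
    exact Eventually.of_forall hfn
  let T : Set (C(Metric.closedBall (0 : E) 1, ℝ) × ℂ) := {p | ∃ l : List E, p = (l.map f).sum}
  have hsm : ∀ t : ℝ, 0 ≤ t → ∀ p ∈ T, t • p ∈ T := by
    rintro t ht _ ⟨l, rfl⟩
    refine ⟨l.map (t • ·), ?_⟩
    rw [List.smul_sum, List.map_map, List.map_map]
    congr 1
    exact List.map_congr_left fun x _ => (hfh t ht x).symm
  have hT : Convex ℝ T := by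
    intro p hp q hq a b ha hb _
    obtain ⟨l, hl⟩ := hsm a ha p hp
    obtain ⟨l', hl'⟩ := hsm b hb q hq
    exact ⟨l ++ l', by rw [hl, hl', List.map_append, List.sum_append]⟩
  have hmem : ∫ x, f x ∂m ∈ closure T := by
    rcases eq_or_ne m 0 with rfl | hm0
    · rw [integral_zero_measure]
      exact subset_closure ⟨[], rfl⟩
    · have : NeZero m := ⟨hm0⟩
      have h := hT.closure.average_mem isClosed_closure
        (Eventually.of_forall fun x => subset_closure ⟨[x], by simp⟩) hfi
      rw [← measure_smul_average]
      exact map_mem_closure (continuous_const_smul (m.real univ)) h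
        fun p hp => hsm _ measureReal_nonneg p hp
  have hfst : ∀ w : Metric.closedBall (0 : E) 1, (∫ x, f x ∂m).1 w = supp Z w := by
    intro w
    rw [hZ]
    have := ((ContinuousMap.evalCLM ℝ w).comp
      (ContinuousLinearMap.fst ℝ C(Metric.closedBall (0 : E) 1, ℝ) ℂ)).integral_comp_comm hfi
    exact this.symm
  have hsnd : (∫ x, f x ∂m).2 = ∫ x, A x ∂m :=
    ((ContinuousLinearMap.snd ℝ C(Metric.closedBall (0 : E) 1, ℝ) ℂ).integral_comp_comm hfi).symm
  rw [← hsnd]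
  refine eq_of_forall_dist_le fun ε hε => ?_
  obtain ⟨δ, hδ, hδ'⟩ := Metric.continuous_iff.1 hΦ Z (ε / 2) (by positivity)
  obtain ⟨p, ⟨l, rfl⟩, hp⟩ := Metric.mem_closure_iff.1 hmem (min (δ / 2) (ε / 2)) (by positivity)
  have hl1 : ∀ l : List E, ∀ w : Metric.closedBall (0 : E) 1,
      (l.map f).sum.1 w = supp (zon l) w := by
    intro l w
    rw [supp_zon]
    induction l with
    | nil => rfl
    | cons x l ih =>
      rw [List.map_cons, List.sum_cons, List.map_cons, List.sum_cons, ← ih]; rfl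
  have hl2 : ∀ l : List E, (l.map f).sum.2 = (l.map A).sum := by
    intro l
    induction l with
    | nil => rfl
    | cons x l ih =>
      rw [List.map_cons, List.sum_cons, List.map_cons, List.sum_cons, ← ih]; rfl
  have hd : dist (zon l) Z ≤ δ / 2 := by
    refine dist_le_of_supp (by positivity) fun w => ?_
    rcases eq_or_ne w 0 with rfl | hw
    · have h1 := abs_supp_sub_le (zon l) Z 0
      simpa using h1
    · have h0 : 0 < ‖w‖ := norm_pos_iff.2 hw
      have h1 : ‖w‖⁻¹ • w ∈ Metric.closedBall (0 : E) 1 := by simp [norm_smul, h0.ne']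
      have h2 : dist ((l.map f).sum.1 ⟨_, h1⟩) ((∫ x, f x ∂m).1 ⟨_, h1⟩) ≤ δ / 2 := by
        refine (ContinuousMap.dist_apply_le_dist _).trans ?_
        rw [dist_comm]
        exact (le_max_left _ _).trans (hp.le.trans (min_le_left _ _))
      rw [hl1, hfst, Real.dist_eq] at h2
      simp only [supp_smul_of_nonneg _ _ (inv_nonneg.2 h0.le)] at h2
      rw [← mul_sub, abs_mul, abs_of_nonneg (inv_nonneg.2 h0.le), inv_mul_le_iff₀ h0] at h2
      linarith
  have h1 := hδ' (zon l) (by linarith)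
  rw [hΦA, ← hl2] at h1
  have h2 : dist (∫ x, f x ∂m).2 (l.map f).sum.2 < ε / 2 :=
    (le_max_right _ _).trans_lt (hp.trans_le (min_le_right _ _))
  calc _ ≤ dist (Φ Z) (l.map f).sum.2 + dist (l.map f).sum.2 (∫ x, f x ∂m).2 := dist_triangle _ _ _
    _ ≤ ε / 2 + ε / 2 := by
      exact add_le_add ((dist_comm _ _).trans_le h1.le) ((dist_comm _ _).trans_le h2.le)
    _ = ε := by ring

end

section

open SchwartzMap FourierTransform
open scoped ContDiff

/-- The kernel `(1 - cos u) / u²`. -/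
def cosKer (u : ℝ) : ℝ := (1 - Real.cos u) / u ^ 2

theorem cosKer_nonneg (u : ℝ) : 0 ≤ cosKer u :=
  div_nonneg (by linarith [Real.cos_le_one u]) (sq_nonneg u)

theorem integrable_cosKer : Integrable cosKer := by
  refine Integrable.mono' (integrable_inv_one_add_sq.const_mul 3) ?_ (Eventually.of_forall fun u => ?_)
  · exact (by unfold cosKer; fun_prop : Measurable cosKer).aestronglyMeasurable
  · rw [Real.norm_eq_abs, abs_of_nonneg (cosKer_nonneg u), cosKer, ← div_eq_mul_inv]
    rcases eq_or_ne u 0 with rfl | hu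
    · simp
    · have h1 := Real.one_sub_sq_div_two_le_cos (x := u)
      have h2 := Real.neg_one_le_cos u
      have hu2 : 0 < u ^ 2 := by positivity
      rw [div_le_div_iff₀ hu2 (by positivity)]
      nlinarith

theorem cosKer_mul (a s : ℝ) : (1 - Real.cos (a * s)) / s ^ 2 = |a| ^ 2 * cosKer (|a| * s) := by
  have h : Real.cos (|a| * s) = Real.cos (a * s) := by
    rcases abs_cases a with ⟨h, -⟩ | ⟨h, -⟩ <;> rw [h]
    rw [neg_mul, Real.cos_neg]
  rcases eq_or_ne a 0 with rfl | ha
  · simp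
  · rw [cosKer, h, mul_pow, ← mul_div_assoc, mul_div_mul_left]
    simpa using ha

theorem integrableOn_cosKer_mul (a : ℝ) :
    IntegrableOn (fun s => (1 - Real.cos (a * s)) / s ^ 2) (Ioi 0) := by
  simp_rw [cosKer_mul]
  rcases eq_or_ne a 0 with rfl | ha
  · simp
  · exact ((integrable_cosKer.comp_mul_left' (abs_ne_zero.2 ha)).const_mul _).integrableOn

theorem integral_cosKer_mul (a : ℝ) :
    ∫ s in Ioi 0, (1 - Real.cos (a * s)) / s ^ 2 = |a| * ∫ s in Ioi 0, cosKer s := by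
  simp_rw [cosKer_mul]
  rcases eq_or_ne a 0 with rfl | ha
  · simp
  · have h0 : 0 < |a| := abs_pos.2 ha
    rw [integral_const_mul, integral_comp_mul_left_Ioi cosKer 0 h0, mul_zero, smul_eq_mul]
    field_simp

variable {V : Type*} [NormedAddCommGroup V] [InnerProductSpace ℝ V] [FiniteDimensional ℝ V]
  [MeasurableSpace V] [BorelSpace V]

theorem exists_cos_transform (σ : 𝓢(V, ℂ)) (hσ : ∀ v, σ (-v) = σ v) :
    ∃ ρ : 𝓢(V, ℂ), ∀ w, σ w = ∫ x, ρ x * (Real.cos (2 * Real.pi * inner ℝ x w) : ℝ) := by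
  refine ⟨𝓕 σ, fun w => ?_⟩
  have h : ∀ w, σ w = ∫ x, Complex.exp (↑(2 * Real.pi * inner ℝ x w) * Complex.I) • (𝓕 σ) x := by
    intro w
    rw [← Real.fourierInv_eq', ← fourierInv_coe, fourierInv_fourier_eq]
  have hi : ∀ w, Integrable
      (fun x => Complex.exp (↑(2 * Real.pi * inner ℝ x w) * Complex.I) • (𝓕 σ) x) := by
    intro w
    refine Integrable.mono' (𝓕 σ).integrable.norm ?_ (Eventually.of_forall fun x => ?_)
    · exact (by have := (𝓕 σ).continuous; fun_prop :
        Continuous _).aestronglyMeasurable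
    · rw [norm_smul, Complex.norm_exp_ofReal_mul_I, one_mul]
  have h2 : σ w = (1 / 2) * (σ w + σ (-w)) := by rw [hσ]; ring
  rw [h2, h w, h (-w), ← integral_add (hi w) (hi (-w)), ← integral_const_mul]
  congr 1; ext x
  rw [inner_neg_right, Complex.ofReal_cos, Complex.cos]
  push_cast
  simp only [smul_eq_mul]
  rw [show (2 : ℂ) * Real.pi * -(inner ℝ x w : ℝ) * Complex.I =
    -(2 * Real.pi * (inner ℝ x w : ℝ)) * Complex.I by ring]
  ring

theorem exists_radial_cutoff : ∃ η : ℝ → ℝ, ContDiff ℝ ∞ η ∧ (∀ t, 0 ≤ η t) ∧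
    (∀ t ≤ 1, η t = 0) ∧ (∀ t, 3 ≤ t → η t = 0) ∧ 0 < ∫ s in Ioi 0, η (s ^ 2) / s := by
  let b : ContDiffBump (2 : ℝ) := ⟨1 / 2, 1, by norm_num, by norm_num⟩
  have h1 : ∀ t ≤ 1, b t = 0 := fun t ht => b.zero_of_le_dist (by
    change 1 ≤ _
    rw [Real.dist_eq, abs_of_nonpos] <;> linarith)
  have h3 : ∀ t, 3 ≤ t → b t = 0 := fun t ht => b.zero_of_le_dist (by
    change 1 ≤ _
    rw [Real.dist_eq, abs_of_nonneg] <;> linarith)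
  refine ⟨b, b.contDiff, fun t => b.nonneg, h1, h3, ?_⟩
  have hk : (fun s : ℝ => b (s ^ 2) / s) = fun s => b (s ^ 2) * (s / max 1 (s ^ 2)) := by
    ext s
    rcases le_total (s ^ 2) 1 with h | h
    · simp [h1 _ h]
    · have hs : s ≠ 0 := by rintro rfl; norm_num at h
      rw [max_eq_right h]
      field_simp
  have hc : Continuous fun s : ℝ => b (s ^ 2) / s := by
    rw [hk]
    have h4 : ∀ s : ℝ, max 1 (s ^ 2) ≠ 0 := fun s => by positivity
    have := b.continuous
    exact (by fun_prop : Continuous fun s : ℝ => b (s ^ 2)).mul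
      (continuous_id.div (by fun_prop) h4)
  have hs : HasCompactSupport fun s : ℝ => b (s ^ 2) / s := by
    refine HasCompactSupport.intro (isCompact_Icc (a := -2) (b := 2)) fun s hs => ?_
    rw [h3, zero_div]
    rw [mem_Icc, not_and_or, not_le, not_le] at hs
    rcases hs with hs | hs <;> nlinarith
  rw [setIntegral_pos_iff_support_of_nonneg_ae]
  · have hsub : Ioo (1.3 : ℝ) 1.5 ⊆ (Function.support fun s : ℝ => b (s ^ 2) / s) ∩ Ioi 0 := by
      intro s hs
      have h0 : 0 < s := by linarith [hs.1]
      refine ⟨?_, h0⟩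
      have : b (s ^ 2) = 1 := b.one_of_mem_closedBall (by
        rw [Metric.mem_closedBall, Real.dist_eq, abs_le]
        change -(1 / 2) ≤ _ ∧ _ ≤ 1 / 2
        obtain ⟨h5, h6⟩ := hs
        constructor <;> nlinarith)
      simp [this, h0.ne']
    refine lt_of_lt_of_le ?_ (measure_mono hsub)
    rw [Real.volume_Ioo]
    norm_num
  · filter_upwards [self_mem_ae_restrict measurableSet_Ioi] with s hs
    exact div_nonneg b.nonneg (le_of_lt hs)
  · exact (hc.integrable_of_hasCompactSupport hs).integrableOn

theorem integrable_cosKer_prod (ρ : 𝓢(V, ℂ)) (v : V) :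
    Integrable (Function.uncurry fun (x : V) (s : ℝ) =>
      ρ x * ((1 - Real.cos (2 * Real.pi * inner ℝ x v * s)) / s ^ 2 : ℝ))
      (volume.prod (volume.restrict (Ioi (0 : ℝ)))) := by
  have hm : AEStronglyMeasurable (Function.uncurry fun (x : V) (s : ℝ) =>
      ρ x * ((1 - Real.cos (2 * Real.pi * inner ℝ x v * s)) / s ^ 2 : ℝ))
      (volume.prod (volume.restrict (Ioi (0 : ℝ)))) := by
    have h1 : Measurable fun p : V × ℝ => ρ p.1 := ρ.continuous.measurable.comp measurable_fst
    have h2 : Measurable fun p : V × ℝ =>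
        (1 - Real.cos (2 * Real.pi * inner ℝ p.1 v * p.2)) / p.2 ^ 2 :=
      (by fun_prop : Continuous fun p : V × ℝ =>
        1 - Real.cos (2 * Real.pi * inner ℝ p.1 v * p.2)).measurable.div
        (measurable_snd.pow_const 2)
    exact (h1.mul (Complex.measurable_ofReal.comp h2)).aestronglyMeasurable
  rw [integrable_prod_iff hm]
  constructor
  · refine Eventually.of_forall fun x => ?_
    have h := (integrableOn_cosKer_mul (2 * Real.pi * inner ℝ x v)).integrable.ofReal (𝕜 := ℂ)
    exact h.const_mul (ρ x)
  · have hpos : ∀ (x : V) (s : ℝ), |(1 - Real.cos (2 * Real.pi * inner ℝ x v * s)) / s ^ 2| =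
        (1 - Real.cos (2 * Real.pi * inner ℝ x v * s)) / s ^ 2 := fun x s =>
      abs_of_nonneg (div_nonneg (sub_nonneg.2 (Real.cos_le_one _)) (sq_nonneg s))
    have : ∀ x : V, (∫ s in Ioi 0, ‖Function.uncurry (fun (x : V) (s : ℝ) =>
        ρ x * ((1 - Real.cos (2 * Real.pi * inner ℝ x v * s)) / s ^ 2 : ℝ)) (x, s)‖) =
        (‖ρ x‖ * |inner ℝ x v|) * (2 * Real.pi * ∫ s in Ioi 0, cosKer s) := by
      intro x
      simp only [Function.uncurry_apply_pair, norm_mul, Complex.norm_real, Real.norm_eq_abs, hpos]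
      rw [integral_const_mul, integral_cosKer_mul, abs_mul,
        abs_of_pos (by positivity : 0 < 2 * Real.pi)]
      ring
    simp only [this]
    refine Integrable.mul_const ?_ _
    refine Integrable.mono' ((ρ.integrable_pow_mul volume 1).const_mul ‖v‖) ?_
      (Eventually.of_forall fun x => ?_)
    · have := ρ.continuous
      exact (by fun_prop : Continuous _).aestronglyMeasurable
    · rw [norm_mul, norm_norm, Real.norm_eq_abs, abs_abs, pow_one]
      have := abs_real_inner_le_norm x v
      nlinarith [norm_nonneg (ρ x), mul_le_mul_of_nonneg_left this (norm_nonneg (ρ x))]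

theorem exists_abs_transform {h : V → ℂ} (he : ∀ v, h (-v) = h v)
    (h1 : ∀ t : ℝ, 0 ≤ t → ∀ v, h (t • v) = t * h v) (hs : ContDiffOn ℝ ∞ h {0}ᶜ) :
    ∃ ρ : 𝓢(V, ℂ), ∀ v, h v = ∫ x, ρ x * (|inner ℝ x v| : ℝ) := by
  obtain ⟨η, hη, hη0, hη1, hη3, hC1⟩ := exists_radial_cutoff
  set C1 := ∫ s in Ioi 0, η (s ^ 2) / s with hC1def
  have hh0 : h 0 = 0 := by simpa using h1 0 le_rfl 0
  have hsm : ContDiff ℝ ∞ fun w => h w * η (‖w‖ ^ 2) := by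
    rw [contDiff_iff_contDiffAt]
    intro w
    have hη' : ContDiff ℝ ∞ fun w : V => ((η (‖w‖ ^ 2) : ℝ) : ℂ) :=
      Complex.ofRealCLM.contDiff.comp (hη.comp (contDiff_norm_sq ℝ))
    rcases eq_or_ne w 0 with rfl | hw
    · refine contDiffAt_const (c := (0 : ℂ)) |>.congr_of_eventuallyEq ?_
      filter_upwards [Metric.ball_mem_nhds (0 : V) one_pos] with w hw
      rw [mem_ball_zero_iff] at hw
      rw [hη1 _ (by nlinarith [norm_nonneg w])]
      simp
    · exact (hs.contDiffAt (isOpen_compl_singleton.mem_nhds hw)).mul hη'.contDiffAt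
  have hcs : HasCompactSupport fun w => h w * η (‖w‖ ^ 2) := by
    have : ProperSpace V := FiniteDimensional.proper ℝ V
    refine HasCompactSupport.intro (isCompact_closedBall (0 : V) 2) fun w hw => ?_
    rw [mem_closedBall_zero_iff, not_le] at hw
    rw [hη3 _ (by nlinarith)]
    simp
  obtain ⟨ρ, hρ⟩ := exists_cos_transform (hcs.toSchwartzMap hsm) (by
    intro v
    simp [HasCompactSupport.toSchwartzMap_toFun, he])
  simp only [HasCompactSupport.toSchwartzMap_toFun] at hρ
  have hρ0 : ∫ x, ρ x = 0 := by
    have := hρ 0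
    simpa [hh0] using this.symm
  have hci : ∀ w, Integrable fun x => ρ x * (Real.cos (2 * Real.pi * inner ℝ x w) : ℝ) := by
    intro w
    refine Integrable.mono' ρ.integrable.norm ?_ (Eventually.of_forall fun x => ?_)
    · have := ρ.continuous
      exact (by fun_prop : Continuous _).aestronglyMeasurable
    · rw [norm_mul, Complex.norm_real]
      exact mul_le_of_le_one_right (norm_nonneg _) (Real.abs_cos_le_one _)
  set C0 := ∫ s in Ioi 0, cosKer s with hC0
  have key : ∀ v, (C1 : ℂ) * h v = -(2 * Real.pi * C0 : ℝ) * ∫ x, ρ x * (|inner ℝ x v| : ℝ) := by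
    intro v
    have e1 : ∀ s : ℝ, 0 < s → (η ((‖v‖ * s) ^ 2) / s : ℝ) * h v =
        -∫ x, ρ x * ((1 - Real.cos (2 * Real.pi * inner ℝ x v * s)) / s ^ 2 : ℝ) := by
      intro s hs
      have e2 := hρ (s • v)
      rw [h1 s hs.le, norm_smul, Real.norm_eq_abs, abs_of_pos hs] at e2
      have e3 : ∫ x, ρ x * ((1 - Real.cos (2 * Real.pi * inner ℝ x v * s)) / s ^ 2 : ℝ) =
          (1 / s ^ 2 : ℝ) * ∫ x, (ρ x - ρ x * (Real.cos (2 * Real.pi * inner ℝ x (s • v)) : ℝ)) := by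
        rw [← integral_const_mul]
        congr 1; ext x
        rw [inner_smul_right, show 2 * Real.pi * (s * inner ℝ x v) = 2 * Real.pi * inner ℝ x v * s
          by ring]
        push_cast
        ring
      rw [e3, integral_sub ρ.integrable (hci _), hρ0, ← e2]
      have : (s : ℂ) ≠ 0 := by exact_mod_cast hs.ne'
      rw [mul_comm ‖v‖ s]
      push_cast
      field_simp
      ring
    have e4 : ∫ s in Ioi 0, ((η ((‖v‖ * s) ^ 2) / s : ℝ) : ℂ) * h v = (C1 : ℂ) * h v := by
      rcases eq_or_ne v 0 with rfl | hv
      · simp [hh0]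
      · rw [integral_mul_const, integral_complex_ofReal]
        congr 2
        have hv0 : 0 < ‖v‖ := norm_pos_iff.2 hv
        have := integral_comp_mul_left_Ioi (fun s => η (s ^ 2) / s) 0 hv0
        rw [mul_zero, smul_eq_mul] at this
        rw [hC1def, ← mul_inv_cancel_left₀ hv0.ne' (∫ s in Ioi 0, η (s ^ 2) / s), ← this,
          ← integral_const_mul]
        refine setIntegral_congr_fun measurableSet_Ioi fun s hs => ?_
        have : s ≠ 0 := ne_of_gt hs
        field_simp
    rw [← e4, setIntegral_congr_fun measurableSet_Ioi (fun s hs => e1 s hs), integral_neg,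
      ← integral_integral_swap]
    · rw [neg_mul, ← integral_const_mul]
      congr 2; ext x
      rw [integral_const_mul, integral_complex_ofReal, integral_cosKer_mul, abs_mul,
        abs_of_pos (by positivity : 0 < 2 * Real.pi)]
      push_cast
      ring
    · exact integrable_cosKer_prod ρ v
  refine ⟨(-(2 * Real.pi * C0 : ℝ) / C1 : ℂ) • ρ, fun v => ?_⟩
  have hC : (C1 : ℂ) ≠ 0 := by exact_mod_cast hC1.ne'
  simp only [smul_apply, smul_eq_mul, mul_assoc (_ / (C1 : ℂ))]
  rw [integral_const_mul, div_mul_eq_mul_div, ← key, mul_div_cancel_left₀ _ hC]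

end

section

section Normed

variable {E : Type*} [NormedAddCommGroup E] [NormedSpace ℝ E]

/-- The reflected body `-K`. -/
def rev (K : ConvexBody E) : ConvexBody E := lmap (-ContinuousLinearMap.id ℝ E) K

theorem mem_rev {K : ConvexBody E} {x : E} : x ∈ rev K ↔ -x ∈ K := by
  rw [rev, mem_lmap]
  constructor
  · rintro ⟨y, hy, rfl⟩
    simpa using hy
  · intro h
    exact ⟨-x, h, by simp⟩

/-- The convex hull of the union of two bodies. -/
def join (K L : ConvexBody E) : ConvexBody E :=
  ⟨convexJoin ℝ K L, K.convex.convexJoin L.convex, by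
    have h : convexJoin ℝ (K : Set E) L =
        (fun p : ℝ × E × E => (1 - p.1) • p.2.1 + p.1 • p.2.2) '' (Icc 0 1 ×ˢ (K : Set E) ×ˢ L) := by
      ext z
      simp only [mem_convexJoin, segment_eq_image, mem_image, mem_prod, Prod.exists]
      constructor
      · rintro ⟨x, hx, y, hy, t, ht, rfl⟩
        exact ⟨t, x, y, ⟨ht, hx, hy⟩, rfl⟩
      · rintro ⟨t, x, y, ⟨ht, hx, hy⟩, rfl⟩
        exact ⟨x, hx, y, hy, t, ht, rfl⟩
    rw [h]
    exact (isCompact_Icc.prod (K.isCompact.prod L.isCompact)).image (by fun_prop),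
    K.nonempty.mono (subset_convexJoin_left L.nonempty)⟩

theorem mem_join {K L : ConvexBody E} {z : E} : z ∈ join K L ↔
    ∃ x ∈ K, ∃ y ∈ L, ∃ t : ℝ, 0 ≤ t ∧ t ≤ 1 ∧ (1 - t) • x + t • y = z := by
  change z ∈ convexJoin ℝ (K : Set E) L ↔ _
  simp only [mem_convexJoin, segment_eq_image, mem_image, mem_Icc, and_assoc]
  rfl

theorem left_mem_join {K L : ConvexBody E} {z : E} (hz : z ∈ K) : z ∈ join K L := by
  obtain ⟨y, hy⟩ := L.nonempty
  exact mem_join.2 ⟨z, hz, y, hy, 0, le_rfl, zero_le_one, by simp⟩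

theorem right_mem_join {K L : ConvexBody E} {z : E} (hz : z ∈ L) : z ∈ join K L := by
  obtain ⟨y, hy⟩ := K.nonempty
  exact mem_join.2 ⟨y, hy, z, hz, 1, zero_le_one, le_rfl, by simp⟩

/-- Two pieces of a body cut by a hyperplane. -/
theorem IsVal.cut {μ : ConvexBody E → ℂ} (hμ : IsVal μ) (a : E →L[ℝ] ℝ) (c : ℝ)
    {M A B I : ConvexBody E} (hA : ∀ x, x ∈ A ↔ x ∈ M ∧ a x ≤ c) (hB : ∀ x, x ∈ B ↔ x ∈ M ∧ c ≤ a x)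
    (hI : ∀ x, x ∈ I ↔ x ∈ M ∧ a x = c) : μ M + μ I = μ A + μ B := by
  refine hμ.union A B M I ?_ ?_
  · ext x
    change x ∈ M ↔ x ∈ A ∨ x ∈ B
    rw [hA, hB]
    have := le_total (a x) c
    tauto
  · ext x
    change x ∈ I ↔ x ∈ A ∧ x ∈ B
    rw [hA, hB, hI, le_antisymm_iff]
    tauto

end Normed

variable {E : Type*} [NormedAddCommGroup E] [InnerProductSpace ℝ E] [FiniteDimensional ℝ E]

omit [FiniteDimensional ℝ E] in
/-- A body which lies over a symmetric base. -/
theorem IsVal.eq_zero_of_base {μ : ConvexBody E → ℂ} (hμ : IsVal μ) (he : ∀ K, μ (rev K) = μ K)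
    (hs : ∀ C, rev C = C → μ C = 0) {a : E →L[ℝ] ℝ} {v : E} {S C : ConvexBody E}
    (h0 : ∀ z ∈ S, 0 ≤ a z) (hC : rev C = C) (hCS : ∀ z ∈ C, z ∈ S)
    (hp : ∀ z ∈ S, proj a v z ∈ C) : μ S = 0 := by
  have hCneg : ∀ z ∈ C, -z ∈ C := fun z hz => by rwa [← mem_rev, hC]
  have cross : ∀ x ∈ S, ∀ y ∈ S, ∀ α β : ℝ, 0 ≤ α → 0 ≤ β → α + β = 1 → β * a y ≤ α * a x →
      α • x + β • (-y) ∈ S := by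
    intro x hx y hy α β hα hβ hαβ hxy
    rcases (h0 y hy).eq_or_lt with hy0 | hy0
    · have hyC : y ∈ C := by
        have := hp y hy
        rwa [proj_apply, ← hy0, zero_smul, sub_zero] at this
      exact S.convex hx (hCS _ (hCneg y hyC)) hα hβ hαβ
    · have hx0 := h0 x hx
      set γ := β * a y / (α * a x + β * a y) with hγ
      rcases (add_nonneg (mul_nonneg hα hx0) (mul_nonneg hβ hy0.le)).eq_or_lt with hd | hd
      · have hb : β = 0 := by
          have := mul_nonneg hα hx0
          have h2 : β * a y = 0 := by nlinarith [mul_nonneg hβ hy0.le]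
          rcases mul_eq_zero.1 h2 with h | h
          · exact h
          · exact absurd h hy0.ne'
        subst hb
        rw [add_zero] at hαβ
        subst hαβ
        simpa using hx
      · have had : 0 < a x + a y := by linarith
        set w := (a y / (a x + a y)) • proj a v x + (a x / (a x + a y)) • (-proj a v y) with hw
        have hwC : w ∈ C := C.convex (hp x hx) (hCneg _ (hp y hy)) (by positivity) (by positivity)
          (by field_simp; ring)
        have hw' : w = (a y / (a x + a y)) • x + (a x / (a x + a y)) • (-y) := by
          rw [hw, proj_apply, proj_apply]
          module
        rcases hx0.eq_or_lt with hx1 | hx1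
        · have : β = 0 := by
            rw [← hx1] at hxy
            nlinarith
          subst this
          rw [add_zero] at hαβ
          subst hαβ
          simpa using hx
        have key : α • x + β • (-y) = (1 - β * (a x + a y) / a x) • x +
            (β * (a x + a y) / a x) • w := by
          rw [hw']
          have hα' : α = 1 - β := by linarith
          rw [hα']
          match_scalars
          · field_simp
            ring
          · field_simp
        rw [key]
        refine S.convex hx (hCS _ hwC) ?_ (by positivity) (by ring)
        rw [sub_nonneg, div_le_one hx1]
        nlinarith
  have hconv : Convex ℝ ((S : Set E) ∪ rev S) := by
    rintro x hx y hy α β hα hβ hαβ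
    have neg_iff : ∀ z, z ∈ (rev S : Set E) ↔ -z ∈ S := fun z => mem_rev
    rw [mem_union, neg_iff] at hx hy ⊢
    have main : ∀ x ∈ S, ∀ y ∈ S, ∀ α β : ℝ, 0 ≤ α → 0 ≤ β → α + β = 1 →
        α • x + β • (-y) ∈ S ∨ -(α • x + β • (-y)) ∈ S := by
      intro x hx y hy α β hα hβ hαβ
      rcases le_total (β * a y) (α * a x) with h | h
      · exact Or.inl (cross x hx y hy α β hα hβ hαβ h)
      · right
        have := cross y hy x hx β α hβ hα (by linarith) h
        convert this using 1
        module
    rcases hx with hx | hx <;> rcases hy with hy | hy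
    · exact Or.inl (S.convex hx hy hα hβ hαβ)
    · have := main x hx (-y) hy α β hα hβ hαβ
      rwa [neg_neg] at this
    · have := main y hy (-x) hx β α hβ hα (by linarith)
      rwa [neg_neg, add_comm] at this
    · right
      have := S.convex hx hy hα hβ hαβ
      rwa [smul_neg, smul_neg, ← neg_add] at this
  let U : ConvexBody E := ⟨(S : Set E) ∪ rev S, hconv, S.isCompact.union (rev S).isCompact,
    S.nonempty.mono subset_union_left⟩
  have hU : rev U = U := by
    refine body_ext fun x => ?_
    rw [mem_rev]
    change (-x ∈ S ∨ -x ∈ rev S) ↔ (x ∈ S ∨ x ∈ rev S)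
    rw [mem_rev, mem_rev, neg_neg, or_comm]
  have h := hμ.union S (rev S) U C rfl (by
    ext x
    change x ∈ C ↔ x ∈ S ∧ x ∈ rev S
    rw [mem_rev]
    constructor
    · exact fun hx => ⟨hCS x hx, hCS _ (hCneg x hx)⟩
    · rintro ⟨h1, h2⟩
      have h3 := h0 _ h2
      rw [map_neg] at h3
      have h4 : a x = 0 := by linarith [h0 x h1]
      have := hp x h1
      rwa [proj_apply, h4, zero_smul, sub_zero] at this)
  rw [hs U hU, hs C hC, he] at h
  have : (2 : ℂ) * μ S = 0 := by linear_combination -h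
  simpa using this

omit [FiniteDimensional ℝ E] in
theorem eq_of_dist_le_seq {μ : ConvexBody E → ℂ} (hμ : Continuous μ) {A : ℕ → ConvexBody E}
    {B : ConvexBody E} {r : ℕ → ℝ} (hr : Tendsto r atTop (𝓝 0)) (h : ∀ n, dist (A n) B ≤ r n) :
    Tendsto (fun n => μ (A n)) atTop (𝓝 (μ B)) :=
  hμ.continuousAt.tendsto.comp
    (tendsto_iff_dist_tendsto_zero.2 (squeeze_zero (fun _ => dist_nonneg) h hr))

/-- The part of the downward cone over `K` above the level `0`. -/
theorem IsVal.apply_lower {μ : ConvexBody E → ℂ} (hμ : IsVal μ) (he : ∀ K, μ (rev K) = μ K)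
    (hs : ∀ C, rev C = C → μ C = 0) {a : E →L[ℝ] ℝ} {v : E} (hv : a v = 1)
    {K M : ConvexBody E} (h0 : ∀ x ∈ K, 0 ≤ a x)
    (hM : ∀ z, z ∈ M ↔ ∃ x ∈ K, ∃ s : ℝ, 0 ≤ s ∧ z = x - s • v ∧ 0 ≤ a z) :
    μ M = μ (lmap (proj a v) K) := by
  have hav : ∀ x, a (proj a v x) = 0 := fun x => by
    rw [proj_apply, map_sub, map_smul, hv]; simp
  obtain ⟨R, hR0, hR⟩ := exists_bound (lmap (proj a v) K)
  obtain ⟨W, hW0, hW⟩ : ∃ W : ℝ, 0 < W ∧ ∀ x ∈ K, a x ≤ W := by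
    obtain ⟨W, hW0, hW⟩ := exists_bound (lmap a K)
    exact ⟨W, hW0, fun x hx => (le_abs_self _).trans (hW _ (mem_lmap.2 ⟨x, hx, rfl⟩))⟩
  have : ProperSpace E := FiniteDimensional.proper ℝ E
  let B : ConvexBody E := ⟨Metric.closedBall 0 R ∩ {x | a x = 0},
    (convex_closedBall _ _).inter (convex_hyperplane a.isBoundedLinearMap.toIsLinearMap 0),
    (isCompact_closedBall _ _).inter_right (isClosed_eq a.continuous continuous_const),
    ⟨0, by simp [hR0.le]⟩⟩
  have hB : ∀ x, x ∈ B ↔ ‖x‖ ≤ R ∧ a x = 0 := fun x =>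
    and_congr mem_closedBall_zero_iff Iff.rfl
  have hBrev : rev B = B := body_ext fun x => by rw [mem_rev, hB, hB, norm_neg, map_neg, neg_eq_zero]
  have hKB : ∀ x ∈ K, proj a v x ∈ B := fun x hx =>
    (hB _).2 ⟨hR _ (mem_lmap.2 ⟨x, hx, rfl⟩), hav x⟩
  -- the shifted cones
  let T : ℝ → ConvexBody E := fun h => join K (B + pt (-h • v))
  have hT : ∀ h z, z ∈ T h ↔ ∃ x ∈ K, ∃ y ∈ B, ∃ t : ℝ, 0 ≤ t ∧ t ≤ 1 ∧
      (1 - t) • x + t • (y - h • v) = z := by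
    intro h z
    rw [mem_join]
    refine exists_congr fun x => and_congr_right fun _ => ?_
    constructor
    · rintro ⟨y, hy, t, h1, h2, rfl⟩
      exact ⟨_, mem_add_pt.1 hy, t, h1, h2, by module⟩
    · rintro ⟨y, hy, t, h1, h2, rfl⟩
      exact ⟨y - h • v, mem_add_pt.2 (by convert hy using 1; module), t, h1, h2, rfl⟩
  have base : ∀ h : ℝ, 0 < h → ∀ S : ConvexBody E, (∀ z ∈ S, z ∈ T h) →
      (∀ z, z + h • v ∈ B → z ∈ S) → μ S = 0 := by
    intro h hh S hST hBS
    rw [← hμ.trans (h • v)]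
    have hz : ∀ z ∈ S, ∃ x ∈ K, ∃ y ∈ B, ∃ t : ℝ, 0 ≤ t ∧ t ≤ 1 ∧
      (1 - t) • x + t • (y - h • v) = z := fun z hz => (hT h z).1 (hST z hz)
    refine hμ.eq_zero_of_base he hs (a := a) (v := v) (C := B) ?_ hBrev
      ?_ ?_
    · intro z hz'
      obtain ⟨x, hx, y, hy, t, h1, h2, h3⟩ := hz _ (mem_add_pt.1 hz')
      rw [← sub_add_cancel z (h • v), ← h3, map_add, map_smul, map_add, map_smul, map_smul,
        map_sub, map_smul, hv, ((hB y).1 hy).2]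
      have := h0 x hx
      simp only [smul_eq_mul]
      nlinarith [mul_nonneg (sub_nonneg.2 h2) this, mul_nonneg (sub_nonneg.2 h2) hh.le]
    · intro z hz'
      exact mem_add_pt.2 (hBS _ (by simpa using hz'))
    · intro z hz'
      obtain ⟨x, hx, y, hy, t, h1, h2, h3⟩ := hz _ (mem_add_pt.1 hz')
      have : proj a v z = (1 - t) • proj a v x + t • y := by
        rw [← sub_add_cancel z (h • v), ← h3]
        simp only [map_add, map_smul, map_sub]
        simp only [proj_apply, hv, ((hB y).1 hy).2]
        module
      rw [this]
      exact B.convex (hKB x hx) hy (by linarith) h1 (by ring)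
  have mem1 : ∀ h : ℝ, 0 < h → ∀ x ∈ K, ∀ s : ℝ, 0 ≤ s → 0 ≤ a (x - s • v) →
      x - s • v ∈ T h := by
    intro h hh x hx s hs0 hs
    rw [map_sub, map_smul, hv, smul_eq_mul, mul_one] at hs
    have h1 := h0 x hx
    have h2 : 0 < a x + h := by linarith
    refine (hT h _).2 ⟨x, hx, proj a v x, hKB x hx, s / (a x + h), by positivity, ?_, ?_⟩
    · rw [div_le_one h2]; linarith
    · rw [proj_apply]
      match_scalars
      · ring
      · field_simp
        ring
  have near : ∀ h : ℝ, 0 < h → ∀ z ∈ T h, 0 ≤ a z → ∃ x ∈ K, ∃ s : ℝ, 0 ≤ s ∧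
      a (x - s • v) = a z ∧ ‖z - (x - s • v)‖ ≤ 2 * R * W / h := by
    intro h hh z hz haz
    obtain ⟨x, hx, y, hy, t, h1, h2, rfl⟩ := (hT h z).1 hz
    have hax := h0 x hx
    have hay := ((hB y).1 hy).2
    have e1 : a ((1 - t) • x + t • (y - h • v)) = a x - t * (a x + h) := by
      simp only [map_add, map_smul, map_sub, hv, hay, smul_eq_mul]; ring
    rw [e1] at haz ⊢
    refine ⟨x, hx, t * (a x + h), by positivity, ?_, ?_⟩
    · rw [map_sub, map_smul, hv, smul_eq_mul, mul_one]
    · have e2 : (1 - t) • x + t • (y - h • v) - (x - (t * (a x + h)) • v) =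
          t • (y - proj a v x) := by
        rw [proj_apply]; module
      rw [e2, norm_smul, Real.norm_eq_abs, abs_of_nonneg h1]
      have h3 : ‖y - proj a v x‖ ≤ 2 * R := by
        refine (norm_sub_le _ _).trans ?_
        have := ((hB y).1 hy).1
        have := ((hB _).1 (hKB x hx)).1
        linarith
      have h4 : t ≤ W / h := by
        rw [le_div_iff₀ hh]
        have := hW x hx
        nlinarith [mul_nonneg h1 hax]
      calc t * ‖y - proj a v x‖ ≤ W / h * (2 * R) := by gcongr
        _ = 2 * R * W / h := by ring
  have key : ∀ h : ℝ, 0 < h → ∃ U I : ConvexBody E, μ U = μ I ∧ dist U M ≤ 2 * R * W / h ∧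
      dist I (lmap (proj a v) K) ≤ 2 * R * W / h := by
    intro h hh
    have hq : 0 ≤ 2 * R * W / h := by positivity
    obtain ⟨x₀, hx₀⟩ := K.nonempty
    obtain ⟨y₀, hy₀⟩ := B.nonempty
    have hpK : ∀ x ∈ K, proj a v x ∈ T h ∧ a (proj a v x) = 0 := fun x hx =>
      ⟨mem1 h hh x hx (a x) (h0 x hx) (hav x).ge, hav x⟩
    let U := inter (T h) _ (convex_ge a 0) (isClosed_ge' a 0)
      ⟨proj a v x₀, (hpK x₀ hx₀).1, (hpK x₀ hx₀).2.ge⟩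
    let L := inter (T h) _ (convex_le a 0) (isClosed_le' a 0)
      ⟨proj a v x₀, (hpK x₀ hx₀).1, (hpK x₀ hx₀).2.le⟩
    let I := inter (T h) {x | a x = 0}
      (convex_hyperplane a.isBoundedLinearMap.toIsLinearMap 0) (isClosed_eq a.continuous continuous_const)
      ⟨proj a v x₀, (hpK x₀ hx₀).1, (hpK x₀ hx₀).2⟩
    have hBT : ∀ z, z + h • v ∈ B → z ∈ T h := fun z hz =>
      (hT h z).2 ⟨x₀, hx₀, _, hz, 1, zero_le_one, le_rfl, by module⟩
    have h1 : μ (T h) = 0 := base h hh _ (fun _ => id) hBT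
    have h2 : μ L = 0 := by
      refine base h hh _ (fun z hz => hz.1) fun z hz => ⟨hBT z hz, ?_⟩
      have := ((hB _).1 hz).2
      rw [map_add, map_smul, hv, smul_eq_mul, mul_one] at this
      change a z ≤ 0
      linarith
    have h3 := hμ.cut a 0 (M := T h) (A := L) (B := U) (I := I) (fun _ => Iff.rfl) (fun _ => Iff.rfl)
      (fun _ => Iff.rfl)
    rw [h1, h2, zero_add, zero_add] at h3
    refine ⟨U, I, h3.symm, dist_le_of hq ?_ ?_, dist_le_of hq ?_ ?_⟩
    · intro z hz
      obtain ⟨x, hx, s, hs, h4, h5⟩ := near h hh z hz.1 hz.2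
      exact ⟨_, (hM _).2 ⟨x, hx, s, hs, rfl, h4.symm ▸ hz.2⟩, h5⟩
    · intro z hz
      obtain ⟨x, hx, s, hs, rfl, h4⟩ := (hM _).1 hz
      exact ⟨_, ⟨mem1 h hh x hx s hs h4, h4⟩, by simpa using hq⟩
    · intro z hz
      obtain ⟨x, hx, s, hs, h4, h5⟩ := near h hh z hz.1 (le_of_eq hz.2.symm)
      refine ⟨_, mem_lmap.2 ⟨x, hx, rfl⟩, ?_⟩
      rw [hz.2, map_sub, map_smul, hv, smul_eq_mul, mul_one, sub_eq_zero] at h4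
      rwa [← h4] at h5
    · intro z hz
      obtain ⟨x, hx, rfl⟩ := mem_lmap.1 hz
      exact ⟨_, hpK x hx, by simpa using hq⟩
  choose! U I hUI hU hI using key
  have hpos : ∀ n : ℕ, (0 : ℝ) < n + 1 := fun n => by positivity
  have hlim : Tendsto (fun n : ℕ => 2 * R * W / ((n : ℝ) + 1)) atTop (𝓝 0) :=
    tendsto_const_nhds.div_atTop (tendsto_natCast_atTop_atTop.atTop_add tendsto_const_nhds)
  have l1 := eq_of_dist_le_seq hμ.cont hlim (A := fun n => U (n + 1)) fun n => hU _ (hpos n)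
  have l2 := eq_of_dist_le_seq hμ.cont hlim (A := fun n => I (n + 1)) fun n => hI _ (hpos n)
  have : (fun n : ℕ => μ (U (n + 1))) = fun n : ℕ => μ (I (n + 1)) := by
    ext n; exact hUI _ (hpos n)
  rw [this] at l1
  exact tendsto_nhds_unique l1 l2

end

section

variable {E : Type*} [NormedAddCommGroup E] [InnerProductSpace ℝ E] [FiniteDimensional ℝ E]

omit [FiniteDimensional ℝ E] in
theorem proj_smul_self {a : E →L[ℝ] ℝ} {v : E} (hv : a v = 1) (t : ℝ) : proj a v (t • v) = 0 := by
  rw [proj_apply, map_smul, hv, smul_eq_mul, mul_one, sub_self]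

theorem IsVal.apply_proj {μ : ConvexBody E → ℂ} (hμ : IsVal μ) (he : ∀ K, μ (rev K) = μ K)
    (hs : ∀ C, rev C = C → μ C = 0) (hD : ∀ v K, μ (K + seg v) = μ K) {a : E →L[ℝ] ℝ} {v : E}
    (hv : a v = 1) (K : ConvexBody E) : μ K = μ (lmap (proj a v) K) := by
  obtain ⟨W, hW0, hW⟩ : ∃ W : ℝ, 0 < W ∧ ∀ x ∈ K, |a x| ≤ W := by
    obtain ⟨W, hW0, hW⟩ := exists_bound (lmap a K)
    exact ⟨W, hW0, fun x hx => hW _ (mem_lmap.2 ⟨x, hx, rfl⟩)⟩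
  suffices h : ∀ (W : ℝ) (K : ConvexBody E), 0 ≤ W → (∀ x ∈ K, 0 ≤ a x ∧ a x ≤ W) →
      μ K = μ (lmap (proj a v) K) by
    have h1 := h (2 * W) (K + pt (W • v)) (by linarith) fun x hx => by
      have := abs_le.1 (hW _ (mem_add_pt.1 hx))
      rw [map_sub, map_smul, hv, smul_eq_mul, mul_one] at this
      constructor <;> linarith
    rw [hμ.trans, lmap_add, lmap_pt, proj_smul_self hv, hμ.trans] at h1
    exact h1
  clear! K W
  intro W K hW0 hK
  have hM : ∀ z, z ∈ K + seg (W • v) ↔ ∃ k ∈ K, ∃ t, 0 ≤ t ∧ t ≤ W ∧ k + t • v = z :=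
    fun z => mem_add_seg_smul hW0
  have hp : ∀ x, proj a v x + W • v = x + (W - a x) • v := fun x => by rw [proj_apply]; module
  have hpm : ∀ x ∈ K, proj a v x + W • v ∈ K + seg (W • v) ∧ a (proj a v x + W • v) = W := by
    intro x hx
    have := hK x hx
    refine ⟨(hM _).2 ⟨x, hx, W - a x, by linarith, by linarith, (hp x).symm⟩, ?_⟩
    rw [hp, map_add, map_smul, hv, smul_eq_mul, mul_one]
    ring
  obtain ⟨x₀, hx₀⟩ := K.nonempty
  let A := inter (K + seg (W • v)) _ (convex_le a W) (isClosed_le' a W)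
    ⟨_, (hpm x₀ hx₀).1, (hpm x₀ hx₀).2.le⟩
  let B := inter (K + seg (W • v)) _ (convex_ge a W) (isClosed_ge' a W)
    ⟨_, (hpm x₀ hx₀).1, (hpm x₀ hx₀).2.ge⟩
  have hcut := hμ.cut a W (M := K + seg (W • v)) (A := A) (B := B)
    (I := lmap (proj a v) K + pt (W • v)) (fun _ => Iff.rfl) (fun _ => Iff.rfl) (by
      intro z
      rw [mem_add_pt, mem_lmap]
      constructor
      · rintro ⟨x, hx, h⟩
        rw [eq_sub_iff_add_eq] at h
        exact h ▸ hpm x hx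
      · rintro ⟨h1, h2⟩
        obtain ⟨x, hx, t, -, -, rfl⟩ := (hM _).1 h1
        rw [map_add, map_smul, hv, smul_eq_mul, mul_one] at h2
        refine ⟨x, hx, ?_⟩
        rw [eq_sub_iff_add_eq, hp, ← h2]
        module)
  have hB : μ B = μ (lmap (proj a v) K) := by
    rw [← hμ.trans (-W • v)]
    refine hμ.apply_lower he hs hv (fun x hx => (hK x hx).1) fun z => ?_
    rw [mem_add_pt]
    change (z - -W • v ∈ K + seg (W • v) ∧ W ≤ a (z - -W • v)) ↔ _
    have e : z - -W • v = z + W • v := by module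
    rw [e, map_add, map_smul, hv, smul_eq_mul, mul_one, hM]
    constructor
    · rintro ⟨⟨x, hx, t, h1, h2, h3⟩, h4⟩
      exact ⟨x, hx, W - t, by linarith, by rw [← sub_eq_iff_eq_add.2 h3]; module, by linarith⟩
    · rintro ⟨x, hx, s, h1, h2, h3⟩
      have h4 := h3
      rw [h2, map_sub, map_smul, hv, smul_eq_mul, mul_one] at h4
      have := (hK x hx).2
      exact ⟨⟨x, hx, W - s, by linarith, by linarith, by rw [h2]; module⟩, by linarith⟩
  have hA : μ A = μ (lmap (proj a v) K) := by
    have hr : lmap (proj a v) (rev K + pt (W • v)) = rev (lmap (proj a v) K) := by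
      rw [lmap_add, lmap_pt, proj_smul_self hv, pt_zero, add_zero, rev, rev, lmap_lmap, lmap_lmap]
      congr 1
      ext x
      simp
    rw [← he A, ← hμ.trans (W • v), ← he (lmap (proj a v) K), ← hr]
    refine hμ.apply_lower he hs hv (fun x hx => ?_) fun z => ?_
    · have := (hK _ (mem_rev.1 (mem_add_pt.1 hx))).2
      rw [map_neg, map_sub, map_smul, hv, smul_eq_mul, mul_one] at this
      linarith
    · rw [mem_add_pt, mem_rev]
      change (-(z - W • v) ∈ K + seg (W • v) ∧ a (-(z - W • v)) ≤ W) ↔ _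
      rw [hM, map_neg, map_sub, map_smul, hv, smul_eq_mul, mul_one]
      constructor
      · rintro ⟨⟨x, hx, t, h1, h2, h3⟩, h4⟩
        refine ⟨W • v - x, mem_add_pt.2 (mem_rev.2 (by convert hx using 1; module)), t, h1, ?_,
          by linarith⟩
        rw [sub_sub, h3]; module
      · rintro ⟨x, hx, s, h1, h2, h3⟩
        have h4 := h3
        rw [h2, map_sub, map_smul, hv, smul_eq_mul, mul_one] at h4
        have hx' := mem_rev.1 (mem_add_pt.1 hx)
        have := (hK _ hx').1
        rw [map_neg, map_sub, map_smul, hv, smul_eq_mul, mul_one] at this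
        exact ⟨⟨_, hx', s, h1, by linarith, by rw [h2]; module⟩, by linarith⟩
  rw [hD, hμ.trans, hA, hB] at hcut
  exact add_right_cancel hcut

/-- A valuation which ignores segments and vanishes on symmetric bodies vanishes. -/
theorem IsVal.eq_zero_of_symm {μ : ConvexBody E → ℂ} (hμ : IsVal μ) (he : ∀ K, μ (rev K) = μ K)
    (hs : ∀ C, rev C = C → μ C = 0) (hD : ∀ v K, μ (K + seg v) = μ K) : μ = 0 := by
  let b := stdOrthonormalBasis ℝ E
  suffices h : ∀ s : Finset (Fin (Module.finrank ℝ E)), ∀ K : ConvexBody E, ∃ L : ConvexBody E,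
      μ K = μ L ∧ ∀ i ∈ s, ∀ x ∈ L, inner ℝ (b i) x = 0 by
    funext K
    obtain ⟨L, h1, h2⟩ := h Finset.univ K
    have : L = 0 := by
      obtain ⟨x₀, hx₀⟩ := L.nonempty
      have h3 : ∀ x ∈ L, x = 0 := fun x hx => by
        have h4 : b.repr x = 0 := by
          ext i
          rw [b.repr_apply_apply, h2 i (Finset.mem_univ i) x hx]
          rfl
        simpa using h4
      refine body_ext fun x => ⟨fun hx => h3 x hx, fun hx => ?_⟩
      have hx' : x = 0 := hx
      rw [hx', ← h3 x₀ hx₀]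
      exact hx₀
    rw [h1, this]
    exact hs 0 (body_ext fun x => by
      rw [mem_rev]
      change -x = 0 ↔ x = 0
      exact neg_eq_zero)
  intro s
  induction s using Finset.induction_on with
  | empty => exact fun K => ⟨K, rfl, by simp⟩
  | insert i s hi ih =>
    intro K
    obtain ⟨L, h1, h2⟩ := ih K
    have hb : innerSL ℝ (b i) (b i) = 1 := by simp
    refine ⟨lmap (proj (innerSL ℝ (b i)) (b i)) L, h1.trans (hμ.apply_proj he hs hD hb L), ?_⟩
    intro j hj x hx
    obtain ⟨y, hy, rfl⟩ := mem_lmap.1 hx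
    rw [proj_apply, inner_sub_right, inner_smul_right, innerSL_apply_apply]
    rcases Finset.mem_insert.1 hj with rfl | hjs
    · simp
    · have hne : j ≠ i := by rintro rfl; exact hi hjs
      simp [h2 j hjs y hy, b.inner_eq_zero hne]

end

section

open SchwartzMap
open scoped ContDiff

variable {E : Type*} [NormedAddCommGroup E] [InnerProductSpace ℝ E] [FiniteDimensional ℝ E]
  [MeasurableSpace E] [BorelSpace E]

theorem integrable_schwartz_mul (ρ : 𝓢(E, ℂ)) {f : E → ℝ} (hf : Continuous f) {C : ℝ}
    (hC : ∀ x, |f x| ≤ C * ‖x‖) : Integrable fun x => ρ x * (f x : ℂ) := by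
  refine Integrable.mono' ((ρ.integrable_pow_mul volume 1).const_mul C) ?_
    (Eventually.of_forall fun x => ?_)
  · have := ρ.continuous
    exact (by fun_prop : Continuous _).aestronglyMeasurable
  · rw [norm_mul, Complex.norm_real, Real.norm_eq_abs, pow_one, ← mul_assoc, mul_comm]
    exact mul_le_mul_of_nonneg_right (hC x) (norm_nonneg _)

omit [FiniteDimensional ℝ E] [MeasurableSpace E] [BorelSpace E] in
theorem abs_max_inner_le (v x : E) : |max 0 (inner ℝ x v)| ≤ ‖v‖ * ‖x‖ := by
  rw [abs_of_nonneg (le_max_left _ _), mul_comm]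
  exact max_le (by positivity) (real_inner_le_norm _ _)

theorem exists_max_transform {h : E → ℂ} (he : ∀ v, h (-v) = h v)
    (h1 : ∀ t : ℝ, 0 ≤ t → ∀ v, h (t • v) = t * h v) (hs : ContDiffOn ℝ ∞ h {0}ᶜ) :
    ∃ ρ : 𝓢(E, ℂ), ∀ v, h v = ∫ x, ρ x * (max 0 (inner ℝ x v) : ℝ) := by
  obtain ⟨ρ, hρ⟩ := exists_abs_transform he h1 hs
  let ρ' : 𝓢(E, ℂ) := compCLMOfContinuousLinearEquiv ℂ (LinearIsometryEquiv.neg ℝ (E := E)) ρ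
  have hρ' : ∀ x, ρ' x = ρ (-x) := fun x => rfl
  refine ⟨ρ + ρ', fun v => ?_⟩
  have hi : ∀ (σ : 𝓢(E, ℂ)) (v : E), Integrable fun x => σ x * (max 0 (inner ℝ x v) : ℝ) :=
    fun σ v => integrable_schwartz_mul σ (by fun_prop) (abs_max_inner_le v)
  have e1 : ∫ x, ρ' x * (max 0 (inner ℝ x v) : ℝ) = ∫ x, ρ x * (max 0 (inner ℝ x (-v)) : ℝ) := by
    rw [← integral_neg_eq_self]
    congr 1; ext x
    rw [hρ', neg_neg, inner_neg_left, inner_neg_right]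
  have e2 : ∫ x, (ρ + ρ') x * (max 0 (inner ℝ x v) : ℝ) =
      ∫ x, (ρ x * (max 0 (inner ℝ x v) : ℝ) + ρ' x * (max 0 (inner ℝ x v) : ℝ)) := by
    congr 1; ext x
    rw [add_apply, add_mul]
  rw [hρ v, e2, integral_add (hi _ _) (hi _ _), e1, ← integral_add (hi _ _) (hi _ _)]
  congr 1; ext x
  rw [← mul_add, ← Complex.ofReal_add, inner_neg_right]
  congr 2
  rcases le_total 0 (inner ℝ x v : ℝ) with h | h
  · rw [abs_of_nonneg h, max_eq_right h, max_eq_left (neg_nonpos.2 h), add_zero]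
  · rw [abs_of_nonpos h, max_eq_left h, max_eq_right (neg_nonneg.2 h), zero_add]

theorem exists_zonoid_density {r : E → ℝ} (hr : Continuous r) (hi : Integrable r)
    (hx : Integrable fun x => ‖x‖ * r x) : ∃ m : Measure E, IsFiniteMeasure m ∧
      Integrable (fun x : E => x) m ∧ ∀ f : E → ℝ, ∫ x, f x ∂m = ∫ x, max 0 (r x) * f x := by
  have hm : Measurable fun x => (r x).toNNReal := hr.measurable.real_toNNReal
  have hc : ∀ x, ((r x).toNNReal : ℝ) = max 0 (r x) := fun x => by
    rw [Real.coe_toNNReal', max_comm]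
  refine ⟨volume.withDensity fun x => (r x).toNNReal, ?_, ?_, fun f => ?_⟩
  · exact isFiniteMeasure_withDensity_ofReal hi.hasFiniteIntegral
  · rw [integrable_withDensity_iff_integrable_smul hm]
    refine Integrable.mono' hx.norm ?_ (Eventually.of_forall fun x => ?_)
    · exact (hm.smul measurable_id).aestronglyMeasurable
    · rw [NNReal.smul_def, hc, norm_smul, norm_mul, norm_norm, mul_comm, Real.norm_eq_abs,
        Real.norm_eq_abs, abs_of_nonneg (le_max_left _ _)]
      gcongr
      exact max_le (abs_nonneg _) (le_abs_self _)
  · rw [integral_withDensity_eq_integral_smul hm]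
    congr 1; ext x
    rw [NNReal.smul_def, hc, smul_eq_mul]

/-- A body with smooth even support function is a difference of zonoids. -/
theorem exists_zonoid_sub {L : ConvexBody E} (he : ∀ w, supp L (-w) = supp L w)
    (hs : ContDiffOn ℝ ∞ (supp L) {0}ᶜ) : ∃ (m₁ m₂ : Measure E) (Z₁ Z₂ : ConvexBody E),
      IsFiniteMeasure m₁ ∧ IsFiniteMeasure m₂ ∧ Integrable (fun x : E => x) m₁ ∧
      Integrable (fun x : E => x) m₂ ∧ (∀ w, supp Z₁ w = ∫ x, max 0 (inner ℝ w x) ∂m₁) ∧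
      (∀ w, supp Z₂ w = ∫ x, max 0 (inner ℝ w x) ∂m₂) ∧ L + Z₂ = Z₁ := by
  obtain ⟨ρ, hρ⟩ := exists_max_transform (h := fun w => (supp L w : ℂ)) (fun v => by rw [he])
    (fun t ht v => by rw [supp_smul_of_nonneg _ _ ht]; push_cast; rfl)
    (Complex.ofRealCLM.contDiff.comp_contDiffOn hs)
  have hr : Continuous fun x => (ρ x).re := Complex.continuous_re.comp ρ.continuous
  have hi : Integrable fun x => (ρ x).re := ρ.integrable.re
  have hx : Integrable fun x => ‖x‖ * (ρ x).re := by
    refine Integrable.mono' (ρ.integrable_pow_mul volume 1)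
      (continuous_norm.mul hr).aestronglyMeasurable (Eventually.of_forall fun x => ?_)
    rw [norm_mul, norm_norm, pow_one]
    gcongr
    exact Complex.abs_re_le_norm _
  have hmax : ∀ w, Integrable fun x => (ρ x).re * max 0 (inner ℝ w x) := by
    intro w
    have := (integrable_schwartz_mul ρ (f := fun x => max 0 (inner ℝ x w)) (by fun_prop)
      (abs_max_inner_le w)).re
    refine this.congr (Eventually.of_forall fun x => ?_)
    simp [real_inner_comm]
  have hL : ∀ w, supp L w = ∫ x, (ρ x).re * max 0 (inner ℝ w x) := by
    intro w
    have h2 := congrArg Complex.re (hρ w)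
    rw [Complex.ofReal_re] at h2
    rw [h2]
    change Complex.reCLM _ = _
    rw [← Complex.reCLM.integral_comp_comm (integrable_schwartz_mul ρ (by fun_prop)
      (abs_max_inner_le w))]
    congr 1; ext x
    simp [real_inner_comm]
  obtain ⟨m₁, hm₁, hm₁i, hm₁f⟩ := exists_zonoid_density hr hi hx
  obtain ⟨m₂, hm₂, hm₂i, hm₂f⟩ := exists_zonoid_density (r := fun x => -(ρ x).re)
    hr.neg hi.neg (by
    exact hx.neg.congr (Eventually.of_forall fun x => by simp))
  obtain ⟨Z₁, hZ₁⟩ := exists_zonoid hm₁i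
  obtain ⟨Z₂, hZ₂⟩ := exists_zonoid hm₂i
  refine ⟨m₁, m₂, Z₁, Z₂, hm₁, hm₂, hm₁i, hm₂i, hZ₁, hZ₂, ext_supp fun w => ?_⟩
  have hpos : ∀ σ : ℝ, Integrable fun x => max 0 (σ * (ρ x).re) * max 0 (inner ℝ w x) := by
    intro σ
    refine Integrable.mono' ((hmax w).norm.const_mul |σ|) ?_ (Eventually.of_forall fun x => ?_)
    · exact (by fun_prop : Continuous _).aestronglyMeasurable
    · rw [norm_mul, norm_mul, ← mul_assoc]
      gcongr
      rw [Real.norm_eq_abs, Real.norm_eq_abs, ← abs_mul, abs_of_nonneg (le_max_left _ _)]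
      exact max_le (abs_nonneg _) (le_abs_self _)
  have p1 := hpos 1
  have p2 := hpos (-1)
  simp only [one_mul, neg_one_mul] at p1 p2
  rw [supp_add, hL, hZ₁, hZ₂, hm₁f, hm₂f, ← integral_add (hmax w) p2]
  congr 1; ext x
  rcases le_total 0 (ρ x).re with h | h
  · rw [max_eq_right h, max_eq_left (neg_nonpos.2 h)]; ring
  · rw [max_eq_left h, max_eq_right (neg_nonneg.2 h)]; ring

theorem IsVal.add_zonoid {μ : ConvexBody E → ℂ} (hμ : IsVal μ) (hD : ∀ v K, μ (K + seg v) = μ K)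
    {m : Measure E} [IsFiniteMeasure m] (hm : Integrable (fun x : E => x) m) {Z : ConvexBody E}
    (hZ : ∀ w, supp Z w = ∫ x, max 0 (inner ℝ w x) ∂m) (K : ConvexBody E) : μ (K + Z) = μ K := by
  have h := zonoid_integral (A := fun _ => 0) continuous_const (fun _ _ _ => by simp)
    (Φ := fun Z => μ (K + Z) - μ K)
    ((hμ.cont.comp (continuous_const.add continuous_id)).sub continuous_const) (fun l => by
      rw [List.map_const', List.sum_replicate, smul_zero, sub_eq_zero]
      induction l generalizing K with
      | nil => rw [zon_nil, add_zero]
      | cons x l ih => rw [zon_cons, ← add_assoc, ih, hD]) hm hZ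
  rwa [integral_zero, sub_eq_zero] at h

omit [MeasurableSpace E] [BorelSpace E] in
theorem exists_smooth_body {ι : Type*} [Fintype ι] (x : ι → E)
    (hx : ∀ w, (∀ i, inner ℝ w (x i) = 0) → w = 0) {p : ℕ} (hp : 1 ≤ p) :
    ∃ B : ConvexBody E, ContDiffOn ℝ ∞ (supp B) {0}ᶜ ∧ (∀ w, supp B (-w) = supp B w) ∧
      (∀ w i, |inner ℝ w (x i)| ≤ supp B w) ∧
      ∀ w M, 0 ≤ M → (∀ i, |inner ℝ w (x i)| ≤ M) →
        supp B w ≤ (Fintype.card ι : ℝ) ^ (((2 * p : ℕ) : ℝ)⁻¹) * M := by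
  have hq : 2 * p ≠ 0 := by omega
  have hev : Even (2 * p) := even_two_mul p
  set q : ℝ := ((2 * p : ℕ) : ℝ) with hqdef
  have hq1 : 1 ≤ q := by rw [hqdef]; exact_mod_cast (by omega : 1 ≤ 2 * p)
  have hq0 : 0 ≤ q⁻¹ := by positivity
  let S : E → ℝ := fun w => ∑ i, (inner ℝ w (x i) : ℝ) ^ (2 * p)
  have hS0 : ∀ w, 0 ≤ S w := fun w => Finset.sum_nonneg fun i _ => hev.pow_nonneg _
  have hSi : ∀ w i, (inner ℝ w (x i) : ℝ) ^ (2 * p) ≤ S w := fun w i =>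
    Finset.single_le_sum (f := fun i => (inner ℝ w (x i) : ℝ) ^ (2 * p))
      (fun i _ => hev.pow_nonneg _) (Finset.mem_univ i)
  have hSpos : ∀ w, w ≠ 0 → S w ≠ 0 := by
    intro w hw h
    refine hw (hx w fun i => ?_)
    have := hSi w i
    rw [h] at this
    exact pow_eq_zero_iff hq |>.1 (le_antisymm this (hev.pow_nonneg _))
  have hupper : ∀ w M, 0 ≤ M → (∀ i, |inner ℝ w (x i)| ≤ M) →
      S w ^ q⁻¹ ≤ (Fintype.card ι : ℝ) ^ q⁻¹ * M := by
    intro w M hM h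
    have h1 : S w ≤ Fintype.card ι * M ^ (2 * p) := by
      refine (Finset.sum_le_card_nsmul _ _ (M ^ (2 * p)) fun i _ => ?_).trans_eq (by simp)
      rw [← hev.pow_abs]
      exact pow_le_pow_left₀ (abs_nonneg _) (h i) _
    refine (Real.rpow_le_rpow (hS0 w) h1 hq0).trans_eq ?_
    rw [Real.mul_rpow (by positivity) (by positivity), hqdef, Real.pow_rpow_inv_natCast hM hq]
  obtain ⟨B, hB⟩ := exists_body (fun w => S w ^ q⁻¹)
    (C := (Fintype.card ι : ℝ) ^ q⁻¹ * ∑ i, ‖x i‖) (by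
      intro t ht w
      have : S (t • w) = t ^ (2 * p) * S w := by
        simp only [S, Finset.mul_sum, real_inner_smul_left, mul_pow]
      rw [this, Real.mul_rpow (by positivity) (hS0 w), hqdef, Real.pow_rpow_inv_natCast ht.le hq])
    (by
      intro v w
      have := Real.Lp_add_le Finset.univ (fun i => inner ℝ v (x i)) (fun i => inner ℝ w (x i)) hq1
      simp only [hqdef, Real.rpow_natCast, hev.pow_abs, one_div] at this
      simpa only [S, inner_add_left] using this)
    (by
      intro w
      rw [abs_of_nonneg (Real.rpow_nonneg (hS0 w) _), mul_assoc]
      refine hupper w _ (by positivity) fun i => ?_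
      refine (abs_real_inner_le_norm _ _).trans ?_
      rw [mul_comm]
      gcongr
      exact Finset.single_le_sum (f := fun i => ‖x i‖) (fun i _ => norm_nonneg _) (Finset.mem_univ i))
  have hBe : supp B = fun w => S w ^ q⁻¹ := funext hB
  refine ⟨B, ?_, ?_, ?_, ?_⟩
  · rw [hBe]
    have hSc : ContDiff ℝ ∞ S := ContDiff.sum fun i _ => (contDiff_id.inner ℝ contDiff_const).pow _
    exact hSc.contDiffOn.rpow_const_of_ne fun w hw => hSpos w hw
  · intro w
    rw [hB, hB]
    congr 1
    simp only [S, inner_neg_left, hev.neg_pow]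
  · intro w i
    rw [hB]
    have h1 := Real.rpow_le_rpow (hev.pow_nonneg _) (hSi w i) hq0
    rwa [← hev.pow_abs, hqdef, Real.pow_rpow_inv_natCast (abs_nonneg _) hq] at h1
  · intro w M hM h
    rw [hB]
    exact hupper w M hM h

omit [FiniteDimensional ℝ E] [MeasurableSpace E] [BorelSpace E] in
theorem supp_rev (K : ConvexBody E) (w : E) : supp (rev K) w = supp K (-w) := by
  refine le_antisymm (supp_le fun x hx => ?_) (supp_le fun x hx => ?_)
  · have := le_supp (mem_rev.1 hx) (-w)
    rwa [inner_neg_neg] at this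
  · have := le_supp (K := rev K) (x := -x) (mem_rev.2 (by rwa [neg_neg])) w
    rwa [inner_neg_right, ← inner_neg_left] at this

omit [MeasurableSpace E] [BorelSpace E] in
theorem exists_smooth_approx {L : ConvexBody E} (hL : rev L = L) {ε : ℝ} (hε : 0 < ε) :
    ∃ B : ConvexBody E, ContDiffOn ℝ ∞ (supp B) {0}ᶜ ∧ (∀ w, supp B (-w) = supp B w) ∧
      dist B L ≤ 2 * ε := by
  obtain ⟨R, hR0, hR⟩ := exists_bound L
  obtain ⟨t, htL, htf, ht⟩ := L.isCompact.finite_cover_balls hε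
  let b := stdOrthonormalBasis ℝ E
  have := htf.fintype
  let x : t ⊕ Fin (Module.finrank ℝ E) → E := Sum.elim (fun y => y) (fun i => ε • b i)
  have hx : ∀ w, (∀ i, inner ℝ w (x i) = 0) → w = 0 := by
    intro w hw
    have h4 : b.repr w = 0 := by
      ext i
      have := hw (Sum.inr i)
      simp only [x, Sum.elim_inr, inner_smul_right, mul_eq_zero, hε.ne', false_or] at this
      rw [b.repr_apply_apply, real_inner_comm, this]
      rfl
    simpa using h4
  set N : ℝ := ((Fintype.card (t ⊕ Fin (Module.finrank ℝ E)) : ℕ) : ℝ)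
  have hN0 : 0 < N := by
    obtain ⟨z, hz⟩ := L.nonempty
    obtain ⟨y, hy, -⟩ := mem_iUnion₂.1 (ht hz)
    have : Nonempty (t ⊕ Fin (Module.finrank ℝ E)) := ⟨Sum.inl ⟨y, hy⟩⟩
    exact Nat.cast_pos.2 Fintype.card_pos
  have hlim : Tendsto (fun p : ℕ => N ^ (((2 * p : ℕ) : ℝ)⁻¹)) atTop (𝓝 1) := by
    have h1 : Tendsto (fun p : ℕ => (((2 * p : ℕ) : ℝ)⁻¹)) atTop (𝓝 0) :=
      tendsto_inv_atTop_zero.comp (tendsto_natCast_atTop_atTop.comp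
        (tendsto_id.const_mul_atTop' two_pos))
    have := (Real.continuousAt_const_rpow hN0.ne' (b := 0)).tendsto.comp h1
    rwa [Real.rpow_zero] at this
  obtain ⟨p, hp1, hp⟩ := ((eventually_ge_atTop 1).and
    (hlim.eventually (gt_mem_nhds (show (1 : ℝ) < 1 + ε / (R + ε) by
      have : 0 < ε / (R + ε) := by positivity
      linarith)))).exists
  obtain ⟨B, hB1, hB2, hB3, hB4⟩ := exists_smooth_body x hx hp1
  refine ⟨B, hB1, hB2, dist_le_of_supp (by positivity) fun w => ?_⟩
  have hLe : supp L (-w) = supp L w := by rw [← supp_rev, hL]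
  have hLabs : ∀ z ∈ L, |inner ℝ w z| ≤ supp L w := fun z hz => by
    refine abs_le.2 ⟨?_, le_supp hz w⟩
    have := le_supp hz (-w)
    rw [hLe, inner_neg_left] at this
    linarith
  have hL0 : 0 ≤ supp L w := by
    obtain ⟨z, hz⟩ := L.nonempty
    exact (abs_nonneg _).trans (hLabs z hz)
  have hLR : supp L w ≤ R * ‖w‖ := supp_le fun z hz => by
    rw [mul_comm]
    refine (real_inner_le_norm _ _).trans ?_
    gcongr
    exact hR z hz
  rw [abs_le]
  constructor
  · obtain ⟨z, hz, hzw⟩ := exists_eq_supp L w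
    obtain ⟨y, hy, hyz⟩ := mem_iUnion₂.1 (ht hz)
    have h1 := (le_abs_self _).trans (hB3 w (Sum.inl ⟨y, hy⟩))
    simp only [x, Sum.elim_inl] at h1
    have h2 : inner ℝ w z - inner ℝ w y ≤ ε * ‖w‖ := by
      rw [← inner_sub_right, mul_comm]
      refine (real_inner_le_norm _ _).trans ?_
      gcongr
      rw [← dist_eq_norm]
      exact (Metric.mem_ball.1 hyz).le
    have := mul_nonneg hε.le (norm_nonneg w)
    linarith
  · have h1 := hB4 w (supp L w + ε * ‖w‖) (by positivity) (by
      rintro (⟨y, hy⟩ | i)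
      · have := hLabs y (htL hy)
        have h3 := mul_nonneg hε.le (norm_nonneg w)
        simp only [x, Sum.elim_inl]
        linarith
      · simp only [x, Sum.elim_inr, inner_smul_right, abs_mul, abs_of_pos hε]
        have := abs_real_inner_le_norm w (b i)
        rw [b.orthonormal.1 i, mul_one] at this
        have h3 := mul_le_mul_of_nonneg_left this hε.le
        linarith)
    have hM : supp L w + ε * ‖w‖ ≤ (R + ε) * ‖w‖ := by linarith
    have hM0 : 0 ≤ supp L w + ε * ‖w‖ := by positivity
    have h2 : N ^ (((2 * p : ℕ) : ℝ)⁻¹) * (supp L w + ε * ‖w‖) ≤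
        (supp L w + ε * ‖w‖) + ε * ‖w‖ := by
      calc _ ≤ (1 + ε / (R + ε)) * (supp L w + ε * ‖w‖) := by gcongr
        _ = (supp L w + ε * ‖w‖) + ε / (R + ε) * (supp L w + ε * ‖w‖) := by ring
        _ ≤ (supp L w + ε * ‖w‖) + ε / (R + ε) * ((R + ε) * ‖w‖) := by gcongr
        _ = _ := by
          have : R + ε ≠ 0 := by positivity
          field_simp
    linarith

theorem IsVal.symm_eq_zero {μ : ConvexBody E → ℂ} (hμ : IsVal μ) (hD : ∀ v K, μ (K + seg v) = μ K)
    (h0 : μ 0 = 0) {L : ConvexBody E} (hL : rev L = L) : μ L = 0 := by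
  have hsm : ∀ B : ConvexBody E, ContDiffOn ℝ ∞ (supp B) {0}ᶜ → (∀ w, supp B (-w) = supp B w) →
      μ B = 0 := by
    intro B hB1 hB2
    obtain ⟨m₁, m₂, Z₁, Z₂, _, _, hm₁, hm₂, hZ₁, hZ₂, h⟩ := exists_zonoid_sub hB2 hB1
    rw [← hμ.add_zonoid hD hm₂ hZ₂, h, ← zero_add Z₁, hμ.add_zonoid hD hm₁ hZ₁, h0]
  choose B hB1 hB2 hB3 using fun n : ℕ => exists_smooth_approx hL
    (ε := 1 / ((n : ℝ) + 1)) (by positivity)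
  have := eq_of_dist_le_seq hμ.cont
    (by simpa using (tendsto_one_div_add_atTop_nhds_zero_nat (𝕜 := ℝ)).const_mul 2) hB3
  rw [funext fun n => hsm (B n) (hB1 n) (hB2 n)] at this
  exact tendsto_nhds_unique this tendsto_const_nhds

omit [FiniteDimensional ℝ E] [MeasurableSpace E] [BorelSpace E] in
theorem rev_add_seg (K : ConvexBody E) (v : E) : rev (K + seg v) = rev K + seg (-v) := by
  rw [rev, lmap_add, lmap_seg]; rfl

omit [FiniteDimensional ℝ E] [MeasurableSpace E] [BorelSpace E] in
theorem even_D {μ : ConvexBody E → ℂ} (hμ : IsVal μ) (he : ∀ K, μ (rev K) = μ K) (v : E)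
    (K : ConvexBody E) : D v μ (rev K) = D v μ K := by
  rw [← hμ.D_neg]
  have := he (K + seg v)
  rw [rev_add_seg] at this
  rw [hμ.D_neg, D, D, he K, ← this]
  have h2 := congrFun (hμ.D_neg v) (rev K)
  simp only [D] at h2
  rw [he] at h2
  exact h2.symm

omit [MeasurableSpace E] [BorelSpace E] in
theorem IsVal.DL_eq_zero_of_finrank_lt {μ : ConvexBody E → ℂ} (hμ : IsVal μ) {l : List E}
    (hl : Module.finrank ℝ (spanL l) < l.length) : CVal.DL l μ = 0 := by
  induction l with
  | nil => simp at hl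
  | cons y r ih =>
    rw [DL_cons]
    by_cases hy : y ∈ spanL r
    · exact hμ.D_of_mem_span hy
    · have hlt : spanL r < spanL (y :: r) := by
        refine lt_of_le_of_ne (fun z hz => mem_spanL_cons.2 ⟨0, z, hz, by simp⟩) fun h => hy ?_
        rw [h]
        exact mem_spanL List.mem_cons_self
      have := Submodule.finrank_lt_finrank_of_lt hlt
      rw [ih (by rw [List.length_cons] at hl; omega)]
      funext K
      simp [D]

/-- An even valuation is determined by its values on parallelotopes. -/
theorem IsVal.eq_zero_of_DL {μ : ConvexBody E → ℂ} (hμ : IsVal μ) (he : ∀ K, μ (rev K) = μ K)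
    (hψ : ∀ l : List E, CVal.DL l μ 0 = 0) : μ = 0 := by
  have heven : ∀ l : List E, ∀ K, CVal.DL l μ (rev K) = CVal.DL l μ K := by
    intro l
    induction l with
    | nil => exact he
    | cons v l ih => exact even_D (hμ.DL l) ih v
  have step : ∀ (k : ℕ) (l : List E), Module.finrank ℝ E + 1 ≤ l.length + k → CVal.DL l μ = 0 := by
    intro k
    induction k with
    | zero =>
      intro l hl
      exact hμ.DL_eq_zero_of_finrank_lt ((Submodule.finrank_le _).trans_lt (by omega))
    | succ k ih =>
      intro l hl
      have hD : ∀ v K, CVal.DL l μ (K + seg v) = CVal.DL l μ K := by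
        intro v K
        have := congrFun (ih (v :: l) (by simp; omega)) K
        exact sub_eq_zero.1 this
      exact (hμ.DL l).eq_zero_of_symm (heven l)
        (fun C hC => (hμ.DL l).symm_eq_zero hD (hψ l) hC) hD
  exact step (Module.finrank ℝ E + 1) [] (by simp)

end

section

variable {E : Type*} [NormedAddCommGroup E] [InnerProductSpace ℝ E]

theorem supp_join (K L : ConvexBody E) (w : E) : supp (join K L) w = max (supp K w) (supp L w) := by
  refine le_antisymm (supp_le fun z hz => ?_) (max_le (supp_le fun z hz => ?_)
    (supp_le fun z hz => ?_))
  · obtain ⟨x, hx, y, hy, t, h0, h1, rfl⟩ := mem_join.1 hz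
    rw [inner_add_right, inner_smul_right, inner_smul_right]
    have hx' := (le_supp hx w).trans (le_max_left _ (supp L w))
    have hy' := (le_supp hy w).trans (le_max_right (supp K w) _)
    nlinarith
  · exact le_supp (left_mem_join hz) w
  · exact le_supp (right_mem_join hz) w

theorem mem_join_pt {K : ConvexBody E} {p z : E} : z ∈ join K (pt p) ↔
    ∃ x ∈ K, ∃ t : ℝ, 0 ≤ t ∧ t ≤ 1 ∧ (1 - t) • x + t • p = z := by
  rw [mem_join]
  constructor
  · rintro ⟨x, hx, y, hy, t, h⟩
    rw [mem_pt] at hy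
    subst hy
    exact ⟨x, hx, t, h⟩
  · rintro ⟨x, hx, t, h⟩
    exact ⟨x, hx, p, mem_pt.2 rfl, t, h⟩

theorem supp_lmap_smul (K : ConvexBody E) {t : ℝ} (ht : 0 ≤ t) (w : E) :
    supp (lmap (t • ContinuousLinearMap.id ℝ E) K) w = t * supp K w := by
  refine le_antisymm (supp_le fun z hz => ?_) ?_
  · obtain ⟨x, hx, rfl⟩ := mem_lmap.1 hz
    simp only [smul_apply, ContinuousLinearMap.id_apply, inner_smul_right]
    exact mul_le_mul_of_nonneg_left (le_supp hx w) ht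
  · obtain ⟨x, hx, h, -⟩ := exists_eq_supp K w
    rw [← h, ← inner_smul_right]
    exact le_supp (K := lmap (t • ContinuousLinearMap.id ℝ E) K) (x := t • x)
      (mem_lmap.2 ⟨x, hx, rfl⟩) w

theorem supp_zero_right (K : ConvexBody E) : supp K 0 = 0 := by
  simpa using supp_smul_of_nonneg K (0 : E) le_rfl

theorem exists_unit_separating {L : ConvexBody E} {z : E} (hz : z ∉ L) :
    ∃ η : E, ‖η‖ = 1 ∧ supp L η < inner ℝ η z := by
  obtain ⟨y, hy, h⟩ := exists_normal L z
  have h0 : z - y ≠ 0 := fun h => hz (sub_eq_zero.1 h ▸ hy)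
  have hn : 0 < ‖z - y‖ := norm_pos_iff.2 h0
  refine ⟨‖z - y‖⁻¹ • (z - y), by rw [norm_smul, norm_inv, norm_norm, inv_mul_cancel₀ hn.ne'], ?_⟩
  rw [supp_smul_of_nonneg _ _ (by positivity), h, real_inner_smul_left]
  refine mul_lt_mul_of_pos_left ?_ (by positivity)
  have h3 : 0 < inner ℝ (z - y) (z - y) := by
    rw [real_inner_self_eq_norm_sq]
    positivity
  rw [inner_sub_right] at h3
  linarith

/-- Bodies whose support functions agree near `η` have the same face in direction `η`. -/
theorem mem_of_mem_face {Z₁ Z₂ : ConvexBody E} {η w : E}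
    (h : ∀ᶠ ζ in 𝓝 η, supp Z₁ ζ = supp Z₂ ζ) (hw : w ∈ Z₂) (hη : supp Z₂ η ≤ inner ℝ η w) :
    w ∈ Z₁ := by
  refine mem_of_inner_le fun ζ => ?_
  by_contra! hζ
  have ht : Tendsto (fun ε : ℝ => η + ε • ζ) (𝓝[>] 0) (𝓝 η) := by
    have : Continuous fun ε : ℝ => η + ε • ζ := by fun_prop
    have h2 := this.tendsto 0
    rw [zero_smul, add_zero] at h2
    exact h2.mono_left nhdsWithin_le_nhds
  obtain ⟨ε, h1, h2⟩ := ((ht.eventually h).and self_mem_nhdsWithin).exists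
  have h2 : 0 < ε := h2
  have h3 := le_supp hw (η + ε • ζ)
  have h4 := supp_add_le Z₁ η (ε • ζ)
  rw [← h1, inner_add_left, real_inner_smul_left] at h3
  rw [supp_smul_of_nonneg _ _ h2.le, h.self_of_nhds] at h4
  have := mul_lt_mul_of_pos_left hζ h2
  linarith

variable [FiniteDimensional ℝ E]

theorem coe_join_add_eq_union {K Z₁ Z₂ : ConvexBody E} {p : E} (hZ : ∀ z ∈ Z₁, z ∈ Z₂)
    (h : ∀ w ≠ 0, supp K w ≤ inner ℝ w p → ∀ᶠ ζ in 𝓝 w, supp Z₁ ζ = supp Z₂ ζ) :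
    ((join K (pt p) + Z₂ : ConvexBody E) : Set E) =
      ↑(join K (pt p) + Z₁) ∪ ↑(K + Z₂) := by
  apply Subset.antisymm
  · intro z hz
    obtain ⟨y, hy, w₀, hw₀, rfl⟩ := mem_add.1 hz
    obtain ⟨k₀, hk₀, t₀, h0, h1, rfl⟩ := mem_join_pt.1 hy
    set z := (1 - t₀) • k₀ + t₀ • p + w₀
    let S : Set (ℝ × E × E) := (Icc 0 1 ×ˢ (K : Set E) ×ˢ (Z₂ : Set E)) ∩
      {q | (1 - q.1) • q.2.1 + q.1 • p + q.2.2 = z}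
    have hS : IsCompact S := (isCompact_Icc.prod (K.isCompact.prod Z₂.isCompact)).inter_right
      (isClosed_eq (by fun_prop) continuous_const)
    obtain ⟨⟨t, k, w⟩, ⟨⟨⟨ht0, ht1⟩, hk, hw⟩, hq⟩, hmin⟩ := hS.exists_isMinOn
      (f := Prod.fst) ⟨(t₀, k₀, w₀), ⟨⟨h0, h1⟩, hk₀, hw₀⟩, rfl⟩ continuous_fst.continuousOn
    simp only at ht0 ht1 hk hw
    have hq : (1 - t) • k + t • p + w = z := hq
    rcases ht0.eq_or_lt with rfl | ht0
    · right
      refine mem_add.2 ⟨k, hk, w, hw, ?_⟩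
      rw [← hq]; simp
    left
    have hsep : ∀ s : ℝ, 0 ≤ s → s < t → ∃ η ∈ Metric.sphere (0 : E) 1,
        supp K η ≤ inner ℝ η p ∧
        (1 - s) * supp K η + s * inner ℝ η p + supp Z₂ η ≤ inner ℝ η z := by
      intro s hs0 hst
      have hnot : z ∉ lmap ((1 - s) • ContinuousLinearMap.id ℝ E) K + pt (s • p) + Z₂ := by
        intro hmem
        obtain ⟨a, ha, w', hw', he⟩ := mem_add.1 hmem
        obtain ⟨b, hb, c, hc, he2⟩ := mem_add.1 ha
        obtain ⟨k', hk', rfl⟩ := mem_lmap.1 hb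
        rw [mem_pt] at hc
        subst hc he2
        have : (s, k', w') ∈ S := ⟨⟨⟨hs0, by linarith⟩, hk', hw'⟩, he⟩
        exact absurd (hmin this) (not_le.2 hst)
      obtain ⟨η, hη, hlt⟩ := exists_unit_separating hnot
      rw [supp_add, supp_add, supp_lmap_smul _ (by linarith), supp_pt, inner_smul_right] at hlt
      refine ⟨η, by simpa using hη, ?_, hlt.le⟩
      have h1 := le_supp hk η
      have h2 := le_supp hw η
      rw [← hq, inner_add_right, inner_add_right, inner_smul_right, inner_smul_right] at hlt
      have h3 := mul_le_mul_of_nonneg_left h1 (show (0 : ℝ) ≤ 1 - t by linarith)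
      by_contra! hcon
      nlinarith
    have hsn : ∀ n : ℕ, 0 ≤ t * (1 - 1 / ((n : ℝ) + 1)) ∧ t * (1 - 1 / ((n : ℝ) + 1)) < t := by
      intro n
      have h1 : 0 < 1 / ((n : ℝ) + 1) := by positivity
      have h2 : 1 / ((n : ℝ) + 1) ≤ 1 := by
        rw [div_le_one (by positivity)]
        have : (0 : ℝ) ≤ n := n.cast_nonneg
        linarith
      constructor
      · exact mul_nonneg ht0.le (by linarith)
      · nlinarith
    choose η hη1 hη2 hη3 using fun n : ℕ => hsep _ (hsn n).1 (hsn n).2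
    obtain ⟨η₀, hη₀, φ, hφ, hlim⟩ := (isCompact_sphere (0 : E) 1).tendsto_subseq hη1
    have hs : Tendsto (fun n => t * (1 - 1 / (((φ n : ℕ) : ℝ) + 1))) atTop (𝓝 t) := by
      have := ((tendsto_one_div_add_atTop_nhds_zero_nat (𝕜 := ℝ)).comp
        hφ.tendsto_atTop).const_sub 1 |>.const_mul t
      simpa using this
    have hK := ((continuous_supp K).tendsto η₀).comp hlim
    have hZ₂ := ((continuous_supp Z₂).tendsto η₀).comp hlim
    have hp := ((show Continuous fun η : E => inner ℝ η p by fun_prop).tendsto η₀).comp hlim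
    have hz' := ((show Continuous fun η : E => inner ℝ η z by fun_prop).tendsto η₀).comp hlim
    have l1 := le_of_tendsto_of_tendsto' hK hp fun n => hη2 (φ n)
    have l2 := le_of_tendsto_of_tendsto' ((((hs.const_sub 1).mul hK).add (hs.mul hp)).add hZ₂) hz'
      fun n => hη3 (φ n)
    have hne : η₀ ≠ 0 := by
      rintro rfl
      simp at hη₀
    refine mem_add.2 ⟨_, mem_join_pt.2 ⟨k, hk, t, ht0.le, ht1, rfl⟩, w, ?_, hq⟩
    refine mem_of_mem_face (h η₀ hne l1) hw ?_
    rw [← hq, inner_add_right, inner_add_right, inner_smul_right, inner_smul_right] at l2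
    have h3 := mul_le_mul_of_nonneg_left (le_supp hk η₀) (show (0 : ℝ) ≤ 1 - t by linarith)
    linarith
  · rintro z (hz | hz)
    · obtain ⟨y, hy, w, hw, rfl⟩ := mem_add.1 hz
      exact mem_add.2 ⟨y, hy, w, hZ w hw, rfl⟩
    · obtain ⟨y, hy, w, hw, rfl⟩ := mem_add.1 hz
      exact mem_add.2 ⟨y, left_mem_join hy, w, hw, rfl⟩

theorem IsVal.local_of_le {μ : ConvexBody E → ℂ} (hμ : IsVal μ) {K Z₁ Z₂ : ConvexBody E} {p : E}
    (hZ : ∀ z ∈ Z₁, z ∈ Z₂)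
    (h : ∀ w ≠ 0, supp K w ≤ inner ℝ w p → ∀ᶠ ζ in 𝓝 w, supp Z₁ ζ = supp Z₂ ζ) :
    μ (join K (pt p) + Z₁) - μ (K + Z₁) = μ (join K (pt p) + Z₂) - μ (K + Z₂) := by
  have := hμ.union _ _ _ (K + Z₁) (coe_join_add_eq_union hZ h) (by
    apply Subset.antisymm
    · intro z hz
      obtain ⟨y, hy, w, hw, rfl⟩ := mem_add.1 hz
      exact ⟨mem_add.2 ⟨y, left_mem_join hy, w, hw, rfl⟩, mem_add.2 ⟨y, hy, w, hZ w hw, rfl⟩⟩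
    · rintro z ⟨h1, h2⟩
      refine mem_of_inner_le fun w => ?_
      have h1 := le_supp h1 w
      have h2 := le_supp h2 w
      rw [supp_add, supp_join, supp_pt] at h1
      rw [supp_add] at h2 ⊢
      rcases eq_or_ne w 0 with rfl | hw
      · simp [supp_zero_right]
      rcases le_total (supp K w) (inner ℝ w p) with hc | hc
      · rwa [(h w hw hc).self_of_nhds]
      · rwa [max_eq_left hc] at h1)
  linear_combination -this

/-- The change of a valuation under adding an apex only depends on the germ of the support function
near the normals at the apex. -/
theorem IsVal.local_eq {μ : ConvexBody E → ℂ} (hμ : IsVal μ) {K Z₁ Z₂ : ConvexBody E} {p : E}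
    (h : ∀ w ≠ 0, supp K w ≤ inner ℝ w p → ∀ᶠ ζ in 𝓝 w, supp Z₁ ζ = supp Z₂ ζ) :
    μ (join K (pt p) + Z₁) - μ (K + Z₁) = μ (join K (pt p) + Z₂) - μ (K + Z₂) := by
  rw [hμ.local_of_le (Z₂ := join Z₁ Z₂) (fun z hz => left_mem_join hz),
    hμ.local_of_le (Z₁ := Z₂) (Z₂ := join Z₁ Z₂) (fun z hz => right_mem_join hz)]
  · intro w hw hc
    filter_upwards [h w hw hc] with ζ hζ
    rw [supp_join, hζ, max_self]
  · intro w hw hc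
    filter_upwards [h w hw hc] with ζ hζ
    rw [supp_join, hζ, max_self]

end

section

section Homogeneous

variable {E : Type*} [NormedAddCommGroup E] [NormedSpace ℝ E]

theorem isVal_const (c : ℂ) : IsVal fun _ : ConvexBody E => c :=
  ⟨fun _ _ _ _ _ _ => rfl, continuous_const, fun _ _ => rfl⟩

theorem DL_const {l : List E} (hl : l ≠ []) (c : ℂ) :
    CVal.DL l (fun _ : ConvexBody E => c) = 0 := by
  induction l with
  | nil => exact absurd rfl hl
  | cons x l ih =>
    funext K
    rcases eq_or_ne l [] with rfl | h
    · simp [D]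
    · rw [DL_cons, ih h]; simp [D]

theorem IsVal.DL_map_smul {μ : ConvexBody E → ℂ} (hμ : IsVal μ) {t : ℝ} (ht : 0 ≤ t) (l : List E) :
    CVal.DL (l.map (t • ·)) μ = fun K => (t : ℂ) ^ l.length * CVal.DL l μ K := by
  induction l with
  | nil => simp
  | cons x l ih =>
    rw [List.map_cons, DL_cons, ih, D_const_mul, (hμ.DL l).D_smul_of_nonneg x ht]
    funext K
    simp only [List.length_cons, DL_cons, pow_succ]
    ring

def dil (t : ℝ) : E →L[ℝ] E := t • ContinuousLinearMap.id ℝ E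

theorem coe_dil (t : ℝ) : (dil t : E → E) = (t • ·) := rfl

theorem exists_dilation_weights {d k : ℕ} (hk : k ≤ d) : ∃ a : Fin (d + 1) → ℂ, ∀ i ≤ d,
    ∑ j, a j * (((j : ℝ) + 1 : ℝ) : ℂ) ^ i = if i = k then 1 else 0 := by
  let v : Fin (d + 1) → ℂ := fun j => (((j : ℝ) + 1 : ℝ) : ℂ)
  have hv : Function.Injective v := by
    intro i j h
    have h2 : ((i : ℝ) + 1) = (j : ℝ) + 1 := Complex.ofReal_injective h
    have h3 : ((i : ℕ) : ℝ) = (j : ℕ) := by linarith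
    exact Fin.ext (by exact_mod_cast h3)
  have hdet : IsUnit (Matrix.vandermonde v).det :=
    (Matrix.det_vandermonde_ne_zero_iff.2 hv).isUnit
  refine ⟨Matrix.vecMul (Pi.single ⟨k, by omega⟩ 1) (Matrix.vandermonde v)⁻¹, fun i hi => ?_⟩
  have h := congrFun (show Matrix.vecMul (Matrix.vecMul (Pi.single (⟨k, by omega⟩ : Fin (d + 1)) 1)
    (Matrix.vandermonde v)⁻¹) (Matrix.vandermonde v) = Pi.single ⟨k, by omega⟩ 1 by
      rw [Matrix.vecMul_vecMul, Matrix.nonsing_inv_mul _ hdet, Matrix.vecMul_one]) ⟨i, by omega⟩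
  simp only [Matrix.vecMul, dotProduct, Matrix.vandermonde_apply, Pi.single_apply, Fin.mk.injEq]
    at h ⊢
  exact h

/-- A weighted sum of dilates of a valuation. -/
def dilSum {d : ℕ} (a : Fin (d + 1) → ℂ) (μ : ConvexBody E → ℂ) (K : ConvexBody E) : ℂ :=
  ∑ j, a j * μ (lmap (dil ((j : ℝ) + 1)) K)

theorem IsVal.dilSum {μ : ConvexBody E → ℂ} (hμ : IsVal μ) {d : ℕ} (a : Fin (d + 1) → ℂ) :
    IsVal (dilSum a μ) :=
  IsVal.sum _ fun _ _ => (hμ.comp_lmap _).const_mul _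

theorem IsVal.DL_dilSum {μ : ConvexBody E → ℂ} (hμ : IsVal μ) {d : ℕ} (a : Fin (d + 1) → ℂ)
    (l : List E) : CVal.DL l (CVal.dilSum a μ) 0 =
      (∑ j, a j * (((j : ℝ) + 1 : ℝ) : ℂ) ^ l.length) * CVal.DL l μ 0 := by
  unfold CVal.dilSum
  rw [DL_sum, Finset.sum_mul]
  refine Finset.sum_congr rfl fun j _ => ?_
  rw [DL_const_mul]
  beta_reduce
  rw [DL_lmap, coe_dil, hμ.DL_map_smul (by positivity), lmap_zero]
  ring

end Homogeneous

variable {E : Type*} [NormedAddCommGroup E] [InnerProductSpace ℝ E] [FiniteDimensional ℝ E]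
  [MeasurableSpace E] [BorelSpace E]

theorem IsVal.D_D_const {μ : ConvexBody E → ℂ} (hμ : IsVal μ) (he : ∀ K, μ (rev K) = μ K)
    (h3 : ∀ l : List E, 2 < l.length → CVal.DL l μ 0 = 0) (x y : E) (K : ConvexBody E) :
    D x (D y μ) K = D x (D y μ) 0 := by
  have h2 := hμ.diff y
  have h := ((h2.diff x).sub (isVal_const (D x (D y μ) 0))).eq_zero_of_DL (fun K => by
    rw [even_D h2 (even_D hμ he y)]) (fun l => by
    rw [DL_sub]
    rcases eq_or_ne l [] with rfl | hl
    · simp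
    · rw [DL_const hl]
      have := h3 (l ++ [x, y]) (by simp [List.length_pos_iff.2 hl])
      rw [DL_append] at this
      simpa using this)
  exact sub_eq_zero.1 (congrFun h K)

omit [FiniteDimensional ℝ E] [MeasurableSpace E] [BorelSpace E] in
theorem sub_add_zon {μ : ConvexBody E → ℂ}
    (h : ∀ (x y : E) (K : ConvexBody E), D x (D y μ) K = D x (D y μ) 0) (K L : ConvexBody E)
    (l : List E) : μ (K + zon l) - μ (L + zon l) - (μ K - μ L) =
      (l.map fun v => D v μ K - D v μ L).sum := by
  induction l generalizing K L with
  | nil => simp [zon_nil]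
  | cons x l ih =>
    rw [zon_cons, ← add_assoc, ← add_assoc, List.map_cons, List.sum_cons]
    have := ih (K + seg x) (L + seg x)
    rw [show (fun v => D v μ (K + seg x) - D v μ (L + seg x)) =
      fun v => D v μ K - D v μ L by
        funext v
        have h1 := h x v K
        have h2 := h x v L
        rw [D] at h1 h2
        linear_combination h1 - h2] at this
    rw [← this]
    simp only [D]
    ring

omit [FiniteDimensional ℝ E] [MeasurableSpace E] [BorelSpace E] in
theorem IsVal.continuous_D {μ : ConvexBody E → ℂ} (hμ : IsVal μ) (K : ConvexBody E) :
    Continuous fun v => D v μ K := by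
  have h1 := hμ.cont
  have h2 := continuous_seg (E := E)
  unfold D
  fun_prop

/-- The second difference of `μ` integrated along the segment measure with direction `n - c • u`. -/
def slabInt (μ : ConvexBody E → ℂ) (K : ConvexBody E) (p u : E) (R : ℝ) (n : E) : ℂ :=
  ∫ c in Icc (-R) R, (D (n - c • u) μ (join K (pt p)) - D (n - c • u) μ K)

def slab (u : E) (R : ℝ) (n : E) : Measure E :=
  (volume.restrict (Icc (-R) R)).map fun c => n - c • u

theorem integral_slab {F : Type*} [NormedAddCommGroup F] [NormedSpace ℝ F] {f : E → F}
    (hf : Continuous f) (u : E) (R : ℝ) (n : E) :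
    ∫ x, f x ∂slab u R n = ∫ c in Icc (-R) R, f (n - c • u) :=
  integral_map (by fun_prop) hf.aestronglyMeasurable

instance (u : E) (R : ℝ) (n : E) : IsFiniteMeasure (slab u R n) := by
  unfold slab; infer_instance

theorem integrable_slab {F : Type*} [NormedAddCommGroup F] [NormedSpace ℝ F] {f : E → F}
    (hf : Continuous f) (u : E) (R : ℝ) (n : E) : Integrable f (slab u R n) := by
  rw [slab, integrable_map_measure hf.aestronglyMeasurable (by fun_prop)]
  exact (hf.comp (by fun_prop)).integrableOn_Icc

theorem setIntegral_max_affine {α β R : ℝ} (hβ : 0 < β) (h : |α| ≤ R * β) :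
    ∫ c in Icc (-R) R, max 0 (α - c * β) = (α + R * β) ^ 2 / (2 * β) := by
  have hR : -R ≤ R := by
    have : 0 ≤ R * β := (abs_nonneg _).trans h
    have : 0 ≤ R := nonneg_of_mul_nonneg_left this hβ
    linarith
  have h1 : -R ≤ α / β := by rw [le_div_iff₀ hβ]; linarith [(abs_le.1 h).1]
  have h2 : α / β ≤ R := by rw [div_le_iff₀ hβ]; exact (abs_le.1 h).2
  have hc : Continuous fun c : ℝ => max 0 (α - c * β) := by fun_prop
  rw [integral_Icc_eq_integral_Ioc, ← intervalIntegral.integral_of_le hR,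
    ← intervalIntegral.integral_add_adjacent_intervals (hc.intervalIntegrable _ (α / β))
      (hc.intervalIntegrable _ _)]
  have e1 : ∫ c in (-R)..(α / β), max 0 (α - c * β) = ∫ c in (-R)..(α / β), (α - c * β) := by
    refine intervalIntegral.integral_congr fun c hc => ?_
    rw [uIcc_of_le h1] at hc
    have := (le_div_iff₀ hβ).1 hc.2
    exact max_eq_right (by linarith)
  have e2 : ∫ c in (α / β)..R, max 0 (α - c * β) = ∫ c in (α / β)..R, (0 : ℝ) := by
    refine intervalIntegral.integral_congr fun c hc => ?_
    rw [uIcc_of_le h2] at hc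
    have := (div_le_iff₀ hβ).1 hc.1
    exact max_eq_left (by linarith)
  rw [e1, e2, intervalIntegral.integral_zero, intervalIntegral.integral_sub (by simp)
    (Continuous.intervalIntegrable (by fun_prop) _ _), intervalIntegral.integral_mul_const,
    integral_id, intervalIntegral.integral_const]
  simp only [smul_eq_mul]
  field_simp
  ring

theorem IsVal.slabInt_parallelogram {μ : ConvexBody E → ℂ} (hμ : IsVal μ)
    (h : ∀ (x y : E) (K : ConvexBody E), D x (D y μ) K = D x (D y μ) 0) {K : ConvexBody E} {p u : E}
    {R : ℝ} {a b : E} (hc : ∀ w ≠ 0, supp K w ≤ inner ℝ w p → 0 < inner ℝ w u ∧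
      ∀ n ∈ [a + b, a - b, a, b], |inner ℝ w n| < R * inner ℝ w u) :
    slabInt μ K p u R (a + b) + slabInt μ K p u R (a - b) + 2 * slabInt μ K p u R 0 =
      2 * slabInt μ K p u R a + slabInt μ K p u R b + slabInt μ K p u R (-b) := by
  set G : E → ℂ := fun v => D v μ (join K (pt p)) - D v μ K with hG
  have hGc : Continuous G := (hμ.continuous_D _).sub (hμ.continuous_D _)
  have hG1 : ∀ t : ℝ, 0 ≤ t → ∀ v, G (t • v) = t * G v := by
    intro t ht v
    simp only [hG, hμ.D_smul_of_nonneg v ht]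
    ring
  have hΦ : Continuous fun Z => μ (join K (pt p) + Z) - μ (K + Z) - (μ (join K (pt p)) - μ K) := by
    have := hμ.cont
    fun_prop
  have hi : ∀ n, Integrable (fun x : E => x) (slab u R n) := integrable_slab continuous_id u R
  set S : E → E → E → E → Measure E := fun n₁ n₂ n₃ n₄ =>
    slab u R n₁ + slab u R n₂ + (slab u R n₃ + slab u R n₄) with hS
  have hiS : ∀ n₁ n₂ n₃ n₄, Integrable (fun x : E => x) (S n₁ n₂ n₃ n₄) := fun _ _ _ _ =>
    ((hi _).add_measure (hi _)).add_measure ((hi _).add_measure (hi _))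
  obtain ⟨Z₁, hZ₁⟩ := exists_zonoid (hiS (a + b) (a - b) 0 0)
  obtain ⟨Z₂, hZ₂⟩ := exists_zonoid (hiS a a b (-b))
  have key : ∀ {F : Type} [NormedAddCommGroup F] [NormedSpace ℝ F] {f : E → F}, Continuous f →
      ∀ n₁ n₂ n₃ n₄, ∫ x, f x ∂S n₁ n₂ n₃ n₄ =
        (∫ c in Icc (-R) R, f (n₁ - c • u)) + (∫ c in Icc (-R) R, f (n₂ - c • u)) +
        ((∫ c in Icc (-R) R, f (n₃ - c • u)) + ∫ c in Icc (-R) R, f (n₄ - c • u)) := by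
    intro F _ _ f hf n₁ n₂ n₃ n₄
    have hf' := fun n => integrable_slab hf u R n
    rw [hS, integral_add_measure ((hf' _).add_measure (hf' _)) ((hf' _).add_measure (hf' _)),
      integral_add_measure (hf' _) (hf' _), integral_add_measure (hf' _) (hf' _),
      integral_slab hf, integral_slab hf, integral_slab hf, integral_slab hf]
  have e₁ := zonoid_integral hGc hG1 hΦ (fun l => sub_add_zon h _ _ l) (hiS _ _ _ _) hZ₁
  have e₂ := zonoid_integral hGc hG1 hΦ (fun l => sub_add_zon h _ _ l) (hiS _ _ _ _) hZ₂
  rw [key hGc] at e₁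
  rw [key hGc] at e₂
  have hloc := hμ.local_eq (K := K) (p := p) (Z₁ := Z₁) (Z₂ := Z₂) (by
    intro w hw hle
    obtain ⟨h0, hn⟩ := hc w hw hle
    have hev : ∀ n ∈ [a + b, a - b, a, b], ∀ᶠ ζ in 𝓝 w, |inner ℝ ζ n| < R * inner ℝ ζ u := by
      intro n hn'
      exact (show Continuous fun ζ : E => |inner ℝ ζ n| by fun_prop).continuousAt.eventually_lt
        (by fun_prop) (hn n hn')
    have hev0 : ∀ᶠ ζ in 𝓝 w, 0 < inner ℝ ζ u :=
      (show Continuous fun ζ : E => inner ℝ ζ u by fun_prop).continuousAt.eventually_const_lt h0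
    filter_upwards [hev0, hev (a + b) (by simp), hev (a - b) (by simp), hev a (by simp),
      hev b (by simp)] with ζ g0 g1 g2 g3 g4
    have hcont : Continuous fun x : E => max 0 (inner ℝ ζ x) := by fun_prop
    rw [hZ₁, hZ₂, key hcont, key hcont]
    have hval : ∀ n, |inner ℝ ζ n| < R * inner ℝ ζ u →
        ∫ c in Icc (-R) R, max 0 (inner ℝ ζ (n - c • u)) =
          (inner ℝ ζ n + R * inner ℝ ζ u) ^ 2 / (2 * inner ℝ ζ u) := by
      intro n hn
      rw [← setIntegral_max_affine g0 hn.le]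
      simp only [inner_sub_right, inner_smul_right]
    have g5 : |inner ℝ ζ (0 : E)| < R * inner ℝ ζ u := by
      rw [inner_zero_right, abs_zero]
      exact (abs_nonneg _).trans_lt g3
    have g6 : |inner ℝ ζ (-b)| < R * inner ℝ ζ u := by rwa [inner_neg_right, abs_neg]
    rw [hval _ g1, hval _ g2, hval _ g3, hval _ g4, hval _ g5, hval _ g6, inner_add_right,
      inner_sub_right, inner_zero_right, inner_neg_right]
    have hne := g0.ne'
    field_simp
    ring)
  simp only [slabInt]
  simp only [hG] at e₁ e₂
  linear_combination -e₁ + e₂ + hloc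

end

section

section Bilin

variable {V : Type*} [NormedAddCommGroup V] [NormedSpace ℝ V]

/-- A continuous function satisfying the parallelogram law is a quadratic form. -/
theorem exists_bilin {T : V → ℂ} (hT : Continuous T)
    (h : ∀ a b, T (a + b) + T (a - b) = 2 * T a + 2 * T b) :
    ∃ B : V →ₗ[ℝ] V →ₗ[ℝ] ℂ, ∀ a, T a = B a a := by
  have h0 : T 0 = 0 := by
    have := h 0 0
    simp only [add_zero, sub_zero] at this
    linear_combination -this / 2
  have hneg : ∀ b, T (-b) = T b := by
    intro b
    have := h 0 b
    simp only [zero_add, zero_sub, h0] at this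
    linear_combination this
  have hsymm : ∀ a b, T (a - b) = T (b - a) := fun a b => by rw [← hneg, neg_sub]
  let β : V → V → ℂ := fun a b => (T (a + b) - T (a - b)) / 4
  have βs : ∀ a b, β a b = β b a := fun a b => by simp only [β]; rw [add_comm, hsymm]
  have βa : ∀ a a' b, β (a + a') b = β a b + β a' b := by
    intro a a' b
    have h1 := h (a + b) a'
    have h2 := h (a - b) a'
    have h3 := h (a' + b) a
    have h4 := h (a' - b) a
    rw [show a + b + a' = a + a' + b by abel, hsymm (a + b), show a' - (a + b) = a' - b - a by abel] at h1
    rw [show a - b + a' = a + a' - b by abel, hsymm (a - b), show a' - (a - b) = a' + b - a by abel] at h2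
    rw [show a' + b + a = a + a' + b by abel] at h3
    rw [show a' - b + a = a + a' - b by abel] at h4
    simp only [β]
    linear_combination (h1 - h2 + h3 - h4) / 8
  have βc : ∀ b, Continuous fun a => β a b := fun b => by simp only [β]; fun_prop
  let g : V → V →ₗ[ℝ] ℂ := fun b => (AddMonoidHom.toRealLinearMap
    (AddMonoidHom.mk' (fun a => β a b) fun a a' => βa a a' b) (βc b)).toLinearMap
  have hg : ∀ a b, g b a = β a b := fun _ _ => rfl
  refine ⟨LinearMap.mk₂ ℝ (fun a b => g a b) ?_ ?_ ?_ ?_, ?_⟩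
  · intro a a' b; simp only [hg]; rw [βs, βa, βs a, βs a']
  · intro c a b
    have := (g b).map_smul c a
    simp only [hg] at this ⊢
    rw [βs, this, βs a]
  · intro a b b'; exact map_add _ _ _
  · intro c a b; exact map_smul _ _ _
  · intro a
    have := h a a
    simp only [LinearMap.mk₂_apply, hg, β]
    simp only [sub_self, h0] at this ⊢
    linear_combination -this / 4

end Bilin

section Moment

variable {ι : Type*} [Fintype ι] [DecidableEq ι]

def cut {V : Type*} [NormedAddCommGroup V] (n : V) : ℝ := max 0 (1 - ‖n‖)

theorem continuous_cut {V : Type*} [NormedAddCommGroup V] : Continuous (cut : V → ℝ) := by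
  unfold cut; fun_prop

theorem cut_nonneg {V : Type*} [NormedAddCommGroup V] (n : V) : 0 ≤ cut n := le_max_left _ _

theorem cut_eq_zero {V : Type*} [NormedAddCommGroup V] {n : V} (h : 1 ≤ ‖n‖) : cut n = 0 :=
  max_eq_left (by linarith)

theorem integrable_mul_cut {V : Type*} [NormedAddCommGroup V] [InnerProductSpace ℝ V]
    [FiniteDimensional ℝ V] [MeasurableSpace V] [BorelSpace V] {F : Type*} [NormedAddCommGroup F]
    [NormedSpace ℝ F] {f : V → F} (hf : Continuous f) : Integrable fun n => cut n • f n := by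
  refine (continuous_cut.smul hf).integrable_of_hasCompactSupport
    (HasCompactSupport.of_support_subset_isCompact (isCompact_closedBall 0 1) fun n hn => ?_)
  rw [mem_closedBall_zero_iff]
  by_contra h
  exact hn (by simp [cut_eq_zero (not_le.1 h).le])

variable {V : Type*} [NormedAddCommGroup V] [InnerProductSpace ℝ V]
    [FiniteDimensional ℝ V] [MeasurableSpace V] [BorelSpace V]

def mom (i₀ i j : ι) : ℝ := ∫ n : EuclideanSpace ℝ ι, cut n * (|n i₀| * n i * n j)

theorem integral_comp_isometry {W F : Type*} [NormedAddCommGroup W] [InnerProductSpace ℝ W]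
    [FiniteDimensional ℝ W] [MeasurableSpace W] [BorelSpace W]
    [NormedAddCommGroup F] [NormedSpace ℝ F] (e : V ≃ₗᵢ[ℝ] W) (f : W → F) :
    ∫ x, f (e x) = ∫ x, f x :=
  e.measurePreserving.integral_comp e.toHomeomorph.measurableEmbedding f

theorem mom_eq_zero {i₀ i j : ι} (h : i ≠ j) : mom i₀ i j = 0 := by
  set e := LinearIsometryEquiv.piLpCongrRight 2
    (fun k => if k = i then LinearIsometryEquiv.neg ℝ else LinearIsometryEquiv.refl ℝ ℝ) with he
  have hk : ∀ (n : EuclideanSpace ℝ ι) k, e n k = if k = i then - n k else n k := by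
    intro n k
    simp only [he, LinearIsometryEquiv.piLpCongrRight_apply]
    split_ifs <;> simp
  have h1 : mom i₀ i j = - mom i₀ i j := by
    conv_lhs => rw [mom, ← integral_comp_isometry e]
    rw [mom, ← integral_neg]
    congr 1; ext n
    rw [show cut (e n) = cut n by rw [cut, LinearIsometryEquiv.norm_map]; rfl]
    simp only [hk, if_true, if_neg h.symm]
    rw [show |if i₀ = i then - n i₀ else n i₀| = |n i₀| by split_ifs <;> simp]
    ring
  linarith

theorem mom_eq_mom {i₀ i j : ι} (hi : i ≠ i₀) (hj : j ≠ i₀) : mom i₀ i i = mom i₀ j j := by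
  conv_lhs => rw [mom, ← integral_comp_isometry
    (LinearIsometryEquiv.piLpCongrLeft 2 ℝ ℝ (Equiv.swap i j))]
  rw [mom]
  congr 1; ext n
  simp only [cut, LinearIsometryEquiv.norm_map, LinearIsometryEquiv.piLpCongrLeft_apply]
  simp [Equiv.piCongrLeft'_apply, Equiv.swap_apply_of_ne_of_ne hi.symm hj.symm]

omit [DecidableEq ι] [FiniteDimensional ℝ V] [MeasurableSpace V] [BorelSpace V] in
theorem sum_bilin_basis (B : V →ₗ[ℝ] V →ₗ[ℝ] ℂ) (b e : OrthonormalBasis ι ℝ V) :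
    ∑ i, B (b i) (b i) = ∑ i, B (e i) (e i) := by
  have h : ∀ i, B (b i) (b i) = ∑ j, ∑ k, ((inner ℝ (e j) (b i) * inner ℝ (b i) (e k) : ℝ) : ℂ) *
      B (e j) (e k) := by
    intro i
    conv_lhs => rw [← e.sum_repr' (b i)]
    simp only [map_sum, LinearMap.sum_apply, map_smul, LinearMap.smul_apply, Finset.smul_sum,
      Complex.real_smul]
    rw [Finset.sum_comm]
    refine Finset.sum_congr rfl fun j _ => Finset.sum_congr rfl fun k _ => ?_
    rw [real_inner_comm (e k) (b i)]
    push_cast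
    ring
  simp only [h]
  rw [Finset.sum_comm]
  refine Finset.sum_congr rfl fun j _ => ?_
  rw [Finset.sum_comm]
  simp only [← Finset.sum_mul, ← Complex.ofReal_sum]
  simp only [b.sum_inner_mul_inner]
  rw [Finset.sum_eq_single j]
  · simp
  · intro k _ hk
    rw [e.inner_eq_zero hk.symm]; simp
  · simp

theorem exists_moment (e : OrthonormalBasis ι ℝ V) : ∃ α β : ℂ, ∀ (B : V →ₗ[ℝ] V →ₗ[ℝ] ℂ) (x : V),
    ‖x‖ = 1 → ∫ n : V, (cut n * |inner ℝ x n| : ℝ) * B n n =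
      α * B x x + β * ∑ i, B (e i) (e i) := by
  rcases isEmpty_or_nonempty ι with hι | ⟨⟨i₀⟩⟩
  · refine ⟨0, 0, fun B x hx => ?_⟩
    have : x = 0 := by rw [← e.sum_repr' x]; simp
    simp [this] at hx
  have hm : ∃ β : ℝ, ∀ i ≠ i₀, mom i₀ i i = β := by
    by_cases h : ∃ i, i ≠ i₀
    · exact ⟨_, fun i hi => mom_eq_mom hi h.choose_spec⟩
    · push Not at h
      exact ⟨0, fun i hi => absurd (h i) hi⟩
  obtain ⟨β, hβ⟩ := hm
  refine ⟨mom i₀ i₀ i₀ - β, β, fun B x hx => ?_⟩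
  obtain ⟨b, hb⟩ := Orthonormal.exists_orthonormalBasis_extension_of_card_eq (𝕜 := ℝ)
    (E := V) (ι := ι) (Module.finrank_eq_card_basis e.toBasis) (v := fun _ => x) (s := {i₀}) (by
      constructor
      · rintro ⟨i, hi⟩; simpa using hx
      · rintro ⟨i, hi⟩ ⟨j, hj⟩ hij
        simp only [mem_singleton_iff] at hi hj
        subst hi hj
        exact absurd rfl hij)
  have hb0 : b i₀ = x := hb i₀ rfl
  rw [← sum_bilin_basis B b e, ← integral_comp_isometry b.repr.symm]
  have hint : ∀ i j, Integrable fun n : EuclideanSpace ℝ ι =>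
      ((cut n * (|n i₀| * n i * n j) : ℝ) : ℂ) * B (b i) (b j) := fun i j =>
    ((integrable_mul_cut (f := fun n : EuclideanSpace ℝ ι => |n i₀| * n i * n j)
      (by fun_prop)).ofReal).mul_const _
  have : ∀ n : EuclideanSpace ℝ ι, ((cut (b.repr.symm n) * |inner ℝ x (b.repr.symm n)| : ℝ) : ℂ) *
      B (b.repr.symm n) (b.repr.symm n) = ∑ i, ∑ j,
        ((cut n * (|n i₀| * n i * n j) : ℝ) : ℂ) * B (b i) (b j) := by
    intro n
    rw [show inner ℝ x (b.repr.symm n) = n i₀ by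
      rw [← hb0, ← b.repr_apply_apply, LinearIsometryEquiv.apply_symm_apply]]
    conv_lhs => rw [← b.sum_repr_symm]
    simp only [map_sum, LinearMap.sum_apply, map_smul, LinearMap.smul_apply,
      Complex.real_smul, Finset.mul_sum]
    rw [Finset.sum_comm]
    refine Finset.sum_congr rfl fun j _ => Finset.sum_congr rfl fun k _ => ?_
    rw [show cut (∑ i, n i • b i) = cut n by
      rw [b.sum_repr_symm, cut, LinearIsometryEquiv.norm_map]; rfl]
    push_cast
    ring
  simp only [this]
  rw [integral_finsetSum _ fun i _ => integrable_finsetSum _ fun j _ => hint i j]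
  simp only [integral_finsetSum _ fun j _ => hint _ j, integral_mul_const, integral_complex_ofReal]
  change ∑ i, ∑ j, ((mom i₀ i j : ℝ) : ℂ) * _ = _
  rw [Finset.sum_congr rfl fun i _ => Finset.sum_eq_single i
    (fun j _ hj => by rw [mom_eq_zero hj.symm]; simp) (by simp),
    ← Finset.add_sum_erase _ _ (Finset.mem_univ i₀),
    ← Finset.add_sum_erase _ (fun i => B (b i) (b i)) (Finset.mem_univ i₀), mul_add, Finset.mul_sum,
    Finset.sum_congr rfl fun i hi => by rw [hβ i (Finset.ne_of_mem_erase hi)], hb0]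
  ring

end Moment

end

section

variable {V : Type*} [NormedAddCommGroup V] [InnerProductSpace ℝ V]

/-- The positive part of `s |Re z| - |Im z|` for `z = (n - c) * y`. -/
def coneKer (s : ℝ) (w : V × ℝ) (y : V) : ℝ :=
  max 0 (s * |inner ℝ w.1 y| - √((‖w.1‖ ^ 2 + w.2 ^ 2) * ‖y‖ ^ 2 - inner ℝ w.1 y ^ 2))

theorem continuous_coneKer (s : ℝ) : Continuous fun p : (V × ℝ) × V => coneKer s p.1 p.2 := by
  unfold coneKer; fun_prop

theorem coneKer_nonneg (s : ℝ) (w : V × ℝ) (y : V) : 0 ≤ coneKer s w y := le_max_left _ _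

theorem inner_sq_le (n y : V) : inner ℝ n y ^ 2 ≤ ‖n‖ ^ 2 * ‖y‖ ^ 2 := by
  rw [← mul_pow, ← sq_abs]
  exact pow_le_pow_left₀ (abs_nonneg _) (abs_real_inner_le_norm _ _) 2

theorem coneKer_le {s : ℝ} (hs : 0 ≤ s) (w : V × ℝ) (y : V) :
    coneKer s w y ≤ s * ‖w.1‖ * ‖y‖ := by
  have h1 := mul_le_mul_of_nonneg_left (abs_real_inner_le_norm w.1 y) hs
  exact max_le (by positivity) (by
    linarith [Real.sqrt_nonneg ((‖w.1‖ ^ 2 + w.2 ^ 2) * ‖y‖ ^ 2 - inner ℝ w.1 y ^ 2)])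

theorem coneKer_eq_zero {s : ℝ} (hs : 0 ≤ s) {w : V × ℝ} (h : s * ‖w.1‖ ≤ |w.2|) (y : V) :
    coneKer s w y = 0 := by
  refine max_eq_left (sub_nonpos.2 (Real.le_sqrt_of_sq_le ?_))
  have h1 : (s * |inner ℝ w.1 y|) ^ 2 ≤ (|w.2| * ‖y‖) ^ 2 := by
    refine pow_le_pow_left₀ (by positivity) ?_ 2
    calc s * |inner ℝ w.1 y| ≤ s * (‖w.1‖ * ‖y‖) :=
          mul_le_mul_of_nonneg_left (abs_real_inner_le_norm _ _) hs
      _ = (s * ‖w.1‖) * ‖y‖ := by ring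
      _ ≤ _ := by gcongr
  rw [mul_pow |w.2|, sq_abs] at h1
  nlinarith [inner_sq_le w.1 y]

theorem coneKer_smul (s : ℝ) (w : V × ℝ) {t : ℝ} (ht : 0 ≤ t) (y : V) :
    coneKer s w (t • y) = t * coneKer s w y := by
  simp only [coneKer, real_inner_smul_right, norm_smul, Real.norm_eq_abs, abs_mul, abs_of_nonneg ht,
    mul_max_of_nonneg _ _ ht, mul_zero]
  rw [show (‖w.1‖ ^ 2 + w.2 ^ 2) * (t * ‖y‖) ^ 2 - (t * inner ℝ w.1 y) ^ 2 =
    t ^ 2 * ((‖w.1‖ ^ 2 + w.2 ^ 2) * ‖y‖ ^ 2 - inner ℝ w.1 y ^ 2) by ring,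
    Real.sqrt_mul (by positivity), Real.sqrt_sq ht]
  congr 1; ring

theorem coneKer_map {W : Type*} [NormedAddCommGroup W] [InnerProductSpace ℝ W] (e : V →ₗᵢ[ℝ] W)
    (s : ℝ) (n y : V) (c : ℝ) : coneKer s (e n, c) (e y) = coneKer s (n, c) y := by
  simp [coneKer]

theorem coneKer_close {s : ℝ} {w : V × ℝ} {x y : V} :
    coneKer s w y * abs (‖y‖ ^ 2 * |inner ℝ x w.1| - |inner ℝ x y| * |inner ℝ w.1 y|) ≤
      coneKer s w y * (s * ‖x‖ * ‖y‖ * |inner ℝ w.1 y|) := by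
  rcases (coneKer_nonneg s w y).eq_or_lt with h | h
  · rw [← h]; simp
  refine mul_le_mul_of_nonneg_left ?_ h.le
  set A := (‖w.1‖ ^ 2 + w.2 ^ 2) * ‖y‖ ^ 2 - inner ℝ w.1 y ^ 2 with hA
  have hle : √A ≤ s * |inner ℝ w.1 y| := by
    by_contra hc
    exact h.ne' (max_eq_left (by linarith))
  have e1 : |inner ℝ x (‖y‖ ^ 2 • w.1 - inner ℝ w.1 y • y)| ≤ ‖x‖ * (‖y‖ * √A) := by
    refine (abs_real_inner_le_norm _ _).trans (mul_le_mul_of_nonneg_left ?_ (norm_nonneg _))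
    refine le_of_sq_le_sq ?_ (by positivity)
    rw [mul_pow, Real.sq_sqrt (by rw [hA]; nlinarith [inner_sq_le w.1 y, sq_nonneg (w.2 * ‖y‖)]),
      norm_sub_sq_real, norm_smul, norm_smul, real_inner_smul_left, real_inner_smul_right,
      Real.norm_eq_abs, Real.norm_eq_abs, mul_pow, mul_pow, sq_abs, sq_abs, hA]
    nlinarith [sq_nonneg (w.2 * ‖y‖ * ‖y‖)]
  rw [inner_sub_right, real_inner_smul_right, real_inner_smul_right] at e1
  rw [← abs_mul, show ‖y‖ ^ 2 * |inner ℝ x w.1| = |‖y‖ ^ 2 * inner ℝ x w.1| by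
    rw [abs_mul, abs_of_nonneg (sq_nonneg ‖y‖)]]
  refine (abs_abs_sub_abs_le_abs_sub _ _).trans ?_
  rw [mul_comm (inner ℝ x y)]
  refine e1.trans ?_
  calc ‖x‖ * (‖y‖ * √A) ≤ ‖x‖ * (‖y‖ * (s * |inner ℝ w.1 y|)) := by gcongr
    _ = _ := by ring

variable [FiniteDimensional ℝ V] [MeasurableSpace V] [BorelSpace V]

omit [FiniteDimensional ℝ V] [MeasurableSpace V] [BorelSpace V] in
theorem coneKer_support {s : ℝ} (hs : 0 ≤ s) {w : V × ℝ} (y : V)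
    (h : w ∉ Metric.closedBall (0 : V) 1 ×ˢ Icc (-s) s) : coneKer s w y * cut w.1 = 0 := by
  by_cases h1 : 1 ≤ ‖w.1‖
  · rw [cut_eq_zero h1, mul_zero]
  · rw [coneKer_eq_zero hs, zero_mul]
    by_contra h2
    push Not at h1 h2
    refine h ⟨mem_closedBall_zero_iff.2 h1.le, abs_le.1 (h2.le.trans ?_)⟩
    nlinarith

omit [MeasurableSpace V] [BorelSpace V] in
theorem hasCompactSupport_coneKer {s : ℝ} (hs : 0 ≤ s) (y : V) {F : Type*} [NormedAddCommGroup F]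
    [NormedSpace ℝ F] (f : V × ℝ → F) :
    HasCompactSupport fun w : V × ℝ => (coneKer s w y * cut w.1) • f w :=
  HasCompactSupport.of_support_subset_isCompact
    ((isCompact_closedBall (0 : V) 1).prod (isCompact_Icc (a := -s) (b := s))) fun w hw => by
      by_contra h
      exact hw (by simp only [coneKer_support hs y h, zero_smul])

theorem integrable_coneKer {s : ℝ} (hs : 0 ≤ s) (y : V) {F : Type*} [NormedAddCommGroup F]
    [NormedSpace ℝ F] {f : V × ℝ → F} (hf : Continuous f) :
    Integrable fun w : V × ℝ => (coneKer s w y * cut w.1) • f w := by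
  refine Continuous.integrable_of_hasCompactSupport ?_ (hasCompactSupport_coneKer hs y f)
  have := (continuous_coneKer (V := V) s).comp (f := fun w => (w, y)) (by fun_prop)
  have h2 := continuous_cut (V := V)
  exact (this.mul (h2.comp continuous_fst)).smul hf

def coneMass (s : ℝ) (y : V) : ℝ :=
  ∫ w : V × ℝ, (coneKer s w y * cut w.1) • |inner ℝ w.1 y|

def coneTransform (s : ℝ) (x y : V) : ℝ :=
  ∫ w : V × ℝ, (coneKer s w y * cut w.1) • |inner ℝ x w.1|

theorem coneMass_smul (s : ℝ) {t : ℝ} (ht : 0 ≤ t) (y : V) :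
    coneMass s (t • y) = t ^ 2 * coneMass s y := by
  rw [coneMass, coneMass, ← integral_const_mul]
  congr 1; ext w
  rw [coneKer_smul s w ht, real_inner_smul_right, abs_mul, abs_of_nonneg ht]
  simp only [smul_eq_mul]; ring

theorem coneMass_map (s : ℝ) (e : V ≃ₗᵢ[ℝ] V) (y : V) : coneMass s (e y) = coneMass s y := by
  have hm : MeasurePreserving (Prod.map e id : V × ℝ → V × ℝ) :=
    e.measurePreserving.prod (MeasurePreserving.id volume)
  rw [coneMass, ← hm.integral_comp
    (e.toHomeomorph.prodCongr (Homeomorph.refl ℝ)).measurableEmbedding, coneMass]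
  congr 1; ext w
  have := coneKer_map e.toLinearIsometry s w.1 y w.2
  simp only [LinearIsometryEquiv.coe_toLinearIsometry] at this
  simp only [Prod.map, id, this, cut, LinearIsometryEquiv.norm_map,
    LinearIsometryEquiv.inner_map_map]

theorem coneMass_eq (s : ℝ) {e : V} (he : ‖e‖ = 1) (y : V) :
    coneMass s y = ‖y‖ ^ 2 * coneMass s e := by
  have h := Submodule.reflection_sub (v := ‖y‖ • e) (w := y) (by rw [norm_smul, he]; simp)
  rw [← coneMass_smul s (norm_nonneg y), ← coneMass_map s _ (‖y‖ • e), h]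

theorem coneMass_pos {s : ℝ} (hs : 0 < s) {e : V} (he : ‖e‖ = 1) : 0 < coneMass s e := by
  have hc : Continuous fun w : V × ℝ => (coneKer s w e * cut w.1) • |inner ℝ w.1 e| := by
    have := (continuous_coneKer (V := V) s).comp (f := fun w => (w, e)) (by fun_prop)
    have h2 := continuous_cut (V := V)
    exact (this.mul (h2.comp continuous_fst)).smul (by fun_prop)
  refine hc.integral_pos_of_hasCompactSupport_nonneg_nonzero (hasCompactSupport_coneKer hs.le _ _)
    (fun w => ?_) (x := ((1 / 2 : ℝ) • e, 0)) ?_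
  · exact mul_nonneg (mul_nonneg (coneKer_nonneg _ _ _) (cut_nonneg _)) (abs_nonneg _)
  · simp only [coneKer, cut, norm_smul, he, real_inner_smul_left, real_inner_self_eq_norm_sq]
    norm_num
    positivity

theorem coneTransform_close {s : ℝ} (hs : 0 ≤ s) {e : V} (he : ‖e‖ = 1) (x y : V) :
    abs (coneTransform s x y - coneMass s e * |inner ℝ x y|) ≤ s * ‖x‖ * ‖y‖ * coneMass s e := by
  rcases eq_or_ne y 0 with rfl | hy
  · have : ∀ w : V × ℝ, coneKer s w 0 = 0 := fun w => by simp [coneKer]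
    simp [coneTransform, this]
  have hy2 : 0 < ‖y‖ ^ 2 := by positivity
  refine le_of_mul_le_mul_left ?_ hy2
  have e1 : ‖y‖ ^ 2 * abs (coneTransform s x y - coneMass s e * |inner ℝ x y|) =
      |‖y‖ ^ 2 * coneTransform s x y - |inner ℝ x y| * coneMass s y| := by
    rw [coneMass_eq s he y, ← abs_of_pos hy2, ← abs_mul, abs_of_pos hy2]
    congr 1; ring
  have e2 : ‖y‖ ^ 2 * (s * ‖x‖ * ‖y‖ * coneMass s e) = s * ‖x‖ * ‖y‖ * coneMass s y := by
    rw [coneMass_eq s he y]; ring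
  rw [e1, e2, coneTransform, coneMass, ← integral_const_mul, ← integral_const_mul,
    ← integral_const_mul]
  have i1 := integrable_coneKer hs y (f := fun w : V × ℝ => |inner ℝ x w.1|) (by fun_prop)
  have i2 := integrable_coneKer hs y (f := fun w : V × ℝ => |inner ℝ w.1 y|) (by fun_prop)
  rw [← integral_sub (i1.const_mul _) (i2.const_mul _), ← Real.norm_eq_abs]
  refine (norm_integral_le_integral_norm _).trans (integral_mono ?_ (i2.const_mul _) fun w => ?_)
  · exact ((i1.const_mul _).sub (i2.const_mul _)).norm
  have := mul_le_mul_of_nonneg_left (coneKer_close (s := s) (w := w) (x := x) (y := y))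
    (cut_nonneg w.1)
  simp only [smul_eq_mul, Real.norm_eq_abs]
  rw [show ‖y‖ ^ 2 * (coneKer s w y * cut w.1 * |inner ℝ x w.1|) -
      |inner ℝ x y| * (coneKer s w y * cut w.1 * |inner ℝ w.1 y|) = cut w.1 * (coneKer s w y *
      (‖y‖ ^ 2 * |inner ℝ x w.1| - |inner ℝ x y| * |inner ℝ w.1 y|)) by ring, abs_mul, abs_mul,
    abs_of_nonneg (cut_nonneg _), abs_of_nonneg (coneKer_nonneg _ _ _)]
  linarith

/-- The cosine transform of `ρ` is a quadratic form on the unit sphere if all its truncated cone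
transforms are quadratic forms. -/
theorem parallelogram_of_cone {f : V → ℂ} (ρ : 𝓢(V, ℂ))
    (hf : ∀ x, f x = ∫ y, ρ y * (|inner ℝ y x| : ℝ))
    (hT : ∀ s : ℝ, 0 < s → ∃ B : V →ₗ[ℝ] V →ₗ[ℝ] ℂ, ∀ n, ∫ c : ℝ, ∫ y, ρ y * coneKer s (n, c) y =
      B n n) (a b : V) :
    (‖a + b‖ : ℂ) * f (a + b) + ‖a - b‖ * f (a - b) = 2 * (‖a‖ * f a) + 2 * (‖b‖ * f b) := by
  obtain hV | hV := subsingleton_or_nontrivial V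
  · simp [Subsingleton.elim a 0, Subsingleton.elim b 0]
  obtain ⟨e, he⟩ := exists_norm_eq V zero_le_one
  choose! B hB using hT
  let o := stdOrthonormalBasis ℝ V
  obtain ⟨α, β, hαβ⟩ := exists_moment o
  let S : ℝ → V → ℂ := fun s x => ∫ y, ρ y * coneTransform s x y
  have hSB : ∀ s, 0 < s → ∀ x : V, ‖x‖ * S s x =
      α * B s x x + β * (‖x‖ : ℂ) ^ 2 * ∑ i, B s (o i) (o i) := by
    intro s hs
    have hunit : ∀ x : V, ‖x‖ = 1 → S s x = α * B s x x + β * ∑ i, B s (o i) (o i) := by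
      intro x hx
      rw [← hαβ _ x hx]
      set Φ : V → V × ℝ → ℂ := fun y w =>
        ρ y * ((coneKer s w y * cut w.1) • |inner ℝ x w.1| : ℝ) with hΦ
      have hΦi : Integrable (Function.uncurry Φ) := by
        have i1 : Integrable (fun y : V => ρ y * (‖y‖ : ℝ)) :=
          integrable_schwartz_mul ρ continuous_norm (C := 1) (by simp)
        have hC : IsCompact (Metric.closedBall (0 : V) 1 ×ˢ Icc (-s) s) :=
          (isCompact_closedBall (0 : V) 1).prod isCompact_Icc
        have i2 : Integrable (fun w : V × ℝ =>
            (Metric.closedBall (0 : V) 1 ×ˢ Icc (-s) s).indicator (fun _ => s) w) := by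
          rw [integrable_indicator_iff hC.measurableSet]
          exact continuous_const.continuousOn.integrableOn_compact hC
        have hcont : Continuous (Function.uncurry Φ) := by
          have h1 := (continuous_coneKer (V := V) s).comp (f := fun p : V × V × ℝ => (p.2, p.1))
            (by fun_prop)
          have h2 := continuous_cut (V := V)
          have h3 := ρ.continuous
          simp only [hΦ, Function.uncurry_def, smul_eq_mul]
          refine (h3.comp continuous_fst).mul (Complex.continuous_ofReal.comp ?_)
          exact (h1.mul (h2.comp (by fun_prop))).mul (by fun_prop)
        refine (i1.norm.mul_prod i2).mono' hcont.aestronglyMeasurable (.of_forall fun ⟨y, w⟩ => ?_)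
        simp only [Function.uncurry_apply_pair, hΦ]
        by_cases hw : w ∈ Metric.closedBall (0 : V) 1 ×ˢ Icc (-s) s
        · rw [indicator_of_mem hw, norm_mul, norm_mul, Complex.norm_real, Complex.norm_real,
            smul_eq_mul, Real.norm_eq_abs, Real.norm_eq_abs, abs_norm,
            mul_assoc ‖ρ y‖]
          refine mul_le_mul_of_nonneg_left ?_ (norm_nonneg (ρ y))
          have hw1 : ‖w.1‖ ≤ 1 := by simpa using (mem_prod.1 hw).1
          have k1 := coneKer_le hs.le w y
          have k2 : cut w.1 ≤ 1 := max_le zero_le_one (by have := norm_nonneg w.1; linarith)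
          have k3 : |inner ℝ x w.1| ≤ 1 := (abs_real_inner_le_norm _ _).trans (by rw [hx]; linarith)
          have k4 := coneKer_nonneg s w y
          have k5 := cut_nonneg w.1
          rw [abs_of_nonneg (by positivity)]
          calc coneKer s w y * cut w.1 * |inner ℝ x w.1| ≤ s * ‖w.1‖ * ‖y‖ * 1 * 1 := by gcongr
            _ ≤ s * 1 * ‖y‖ * 1 * 1 := by gcongr
            _ = _ := by ring
        · rw [coneKer_support hs.le y hw, indicator_of_notMem hw]; simp
      have e1 : S s x = ∫ y, ∫ w, Φ y w := by
        simp only [S, coneTransform, hΦ]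
        congr 1; ext y
        rw [integral_const_mul, integral_complex_ofReal]
      rw [e1, integral_integral_swap hΦi, Measure.volume_eq_prod,
        integral_prod (fun w : V × ℝ => ∫ y, Φ y w) hΦi.integral_prod_right]
      congr 1; ext n
      rw [← hB s hs n, ← integral_const_mul]
      congr 1; ext c
      rw [← integral_const_mul]
      congr 1; ext y
      simp only [hΦ, smul_eq_mul]
      push_cast
      ring
    have hSsmul : ∀ t : ℝ, 0 ≤ t → ∀ x, S s (t • x) = t * S s x := by
      intro t ht x
      simp only [S]
      rw [← integral_const_mul]
      congr 1; ext y
      rw [show coneTransform s (t • x) y = t * coneTransform s x y by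
        rw [coneTransform, coneTransform, ← integral_const_mul]
        congr 1; ext w
        rw [real_inner_smul_left, abs_mul, abs_of_nonneg ht]
        simp only [smul_eq_mul]; ring]
      push_cast
      ring
    intro x
    rcases eq_or_ne x 0 with rfl | hx
    · simp
    have hx' : ‖x‖ ≠ 0 := norm_ne_zero_iff.2 hx
    obtain ⟨u, hu, hxu⟩ : ∃ u : V, ‖u‖ = 1 ∧ x = ‖x‖ • u :=
      ⟨‖x‖⁻¹ • x, by rw [norm_smul]; simp [hx'], by rw [smul_smul, mul_inv_cancel₀ hx', one_smul]⟩
    conv_lhs => rw [hxu, hSsmul _ (norm_nonneg x), hunit u hu, ← hxu]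
    conv_rhs => rw [hxu]
    simp only [map_smul, LinearMap.smul_apply, Complex.real_smul, norm_smul, norm_norm, hu, mul_one]
    ring
  have hSf : ∀ s, 0 < s → ∀ x, ‖S s x - coneMass s e * f x‖ ≤
      s * ‖x‖ * coneMass s e * ∫ y, ‖y‖ * ‖ρ y‖ := by
    intro s hs x
    have i1 : Integrable fun y : V => ρ y * (‖y‖ : ℝ) :=
      integrable_schwartz_mul ρ continuous_norm (C := 1) (by simp)
    have hKc : Continuous fun y => coneTransform s x y := by
      have hc := continuous_coneKer (V := V) s
      have h2 := continuous_cut (V := V)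
      refine continuousOn_univ.1 (continuousOn_integral_of_compact_support (s := univ)
        ((isCompact_closedBall (0 : V) 1).prod (isCompact_Icc (a := -s) (b := s))) ?_ ?_)
      · refine Continuous.continuousOn ?_
        simp only [Function.uncurry_def, smul_eq_mul]
        exact ((hc.comp (f := fun p : V × V × ℝ => (p.2, p.1)) (by fun_prop)).mul
          (h2.comp (by fun_prop))).mul (by fun_prop)
      · intro y w _ hw
        rw [coneKer_support hs.le y hw, zero_smul]
    have i2 : Integrable fun y => ρ y * (coneTransform s x y : ℝ) := by
      refine integrable_schwartz_mul ρ hKc (C := s * ‖x‖ * coneMass s e + coneMass s e * ‖x‖)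
        fun y => ?_
      have h1 := coneTransform_close hs.le he x y
      have h2 := abs_real_inner_le_norm x y
      have h3 := (coneMass_pos hs he).le
      have h4 := abs_sub_abs_le_abs_sub (coneTransform s x y) (coneMass s e * |inner ℝ x y|)
      rw [abs_mul, abs_abs, abs_of_nonneg h3] at h4
      have h5 := mul_le_mul_of_nonneg_left h2 h3
      linarith
    have i3 : Integrable fun y => ρ y * (|inner ℝ y x| : ℝ) :=
      integrable_schwartz_mul ρ (by fun_prop) (C := ‖x‖) fun y => by
        rw [abs_abs, mul_comm]; exact abs_real_inner_le_norm _ _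
    rw [hf x, ← integral_const_mul]
    simp only [S]
    rw [← integral_sub i2 (i3.const_mul _), ← integral_const_mul]
    refine (norm_integral_le_integral_norm _).trans (integral_mono
      (i2.sub (i3.const_mul _)).norm ?_ fun y => ?_)
    · refine Integrable.const_mul ?_ _
      simpa [mul_comm] using i1.norm
    · have h1 := coneTransform_close hs.le he x y
      simp only
      rw [show ρ y * (coneTransform s x y : ℂ) - coneMass s e * (ρ y * (|inner ℝ y x| : ℝ)) =
        ρ y * ((coneTransform s x y - coneMass s e * |inner ℝ x y| : ℝ) : ℂ) by
          rw [real_inner_comm]; push_cast; ring, norm_mul, Complex.norm_real, Real.norm_eq_abs]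
      calc _ ≤ ‖ρ y‖ * (s * ‖x‖ * ‖y‖ * coneMass s e) := by gcongr
        _ = _ := by ring
  have hlim : ∀ x, Tendsto (fun s : ℝ => (coneMass s e : ℂ)⁻¹ * S s x) (𝓝[>] 0) (𝓝 (f x)) := by
    intro x
    rw [tendsto_iff_norm_sub_tendsto_zero]
    have h0 : Tendsto (fun s : ℝ => s * (‖x‖ * ∫ y, ‖y‖ * ‖ρ y‖)) (𝓝[>] 0) (𝓝 0) := by
      have : Tendsto (fun s : ℝ => s * (‖x‖ * ∫ y, ‖y‖ * ‖ρ y‖)) (𝓝 0) (𝓝 (0 * _)) :=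
        tendsto_id.mul_const _
      rw [zero_mul] at this
      exact this.mono_left nhdsWithin_le_nhds
    refine squeeze_zero' (.of_forall fun _ => norm_nonneg _) ?_ h0
    filter_upwards [self_mem_nhdsWithin] with s hs
    have hm := coneMass_pos hs he
    have hm' : (coneMass s e : ℂ) ≠ 0 := by exact_mod_cast hm.ne'
    rw [show (coneMass s e : ℂ)⁻¹ * S s x - f x = (coneMass s e : ℂ)⁻¹ * (S s x - coneMass s e * f x)
      by field_simp, norm_mul, norm_inv, Complex.norm_real, Real.norm_eq_abs, abs_of_pos hm,
      inv_mul_le_iff₀ hm]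
    refine (hSf s hs x).trans_eq (by ring)
  have hpar : ∀ s, 0 < s → (‖a + b‖ : ℂ) * ((coneMass s e : ℂ)⁻¹ * S s (a + b)) +
      ‖a - b‖ * ((coneMass s e : ℂ)⁻¹ * S s (a - b)) =
      2 * (‖a‖ * ((coneMass s e : ℂ)⁻¹ * S s a)) + 2 * (‖b‖ * ((coneMass s e : ℂ)⁻¹ * S s b)) := by
    intro s hs
    have hn : (‖a + b‖ : ℂ) ^ 2 + (‖a - b‖ : ℂ) ^ 2 = 2 * (‖a‖ : ℂ) ^ 2 + 2 * (‖b‖ : ℂ) ^ 2 := by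
      have := parallelogram_law_with_norm ℝ a b
      norm_cast
      linarith
    have h1 := hSB s hs (a + b)
    have h2 := hSB s hs (a - b)
    have h3 := hSB s hs a
    have h4 := hSB s hs b
    simp only [map_add, map_sub, LinearMap.add_apply, LinearMap.sub_apply] at h1 h2
    linear_combination (coneMass s e : ℂ)⁻¹ * (h1 + h2 - 2 * h3 - 2 * h4) +
      (coneMass s e : ℂ)⁻¹ * β * (∑ i, B s (o i) (o i)) * hn
  refine tendsto_nhds_unique_of_eventuallyEq (l := 𝓝[>] (0 : ℝ))
    (((hlim _).const_mul _).add ((hlim _).const_mul _))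
    ((((hlim _).const_mul _).const_mul _).add (((hlim _).const_mul _).const_mul _)) ?_
  filter_upwards [self_mem_nhdsWithin] with s hs using hpar s hs

end

section

section Ball

variable {E : Type*} [NormedAddCommGroup E] [InnerProductSpace ℝ E]
    [FiniteDimensional ℝ E] [MeasurableSpace E] [BorelSpace E]

theorem continuous_ball_integral {X : Type*} [TopologicalSpace X] {f : X → E → ℂ}
    (hf : Continuous (Function.uncurry f)) :
    Continuous fun x => ∫ q in Metric.closedBall (0 : E) 1, f x q := by
  let χ : E → ℝ := fun q => min 1 (max 0 (2 - ‖q‖))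
  have h1 : ∀ x, ∫ q in Metric.closedBall (0 : E) 1, f x q =
      ∫ q in Metric.closedBall (0 : E) 1, χ q * f x q := by
    intro x
    refine setIntegral_congr_fun Metric.isClosed_closedBall.measurableSet fun q hq => ?_
    have : ‖q‖ ≤ 1 := mem_closedBall_zero_iff.1 hq
    simp only [χ]
    rw [max_eq_right (by linarith), min_eq_left (by linarith)]
    simp
  simp only [h1]
  refine continuousOn_univ.1 (continuousOn_integral_of_compact_support (s := univ)
    (isCompact_closedBall (0 : E) 2) ?_ ?_)
  · refine Continuous.continuousOn ?_
    simp only [Function.uncurry_def, χ]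
    have : Continuous fun p : X × E => f p.1 p.2 := hf
    fun_prop
  · intro x q _ hq
    rw [mem_closedBall_zero_iff, not_le] at hq
    simp only [χ]
    rw [max_eq_left (by linarith)]
    simp

theorem integrableOn_ball {f : E → ℂ} (hf : Continuous f) :
    IntegrableOn f (Metric.closedBall (0 : E) 1) :=
  hf.continuousOn.integrableOn_compact (isCompact_closedBall 0 1)

theorem contDiff_ball_integral (j : ℕ) {g : E → ℂ} (hg : Continuous g) :
    ContDiff ℝ ∞ fun p : E => ∫ q in Metric.closedBall (0 : E) 1,
      ((1 + inner ℝ p q : ℝ) : ℂ) ^ j * g q := by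
  let e := stdOrthonormalBasis ℝ E
  induction j generalizing g with
  | zero => simpa using contDiff_const
  | succ j ih =>
    have h : (fun p : E => ∫ q in Metric.closedBall (0 : E) 1,
        ((1 + inner ℝ p q : ℝ) : ℂ) ^ (j + 1) * g q) = fun p =>
        (∫ q in Metric.closedBall (0 : E) 1, ((1 + inner ℝ p q : ℝ) : ℂ) ^ j * g q) +
        ∑ i, ((inner ℝ p (e i) : ℝ) : ℂ) * ∫ q in Metric.closedBall (0 : E) 1,
          ((1 + inner ℝ p q : ℝ) : ℂ) ^ j * (((inner ℝ (e i) q : ℝ) : ℂ) * g q) := by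
      funext p
      simp only [← integral_const_mul]
      rw [← integral_finsetSum, ← integral_add]
      · congr 1; ext q
        rw [pow_succ, ← e.sum_inner_mul_inner p q, Complex.ofReal_add, mul_add, add_mul]
        simp only [Complex.ofReal_sum, Finset.mul_sum, Finset.sum_mul, Complex.ofReal_mul]
        congr 1
        · simp
        · refine Finset.sum_congr rfl fun i _ => by ring
      · exact integrableOn_ball (by fun_prop)
      · exact integrableOn_ball (by fun_prop)
      · intro i _
        exact integrableOn_ball (by fun_prop)
    rw [h]
    refine (ih hg).add (ContDiff.sum fun i _ => ContDiff.mul ?_ (ih (by fun_prop)))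
    have h2 : ContDiff ℝ ∞ fun p : E => inner ℝ p (e i) := contDiff_id.inner ℝ contDiff_const
    exact Complex.ofRealCLM.contDiff.comp h2

theorem setIntegral_ball_comp (e : E ≃ₗᵢ[ℝ] E) (f : E → ℂ) :
    ∫ q in Metric.closedBall (0 : E) 1, f (e q) = ∫ q in Metric.closedBall (0 : E) 1, f q := by
  have := e.measurePreserving.setIntegral_preimage_emb e.toHomeomorph.measurableEmbedding f
    (Metric.closedBall 0 1)
  rw [← this]
  congr 2
  ext q; simp

/-- Averages of pushforwards of a valuation. -/
theorem IsVal.ball_integral {F : Type*} [NormedAddCommGroup F] [NormedSpace ℝ F]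
    {G : Type*} [NormedAddCommGroup G] [NormedSpace ℝ G]
    {μ : ConvexBody F → ℂ} (hμ : IsVal μ) {m : E → G →L[ℝ] F} (hm : Continuous m) {κ : E → ℂ}
    (hκ : Continuous κ) :
    IsVal fun K : ConvexBody G => ∫ q in Metric.closedBall (0 : E) 1, κ q * μ (lmap (m q) K) := by
  have hc : Continuous (Function.uncurry fun (K : ConvexBody G) (q : E) => κ q * μ (lmap (m q) K)) := by
    have h1 := continuous_lmap_uncurry (E := G) (F := F)
    have h2 := hμ.cont
    simp only [Function.uncurry_def]
    exact (hκ.comp continuous_snd).mul (h2.comp (h1.comp (f := fun p : ConvexBody G × E =>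
      (m p.2, p.1)) (by fun_prop)))
  have hi : ∀ K : ConvexBody G, IntegrableOn (fun q => κ q * μ (lmap (m q) K))
      (Metric.closedBall (0 : E) 1) := fun K =>
    integrableOn_ball (hc.comp (f := fun q => (K, q)) (by fun_prop))
  refine ⟨?_, continuous_ball_integral hc, ?_⟩
  · intro K L U I hU hI
    rw [← integral_add (hi _) (hi _), ← integral_add (hi _) (hi _)]
    congr 1; ext q
    rw [← mul_add, ← mul_add, (hμ.comp_lmap (m q)).union K L U I hU hI]
  · intro x K
    congr 1; ext q
    rw [(hμ.comp_lmap (m q)).trans x K]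

theorem DL_ball_integral {F : Type*} [NormedAddCommGroup F] [NormedSpace ℝ F]
    {G : Type*} [NormedAddCommGroup G] [NormedSpace ℝ G]
    {μ : ConvexBody F → ℂ} (hμ : IsVal μ) {m : E → G →L[ℝ] F} (hm : Continuous m) {κ : E → ℂ}
    (hκ : Continuous κ) (l : List G) (K : ConvexBody G) :
    DL l (fun K : ConvexBody G => ∫ q in Metric.closedBall (0 : E) 1, κ q * μ (lmap (m q) K)) K =
      ∫ q in Metric.closedBall (0 : E) 1, κ q * DL (l.map (m q)) μ (lmap (m q) K) := by
  simp only [← DL_lmap]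
  have hc : ∀ l : List G, ∀ K, Continuous fun q => κ q * DL l (fun K => μ (lmap (m q) K)) K := by
    intro l
    induction l with
    | nil =>
      intro K
      have h1 := continuous_lmap_uncurry (E := G) (F := F)
      have h2 := hμ.cont
      exact hκ.mul (h2.comp (h1.comp (f := fun q => (m q, K)) (by fun_prop)))
    | cons x l ih =>
      intro K
      simp only [DL_cons, D, mul_sub]
      exact (ih _).sub (ih _)
  induction l generalizing K with
  | nil => rfl
  | cons x l ih =>
    simp only [DL_cons, D, ih, mul_sub]
    rw [integral_sub (integrableOn_ball (hc l _)) (integrableOn_ball (hc l _))]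

end Ball

section Supp

variable {E : Type*} [NormedAddCommGroup E] [InnerProductSpace ℝ E]

theorem supp_union_add_inter {K L U I : ConvexBody E} (hU : (U : Set E) = (K : Set E) ∪ L)
    (hI : (I : Set E) = (K : Set E) ∩ L) (w : E) : supp U w + supp I w = supp K w + supp L w := by
  have hU' : ∀ {x}, x ∈ U ↔ x ∈ K ∨ x ∈ L := fun {x} => Set.ext_iff.1 hU x
  have hI' : ∀ {x}, x ∈ I ↔ x ∈ K ∧ x ∈ L := fun {x} => Set.ext_iff.1 hI x
  obtain ⟨k, hk, hk1, -⟩ := exists_eq_supp K w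
  obtain ⟨l, hl, hl1, -⟩ := exists_eq_supp L w
  have e1 : supp U w = max (supp K w) (supp L w) := by
    refine le_antisymm (supp_le fun x hx => ?_) (max_le ?_ ?_)
    · rcases hU'.1 hx with h | h
      · exact (le_supp h w).trans (le_max_left _ _)
      · exact (le_supp h w).trans (le_max_right _ _)
    · rw [← hk1]; exact le_supp (hU'.2 (.inl hk)) w
    · rw [← hl1]; exact le_supp (hU'.2 (.inr hl)) w
  have e2 : supp I w = min (supp K w) (supp L w) := by
    refine le_antisymm (supp_le fun x hx => ?_) ?_
    · exact le_min (le_supp (hI'.1 hx).1 w) (le_supp (hI'.1 hx).2 w)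
    · obtain ⟨t, h0, h1, hK, hL⟩ := exists_mem_inter hU hk hl
      have := le_supp (hI'.2 ⟨hK, hL⟩) w
      rw [inner_add_right, inner_smul_right, inner_smul_right, hk1, hl1] at this
      have a1 := min_le_left (supp K w) (supp L w)
      have a2 := min_le_right (supp K w) (supp L w)
      nlinarith
  rw [e1, e2, max_add_min]

variable {V : Type*} [NormedAddCommGroup V] [InnerProductSpace ℝ V] [FiniteDimensional ℝ V]
  [MeasurableSpace V] [BorelSpace V] (ρ : 𝓢(V, ℂ)) (g : V →L[ℝ] E)

/-- The even Minkowski additive functional with density `ρ` along `g`. -/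
def evenLin (K : ConvexBody E) : ℂ := ∫ y, ρ y * (supp K (g y) + supp K (-g y) : ℝ)

variable [FiniteDimensional ℝ E]

omit [FiniteDimensional ℝ E] in
theorem integrable_evenLin (K : ConvexBody E) :
    Integrable fun y => ρ y * (supp K (g y) + supp K (-g y) : ℝ) := by
  obtain ⟨R, hR0, hR⟩ := exists_bound K
  have hc := continuous_supp K
  refine integrable_schwartz_mul ρ (by fun_prop) (C := 2 * R * ‖g‖) fun y => ?_
  have h1 := abs_supp_le hR (g y)
  have h2 := abs_supp_le hR (-g y)
  rw [norm_neg] at h2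
  have h3 : R * ‖g y‖ ≤ R * (‖g‖ * ‖y‖) := mul_le_mul_of_nonneg_left (g.le_opNorm y) hR0.le
  refine (abs_add_le _ _).trans ?_
  linarith

omit [FiniteDimensional ℝ E] in
theorem evenLin_add (K L : ConvexBody E) :
    evenLin ρ g (K + L) = evenLin ρ g K + evenLin ρ g L := by
  rw [evenLin, evenLin, evenLin, ← integral_add (integrable_evenLin ρ g K) (integrable_evenLin ρ g L)]
  congr 1; ext y
  rw [supp_add, supp_add]; push_cast; ring

omit [FiniteDimensional ℝ E] in
theorem evenLin_pt (x : E) : evenLin ρ g (pt x) = 0 := by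
  simp [evenLin, supp_pt]

omit [FiniteDimensional ℝ E] in
theorem evenLin_seg (x : E) : evenLin ρ g (seg x) = ∫ y, ρ y * (|inner ℝ (g y) x| : ℝ) := by
  rw [evenLin]
  congr 1; ext y
  rw [supp_seg, supp_seg, inner_neg_left]
  congr 2
  rcases le_total 0 (inner ℝ (g y) x) with h | h
  · rw [max_eq_right h, max_eq_left (by linarith), abs_of_nonneg h, add_zero]
  · rw [max_eq_left h, max_eq_right (by linarith), abs_of_nonpos h, zero_add]

omit [FiniteDimensional ℝ E] in
theorem evenLin_rev (K : ConvexBody E) : evenLin ρ g (rev K) = evenLin ρ g K := by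
  simp only [evenLin, supp_rev, neg_neg, add_comm]

omit [FiniteDimensional ℝ E] in
theorem isVal_evenLin : IsVal (evenLin ρ g) := by
  refine ⟨?_, ?_, fun x K => by rw [evenLin_add, evenLin_pt, add_zero]⟩
  · intro K L U I hU hI
    have hi := integrable_evenLin ρ g
    simp only [evenLin]
    rw [← integral_add (hi _) (hi _), ← integral_add (hi _) (hi _)]
    congr 1; ext y
    have h1 := supp_union_add_inter hU hI (g y)
    have h2 := supp_union_add_inter hU hI (-g y)
    rw [← mul_add, ← mul_add]
    congr 1
    norm_cast
    linarith
  · set C : ℝ := 2 * ‖g‖ * ∫ y, ‖ρ y * (‖y‖ : ℝ)‖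
    have hC : 0 ≤ C := by positivity
    refine (LipschitzWith.of_dist_le_mul (K := ⟨C, hC⟩) fun K L => ?_).continuous
    have i1 : Integrable fun y => ρ y * (‖y‖ : ℝ) :=
      integrable_schwartz_mul ρ continuous_norm (C := 1) (by simp)
    have hi := integrable_evenLin ρ g
    rw [dist_eq_norm, evenLin, evenLin, ← integral_sub (hi K) (hi L)]
    refine (norm_integral_le_integral_norm _).trans ?_
    change _ ≤ 2 * ‖g‖ * (∫ y, ‖ρ y * (‖y‖ : ℝ)‖) * dist K L
    rw [mul_right_comm, ← integral_const_mul]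
    refine integral_mono ((hi K).sub (hi L)).norm (i1.norm.const_mul _) fun y => ?_
    have h1 := abs_supp_sub_le K L (g y)
    have h2 := abs_supp_sub_le K L (-g y)
    have h3 : dist K L * ‖g y‖ ≤ dist K L * (‖g‖ * ‖y‖) :=
      mul_le_mul_of_nonneg_left (g.le_opNorm y) dist_nonneg
    rw [norm_neg] at h2
    simp only
    rw [← mul_sub, ← Complex.ofReal_sub, norm_mul, norm_mul, Complex.norm_real, Complex.norm_real,
      norm_norm, Real.norm_eq_abs, show supp K (g y) + supp K (-g y) - (supp L (g y) +
        supp L (-g y)) = (supp K (g y) - supp L (g y)) + (supp K (-g y) - supp L (-g y)) by ring]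
    calc _ ≤ ‖ρ y‖ * (2 * (dist K L * (‖g‖ * ‖y‖))) := by
          refine mul_le_mul_of_nonneg_left ((abs_add_le _ _).trans ?_) (norm_nonneg _)
          linarith
      _ = _ := by ring

/-- An even valuation of degree two has differences that are Minkowski additive with the density
of its kernel. -/
theorem IsVal.D_eq_evenLin [MeasurableSpace E] [BorelSpace E] {μ : ConvexBody E → ℂ} (hμ : IsVal μ)
    (he : ∀ K, μ (rev K) = μ K) (h2 : ∀ l : List E, l.length ≠ 2 → CVal.DL l μ 0 = 0) {v : E}
    (h : ∀ x, D x (D v μ) 0 = ∫ y, ρ y * (|inner ℝ (g y) x| : ℝ)) : D v μ = evenLin ρ g := by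
  refine sub_eq_zero.1 (IsVal.eq_zero_of_DL ((hμ.diff v).sub (isVal_evenLin ρ g)) ?_ ?_)
  · intro K
    simp only [Pi.sub_apply, even_D hμ he, evenLin_rev]
  · intro l
    have hz : ∀ x, D x (evenLin ρ g) = fun _ => evenLin ρ g (seg x) := fun x => by
      funext K; rw [D, evenLin_add]; ring
    have h0 : evenLin ρ g 0 = 0 := by
      have := evenLin_pt ρ g (0 : E)
      rwa [pt_zero] at this
    change CVal.DL l (fun K => D v μ K - evenLin ρ g K) 0 = 0
    rw [DL_sub]
    have e1 : CVal.DL l (D v μ) = CVal.DL (l ++ [v]) μ := by rw [DL_append]; rfl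
    rw [e1]
    match l with
    | [] => simpa [DL_nil, h0] using h2 [v] (by simp)
    | [x] =>
      change D x (D v μ) 0 - D x (evenLin ρ g) 0 = 0
      rw [h, hz, evenLin_seg, sub_self]
    | x :: y :: l =>
      have e2 : CVal.DL (x :: y :: l) (evenLin ρ g) 0 = 0 := by
        have hp : (x :: y :: l).Perm (l ++ [x, y]) := by
          have := List.perm_append_comm (l₁ := [x, y]) (l₂ := l)
          simpa using this
        rw [DL_perm hp, DL_append]
        change CVal.DL l (D x (D y (evenLin ρ g))) 0 = 0
        rw [hz y, show D x (fun _ : ConvexBody E => evenLin ρ g (seg y)) = fun _ => 0 by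
          funext K; simp [D]]
        have := DL_const_mul l 0 (fun _ : ConvexBody E => (0 : ℂ))
        simp only [zero_mul] at this
        rw [this]
      change CVal.DL (x :: y :: l ++ [v]) μ 0 - CVal.DL (x :: y :: l) (evenLin ρ g) 0 = 0
      rw [e2, sub_zero]
      exact h2 _ (by simp)

end Supp

end

section

/-! ### Valuations on the quaternions invariant under left multiplication -/

section Quat

open scoped Quaternion

instance : MeasurableSpace ℍ[ℝ] := borel _

instance : BorelSpace ℍ[ℝ] := ⟨rfl⟩

abbrev V3 := EuclideanSpace ℝ (Fin 3)

def lmul (q : ℍ[ℝ]) : ℍ[ℝ] →L[ℝ] ℍ[ℝ] := ContinuousLinearMap.mul ℝ ℍ[ℝ] q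

def rmul (q : ℍ[ℝ]) : ℍ[ℝ] →L[ℝ] ℍ[ℝ] := (ContinuousLinearMap.mul ℝ ℍ[ℝ]).flip q

theorem lmul_apply (q x : ℍ[ℝ]) : lmul q x = q * x := rfl

theorem rmul_apply (q x : ℍ[ℝ]) : rmul q x = x * q := rfl

theorem continuous_rmul : Continuous rmul := (ContinuousLinearMap.mul ℝ ℍ[ℝ]).flip.continuous

theorem norm_sq_quat (q : ℍ[ℝ]) : ‖q‖ ^ 2 = q.re ^ 2 + q.imI ^ 2 + q.imJ ^ 2 + q.imK ^ 2 := by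
  rw [sq, ← Quaternion.normSq_eq_norm_mul_self, Quaternion.normSq_def']

theorem inner_quat (p q : ℍ[ℝ]) :
    inner ℝ p q = p.re * q.re + p.imI * q.imI + p.imJ * q.imJ + p.imK * q.imK := by
  rw [Quaternion.inner_def]
  simp

theorem norm_sq_V3 (m : V3) : ‖m‖ ^ 2 = m 0 ^ 2 + m 1 ^ 2 + m 2 ^ 2 := by
  rw [EuclideanSpace.norm_sq_eq, Fin.sum_univ_three]
  simp

theorem inner_V3 (m n : V3) : inner ℝ m n = m 0 * n 0 + m 1 * n 1 + m 2 * n 2 := by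
  rw [PiLp.inner_apply, Fin.sum_univ_three]
  simp [mul_comm]

/-- The purely imaginary quaternions. -/
def imq : V3 →L[ℝ] ℍ[ℝ] := LinearMap.toContinuousLinearMap
  { toFun := fun m => ⟨0, m 0, m 1, m 2⟩
    map_add' := fun _ _ => Quaternion.ext _ _ (add_zero (0 : ℝ)).symm rfl rfl rfl
    map_smul' := fun t _ => Quaternion.ext _ _ (mul_zero t).symm rfl rfl rfl }

@[simp] theorem re_imq (m : V3) : (imq m).re = 0 := rfl
@[simp] theorem imI_imq (m : V3) : (imq m).imI = m 0 := rfl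
@[simp] theorem imJ_imq (m : V3) : (imq m).imJ = m 1 := rfl
@[simp] theorem imK_imq (m : V3) : (imq m).imK = m 2 := rfl

/-- The imaginary part of a quaternion. -/
def imv : ℍ[ℝ] →L[ℝ] V3 := LinearMap.toContinuousLinearMap
  { toFun := fun q => !₂[q.imI, q.imJ, q.imK]
    map_add' := fun p q => by ext i; fin_cases i <;> simp
    map_smul' := fun t m => by ext i; fin_cases i <;> simp }

@[simp] theorem imv_zero (q : ℍ[ℝ]) : imv q 0 = q.imI := rfl
@[simp] theorem imv_one (q : ℍ[ℝ]) : imv q 1 = q.imJ := rfl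
@[simp] theorem imv_two (q : ℍ[ℝ]) : imv q 2 = q.imK := rfl

theorem imv_imq (m : V3) : imv (imq m) = m := by
  ext i; fin_cases i <;> simp

theorem eq_re_add_imq (q : ℍ[ℝ]) : q = imq (imv q) + q.re • 1 := by
  ext <;> simp

theorem norm_imq (m : V3) : ‖imq m‖ = ‖m‖ := by
  rw [← sq_eq_sq₀ (norm_nonneg _) (norm_nonneg _), norm_sq_quat, norm_sq_V3]
  simp

theorem norm_imv_sq (q : ℍ[ℝ]) : ‖imv q‖ ^ 2 = ‖q‖ ^ 2 - q.re ^ 2 := by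
  rw [norm_sq_quat, norm_sq_V3]
  simp
  ring

theorem inner_imq (m : V3) (q : ℍ[ℝ]) : inner ℝ (imq m) q = inner ℝ m (imv q) := by
  rw [inner_quat, inner_V3]
  simp

theorem inner_mul_left_quat (v p q : ℍ[ℝ]) : inner ℝ (v * p) q = inner ℝ p (star v * q) := by
  rw [inner_quat, inner_quat]
  simp
  ring

variable {ν : ConvexBody ℍ[ℝ] → ℂ}

/-- The mixed second difference of `ν` at `1` and `x`. -/
def quatFun (ν : ConvexBody ℍ[ℝ] → ℂ) (x : ℍ[ℝ]) : ℂ := D x (D 1 ν) 0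

theorem IsVal.continuous_quatFun (hν : IsVal ν) : Continuous (quatFun ν) :=
  (hν.diff 1).continuous_D 0

theorem IsVal.quatFun_smul (hν : IsVal ν) (t : ℝ) (x : ℍ[ℝ]) :
    quatFun ν (t • x) = ((|t| : ℝ) : ℂ) * quatFun ν x := by
  rw [quatFun, (hν.diff 1).D_smul]; rfl

theorem IsVal.quatFun_imv (hν : IsVal ν) (x : ℍ[ℝ]) : quatFun ν (imq (imv x)) = quatFun ν x := by
  conv_rhs => rw [eq_re_add_imq x, quatFun, hν.D_shear]
  rfl

variable (hinv : ∀ g : ℍ[ℝ], ‖g‖ = 1 → ∀ K, ν (lmap (lmul g) K) = ν K)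

include hinv

theorem DL_lmul {g : ℍ[ℝ]} (hg : ‖g‖ = 1) (l : List ℍ[ℝ]) :
    DL (l.map (g * ·)) ν 0 = DL l ν 0 := by
  have h := DL_lmap (lmul g) l ν 0
  rw [show (fun K => ν (lmap (lmul g) K)) = ν from funext (hinv g hg), lmap_zero] at h
  exact h.symm

theorem rev_of_lmul (K : ConvexBody ℍ[ℝ]) : ν (rev K) = ν K := by
  rw [← hinv (-1) (by simp) K]
  congr 1
  apply body_ext
  intro x
  simp only [mem_rev, mem_lmap, lmul_apply]
  exact ⟨fun h => ⟨_, h, by simp⟩, by rintro ⟨y, hy, rfl⟩; simpa using hy⟩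

theorem IsVal.D_D_quat (hν : IsVal ν) (x y : ℍ[ℝ]) : D y (D x ν) 0 = quatFun ν (star x * y) := by
  by_cases hx : x = 0
  · subst hx
    rw [D_zero_left, star_zero, zero_mul, quatFun, D_zero_left]
    simp [D]
  have hn : ‖x‖ ≠ 0 := norm_ne_zero_iff.2 hx
  have hg : ‖‖x‖⁻¹ • star x‖ = 1 := by
    rw [norm_smul, norm_inv, norm_norm, Quaternion.norm_star, inv_mul_cancel₀ hn]
  have h := DL_lmul hinv hg [y, x]
  simp only [List.map_cons, List.map_nil] at h
  change D _ (D _ ν) 0 = D y (D x ν) 0 at h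
  have h1 : (‖x‖⁻¹ • star x) * x = ‖x‖ • (1 : ℍ[ℝ]) := by
    rw [smul_mul_assoc, Quaternion.star_mul_self, Quaternion.normSq_eq_norm_mul_self]
    ext <;> simp [hn]
  rw [← h, h1, smul_mul_assoc, hν.D_smul_of_nonneg _ (norm_nonneg _), D_const_mul,
    (hν.diff 1).D_smul_of_nonneg _ (inv_nonneg.2 (norm_nonneg _))]
  change (‖x‖ : ℂ) * (((‖x‖⁻¹ : ℝ) : ℂ) * quatFun ν (star x * y)) = _
  rw [← mul_assoc, ← Complex.ofReal_mul, mul_inv_cancel₀ hn, Complex.ofReal_one, one_mul]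

end Quat

end

section QuatSmooth

open scoped Quaternion

variable {ν : ConvexBody ℍ[ℝ] → ℂ}

theorem max_add_max_neg {t N : ℝ} (hN : 0 ≤ N) :
    max N t + max N (-t) - (N + N) = max 0 (|t| - N) := by
  rcases abs_cases t with ⟨h, h'⟩ | ⟨h, h'⟩ <;> rw [h] <;>
    rcases max_cases N t with ⟨h1, h1'⟩ | ⟨h1, h1'⟩ <;>
    rcases max_cases N (-t) with ⟨h2, h2'⟩ | ⟨h2, h2'⟩ <;> rw [h1, h2] <;>
    first
    | (rw [max_eq_left (by linarith)]; linarith)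
    | (rw [max_eq_right (by linarith)]; linarith)

theorem coneKer_eq_quat {s : ℝ} (hs : 0 < s) (n y : V3) (c : ℝ) :
    coneKer s (n, c) y = max ‖imv ((imq n - c • 1) * imq y)‖ (s * ((imq n - c • 1) * imq y).re) +
      max ‖imv ((imq n - c • 1) * imq y)‖ (-(s * ((imq n - c • 1) * imq y).re)) -
      (‖imv ((imq n - c • 1) * imq y)‖ + ‖imv ((imq n - c • 1) * imq y)‖) := by
  have hre : ((imq n - c • 1) * imq y).re = -inner ℝ n y := by
    rw [inner_V3]
    simp
    ring
  have him : ‖imv ((imq n - c • 1) * imq y)‖ =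
      √((‖n‖ ^ 2 + c ^ 2) * ‖y‖ ^ 2 - inner ℝ n y ^ 2) := by
    rw [← Real.sqrt_sq (norm_nonneg _), norm_imv_sq, norm_mul, mul_pow, hre, norm_imq, neg_sq,
      norm_sq_quat, norm_sq_V3 n]
    congr 3
    simp
    ring
  rw [max_add_max_neg (norm_nonneg _), hre, him, abs_mul, abs_of_pos hs, abs_neg]
  rfl

variable (hν : IsVal ν) (hinv : ∀ g : ℍ[ℝ], ‖g‖ = 1 → ∀ K, ν (lmap (lmul g) K) = ν K)

include hν hinv

/-- The parallelogram law for smooth left-invariant valuations of degree two. -/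
theorem IsVal.quat_parallelogram (h2 : ∀ l : List ℍ[ℝ], l.length ≠ 2 → CVal.DL l ν 0 = 0)
    (hsm : ContDiffOn ℝ ∞ (fun m => quatFun ν (imq m)) {0}ᶜ) (a b : V3) :
    (‖a + b‖ : ℂ) * quatFun ν (imq (a + b)) + ‖a - b‖ * quatFun ν (imq (a - b)) =
      2 * (‖a‖ * quatFun ν (imq a)) + 2 * (‖b‖ * quatFun ν (imq b)) := by
  have he := rev_of_lmul hinv
  have hneg : ∀ m : V3, quatFun ν (imq (-m)) = quatFun ν (imq m) := fun m => by
    have := hν.quatFun_smul (-1) (imq m)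
    rwa [abs_neg, abs_one, Complex.ofReal_one, one_mul, ← map_smul, neg_one_smul] at this
  obtain ⟨ρ, hρ⟩ := exists_abs_transform hneg (fun t ht v => by
    rw [map_smul, hν.quatFun_smul, abs_of_nonneg ht]) hsm
  refine parallelogram_of_cone (f := fun m => quatFun ν (imq m)) ρ
    (fun x => hρ x) (fun s hs => ?_) a b
  have hD : ∀ v, D v ν = evenLin ρ ((lmul v).comp imq) := by
    intro v
    refine hν.D_eq_evenLin ρ _ he h2 fun x => ?_
    rw [hν.D_D_quat hinv, ← hν.quatFun_imv, hρ]
    simp only [ContinuousLinearMap.comp_apply, lmul_apply, inner_mul_left_quat, inner_imq]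
  obtain ⟨K, hK⟩ := exists_body (E := ℍ[ℝ]) (fun w => ‖imv w‖)
    (fun t ht w => by rw [map_smul, norm_smul, Real.norm_eq_abs, abs_of_pos ht])
    (fun v w => by rw [map_add]; exact norm_add_le _ _) (C := ‖imv‖)
    (fun w => by rw [abs_of_nonneg (norm_nonneg _)]; exact imv.le_opNorm w)
  have hG : ∀ (n : V3) (c : ℝ), D (imq n - c • 1) ν (join K (pt (s • 1))) -
      D (imq n - c • 1) ν K = ∫ y, ρ y * coneKer s (n, c) y := by
    intro n c
    rw [hD, evenLin, evenLin, ← integral_sub (integrable_evenLin ρ _ _) (integrable_evenLin ρ _ _)]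
    congr 1; ext y
    have h1 : ∀ w : ℍ[ℝ], inner ℝ w (s • (1 : ℍ[ℝ])) = s * w.re := fun w => by
      rw [inner_quat]; simp [mul_comm]
    rw [coneKer_eq_quat hs, ← mul_sub, ← Complex.ofReal_sub]
    simp only [supp_join, hK, supp_pt, h1, ContinuousLinearMap.comp_apply, lmul_apply, map_neg,
      norm_neg, Quaternion.re_neg, mul_neg]
  set T : V3 → ℂ := fun n => ∫ c : ℝ, ∫ y, ρ y * coneKer s (n, c) y with hT
  have hslab : ∀ (R : ℝ) (n : V3), s * ‖n‖ ≤ R → T n = slabInt ν K (s • 1) 1 R (imq n) := by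
    intro R n hR
    simp only [slabInt, hG, hT]
    refine (setIntegral_eq_integral_of_forall_compl_eq_zero fun c hc => ?_).symm
    have hcR : R ≤ |c| := by
      by_contra! h
      exact hc ⟨(abs_lt.1 h).1.le, (abs_lt.1 h).2.le⟩
    simp [coneKer_eq_zero hs.le (w := (n, c)) (hR.trans hcR)]
  have hTc : Continuous T := by
    refine continuous_iff_continuousAt.2 fun n₀ => ?_
    have hc : Continuous fun n : V3 => slabInt ν K (s • 1) 1 (s * (‖n₀‖ + 1)) (imq n) := by
      refine continuous_parametric_integral_of_continuous ?_ isCompact_Icc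
      have h1 := hν.continuous_D (join K (pt (s • 1)))
      have h2 := hν.continuous_D K
      exact (h1.comp (by fun_prop : Continuous fun p : V3 × ℝ => imq p.1 - p.2 • (1 : ℍ[ℝ]))).sub
        (h2.comp (by fun_prop : Continuous fun p : V3 × ℝ => imq p.1 - p.2 • (1 : ℍ[ℝ])))
    refine hc.continuousAt.congr ?_
    filter_upwards [(continuous_norm.tendsto n₀).eventually_lt_const
      (show ‖n₀‖ < ‖n₀‖ + 1 by linarith)] with n hn
    exact (hslab _ n (mul_le_mul_of_nonneg_left hn.le hs.le)).symm
  have hT0 : T 0 = 0 := by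
    simp only [hT]
    simp [coneKer_eq_zero hs.le (w := ((0 : V3), _)) (by simp)]
  have hTn : ∀ b, T (-b) = T b := by
    intro b
    simp only [hT, coneKer, norm_neg, inner_neg_left, abs_neg, neg_sq]
  refine exists_bilin hTc fun a b => ?_
  have key := hν.slabInt_parallelogram (hν.D_D_const he fun l hl => h2 l (by omega)) (K := K)
    (p := s • 1) (u := 1) (R := s * (‖a‖ + ‖b‖) + 1) (a := imq a) (b := imq b) ?_
  · have hab := norm_add_le a b
    have hab' := norm_sub_le a b
    have ha := norm_nonneg a
    have hb := norm_nonneg b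
    have hle : ∀ n : V3, ‖n‖ ≤ ‖a‖ + ‖b‖ → s * ‖n‖ ≤ s * (‖a‖ + ‖b‖) + 1 := fun n hn => by
      have := mul_le_mul_of_nonneg_left hn hs.le
      linarith
    rw [← map_add, ← map_sub, ← map_neg, ← map_zero imq, ← hslab _ _ (hle _ hab),
      ← hslab _ _ (hle _ hab'), ← hslab _ _ (hle 0 (by rw [norm_zero]; positivity)),
      ← hslab _ a (hle _ (by linarith)),
      ← hslab _ b (hle _ (by linarith)), ← hslab _ (-b) (hle _ (by rw [norm_neg]; linarith)),
      hTn, hT0] at key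
    linear_combination key
  · intro w hw h
    have h1 : ∀ t : ℝ, inner ℝ w (t • (1 : ℍ[ℝ])) = t * w.re := fun t => by
      rw [inner_quat]; simp [mul_comm]
    rw [hK, h1] at h
    have hwr : inner ℝ w (1 : ℍ[ℝ]) = w.re := by simpa using h1 1
    have hre : 0 < w.re := by
      refine lt_of_le_of_ne ?_ fun h0 => hw ?_
      · by_contra! h0
        nlinarith [norm_nonneg (imv w)]
      · rw [← h0, mul_zero] at h
        rw [eq_re_add_imq w, ← h0, norm_le_zero_iff.1 h]
        simp
    rw [hwr]
    refine ⟨hre, ?_⟩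
    have hn : ∀ n : V3, ‖n‖ ≤ ‖a‖ + ‖b‖ →
        |inner ℝ w (imq n)| < (s * (‖a‖ + ‖b‖) + 1) * w.re := by
      intro n hn
      rw [real_inner_comm, inner_imq]
      have h3 := abs_real_inner_le_norm n (imv w)
      have h4 : ‖n‖ * ‖imv w‖ ≤ (‖a‖ + ‖b‖) * (s * w.re) :=
        mul_le_mul hn h (norm_nonneg _) (by positivity)
      nlinarith
    have ha := norm_nonneg a
    have hb := norm_nonneg b
    simp only [← map_add, ← map_sub, List.forall_mem_cons, List.not_mem_nil, false_imp_iff,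
      implies_true, and_true]
    exact ⟨hn _ (norm_add_le a b), hn _ (norm_sub_le a b), hn _ (by linarith), hn _ (by linarith)⟩

end QuatSmooth

section QuatGeneral

open scoped Quaternion

variable {ν : ConvexBody ℍ[ℝ] → ℂ}

/-- Averages of `ν` over right multiplications, concentrating at the identity as `j` grows. -/
def rightAvg (ν : ConvexBody ℍ[ℝ] → ℂ) (j : ℕ) (K : ConvexBody ℍ[ℝ]) : ℂ :=
  ∫ q in Metric.closedBall (0 : ℍ[ℝ]) 1, ((1 + q.re : ℝ) : ℂ) ^ j * ν (lmap (rmul q) K)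

theorem continuous_weight (j : ℕ) : Continuous fun q : ℍ[ℝ] => ((1 + q.re : ℝ) : ℂ) ^ j := by
  have := Quaternion.continuous_re
  fun_prop

theorem IsVal.rightAvg (hν : IsVal ν) (j : ℕ) : IsVal (rightAvg ν j) :=
  hν.ball_integral continuous_rmul (continuous_weight j)

theorem IsVal.DL_rightAvg (hν : IsVal ν) (j : ℕ) (l : List ℍ[ℝ]) :
    CVal.DL l (CVal.rightAvg ν j) 0 = ∫ q in Metric.closedBall (0 : ℍ[ℝ]) 1,
      ((1 + q.re : ℝ) : ℂ) ^ j * CVal.DL (l.map (rmul q)) ν 0 := by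
  have h := DL_ball_integral hν continuous_rmul (continuous_weight j) l 0
  simp only [lmap_zero] at h
  exact h

theorem rightAvg_lmul (hinv : ∀ g : ℍ[ℝ], ‖g‖ = 1 → ∀ K, ν (lmap (lmul g) K) = ν K) (j : ℕ)
    (g : ℍ[ℝ]) (hg : ‖g‖ = 1) (K : ConvexBody ℍ[ℝ]) :
    rightAvg ν j (lmap (lmul g) K) = rightAvg ν j K := by
  unfold rightAvg
  congr 1; ext q
  rw [lmap_lmap, show (rmul q).comp (lmul g) = (lmul g).comp (rmul q) by
    ext1 x; simp only [ContinuousLinearMap.comp_apply, rmul_apply, lmul_apply, mul_assoc],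
    ← lmap_lmap, hinv g hg]

theorem IsVal.quatFun_rightAvg (hν : IsVal ν)
    (hinv : ∀ g : ℍ[ℝ], ‖g‖ = 1 → ∀ K, ν (lmap (lmul g) K) = ν K) (j : ℕ) (x : ℍ[ℝ]) :
    quatFun (CVal.rightAvg ν j) x = ∫ q in Metric.closedBall (0 : ℍ[ℝ]) 1,
      ((1 + q.re : ℝ) : ℂ) ^ j * quatFun ν (star q * x * q) := by
  have h := hν.DL_rightAvg j [x, 1]
  change quatFun (CVal.rightAvg ν j) x = _ at h
  rw [h]
  congr 1; ext q
  change _ * D (x * q) (D (1 * q) ν) 0 = _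
  rw [one_mul, hν.D_D_quat hinv, mul_assoc]

/-- Left multiplication by a unit quaternion as an isometry. -/
def lmulIso (p : ℍ[ℝ]) (hp : ‖p‖ = 1) : ℍ[ℝ] ≃ₗᵢ[ℝ] ℍ[ℝ] :=
  LinearIsometryEquiv.ofSurjective ⟨(lmul p : ℍ[ℝ] →ₗ[ℝ] ℍ[ℝ]), fun x => by
    change ‖p * x‖ = ‖x‖; rw [norm_mul, hp, one_mul]⟩ fun y =>
      ⟨p⁻¹ * y, by
        change p * (p⁻¹ * y) = y
        rw [← mul_assoc, mul_inv_cancel₀ (by rintro rfl; simp at hp), one_mul]⟩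

theorem lmulIso_apply (p : ℍ[ℝ]) (hp : ‖p‖ = 1) (x : ℍ[ℝ]) : lmulIso p hp x = p * x := rfl

theorem norm_sq_smul_quat (p x : ℍ[ℝ]) : star p * (p * x) = (‖p‖ ^ 2) • x := by
  rw [← mul_assoc, Quaternion.star_mul_self, Quaternion.normSq_eq_norm_mul_self, ← sq,
    Quaternion.coe_mul_eq_smul]

theorem imq_mul_self (m : V3) : imq m * imq m = -(‖m‖ ^ 2) • 1 := by
  rw [norm_sq_V3]
  ext <;> simp <;> ring

/-- Right averages have a smooth second difference. -/
theorem IsVal.contDiffOn_quatFun_rightAvg (hν : IsVal ν)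
    (hinv : ∀ g : ℍ[ℝ], ‖g‖ = 1 → ∀ K, ν (lmap (lmul g) K) = ν K) (j : ℕ) :
    ContDiffOn ℝ ∞ (fun m => quatFun (CVal.rightAvg ν j) (imq m)) {0}ᶜ := by
  intro m₀ hm₀
  have hm₀ : m₀ ≠ 0 := hm₀
  have hn₀ : ‖m₀‖ ≠ 0 := norm_ne_zero_iff.2 hm₀
  refine ContDiffAt.contDiffWithinAt ?_
  set u : V3 := ‖m₀‖⁻¹ • m₀ with hu
  have hu1 : ‖u‖ = 1 := by rw [hu, norm_smul, norm_inv, norm_norm, inv_mul_cancel₀ hn₀]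
  have huu : imq u * imq u = -1 := by
    rw [imq_mul_self, hu1]; simp
  set P : V3 → ℍ[ℝ] := fun m => ‖m‖ • 1 - imq u * imq m with hP
  have hP0 : P m₀ ≠ 0 := by
    have : P m₀ = (2 * ‖m₀‖) • 1 := by
      simp only [hP, hu, map_smul, smul_mul_assoc, imq_mul_self, neg_smul, smul_neg, smul_smul]
      rw [sub_neg_eq_add, ← add_smul]
      congr 1
      field_simp
      ring
    rw [this]
    exact smul_ne_zero (mul_ne_zero two_ne_zero hn₀) one_ne_zero
  have hPs : ContDiffAt ℝ ∞ P m₀ := by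
    refine ContDiffAt.sub ((contDiffAt_norm ℝ hm₀).smul contDiffAt_const) ?_
    exact ((lmul (imq u)).comp imq).contDiff.contDiffAt
  have hPc : ContinuousAt P m₀ := hPs.continuousAt
  have hPn : ContDiffAt ℝ ∞ (fun m => ‖P m‖⁻¹ • P m) m₀ :=
    ((hPs.norm ℝ hP0).inv (norm_ne_zero_iff.2 hP0)).smul hPs
  have hg : Continuous fun q => quatFun ν (star q * imq u * q) := by
    have := hν.continuous_quatFun
    fun_prop
  have hΦ := (contDiff_ball_integral j hg).contDiffAt (x := ‖P m₀‖⁻¹ • P m₀)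
  have hcomp := ((Complex.ofRealCLM.contDiff.contDiffAt (x := ‖m₀‖)).comp m₀
    (contDiffAt_norm ℝ hm₀)).mul (ContDiffAt.comp m₀ hΦ hPn)
  refine hcomp.congr_of_eventuallyEq ?_
  filter_upwards [hPc.eventually_ne hP0] with m hPm
  simp only [Function.comp_apply]
  set p := ‖P m‖⁻¹ • P m with hp
  have hp1 : ‖p‖ = 1 := by
    rw [hp, norm_smul, norm_inv, norm_norm, inv_mul_cancel₀ (norm_ne_zero_iff.2 hPm)]
  have hcomm : ‖m‖ • (imq u * p) = p * imq m := by
    rw [hp, mul_smul_comm, smul_mul_assoc, smul_comm]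
    congr 1
    simp only [hP, mul_sub, sub_mul, mul_smul_comm, mul_one, smul_mul_assoc, one_mul, ← mul_assoc,
      huu, neg_mul]
    rw [mul_assoc (imq u), imq_mul_self, smul_sub, mul_smul_comm, mul_one, neg_smul, sub_neg_eq_add,
      smul_smul, ← sq, smul_neg, sub_neg_eq_add, add_comm]
  have hx : imq m = ‖m‖ • (star p * (imq u * p)) := by
    rw [← mul_smul_comm, hcomm, norm_sq_smul_quat, hp1]
    simp
  rw [hν.quatFun_rightAvg hinv, ← setIntegral_ball_comp (lmulIso p hp1) (fun q =>
    ((1 + inner ℝ p q : ℝ) : ℂ) ^ j * quatFun ν (star q * imq u * q)), ← integral_const_mul]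
  congr 1; ext q
  have h1 : inner ℝ p (p * q) = q.re := by
    rw [real_inner_comm, inner_mul_left_quat, Quaternion.star_mul_self,
      Quaternion.normSq_eq_norm_mul_self, hp1, inner_quat]
    simp
  have h2 : star q * imq m * q = ‖m‖ • (star (p * q) * imq u * (p * q)) := by
    rw [hx, star_mul, mul_smul_comm, smul_mul_assoc]
    simp only [mul_assoc]
  rw [lmulIso_apply, h1, h2, hν.quatFun_smul, abs_of_nonneg (norm_nonneg _)]
  simp only [Complex.ofRealCLM_apply]
  ring

theorem re_lt_one_of_ne {q : ℍ[ℝ]} (hq : ‖q‖ ≤ 1) (h : q ≠ 1) : q.re < 1 := by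
  have h1 := norm_sq_quat q
  have h2 : ‖q‖ ^ 2 ≤ 1 := by nlinarith [norm_nonneg q]
  by_contra! h3
  refine h (Quaternion.ext _ _ ?_ ?_ ?_ ?_) <;> simp <;>
    nlinarith [sq_nonneg q.imI, sq_nonneg q.imJ, sq_nonneg q.imK]

theorem IsVal.tendsto_quatFun_rightAvg (hν : IsVal ν)
    (hinv : ∀ g : ℍ[ℝ], ‖g‖ = 1 → ∀ K, ν (lmap (lmul g) K) = ν K) (x : ℍ[ℝ]) :
    Tendsto (fun j : ℕ => (∫ q in Metric.closedBall (0 : ℍ[ℝ]) 1, (1 + q.re) ^ j)⁻¹ •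
      quatFun (CVal.rightAvg ν j) x) atTop (𝓝 (quatFun ν x)) := by
  have hre := Quaternion.continuous_re
  have hg : Continuous fun q => quatFun ν (star q * x * q) := by
    have := hν.continuous_quatFun
    fun_prop
  have h := tendsto_setIntegral_pow_smul_of_unique_maximum_of_isCompact_of_continuousOn
    (μ := (volume : Measure ℍ[ℝ])) (isCompact_closedBall (0 : ℍ[ℝ]) 1) (c := fun q => 1 + q.re)
    (x₀ := 1) (g := fun q => quatFun ν (star q * x * q)) (by fun_prop) (fun y hy hne => by
      have := re_lt_one_of_ne (mem_closedBall_zero_iff.1 hy) hne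
      simpa using this)
    (fun y hy => by
      have h1 := norm_sq_quat y
      have h2 := mem_closedBall_zero_iff.1 hy
      nlinarith [norm_nonneg y, sq_nonneg y.imI, sq_nonneg y.imJ, sq_nonneg y.imK])
    (by simp) (by
      rw [interior_closedBall _ one_ne_zero, closure_ball _ one_ne_zero]
      simp) hg.continuousOn
  simp only [star_one, one_mul, mul_one] at h
  refine h.congr fun j => ?_
  rw [hν.quatFun_rightAvg hinv]
  congr 2; ext q
  rw [Complex.real_smul, Complex.ofReal_pow]

/-- The mixed second difference of a left-invariant valuation on the quaternions is quadratic. -/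
theorem IsVal.exists_bilin_quat (hν : IsVal ν)
    (hinv : ∀ g : ℍ[ℝ], ‖g‖ = 1 → ∀ K, ν (lmap (lmul g) K) = ν K) :
    ∃ B : V3 →ₗ[ℝ] V3 →ₗ[ℝ] ℂ, ∀ m, (‖m‖ : ℂ) * quatFun ν (imq m) = B m m := by
  obtain ⟨a, ha⟩ := exists_dilation_weights (d := 4) (k := 2) (by norm_num)
  set ν₂ := CVal.dilSum a ν with hν₂
  have hV := hν.dilSum a
  have hinv2 : ∀ g : ℍ[ℝ], ‖g‖ = 1 → ∀ K, ν₂ (lmap (lmul g) K) = ν₂ K := by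
    intro g hg K
    simp only [hν₂, CVal.dilSum]
    refine Finset.sum_congr rfl fun j _ => ?_
    rw [lmap_lmap, show (dil ((j : ℝ) + 1)).comp (lmul g) = (lmul g).comp (dil ((j : ℝ) + 1)) by
      ext1 x; simp [dil], ← lmap_lmap, hinv g hg]
  have hdim : Module.finrank ℝ ℍ[ℝ] = 4 := Quaternion.finrank_eq_four
  have hDL : ∀ l : List ℍ[ℝ], CVal.DL l ν₂ 0 = (if l.length = 2 then 1 else 0) * CVal.DL l ν 0 := by
    intro l
    by_cases hl : l.length ≤ 4
    · rw [hν.DL_dilSum, ha _ hl]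
    · have h0 : CVal.DL l ν = 0 := hν.DL_eq_zero_of_finrank_lt
        ((Submodule.finrank_le _).trans_lt (by omega))
      rw [hν.DL_dilSum, h0]
      simp
  have h2 : ∀ l : List ℍ[ℝ], l.length ≠ 2 → CVal.DL l ν₂ 0 = 0 := fun l hl => by
    rw [hDL, if_neg hl, zero_mul]
  have hq : ∀ x, quatFun ν₂ x = quatFun ν x := fun x => by
    have := hDL [x, 1]
    rw [if_pos (by simp), one_mul] at this
    exact this
  have hpar : ∀ j (a b : V3), (‖a + b‖ : ℂ) * quatFun (CVal.rightAvg ν₂ j) (imq (a + b)) +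
      ‖a - b‖ * quatFun (CVal.rightAvg ν₂ j) (imq (a - b)) =
      2 * (‖a‖ * quatFun (CVal.rightAvg ν₂ j) (imq a)) +
      2 * (‖b‖ * quatFun (CVal.rightAvg ν₂ j) (imq b)) := by
    intro j
    refine (hV.rightAvg j).quat_parallelogram (rightAvg_lmul hinv2 j) (fun l hl => ?_)
      (hV.contDiffOn_quatFun_rightAvg hinv2 j)
    have hz : ∀ q, CVal.DL (l.map (rmul q)) (CVal.dilSum a ν) 0 = 0 := fun q =>
      h2 _ (by simpa using hl)
    rw [hV.DL_rightAvg]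
    simp only [hz, mul_zero, integral_zero]
  refine exists_bilin (T := fun m => (‖m‖ : ℂ) * quatFun ν (imq m)) ?_ fun a b => ?_
  · have := hν.continuous_quatFun
    fun_prop
  · have ht := fun x : V3 => hV.tendsto_quatFun_rightAvg hinv2 (imq x)
    simp only [← hq]
    refine tendsto_nhds_unique (((ht (a + b)).const_mul _).add ((ht (a - b)).const_mul _))
      (((((ht a).const_mul _).const_mul 2).add (((ht b).const_mul _).const_mul 2)).congr fun j => ?_)
    simp only [mul_smul_comm, ← smul_add]
    rw [hpar]

end QuatGeneral

section SUAction

open scoped Quaternion Matrix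

variable {n : ℕ}

/-- The real linear action of a complex matrix on `ℂⁿ`. -/
def act (g : Matrix (Fin n) (Fin n) ℂ) : Cn n →L[ℝ] Cn n :=
  (LinearMap.toContinuousLinearMap (Matrix.toEuclideanLin g)).restrictScalars ℝ

theorem act_apply (g : Matrix (Fin n) (Fin n) ℂ) (x : Cn n) : act g x = Matrix.toEuclideanLin g x :=
  rfl

theorem act_smul (g : Matrix (Fin n) (Fin n) ℂ) (c : ℂ) (x : Cn n) : act g (c • x) = c • act g x :=
  map_smul (Matrix.toEuclideanLin g) c x

structure IsSU (μ : ConvexBody (Cn n) → ℂ) : Prop where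
  val : IsVal μ
  inv : ∀ g ∈ Matrix.specialUnitaryGroup (Fin n) ℂ, ∀ K, μ (lmap (act g) K) = μ K

theorem mem_suValuations {μ : ConvexBody (Cn n) → ℂ} : μ ∈ SUValuations n ↔ IsSU μ := by
  constructor
  · rintro ⟨h1, h2, h3, h4⟩
    refine ⟨⟨h1, h2, fun x K => h3 x K _ ?_⟩, fun g hg K => h4 g hg K _ (coe_lmap _ _)⟩
    rw [ConvexBody.coe_add]
    ext y
    simp only [Set.mem_add, Set.mem_image]
    constructor
    · rintro ⟨a, ha, b, hb, rfl⟩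
      exact ⟨a, ha, by rw [show b = x from hb, add_comm]⟩
    · rintro ⟨a, ha, rfl⟩
      exact ⟨a, ha, x, rfl, add_comm _ _⟩
  · rintro ⟨h1, h2⟩
    refine ⟨h1.union, h1.cont, fun x K L h => ?_, fun g hg K L h => ?_⟩
    · rw [← h1.trans x K]
      congr 1
      apply ConvexBody.ext
      rw [h, ConvexBody.coe_add]
      ext y
      simp only [Set.mem_add, Set.mem_image]
      constructor
      · rintro ⟨a, ha, rfl⟩
        exact ⟨a, ha, x, rfl, add_comm _ _⟩
      · rintro ⟨a, ha, b, hb, rfl⟩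
        exact ⟨a, ha, by rw [show b = x from hb, add_comm]⟩
    · rw [← h2 g hg K]
      congr 1
      exact ConvexBody.ext (h.trans (coe_lmap (act g) K).symm)

theorem IsSU.DL_map {μ : ConvexBody (Cn n) → ℂ} (hμ : IsSU μ) {g : Matrix (Fin n) (Fin n) ℂ}
    (hg : g ∈ Matrix.specialUnitaryGroup (Fin n) ℂ) (l : List (Cn n)) (K : ConvexBody (Cn n)) :
    DL (l.map (act g)) μ (lmap (act g) K) = DL l μ K := by
  rw [← DL_lmap, show (fun K => μ (lmap (act g) K)) = μ from funext (hμ.inv g hg)]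

theorem IsSU.DL_map_zero {μ : ConvexBody (Cn n) → ℂ} (hμ : IsSU μ) {g : Matrix (Fin n) (Fin n) ℂ}
    (hg : g ∈ Matrix.specialUnitaryGroup (Fin n) ℂ) (l : List (Cn n)) :
    DL (l.map (act g)) μ 0 = DL l μ 0 := by
  have := hμ.DL_map hg l 0
  rwa [lmap_zero] at this

/-- The real linear identification of the quaternions with the complex span of `u` and `w`. -/
def emb (u w : Cn n) : ℍ[ℝ] →L[ℝ] Cn n := LinearMap.toContinuousLinearMap
  { toFun := fun q => ((q.re : ℂ) + q.imI * Complex.I) • u + ((q.imJ : ℂ) - q.imK * Complex.I) • w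
    map_add' := fun p q => by
      simp only [Quaternion.re_add, Quaternion.imI_add, Quaternion.imJ_add, Quaternion.imK_add,
        Complex.ofReal_add]
      module
    map_smul' := fun t q => by
      simp only [Quaternion.re_smul, Quaternion.imI_smul, Quaternion.imJ_smul, Quaternion.imK_smul,
        smul_eq_mul, Complex.ofReal_mul, RingHom.id_apply, ← Complex.coe_smul]
      module }

theorem emb_apply (u w : Cn n) (q : ℍ[ℝ]) : emb u w q =
    ((q.re : ℂ) + q.imI * Complex.I) • u + ((q.imJ : ℂ) - q.imK * Complex.I) • w := rfl

/-- The matrix of left multiplication by a quaternion. -/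
def quatMat (q : ℍ[ℝ]) : Matrix (Fin 2) (Fin 2) ℂ :=
  !![q.re + q.imI * Complex.I, -q.imJ - q.imK * Complex.I;
    q.imJ - q.imK * Complex.I, q.re - q.imI * Complex.I]

theorem quatMat_mul (p q : ℍ[ℝ]) : quatMat (p * q) = quatMat p * quatMat q := by
  ext i j
  fin_cases i <;> fin_cases j <;> simp [quatMat, Matrix.mul_apply] <;> ring_nf <;>
    simp only [Complex.I_sq] <;> ring

theorem quatMat_star (q : ℍ[ℝ]) : quatMat (star q) = (quatMat q)ᴴ := by
  ext i j
  fin_cases i <;> fin_cases j <;> simp [quatMat, Matrix.conjTranspose_apply]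

theorem quatMat_one : quatMat 1 = 1 := by
  ext i j
  fin_cases i <;> fin_cases j <;> simp [quatMat]

theorem det_quatMat (q : ℍ[ℝ]) : (quatMat q).det = ((‖q‖ ^ 2 : ℝ) : ℂ) := by
  rw [norm_sq_quat, quatMat, Matrix.det_fin_two_of]
  push_cast
  ring_nf
  simp only [Complex.I_sq]
  ring

/-- The matrix with columns `u` and `w`. -/
def frameMat (u w : Cn n) : Matrix (Fin n) (Fin 2) ℂ := Matrix.of fun i j => (![u, w] j) i

theorem conjTranspose_frameMat_mulVec (u w x : Cn n) :
    (frameMat u w)ᴴ *ᵥ x.ofLp = ![inner ℂ u x, inner ℂ w x] := by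
  ext i
  fin_cases i <;> simp [frameMat, Matrix.mulVec, EuclideanSpace.inner_eq_star_dotProduct,
    dotProduct, mul_comm]

theorem frameMat_mulVec (u w : Cn n) (z : Fin 2 → ℂ) :
    frameMat u w *ᵥ z = (z 0 • u + z 1 • w).ofLp := by
  ext i
  simp [frameMat, Matrix.mulVec, dotProduct, Fin.sum_univ_two, mul_comm]

theorem conjTranspose_frameMat_mul {u w : Cn n} (hu : ‖u‖ = 1) (hw : ‖w‖ = 1)
    (huw : inner ℂ u w = 0) : (frameMat u w)ᴴ * frameMat u w = 1 := by
  have hwu : inner ℂ w u = 0 := inner_eq_zero_symm.1 huw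
  have h : ∀ j, ((frameMat u w)ᴴ * frameMat u w).col j = (1 : Matrix (Fin 2) (Fin 2) ℂ).col j := by
    intro j
    have e : ((frameMat u w)ᴴ * frameMat u w).col j = (frameMat u w)ᴴ *ᵥ (![u, w] j).ofLp := by
      ext i; rfl
    rw [e, conjTranspose_frameMat_mulVec]
    ext i
    fin_cases j <;> fin_cases i <;>
      simp [huw, hwu, inner_self_eq_norm_sq_to_K, hu, hw]
  ext i j
  exact congrFun (h j) i

/-- The unitary map acting as left multiplication by `g` on the span of `u` and `w`. -/
def suQuat (u w : Cn n) (g : ℍ[ℝ]) : Matrix (Fin n) (Fin n) ℂ :=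
  1 + frameMat u w * ((quatMat g - 1) * (frameMat u w)ᴴ)

theorem act_suQuat (u w : Cn n) (g : ℍ[ℝ]) (x : Cn n) : act (suQuat u w g) x =
    x + WithLp.toLp 2 (frameMat u w *ᵥ ((quatMat g - 1) *ᵥ ![inner ℂ u x, inner ℂ w x])) := by
  rw [act_apply, Matrix.toLpLin_apply, suQuat, Matrix.add_mulVec, Matrix.one_mulVec,
    ← Matrix.mulVec_mulVec, ← Matrix.mulVec_mulVec, conjTranspose_frameMat_mulVec]
  rfl

theorem act_suQuat_of_orth {u w x : Cn n} (hu : inner ℂ u x = 0) (hw : inner ℂ w x = 0)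
    (g : ℍ[ℝ]) : act (suQuat u w g) x = x := by
  rw [act_suQuat, hu, hw, show (![0, 0] : Fin 2 → ℂ) = 0 by ext i; fin_cases i <;> rfl]
  simp

variable {u w : Cn n} (hu : ‖u‖ = 1) (hw : ‖w‖ = 1) (huw : inner ℂ u w = 0)

include hu hw huw

theorem suQuat_mul (g h : ℍ[ℝ]) : suQuat u w g * suQuat u w h = suQuat u w (g * h) := by
  have h1 := conjTranspose_frameMat_mul hu hw huw
  have h2 : frameMat u w * ((quatMat g - 1) * (frameMat u w)ᴴ) * (frameMat u w *
      ((quatMat h - 1) * (frameMat u w)ᴴ)) = frameMat u w * ((quatMat g - 1) * (quatMat h - 1) *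
        (frameMat u w)ᴴ) := by
    rw [Matrix.mul_assoc (frameMat u w), Matrix.mul_assoc (quatMat g - 1),
      ← Matrix.mul_assoc _ (frameMat u w), h1, Matrix.one_mul, Matrix.mul_assoc (quatMat g - 1)]
  simp only [suQuat, Matrix.add_mul, Matrix.mul_add, Matrix.one_mul, Matrix.mul_one, h2]
  rw [add_assoc, ← Matrix.mul_add, ← Matrix.mul_add, ← Matrix.add_mul, ← Matrix.add_mul,
    quatMat_mul]
  congr 3
  noncomm_ring

theorem suQuat_mem {g : ℍ[ℝ]} (hg : ‖g‖ = 1) :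
    suQuat u w g ∈ Matrix.specialUnitaryGroup (Fin n) ℂ := by
  rw [Matrix.mem_specialUnitaryGroup_iff, Matrix.mem_unitaryGroup_iff]
  constructor
  · have h1 : star (suQuat u w g) = suQuat u w (star g) := by
      rw [suQuat, suQuat, Matrix.star_eq_conjTranspose, Matrix.conjTranspose_add,
        Matrix.conjTranspose_one, Matrix.conjTranspose_mul, Matrix.conjTranspose_mul,
        Matrix.conjTranspose_conjTranspose, quatMat_star, Matrix.conjTranspose_sub,
        Matrix.conjTranspose_one, Matrix.mul_assoc]
    rw [h1, suQuat_mul hu hw huw, Quaternion.self_mul_star, Quaternion.normSq_eq_norm_mul_self, hg]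
    simp [suQuat, quatMat_one]
  · rw [suQuat, Matrix.det_one_add_mul_comm, Matrix.mul_assoc, conjTranspose_frameMat_mul hu hw huw,
      Matrix.mul_one, add_sub_cancel, det_quatMat, hg]
    simp

theorem act_suQuat_emb (g q : ℍ[ℝ]) : act (suQuat u w g) (emb u w q) = emb u w (g * q) := by
  have hwu : inner ℂ w u = 0 := inner_eq_zero_symm.1 huw
  have h1 : inner ℂ u (emb u w q) = (q.re : ℂ) + q.imI * Complex.I := by
    rw [emb_apply, inner_add_right, inner_smul_right, inner_smul_right, huw,
      inner_self_eq_norm_sq_to_K, hu]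
    simp
  have h2 : inner ℂ w (emb u w q) = (q.imJ : ℂ) - q.imK * Complex.I := by
    rw [emb_apply, inner_add_right, inner_smul_right, inner_smul_right, hwu,
      inner_self_eq_norm_sq_to_K, hw]
    simp
  rw [act_suQuat, h1, h2, frameMat_mulVec, emb_apply, emb_apply]
  simp only [quatMat, Matrix.sub_mulVec, Matrix.one_mulVec, WithLp.toLp_ofLp]
  rw [add_add_add_comm, ← add_smul, ← add_smul]
  congr 2 <;> simp <;> ring_nf <;> simp only [Complex.I_sq] <;> ring

/-- Second differences in a complex plane are quadratic. -/
theorem IsSU.exists_bilin {μ : ConvexBody (Cn n) → ℂ} (hμ : IsSU μ) {l : List (Cn n)}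
    (hlu : ∀ x ∈ l, inner ℂ u x = 0) (hlw : ∀ x ∈ l, inner ℂ w x = 0) :
    ∃ B : V3 →ₗ[ℝ] V3 →ₗ[ℝ] ℂ, ∀ m,
      (‖m‖ : ℂ) * DL (emb u w (imq m) :: u :: l) μ 0 = B m m := by
  have hν : IsVal fun K => DL l μ (lmap (emb u w) K) := (hμ.val.DL l).comp_lmap _
  obtain ⟨B, hB⟩ := hν.exists_bilin_quat fun g hg K => by
    rw [lmap_lmap, show (emb u w).comp (lmul g) = (act (suQuat u w g)).comp (emb u w) by
      ext1 q
      simp only [ContinuousLinearMap.comp_apply, lmul_apply, act_suQuat_emb hu hw huw],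
      ← lmap_lmap]
    rw [← hμ.DL_map (suQuat_mem hu hw huw hg) l (lmap (emb u w) K)]
    congr 1
    symm
    refine (List.map_congr_left fun x hx => ?_).trans (List.map_id l)
    exact act_suQuat_of_orth (hlu x hx) (hlw x hx) g
  refine ⟨B, fun m => ?_⟩
  rw [← hB]
  have h := DL_lmap (emb u w) [imq m, 1] (DL l μ) 0
  rw [lmap_zero, ← DL_append] at h
  have h1 : emb u w 1 = u := by simp [emb_apply]
  simp only [List.map_cons, List.map_nil, h1, List.cons_append, List.nil_append] at h
  rw [← h]
  rfl

end SUAction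

section Frames

variable {n : ℕ}

/-- Lists of Hermitian orthonormal vectors. -/
def ON (l : List (Cn n)) : Prop := (∀ x ∈ l, ‖x‖ = 1) ∧ l.Pairwise fun x y => inner ℂ x y = 0

theorem ON.perm {l l' : List (Cn n)} (h : ON l) (hp : l.Perm l') : ON l' :=
  ⟨fun x hx => h.1 x (hp.mem_iff.2 hx),
    (hp.pairwise_iff fun hxy => inner_eq_zero_symm.1 hxy).1 h.2⟩

theorem on_cons {v : Cn n} {l : List (Cn n)} :
    ON (v :: l) ↔ ‖v‖ = 1 ∧ (∀ x ∈ l, inner ℂ v x = 0) ∧ ON l := by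
  simp only [ON, List.forall_mem_cons, List.pairwise_cons]
  tauto

theorem on_append {l l' : List (Cn n)} :
    ON (l ++ l') ↔ ON l ∧ ON l' ∧ ∀ x ∈ l, ∀ y ∈ l', inner ℂ x y = 0 := by
  simp only [ON, List.forall_mem_append, List.pairwise_append]
  tauto

theorem ON.orthonormal {l : List (Cn n)} (h : ON l) : Orthonormal ℂ l.get := by
  refine ⟨fun i => h.1 _ (l.get_mem i), fun i j hij => ?_⟩
  rcases lt_or_gt_of_ne hij with hlt | hlt
  · exact List.pairwise_iff_get.1 h.2 i j hlt
  · exact inner_eq_zero_symm.1 (List.pairwise_iff_get.1 h.2 j i hlt)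

theorem ON.length_le {l : List (Cn n)} (h : ON l) : l.length ≤ n := by
  simpa using h.orthonormal.linearIndependent.fintype_card_le_finrank

theorem exists_unit_orthogonal {l : List (Cn n)} (h : l.length < n) :
    ∃ v : Cn n, ‖v‖ = 1 ∧ ∀ x ∈ l, inner ℂ v x = 0 := by
  classical
  set W := Submodule.span ℂ (l.toFinset : Set (Cn n)) with hW
  have h1 : Module.finrank ℂ W < Module.finrank ℂ (Cn n) := by
    rw [finrank_euclideanSpace_fin]
    exact ((finrank_span_finset_le_card _).trans l.toFinset_card_le).trans_lt h
  have h2 : Wᗮ ≠ ⊥ := fun h0 => by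
    rw [Submodule.orthogonal_eq_bot_iff] at h0
    rw [h0, finrank_top] at h1
    exact lt_irrefl _ h1
  obtain ⟨v, hv, hv0⟩ := Submodule.exists_mem_ne_zero_of_ne_bot h2
  refine ⟨((‖v‖ : ℂ)⁻¹) • v, norm_smul_inv_norm hv0, fun x hx => ?_⟩
  rw [inner_smul_left, (Submodule.mem_orthogonal' W v).1 hv x (Submodule.subset_span (by simpa)),
    mul_zero]

theorem ON.exists_extend {l : List (Cn n)} (h : ON l) : ∃ l', ON (l ++ l') ∧
    (l ++ l').length = n := by
  obtain ⟨k, hk⟩ := Nat.exists_eq_add_of_le h.length_le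
  induction k generalizing l with
  | zero => exact ⟨[], by simpa using h, by simpa using hk.symm⟩
  | succ k ih =>
    obtain ⟨v, hv, hvl⟩ := exists_unit_orthogonal (l := l) (by omega)
    have h' : ON (l ++ [v]) := (on_cons.2 ⟨hv, hvl, h⟩).perm (List.perm_append_singleton v l).symm
    obtain ⟨l', h1, h2⟩ := ih h' (by simp only [List.length_append, List.length_singleton]; omega)
    exact ⟨v :: l', by simpa using h1, by simpa using h2⟩

/-- The standard basis as a list. -/
def std (n : ℕ) : List (Cn n) := List.ofFn fun i => EuclideanSpace.single i 1

theorem length_std : (std n).length = n := List.length_ofFn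

theorem on_std : ON (std n) := by
  refine ⟨fun x hx => ?_, ?_⟩
  · obtain ⟨i, rfl⟩ := (List.mem_ofFn' _ _).1 hx
    exact (PiLp.norm_single 2 (fun _ => ℂ) i (1 : ℂ)).trans norm_one
  · rw [std, List.pairwise_ofFn]
    intro i j hij
    rw [EuclideanSpace.inner_single_left]
    simp [hij.ne]

theorem act_single (U : Matrix (Fin n) (Fin n) ℂ) (j : Fin n) :
    act U (EuclideanSpace.single j 1) = WithLp.toLp 2 (U.col j) := by
  rw [act_apply, Matrix.toLpLin_apply]
  simp

theorem ON.exists_unitary {l : List (Cn n)} (h : ON l) (hl : l.length = n) :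
    ∃ U ∈ Matrix.unitaryGroup (Fin n) ℂ, l = (std n).map (act U) := by
  let b : Fin n → Cn n := fun j => l.get (j.cast hl.symm)
  have hb : Orthonormal ℂ b := h.orthonormal.comp _ (Fin.cast_injective _)
  refine ⟨Matrix.of fun i j => b j i, ?_, ?_⟩
  · rw [Matrix.mem_unitaryGroup_iff']
    ext i j
    have := (orthonormal_iff_ite.1 hb) i j
    rw [Matrix.one_apply, ← this, EuclideanSpace.inner_eq_star_dotProduct]
    simp [Matrix.mul_apply, Matrix.star_apply, dotProduct, mul_comm]
  · refine List.ext_getElem (by simp [std, hl]) fun i h1 h2 => ?_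
    simp only [std, List.getElem_map, List.getElem_ofFn, act_single]
    rfl

/-- `SU(n)` acts transitively on orthonormal bases up to a phase of one vector. -/
theorem ON.exists_phase {l₁ l₂ : List (Cn n)} {v : Cn n} (h : ON (l₁ ++ v :: l₂))
    (hl : (l₁ ++ v :: l₂).length = n) : ∃ θ : ℂ, ‖θ‖ = 1 ∧
      ∃ g ∈ Matrix.specialUnitaryGroup (Fin n) ℂ, l₁ ++ θ • v :: l₂ = (std n).map (act g) := by
  obtain ⟨U, hU, hlU⟩ := h.exists_unitary hl
  have hd := Matrix.det_of_mem_unitary hU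
  have hθ : ‖star U.det‖ = 1 := by rw [norm_star]; exact CStarRing.norm_of_mem_unitary hd
  have h1 : l₁.length < n := by
    simp only [List.length_append, List.length_cons] at hl
    omega
  set j₀ : Fin n := ⟨l₁.length, h1⟩
  set d : Fin n → ℂ := Function.update 1 j₀ (star U.det) with hdd
  refine ⟨star U.det, hθ, U * Matrix.diagonal d, ?_, ?_⟩
  · rw [Matrix.mem_specialUnitaryGroup_iff]
    constructor
    · refine mul_mem hU ?_
      rw [Matrix.mem_unitaryGroup_iff, Matrix.star_eq_conjTranspose, Matrix.diagonal_conjTranspose,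
        Matrix.diagonal_mul_diagonal, ← Matrix.diagonal_one]
      congr 1
      ext i
      by_cases hi : i = j₀
      · subst hi
        simp only [hdd, Pi.star_apply, Function.update_self, star_star]
        exact (Unitary.mem_iff.1 hd).1
      · simp [hdd, hi]
    · rw [Matrix.det_mul, Matrix.det_diagonal, hdd, Finset.prod_update_of_mem (Finset.mem_univ _)]
      simpa using (Unitary.mem_iff.1 hd).2
  · have e : l₁ ++ star U.det • v :: l₂ = (l₁ ++ v :: l₂).set l₁.length (star U.det • v) := by
      simp
    refine List.ext_getElem (by simpa [length_std] using hl) fun i h2 h3 => ?_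
    have hi : i < n := by simpa [length_std] using h3
    have hm : act (U * Matrix.diagonal d) (EuclideanSpace.single ⟨i, hi⟩ 1) =
        d ⟨i, hi⟩ • act U (EuclideanSpace.single ⟨i, hi⟩ 1) := by
      rw [act_single, act_single]
      ext k
      simp [Matrix.mul_diagonal, mul_comm]
    have hli : ∀ hh : i < (l₁ ++ v :: l₂).length, (l₁ ++ v :: l₂)[i] =
        act U (EuclideanSpace.single ⟨i, hi⟩ 1) := by
      intro hh
      simp only [hlU, std, List.getElem_map, List.getElem_ofFn]
    simp only [std, List.getElem_map, List.getElem_ofFn, hm]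
    simp only [e, List.getElem_set]
    by_cases hij : l₁.length = i
    · subst hij
      have hv : (l₁ ++ v :: l₂)[l₁.length] = v := by simp
      rw [if_pos rfl, ← hli (by simp), hv]
      simp [hdd, j₀]
    · have : (⟨i, hi⟩ : Fin n) ≠ j₀ := fun h => hij (congrArg Fin.val h).symm
      rw [if_neg hij, hli]
      simp [hdd, this]

/-- Two spanning vectors of a plane with given Kähler angle and phase. -/
def gv (p : Cn n × Cn n × V3) : List (Cn n) := [emb p.1 p.2.1 (imq p.2.2), p.1]

/-- Real basis of a complex line. -/
def cv (u : Cn n) : List (Cn n) := [Complex.I • u, u]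

def vecs (Gs : List (Cn n × Cn n × V3)) (Cs Rs : List (Cn n)) : List (Cn n) :=
  Gs.flatMap gv ++ (Cs.flatMap cv ++ Rs)

def frame (Gs : List (Cn n × Cn n × V3)) (Cs Rs : List (Cn n)) : List (Cn n) :=
  (Gs.flatMap fun p => [p.1, p.2.1]) ++ (Cs ++ Rs)

theorem real_inner_Cn (x z : Cn n) : inner ℝ x z = (inner ℂ x z).re := by
  simp [PiLp.inner_apply]

theorem real_inner_I_smul (x z : Cn n) : inner ℝ (Complex.I • x) z = (inner ℂ x z).im := by
  rw [real_inner_Cn, inner_smul_left]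
  simp

theorem inner_eq_zero_of_real {x z : Cn n} (h1 : inner ℝ x z = 0)
    (h2 : inner ℝ (Complex.I • x) z = 0) : inner ℂ x z = 0 :=
  Complex.ext ((real_inner_Cn x z).symm.trans h1) ((real_inner_I_smul x z).symm.trans h2)

theorem exists_perp (W : Submodule ℝ (Cn n)) {x : Cn n} (hx : x ∈ W) (hx1 : ‖x‖ = 1) :
    ∃ W' ≤ W, Module.finrank ℝ W' < Module.finrank ℝ W ∧ (∀ z ∈ W', inner ℝ x z = 0) ∧
      ∀ z ∈ W, inner ℝ x z = 0 → z ∈ W' := by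
  refine ⟨W ⊓ LinearMap.ker (innerₛₗ ℝ x), inf_le_left, Submodule.finrank_lt_finrank_of_lt ?_,
    fun z hz => hz.2, fun z hz h => ⟨hz, h⟩⟩
  refine lt_of_le_of_ne inf_le_left fun h => ?_
  rw [← h] at hx
  have h1 : inner ℝ x x = 0 := hx.2
  rw [real_inner_self_eq_norm_sq, hx1] at h1
  norm_num at h1

theorem inner_eq_zero_of_mem_span {s : Set (Cn n)} {x f : Cn n} (h : ∀ z ∈ s, inner ℂ x z = 0)
    (hf : f ∈ Submodule.span ℂ s) : inner ℂ x f = 0 := by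
  induction hf using Submodule.span_induction with
  | mem z hz => exact h z hz
  | zero => exact inner_zero_right _
  | add a b _ _ ha hb => rw [inner_add_right, ha, hb, add_zero]
  | smul c a _ ha => rw [inner_smul_right, ha, mul_zero]

/-- A nonzero real subspace contains a unit eigenvector of the square of the compression of
multiplication by `I`. -/
theorem exists_eigen (W : Submodule ℝ (Cn n)) (hW : W ≠ ⊥) : ∃ x ∈ W, ‖x‖ = 1 ∧
    ((∀ z ∈ W, inner ℝ (Complex.I • x) z = 0) ∨ ∃ y ∈ W, ‖y‖ = 1 ∧ inner ℝ x y = 0 ∧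
      ∃ a b : ℝ, (∀ z ∈ W, inner ℝ (Complex.I • x) z = a * inner ℝ y z) ∧
        ∀ z ∈ W, inner ℝ (Complex.I • y) z = b * inner ℝ x z) := by
  have : Nontrivial W := Submodule.nontrivial_iff_ne_bot.2 hW
  let J : Cn n →ₗ[ℝ] Cn n :=
    { toFun := fun x => Complex.I • x
      map_add' := fun x y => smul_add _ _ _
      map_smul' := fun t x => smul_comm _ _ _ }
  obtain ⟨A, hA⟩ : ∃ A : W →ₗ[ℝ] W, ∀ x z : W,
      inner ℝ (A x) z = inner ℝ (Complex.I • (x : Cn n)) (z : Cn n) :=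
    ⟨W.orthogonalProjectionOnto.toLinearMap ∘ₗ J ∘ₗ W.subtype, fun x z => by
      rw [real_inner_comm, real_inner_comm (z : Cn n)]
      exact Submodule.inner_orthogonalProjectionOnto_eq_of_mem_left z (J x)⟩
  have hskew : ∀ x z : W, inner ℝ (A x) z = -inner ℝ x (A z) := by
    intro x z
    rw [hA, real_inner_comm (A z) x, hA, real_inner_I_smul, real_inner_I_smul,
      ← inner_conj_symm (z : Cn n), Complex.conj_im, neg_neg]
  have hsym : LinearMap.IsSymmetric (𝕜 := ℝ) (E := W) (A ∘ₗ A) := fun x z => by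
    rw [LinearMap.comp_apply, LinearMap.comp_apply, hskew, ← neg_eq_iff_eq_neg.2 (hskew x (A z))]
  obtain ⟨x₀, hx₀⟩ := hsym.hasEigenvalue_iSup_of_finiteDimensional.exists_hasEigenvector
  obtain ⟨lam, hlam⟩ : ∃ lam : ℝ, A (A x₀) = lam • x₀ := ⟨_, hx₀.apply_eq_smul⟩
  have hn0 : ‖x₀‖ ≠ 0 := norm_ne_zero_iff.2 hx₀.2
  set x : W := ‖x₀‖⁻¹ • x₀ with hx
  have hx1 : ‖x‖ = 1 := by rw [hx, norm_smul, norm_inv, norm_norm, inv_mul_cancel₀ hn0]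
  have hAA : A (A x) = lam • x := by rw [hx, map_smul, map_smul, hlam, smul_comm]
  have hsm : ∀ (t : ℝ) (x z : W), inner ℝ (t • x) z = t * inner ℝ x z := fun t x z =>
    real_inner_smul_left (x : Cn n) z t
  refine ⟨x, x.2, hx1, ?_⟩
  by_cases h0 : A x = 0
  · left
    intro z hz
    rw [← hA x ⟨z, hz⟩, h0, inner_zero_left]
  · right
    have hc : ‖A x‖ ≠ 0 := norm_ne_zero_iff.2 h0
    refine ⟨(‖A x‖⁻¹ • A x : W), Subtype.prop _, ?_, ?_, ‖A x‖, ‖A x‖⁻¹ * lam, fun z hz => ?_,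
      fun z hz => ?_⟩
    · rw [← Submodule.coe_norm, norm_smul, norm_inv, norm_norm, inv_mul_cancel₀ hc]
    · have h1 := hskew x x
      rw [real_inner_comm] at h1
      rw [← Submodule.coe_inner, real_inner_comm, hsm, real_inner_comm]
      have : inner ℝ x (A x) = 0 := by linarith
      rw [this, mul_zero]
    · rw [← hA x ⟨z, hz⟩]
      change _ = ‖A x‖ * inner ℝ (‖A x‖⁻¹ • A x) (⟨z, hz⟩ : W)
      rw [hsm, mul_inv_cancel_left₀ hc]
    · rw [← hA _ ⟨z, hz⟩, map_smul, hAA, smul_smul, hsm]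
      rfl

theorem frame_cons_spare (Gs : List (Cn n × Cn n × V3)) (Cs Rs : List (Cn n)) (x : Cn n) :
    (frame Gs Cs (x :: Rs)).Perm (x :: frame Gs Cs Rs) := by
  rw [frame, frame, ← List.append_assoc, ← List.append_assoc]
  exact List.perm_middle

theorem frame_cons_complex (Gs : List (Cn n × Cn n × V3)) (Cs Rs : List (Cn n)) (x : Cn n) :
    (frame Gs (x :: Cs) Rs).Perm (x :: frame Gs Cs Rs) := List.perm_middle

theorem vecs_cons_spare (Gs : List (Cn n × Cn n × V3)) (Cs Rs : List (Cn n)) (x : Cn n) :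
    (vecs Gs Cs (x :: Rs)).Perm (x :: vecs Gs Cs Rs) := by
  rw [vecs, vecs, ← List.append_assoc, ← List.append_assoc]
  exact List.perm_middle

theorem vecs_cons_complex (Gs : List (Cn n × Cn n × V3)) (Cs Rs : List (Cn n)) (x : Cn n) :
    (vecs Gs (x :: Cs) Rs).Perm (cv x ++ vecs Gs Cs Rs) := by
  rw [vecs, vecs, List.flatMap_cons, List.append_assoc, ← List.append_assoc _ (cv x),
    ← List.append_assoc (cv x)]
  exact List.perm_append_comm.append_right _

/-- Every real subspace is spanned by vectors in normal form adapted to a Hermitian orthonormal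
frame. -/
theorem exists_normal_form (k : ℕ) (W : Submodule ℝ (Cn n)) (hk : Module.finrank ℝ W = k) :
    ∃ Gs Cs Rs, ON (frame Gs Cs Rs) ∧
      (∀ x ∈ frame Gs Cs Rs, x ∈ Submodule.span ℂ (W : Set (Cn n))) ∧
      (∀ x ∈ W, x ∈ spanL (vecs Gs Cs Rs)) ∧ (vecs Gs Cs Rs).length ≤ k := by
  induction k using Nat.strong_induction_on generalizing W with
  | _ k ih =>
  obtain rfl | hW := eq_or_ne W ⊥
  · refine ⟨[], [], [], ⟨by simp [frame], by simp [frame]⟩, by simp [frame], ?_, by simp [vecs]⟩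
    rintro x hx
    rw [(Submodule.mem_bot ℝ).1 hx]
    exact zero_mem _
  obtain ⟨x, hx, hx1, h⟩ := exists_eigen W hW
  obtain ⟨W₁, hW₁, hlt₁, hxW, hW₁'⟩ := exists_perp W hx hx1
  have hsx : x ∈ Submodule.span ℂ (W : Set (Cn n)) := Submodule.subset_span hx
  rcases h with h | ⟨y, hy, hy1, hxy, a, b, hxa, hyb⟩
  · obtain ⟨Gs, Cs, Rs, h1, h2, h3, h4⟩ := ih _ (hlt₁.trans_eq hk) W₁ rfl
    have ho : ∀ z ∈ frame Gs Cs Rs, inner ℂ x z = 0 := fun z hz => inner_eq_zero_of_mem_span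
      (fun z hz => inner_eq_zero_of_real (hxW z hz) (h z (hW₁ hz))) (h2 z hz)
    refine ⟨Gs, Cs, x :: Rs, (on_cons.2 ⟨hx1, ho, h1⟩).perm (frame_cons_spare _ _ _ _).symm,
      fun z hz => ?_, fun z hz => ?_, ?_⟩
    · rcases List.mem_cons.1 ((frame_cons_spare _ _ _ _).mem_iff.1 hz) with rfl | hz
      · exact hsx
      · exact Submodule.span_mono hW₁ (h2 z hz)
    · rw [spanL_perm (vecs_cons_spare _ _ _ _), mem_spanL_cons]
      refine ⟨inner ℝ x z, z - inner ℝ x z • x, h3 _ (hW₁' _ ?_ ?_), by abel⟩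
      · exact W.sub_mem hz (W.smul_mem _ hx)
      · rw [inner_sub_right, real_inner_smul_right, real_inner_self_eq_norm_sq, hx1]
        ring
    · rw [(vecs_cons_spare _ _ _ _).length_eq, List.length_cons]
      omega
  · have hyx : inner ℝ y x = 0 := (real_inner_comm _ _).trans hxy
    obtain ⟨W₂, hW₂, hlt₂, hyW, hW₂'⟩ := exists_perp W₁ (hW₁' y hy hxy) hy1
    have hsy : y ∈ Submodule.span ℂ (W : Set (Cn n)) := Submodule.subset_span hy
    obtain ⟨Gs, Cs, Rs, h1, h2, h3, h4⟩ := ih _ ((hlt₂.trans hlt₁).trans_eq hk) W₂ rfl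
    have hsW : ∀ z ∈ frame Gs Cs Rs, z ∈ Submodule.span ℂ (W : Set (Cn n)) := fun z hz =>
      Submodule.span_mono (hW₂.trans hW₁) (h2 z hz)
    have hox : ∀ z ∈ frame Gs Cs Rs, inner ℂ x z = 0 := fun z hz => inner_eq_zero_of_mem_span
      (fun z hz => inner_eq_zero_of_real (hxW z (hW₂ hz)) (by
        rw [hxa z (hW₁ (hW₂ hz)), hyW z hz, mul_zero])) (h2 z hz)
    have hoy : ∀ z ∈ frame Gs Cs Rs, inner ℂ y z = 0 := fun z hz => inner_eq_zero_of_mem_span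
      (fun z hz => inner_eq_zero_of_real (hyW z hz) (by
        rw [hyb z (hW₁ (hW₂ hz)), hxW z (hW₂ hz), mul_zero])) (h2 z hz)
    have hdec : ∀ z ∈ W, z ∈ spanL (y :: x :: vecs Gs Cs Rs) := fun z hz => by
      rw [mem_spanL_cons]
      refine ⟨inner ℝ y z, inner ℝ x z • x + (z - inner ℝ x z • x - inner ℝ y z • y),
        mem_spanL_cons.2 ⟨_, _, h3 _ (hW₂' _ (hW₁' _ ?_ ?_) ?_), rfl⟩, by abel⟩
      · exact W.sub_mem (W.sub_mem hz (W.smul_mem _ hx)) (W.smul_mem _ hy)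
      · rw [inner_sub_right, inner_sub_right, real_inner_smul_right, real_inner_smul_right,
          real_inner_self_eq_norm_sq, hx1, hxy]
        ring
      · rw [inner_sub_right, inner_sub_right, real_inner_smul_right, real_inner_smul_right,
          real_inner_self_eq_norm_sq, hy1, hyx]
        ring
    have hixy : inner ℂ x y = a * Complex.I := by
      apply Complex.ext
      · rw [← real_inner_Cn, hxy]; simp
      · rw [← real_inner_I_smul, hxa y hy, real_inner_self_eq_norm_sq, hy1]; simp
    have hxx : inner ℂ x x = 1 := by rw [inner_self_eq_norm_sq_to_K, hx1]; simp
    set w := y - (a * Complex.I) • x with hw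
    have hxw : inner ℂ x w = 0 := by rw [hw, inner_sub_right, inner_smul_right, hixy, hxx]; ring
    have how : ∀ z ∈ frame Gs Cs Rs, inner ℂ w z = 0 := fun z hz => by
      rw [hw, inner_sub_left, inner_smul_left, hox z hz, hoy z hz]; ring
    have hyw : y = (a * Complex.I) • x + w := by rw [hw]; abel
    by_cases hw0 : w = 0
    · rw [hw0, add_zero] at hyw
      have ha : a ≠ 0 := by
        rintro rfl
        rw [hyw] at hy1
        simp at hy1
      have hya : y = a • (Complex.I • x) := by
        rw [hyw, mul_smul, Complex.coe_smul]
      refine ⟨Gs, x :: Cs, Rs, (on_cons.2 ⟨hx1, hox, h1⟩).perm (frame_cons_complex _ _ _ _).symm,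
        fun z hz => ?_, fun z hz => ?_, ?_⟩
      · rcases List.mem_cons.1 ((frame_cons_complex _ _ _ _).mem_iff.1 hz) with rfl | hz
        · exact hsx
        · exact hsW z hz
      · obtain ⟨t, z', hz', rfl⟩ := mem_spanL_cons.1 (hdec z hz)
        rw [spanL_perm (vecs_cons_complex _ _ _ _)]
        exact mem_spanL_cons.2 ⟨t * a, z', hz', by rw [hya, smul_smul]⟩
      · rw [(vecs_cons_complex _ _ _ _).length_eq, List.length_append]
        simp only [cv, List.length_cons, List.length_nil]
        omega
    · have hn : (‖w‖ : ℂ) ≠ 0 := by simpa using hw0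
      have hemb : emb x ((‖w‖ : ℂ)⁻¹ • w) (imq !₂[a, ‖w‖, 0]) = y := by
        rw [emb_apply, smul_smul]
        simp [hn, hyw]
      refine ⟨(x, (‖w‖ : ℂ)⁻¹ • w, !₂[a, ‖w‖, 0]) :: Gs, Cs, Rs, on_cons.2 ⟨hx1, ?_, on_cons.2
        ⟨norm_smul_inv_norm hw0, ?_, h1⟩⟩, ?_, ?_, ?_⟩
      · intro z hz
        rcases List.mem_cons.1 hz with rfl | hz
        · rw [inner_smul_right, hxw, mul_zero]
        · exact hox z hz
      · intro z hz
        rw [inner_smul_left, how z hz, mul_zero]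
      · intro z hz
        rcases List.mem_cons.1 hz with rfl | hz
        · exact hsx
        rcases List.mem_cons.1 hz with rfl | hz
        · exact Submodule.smul_mem _ _ (Submodule.sub_mem _ hsy (Submodule.smul_mem _ _ hsx))
        · exact hsW z hz
      · intro z hz
        change z ∈ spanL (emb x ((‖w‖ : ℂ)⁻¹ • w) (imq !₂[a, ‖w‖, 0]) :: x :: vecs Gs Cs Rs)
        rw [hemb]
        exact hdec z hz
      · change (vecs Gs Cs Rs).length + 1 + 1 ≤ k
        omega

end Frames

section Vanishing

open scoped Quaternion

variable {n : ℕ} {μ : ConvexBody (Cn n) → ℂ}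

theorem IsVal.DL_map_of_neg (hμ : IsVal μ) {f : Cn n → Cn n} {l : List (Cn n)}
    (h : ∀ x ∈ l, f x = x ∨ f x = -x) : CVal.DL (l.map f) μ = CVal.DL l μ := by
  induction l with
  | nil => rfl
  | cons y r ih =>
    rw [List.map_cons, DL_cons, DL_cons, ih fun x hx => h x (List.mem_cons_of_mem _ hx)]
    rcases h y List.mem_cons_self with h | h
    · rw [h]
    · rw [h, (hμ.DL r).D_neg]

theorem IsVal.DL_eq_zero_of_span (hμ : IsVal μ) {l l' : List (Cn n)} (hl : l.length = l'.length)
    (h : ∀ x ∈ l, x ∈ spanL l') (h0 : CVal.DL l' μ 0 = 0) : CVal.DL l μ 0 = 0 := by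
  obtain ⟨c, hc⟩ := hμ.exchange l.length l l' rfl hl.symm h
  rw [hc]
  simp only [h0, mul_zero]

theorem mem_spanL_of_mem {l : List (Cn n)} {x : Cn n} (h : x ∈ l) : x ∈ spanL l :=
  Submodule.subset_span h

/-- It suffices to test on vectors in normal form. -/
theorem IsVal.DL_eq_zero_of_vecs (hμ : IsVal μ)
    (h : ∀ Gs Cs Rs, ON (frame Gs Cs Rs) → CVal.DL (vecs Gs Cs Rs) μ 0 = 0) (l : List (Cn n)) :
    CVal.DL l μ 0 = 0 := by
  by_cases hl : Module.finrank ℝ (spanL l) < l.length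
  · rw [hμ.DL_eq_zero_of_finrank_lt hl]
    rfl
  obtain ⟨Gs, Cs, Rs, h1, -, h3, h4⟩ := exists_normal_form _ (spanL l) rfl
  have h5 : ∀ l : List (Cn n), Module.finrank ℝ (spanL l) ≤ l.length := fun l => by
    classical
    have := finrank_span_finset_le_card (R := ℝ) l.toFinset
    rw [List.coe_toFinset] at this
    exact this.trans l.toFinset_card_le
  have h6 : Module.finrank ℝ (spanL l) ≤ Module.finrank ℝ (spanL (vecs Gs Cs Rs)) :=
    Submodule.finrank_mono h3
  have h7 := h5 l
  have h8 := h5 (vecs Gs Cs Rs)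
  exact hμ.DL_eq_zero_of_span (by omega) (fun x hx => h3 x (mem_spanL_of_mem hx)) (h _ _ _ h1)

theorem inner_emb_eq_zero {y u w : Cn n} (hu : inner ℂ y u = 0) (hw : inner ℂ y w = 0)
    (q : ℍ[ℝ]) : inner ℂ y (emb u w q) = 0 := by
  rw [emb_apply, inner_add_right, inner_smul_right, inner_smul_right, hu, hw, mul_zero, mul_zero,
    add_zero]

theorem act_emb (g : Matrix (Fin n) (Fin n) ℂ) (u w : Cn n) (q : ℍ[ℝ]) :
    act g (emb u w q) = emb (act g u) (act g w) q := by
  rw [emb_apply, emb_apply, map_add, act_smul, act_smul]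

theorem map_act_gv (g : Matrix (Fin n) (Fin n) ℂ) (u w : Cn n) (m : V3) :
    (gv (u, w, m)).map (act g) = gv (act g u, act g w, m) := by
  simp [gv, act_emb]

theorem map_act_cv (g : Matrix (Fin n) (Fin n) ℂ) (u : Cn n) :
    (cv u).map (act g) = cv (act g u) := by
  simp [cv, act_smul]

theorem map_act_flatMap_cv (g : Matrix (Fin n) (Fin n) ℂ) (l : List (Cn n)) :
    (l.flatMap cv).map (act g) = (l.map (act g)).flatMap cv := by
  induction l with
  | nil => rfl
  | cons a l ih => rw [List.flatMap_cons, List.map_append, ih, map_act_cv, List.map_cons,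
      List.flatMap_cons]

theorem orth_flatMap_gv {y : Cn n} {Gs : List (Cn n × Cn n × V3)}
    (h : ∀ x ∈ Gs.flatMap fun p => [p.1, p.2.1], inner ℂ y x = 0) :
    ∀ x ∈ Gs.flatMap gv, inner ℂ y x = 0 := by
  intro x hx
  obtain ⟨p, hp, hx⟩ := List.mem_flatMap.1 hx
  have h1 : inner ℂ y p.1 = 0 := h _ (List.mem_flatMap.2 ⟨p, hp, by simp⟩)
  have h2 : inner ℂ y p.2.1 = 0 := h _ (List.mem_flatMap.2 ⟨p, hp, by simp⟩)
  rcases List.mem_pair.1 hx with rfl | rfl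
  · exact inner_emb_eq_zero h1 h2 _
  · exact h1

theorem orth_vecs {y : Cn n} {Gs Cs Rs} (h : ∀ x ∈ frame Gs Cs Rs, inner ℂ y x = 0) :
    ∀ x ∈ vecs Gs Cs Rs, inner ℂ y x = 0 := by
  simp only [frame, List.forall_mem_append] at h
  simp only [vecs, List.forall_mem_append]
  refine ⟨orth_flatMap_gv h.1, fun x hx => ?_, h.2.2⟩
  obtain ⟨c, hc, hx⟩ := List.mem_flatMap.1 hx
  rcases List.mem_pair.1 hx with rfl | rfl
  · rw [inner_smul_right, h.2.1 c hc, mul_zero]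
  · exact h.2.1 _ hc

theorem quad_eq_zero {B : V3 →ₗ[ℝ] V3 →ₗ[ℝ] ℂ} {a b : V3} (ha : B a a = 0) (hb : B b b = 0)
    {s₀ t₀ : ℝ} (hs : s₀ ≠ 0) (ht : t₀ ≠ 0)
    (hab : B (s₀ • a + t₀ • b) (s₀ • a + t₀ • b) = 0) : B a b + B b a = 0 := by
  simp only [map_add, map_smul, LinearMap.add_apply, LinearMap.smul_apply, ha, hb, smul_zero,
    zero_add, add_zero, smul_smul] at hab
  rw [mul_comm t₀, ← smul_add] at hab
  have := (smul_eq_zero.1 hab).resolve_left (mul_ne_zero hs ht)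
  rwa [add_comm]

theorem V3_eq (m : V3) : m = m 0 • !₂[1, 0, 0] + (m 1 • !₂[0, 1, 0] + m 2 • !₂[0, 0, 1]) := by
  ext i
  fin_cases i <;> simp

theorem gv_zero (u w : Cn n) (m1 m2 : ℝ) :
    gv (u, w, !₂[0, m1, m2]) = [((m1 : ℂ) - m2 * Complex.I) • w, u] := by
  simp [gv, emb_apply]

theorem gv_one (u w : Cn n) : gv (u, w, !₂[1, 0, 0]) = cv u := by
  simp [gv, emb_apply, cv]

theorem norm_real_sub (s t : ℝ) (h : s ^ 2 + t ^ 2 = 1) : ‖(s : ℂ) - t * Complex.I‖ = 1 := by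
  rw [show (s : ℂ) - t * Complex.I = s + ((-t : ℝ) : ℂ) * Complex.I by push_cast; ring,
    Complex.norm_add_mul_I, neg_sq, h, Real.sqrt_one]

/-- The polar part vanishes as soon as all configurations with fewer general planes do. -/
theorem IsSU.slot (hμ : IsSU μ) {u w : Cn n} {Gs Cs Rs m₀}
    (hf : ON (frame ((u, w, m₀) :: Gs) Cs Rs))
    (ih : ∀ Cs Rs, ON (frame Gs Cs Rs) → DL (vecs Gs Cs Rs) μ 0 = 0) :
    ∃ b₁ b₂ : ℂ, ∀ m : V3, (‖m‖ : ℂ) * DL (gv (u, w, m) ++ vecs Gs Cs Rs) μ 0 =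
      m 0 * (m 1 * b₁ + m 2 * b₂) := by
  obtain ⟨hu, h1, h2⟩ := on_cons.1 (show ON (u :: w :: frame Gs Cs Rs) from hf)
  obtain ⟨hw, h3, h4⟩ := on_cons.1 h2
  simp only [List.forall_mem_cons] at h1
  obtain ⟨B, hB⟩ := hμ.exists_bilin hu hw h1.1 (orth_vecs h1.2) (orth_vecs h3)
  have hB' : ∀ m, (‖m‖ : ℂ) * DL (gv (u, w, m) ++ vecs Gs Cs Rs) μ 0 = B m m := hB
  have z0 : B !₂[1, 0, 0] !₂[1, 0, 0] = 0 := by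
    rw [← hB', gv_one, ← DL_perm (vecs_cons_complex _ _ _ _), ih, mul_zero]
    exact (on_cons.2 ⟨hu, h1.2, h4⟩).perm (frame_cons_complex _ _ _ _).symm
  have zr : ∀ s t : ℝ, s ^ 2 + t ^ 2 = 1 → B !₂[0, s, t] !₂[0, s, t] = 0 := by
    intro s t hst
    rw [← hB', gv_zero]
    set θ := (s : ℂ) - t * Complex.I
    have e : (vecs Gs Cs ((θ • w) :: u :: Rs)).Perm ([θ • w, u] ++ vecs Gs Cs Rs) :=
      (vecs_cons_spare _ _ _ _).trans ((vecs_cons_spare _ _ _ _).cons _)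
    rw [← DL_perm e, ih, mul_zero]
    refine ON.perm ?_ (((frame_cons_spare _ _ _ _).cons (θ • w)).symm.trans
      (frame_cons_spare _ _ _ _).symm)
    refine on_cons.2 ⟨by rw [norm_smul, norm_real_sub s t hst, hw, one_mul], ?_,
      on_cons.2 ⟨hu, h1.2, h4⟩⟩
    intro x hx
    rw [inner_smul_left]
    rcases List.mem_cons.1 hx with rfl | hx
    · rw [inner_eq_zero_symm.1 h1.1, mul_zero]
    · rw [h3 x hx, mul_zero]
  have z1 := zr 1 0 (by norm_num)
  have z2 := zr 0 1 (by norm_num)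
  have z12 := quad_eq_zero z1 z2 (s₀ := 3 / 5) (t₀ := 4 / 5) (by norm_num) (by norm_num) (by
    convert zr (3 / 5) (4 / 5) (by norm_num) using 2 <;> (try congr 1) <;>
    · ext i; fin_cases i <;> simp)
  refine ⟨B !₂[1, 0, 0] !₂[0, 1, 0] + B !₂[0, 1, 0] !₂[1, 0, 0],
    B !₂[1, 0, 0] !₂[0, 0, 1] + B !₂[0, 0, 1] !₂[1, 0, 0], fun m => ?_⟩
  rw [hB']
  conv_lhs => rw [V3_eq m]
  simp only [map_add, map_smul, LinearMap.add_apply, LinearMap.smul_apply, z0, z1, z2,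
    Complex.real_smul]
  linear_combination (m 1 * m 2 : ℂ) * z12

/-- A sign change of the angle parameters. -/
theorem IsSU.slot_zero_of_flip (hμ : IsSU μ) {u w v : Cn n} {m : V3} {Gs Cs Rs}
    (hf : ON (frame ((u, w, m) :: Gs) Cs Rs))
    (ih : ∀ Cs Rs, ON (frame Gs Cs Rs) → DL (vecs Gs Cs Rs) μ 0 = 0) (hv : ‖v‖ = 1)
    (hvu : inner ℂ v u = 0) (hvw : inner ℂ v w = 0)
    (hl : ∀ x ∈ vecs Gs Cs Rs, inner ℂ v x = 0 ∨ ∃ c : ℂ, x = c • v) :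
    DL (vecs ((u, w, m) :: Gs) Cs Rs) μ 0 = 0 := by
  obtain ⟨b₁, b₂, hb⟩ := hμ.slot hf ih
  obtain ⟨hu, h1, h2⟩ := on_cons.1 (show ON (u :: w :: frame Gs Cs Rs) from hf)
  obtain ⟨hw, h3, h4⟩ := on_cons.1 h2
  simp only [List.forall_mem_cons] at h1
  have hwv := inner_eq_zero_symm.1 hvw
  have hq : ‖(-1 : ℍ[ℝ])‖ = 1 := by rw [norm_neg, norm_one]
  set g := suQuat w v (-1) with hg
  have hgw : act g w = -w := by
    have h1 : emb w v (1 : ℍ[ℝ]) = w := by simp [emb_apply]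
    have := act_suQuat_emb hw hv hwv (-1) 1
    rwa [mul_one, map_neg, h1] at this
  have hgv : act g v = -v := by
    have h1 : emb w v (imq !₂[0, 1, 0]) = v := by simp [emb_apply]
    have := act_suQuat_emb hw hv hwv (-1) (imq !₂[0, 1, 0])
    rwa [neg_one_mul, map_neg, h1] at this
  have hgu : act g u = u := act_suQuat_of_orth (inner_eq_zero_symm.1 h1.1) hvu _
  have hgl : ∀ x ∈ vecs Gs Cs Rs, act g x = x ∨ act g x = -x := fun x hx => by
    rcases hl x hx with h | ⟨c, rfl⟩
    · exact Or.inl (act_suQuat_of_orth (orth_vecs h3 x hx) h _)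
    · right
      rw [act_smul, hgv, smul_neg]
  have e1 := hμ.DL_map_zero (suQuat_mem hw hv hwv hq) (gv (u, w, m) ++ vecs Gs Cs Rs)
  rw [← hg, List.map_append, map_act_gv, hgu, hgw, DL_append, hμ.val.DL_map_of_neg hgl,
    ← DL_append] at e1
  set m' : V3 := !₂[m 0, -m 1, -m 2] with hm'
  have e2 : gv (u, -w, m) = gv (u, w, m') := by
    simp only [gv, emb_apply, hm']
    congr 2
    simp
    module
  have hn : ‖m'‖ = ‖m‖ := by
    rw [← sq_eq_sq₀ (norm_nonneg _) (norm_nonneg _), norm_sq_V3, norm_sq_V3]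
    simp [hm']
  have h5 := hb m
  have h6 := hb m'
  rw [← e2, e1, hn] at h6
  simp only [hm'] at h6
  simp at h6
  have h7 : (‖m‖ : ℂ) * DL (gv (u, w, m) ++ vecs Gs Cs Rs) μ 0 = 0 := by
    linear_combination h5 / 2 + h6 / 2
  rcases mul_eq_zero.1 h7 with h | h
  · have : m = 0 := by simpa using h
    change DL (emb u w (imq m) :: u :: vecs Gs Cs Rs) μ 0 = 0
    rw [this, map_zero, map_zero, DL_cons, D_zero_left]
    rfl
  · exact h

theorem IsSU.slot_zero (hμ : IsSU μ) {u w : Cn n} {m : V3} {Gs Cs Rs}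
    (hf : ON (frame ((u, w, m) :: Gs) Cs Rs))
    (ih : ∀ Cs Rs, ON (frame Gs Cs Rs) → DL (vecs Gs Cs Rs) μ 0 = 0)
    (h : Cs ++ Rs ≠ [] ∨ (frame ((u, w, m) :: Gs) Cs Rs).length < n) :
    DL (vecs ((u, w, m) :: Gs) Cs Rs) μ 0 = 0 := by
  have h0 : ON (u :: w :: frame Gs Cs Rs) := hf
  rcases h with h | h
  · obtain ⟨v, hv⟩ := List.exists_mem_of_ne_nil _ h
    have hvf : v ∈ frame Gs Cs Rs := List.mem_append_right _ hv
    have hf' := on_append.1 (show ON ((Gs.flatMap fun p => [p.1, p.2.1]) ++ (Cs ++ Rs)) from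
      (on_cons.1 (on_cons.1 h0).2.2).2.2)
    have : Std.Symm fun x y : Cn n => inner ℂ x y = 0 := ⟨fun _ _ => inner_eq_zero_symm.1⟩
    have hcr : ∀ x ∈ Cs ++ Rs, inner ℂ v x = 0 ∨ x = v := fun x hx => by
      by_cases hxv : v = x
      · exact Or.inr hxv.symm
      · exact Or.inl (hf'.2.1.2.forall hv hx hxv)
    refine hμ.slot_zero_of_flip hf ih (v := v) (hf'.2.1.1 v hv)
      (inner_eq_zero_symm.1 ((on_cons.1 h0).2.1 v (List.mem_cons_of_mem _ hvf)))
      (inner_eq_zero_symm.1 ((on_cons.1 (on_cons.1 h0).2.2).2.1 v hvf)) ?_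
    simp only [vecs, List.forall_mem_append]
    refine ⟨fun x hx => Or.inl (orth_flatMap_gv (fun z hz => inner_eq_zero_symm.1
      (hf'.2.2 z hz v hv)) x hx), fun x hx => ?_, fun x hx => ?_⟩
    · obtain ⟨c, hc, hx⟩ := List.mem_flatMap.1 hx
      rcases List.mem_pair.1 hx with rfl | rfl
      · rcases hcr c (List.mem_append_left _ hc) with h | rfl
        · exact Or.inl (by rw [inner_smul_right, h, mul_zero])
        · exact Or.inr ⟨_, rfl⟩
      · rcases hcr x (List.mem_append_left _ hc) with h | rfl
        · exact Or.inl h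
        · exact Or.inr ⟨1, (one_smul _ _).symm⟩
    · rcases hcr x (List.mem_append_right _ hx) with h | rfl
      · exact Or.inl h
      · exact Or.inr ⟨1, (one_smul _ _).symm⟩
  · obtain ⟨v, hv, hvo⟩ := exists_unit_orthogonal h
    exact hμ.slot_zero_of_flip hf ih hv (hvo u List.mem_cons_self)
      (hvo w (List.mem_cons_of_mem _ List.mem_cons_self)) fun x hx => Or.inl (orth_vecs
        (fun z hz => hvo z (List.mem_cons_of_mem _ (List.mem_cons_of_mem _ hz))) x hx)

/-- The configuration of `q` complex lines and `r` further vectors. -/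
def cfg (q r : ℕ) (l : List (Cn n)) : List (Cn n) := vecs [] (l.take q) ((l.drop q).take r)

def pairs : List (Cn n) → List (Cn n × Cn n × V3)
  | a :: b :: l => (a, b, !₂[1, 1, 0]) :: pairs l
  | _ => []

def lagr (m : V3) : List (Cn n) → List (Cn n)
  | a :: b :: l => gv (a, b, m) ++ l
  | _ => []

def quads (m : V3) : List (Cn n) → List (Cn n)
  | a :: b :: l => gv (a, b, m) ++ (pairs l).flatMap gv
  | _ => []

theorem map_cfg (g : Matrix (Fin n) (Fin n) ℂ) (q r : ℕ) (l : List (Cn n)) :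
    (cfg q r l).map (act g) = cfg q r (l.map (act g)) := by
  simp only [cfg, vecs, List.flatMap_nil, List.nil_append, List.map_append, map_act_flatMap_cv,
    List.map_take, List.map_drop]

theorem map_lagr (g : Matrix (Fin n) (Fin n) ℂ) (m : V3) (l : List (Cn n)) :
    (lagr m l).map (act g) = lagr m (l.map (act g)) := by
  match l with
  | [] => rfl
  | [a] => rfl
  | a :: b :: l => simp only [lagr, List.map_cons, List.map_append, map_act_gv]

theorem map_pairs (g : Matrix (Fin n) (Fin n) ℂ) : ∀ l : List (Cn n),
    ((pairs l).flatMap gv).map (act g) = (pairs (l.map (act g))).flatMap gv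
  | [] => rfl
  | [a] => rfl
  | a :: b :: l => by
    simp only [pairs, List.map_cons, List.flatMap_cons, List.map_append, map_act_gv, map_pairs g l]

theorem map_quads (g : Matrix (Fin n) (Fin n) ℂ) (m : V3) (l : List (Cn n)) :
    (quads m l).map (act g) = quads m (l.map (act g)) := by
  match l with
  | [] => rfl
  | [a] => rfl
  | a :: b :: l => simp only [quads, List.map_cons, List.map_append, map_act_gv, map_pairs]

theorem pairs_flatMap {Gs : List (Cn n × Cn n × V3)} (h : ∀ p ∈ Gs, p.2.2 = !₂[1, 1, 0]) :
    pairs (Gs.flatMap fun p => [p.1, p.2.1]) = Gs := by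
  induction Gs with
  | nil => rfl
  | cons p Gs ih =>
    rw [List.forall_mem_cons] at h
    obtain ⟨u, w, m⟩ := p
    obtain rfl : m = _ := h.1
    change (u, w, _) :: pairs (Gs.flatMap fun p => [p.1, p.2.1]) = _
    rw [ih h.2]

theorem exists_phase_param {θ : ℂ} (h : ‖θ‖ = 1) :
    ∃ s t : ℝ, ((s : ℂ) - t * Complex.I) * θ = 1 := by
  refine ⟨θ.re, θ.im, ?_⟩
  have : ((θ.re : ℂ) - θ.im * Complex.I) = (starRingEnd ℂ) θ := by
    apply Complex.ext <;> simp
  rw [this, Complex.conj_mul', h]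
  norm_num

/-- The test functionals vanish. -/
structure TestZero (μ : ConvexBody (Cn n) → ℂ) : Prop where
  cfg : ∀ q r, q + r ≤ n → DL (cfg q r (std n)) μ 0 = 0
  lagr₁ : DL (lagr !₂[0, 0, 1] (std n)) μ 0 = 0
  lagr₂ : DL (lagr !₂[0, 1, 1] (std n)) μ 0 = 0
  quads₁ : DL (quads !₂[1, 1, 0] (std n)) μ 0 = 0
  quads₂ : DL (quads !₂[1, 0, 1] (std n)) μ 0 = 0

theorem mem_spanL_cv {u : Cn n} {θ : ℂ} (h : ‖θ‖ = 1) (c : ℂ) : c • u ∈ spanL (cv (θ • u)) := by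
  have h0 : θ ≠ 0 := fun h0 => by rw [h0, norm_zero] at h; exact zero_ne_one h
  refine mem_spanL_cons.2 ⟨(c * θ⁻¹).im, _, mem_spanL_cons.2
    ⟨(c * θ⁻¹).re, 0, zero_mem _, rfl⟩, ?_⟩
  rw [add_zero, ← Complex.coe_smul, ← Complex.coe_smul, smul_smul, smul_smul, smul_smul, ← add_smul]
  congr 1
  have := Complex.re_add_im (c * θ⁻¹)
  calc c = (c * θ⁻¹) * θ := by field_simp
    _ = _ := by nth_rw 1 [← this]; ring

theorem TestZero.base (hμ : IsSU μ) (h : TestZero μ) (h2 : 2 ≤ n) {Cs Rs : List (Cn n)}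
    (hf : ON (Cs ++ Rs)) : DL (vecs [] Cs Rs) μ 0 = 0 := by
  obtain ⟨S, hS, hSn⟩ := hf.exists_extend
  have hlen : Cs.length + Rs.length ≤ n := by
    simp only [List.length_append] at hSn
    omega
  have key : ∀ g ∈ Matrix.specialUnitaryGroup (Fin n) ℂ, ∀ Cs' Rs' S' : List (Cn n),
      Cs' ++ Rs' ++ S' = (std n).map (act g) → Cs'.length + Rs'.length ≤ n →
      DL (vecs [] Cs' Rs') μ 0 = 0 := by
    intro g hg Cs' Rs' S' he hl
    have e : vecs [] Cs' Rs' = CVal.cfg Cs'.length Rs'.length (Cs' ++ Rs' ++ S') := by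
      simp [CVal.cfg, List.append_assoc]
    rw [e, he, ← map_cfg, hμ.DL_map_zero hg, h.cfg _ _ hl]
  match Cs, S, Rs with
  | c :: Cs, S, Rs =>
    obtain ⟨θ, hθ, g, hg, he⟩ := ON.exists_phase (l₁ := []) hS hSn
    have := key g hg (θ • c :: Cs) Rs S (by simpa using he) hlen
    refine hμ.val.DL_eq_zero_of_span (by simp [vecs, cv]) (fun x hx => ?_) this
    have hx : x ∈ cv c ++ vecs [] Cs Rs := hx
    rw [show vecs [] (θ • c :: Cs) Rs = cv (θ • c) ++ vecs [] Cs Rs from rfl]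
    rcases List.mem_append.1 hx with hx | hx
    · have hx' : x ∈ spanL (cv (θ • c)) := by
        rcases List.mem_pair.1 hx with rfl | rfl
        · exact mem_spanL_cv hθ _
        · simpa using mem_spanL_cv (u := x) hθ 1
      exact Submodule.span_mono (fun z hz => List.mem_append_left _ hz) hx'
    · exact mem_spanL_of_mem (List.mem_append_right _ hx)
  | [], s :: S, Rs =>
    obtain ⟨θ, hθ, g, hg, he⟩ := ON.exists_phase (l₁ := Rs) hS hSn
    exact key g hg [] Rs _ he hlen
  | [], [], [] => simp at hSn; omega
  | [], [], [a] => simp at hSn; omega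
  | [], [], a :: b :: R =>
    rw [List.append_nil] at hS
    obtain ⟨θ, hθ, g, hg, he⟩ := ON.exists_phase (l₁ := [a]) hS (by simpa using hSn)
    have hθ0 : θ ≠ 0 := fun h0 => by rw [h0, norm_zero] at hθ; exact zero_ne_one hθ
    simp only [List.nil_append, List.singleton_append, on_cons, List.forall_mem_cons] at hS he
    obtain ⟨ha, ⟨hab, haR⟩, hb, hbR, hR⟩ := hS
    obtain ⟨B, hB⟩ := hμ.exists_bilin ha (w := θ • b) (by rw [norm_smul, hθ, hb, one_mul])
      (by rw [inner_smul_right, hab, mul_zero]) (l := R) haR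
      (fun x hx => by rw [inner_smul_left, hbR x hx, mul_zero])
    have hB' : ∀ m, (‖m‖ : ℂ) * DL (lagr m ((std n).map (act g))) μ 0 = B m m := fun m => by
      rw [← he]
      exact hB m
    have z1 : B !₂[0, 1, 0] !₂[0, 1, 0] = 0 := by
      rw [← hB', ← he]
      have h5 := key g hg [] (a :: θ • b :: R) [] (by simpa using he) (by simpa using hlen)
      rw [vecs, List.flatMap_nil, List.nil_append, List.flatMap_nil, List.nil_append,
        DL_perm (List.Perm.swap _ _ _)] at h5
      rw [CVal.lagr, gv_zero]
      simp [h5]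
    have z2 : B !₂[0, 0, 1] !₂[0, 0, 1] = 0 := by
      rw [← hB', ← map_lagr, hμ.DL_map_zero hg, h.lagr₁, mul_zero]
    have z12 := quad_eq_zero z1 z2 (s₀ := 1) (t₀ := 1) one_ne_zero one_ne_zero (by
      rw [← hB', ← map_lagr, hμ.DL_map_zero hg]
      convert mul_zero _ 
      convert h.lagr₂ using 3
      ext i; fin_cases i <;> simp)
    obtain ⟨s, t, hst⟩ := exists_phase_param hθ
    have h5 := hB' !₂[0, s, t]
    rw [← he, CVal.lagr, gv_zero, smul_smul, hst, one_smul,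
      show B !₂[0, s, t] !₂[0, s, t] = (s * t : ℂ) * (B !₂[0, 1, 0] !₂[0, 0, 1] +
        B !₂[0, 0, 1] !₂[0, 1, 0]) by
      rw [V3_eq !₂[0, s, t]]
      simp [z1, z2]
      ring, z12, mul_zero] at h5
    have hm : ‖(!₂[0, s, t] : V3)‖ ≠ 0 := by
      rw [norm_ne_zero_iff]
      intro h0
      have hs : s = 0 := congrArg (fun m : V3 => m 1) h0
      have ht : t = 0 := congrArg (fun m : V3 => m 2) h0
      simp [hs, ht] at hst
    rw [show [b, a] ++ R = b :: a :: R from rfl, DL_perm (List.Perm.swap _ _ _)] at h5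
    exact (mul_eq_zero.1 h5).resolve_left (by exact_mod_cast hm)

theorem IsSU.slot_reduce (hμ : IsSU μ) {u w : Cn n} {Gs Cs Rs m₀}
    (hf : ON (frame ((u, w, m₀) :: Gs) Cs Rs))
    (ih : ∀ Cs Rs, ON (frame Gs Cs Rs) → DL (vecs Gs Cs Rs) μ 0 = 0)
    (h₁ : DL (gv (u, w, !₂[1, 1, 0]) ++ vecs Gs Cs Rs) μ 0 = 0)
    (h₂ : DL (gv (u, w, !₂[1, 0, 1]) ++ vecs Gs Cs Rs) μ 0 = 0) (m : V3) :
    DL (gv (u, w, m) ++ vecs Gs Cs Rs) μ 0 = 0 := by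
  obtain ⟨b₁, b₂, hb⟩ := hμ.slot hf ih
  have h3 := hb !₂[1, 1, 0]
  have h4 := hb !₂[1, 0, 1]
  rw [h₁] at h3
  rw [h₂] at h4
  simp at h3 h4
  have h5 := hb m
  rw [← h3, ← h4, mul_zero, mul_zero, add_zero, mul_zero] at h5
  rcases mul_eq_zero.1 h5 with h | h
  · have : m = 0 := by simpa using h
    change DL (emb u w (imq m) :: u :: vecs Gs Cs Rs) μ 0 = 0
    rw [this, map_zero, map_zero, DL_cons, D_zero_left]
    rfl
  · exact h

theorem vecs_perm {Gs Gs' : List (Cn n × Cn n × V3)} (h : Gs.Perm Gs') (Cs Rs : List (Cn n)) :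
    (vecs Gs Cs Rs).Perm (vecs Gs' Cs Rs) := (h.flatMap_right gv).append_right _

theorem frame_perm {Gs Gs' : List (Cn n × Cn n × V3)} (h : Gs.Perm Gs') (Cs Rs : List (Cn n)) :
    (frame Gs Cs Rs).Perm (frame Gs' Cs Rs) := (h.flatMap_right _).append_right _

theorem gv_conj (u w : Cn n) :
    gv (u, w, !₂[1, 0, 1]) = gv (u, (-Complex.I) • w, !₂[1, 1, 0]) := by
  simp [gv, emb_apply]

theorem TestZero.full (hμ : IsSU μ) (h : TestZero μ) {Gs : List (Cn n × Cn n × V3)}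
    (hG : Gs ≠ []) (ih : ∀ Gs' : List (Cn n × Cn n × V3), Gs'.length < Gs.length → ∀ Cs Rs,
      ON (frame Gs' Cs Rs) → DL (vecs Gs' Cs Rs) μ 0 = 0)
    (hf : ON (frame Gs [] [])) (hl : (frame Gs [] []).length = n)
    (h110 : ∀ p ∈ Gs, p.2.2 = !₂[1, 1, 0]) : DL (vecs Gs [] []) μ 0 = 0 := by
  obtain ⟨⟨u, w, m⟩, Gs, rfl⟩ := List.exists_cons_of_ne_nil hG
  rw [List.forall_mem_cons] at h110
  obtain rfl : m = _ := h110.1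
  set F := Gs.flatMap fun p => [p.1, p.2.1]
  have hF : frame Gs [] [] = F := by simp [frame, F]
  obtain ⟨θ, hθ, g, hg, he⟩ := ON.exists_phase (l₁ := [u]) (v := w) (l₂ := frame Gs [] []) hf hl
  have hθ0 : θ ≠ 0 := fun h0 => by rw [h0, norm_zero] at hθ; exact zero_ne_one hθ
  have hq : ∀ m, (quads m (std n)).map (act g) = gv (u, θ • w, m) ++ vecs Gs [] [] := fun m => by
    rw [map_quads, ← he, hF]
    change gv (u, θ • w, m) ++ (pairs F).flatMap gv = _
    rw [pairs_flatMap h110.2]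
    simp [vecs]
  have h1 := h.quads₁
  have h2 := h.quads₂
  rw [← hμ.DL_map_zero hg, hq] at h1 h2
  obtain ⟨hu, h3, h4⟩ := on_cons.1 (show ON (u :: w :: frame Gs [] []) from hf)
  obtain ⟨hw, h5, h6⟩ := on_cons.1 h4
  rw [List.forall_mem_cons] at h3
  have hf' : ON (frame ((u, θ • w, !₂[1, 1, 0]) :: Gs) [] []) := by
    refine on_cons.2 ⟨hu, List.forall_mem_cons.2 ⟨?_, h3.2⟩, on_cons.2 ⟨?_, fun x hx => ?_, h6⟩⟩
    · rw [inner_smul_right, h3.1, mul_zero]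
    · rw [norm_smul, hθ, hw, one_mul]
    · rw [inner_smul_left, h5 x hx, mul_zero]
  obtain ⟨s, t, hst⟩ := exists_phase_param hθ
  have h7 := hμ.slot_reduce hf' (ih Gs (by simp)) h1 h2 !₂[1, s, t]
  have h8 : gv (u, θ • w, !₂[1, s, t]) = gv (u, w, !₂[1, 1, 0]) := by
    simp [gv, emb_apply, smul_smul, hst]
  rw [h8] at h7
  exact h7

theorem TestZero.vanish (hμ : IsSU μ) (h : TestZero μ) (h2 : 2 ≤ n) (k : ℕ) :
    ∀ Gs : List (Cn n × Cn n × V3), Gs.length = k → ∀ Cs Rs, ON (frame Gs Cs Rs) →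
      DL (vecs Gs Cs Rs) μ 0 = 0 := by
  induction k using Nat.strong_induction_on with
  | _ k ih =>
  intro Gs hk Cs Rs hf
  obtain rfl | hG := eq_or_ne Gs []
  · exact h.base hμ h2 hf
  obtain ⟨⟨u, w, m⟩, Gs, rfl⟩ := List.exists_cons_of_ne_nil hG
  have hk' : Gs.length + 1 = k := hk
  by_cases hc : Cs ++ Rs ≠ [] ∨ (frame ((u, w, m) :: Gs) Cs Rs).length < n
  · exact hμ.slot_zero hf (ih _ (by omega) _ rfl) hc
  simp only [not_or, not_not, List.append_eq_nil_iff, not_lt] at hc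
  obtain ⟨⟨rfl, rfl⟩, hc⟩ := hc
  have hl := hf.length_le.antisymm hc
  have key : ∀ A B : List (Cn n × Cn n × V3), (A ++ B).length = k → ON (frame (A ++ B) [] []) →
      (frame (A ++ B) [] []).length = n → (∀ p ∈ B, p.2.2 = !₂[1, 1, 0]) →
      DL (vecs (A ++ B) [] []) μ 0 = 0 := by
    intro A
    induction A with
    | nil =>
      intro B hB h3 h4 h5
      simp only [List.nil_append] at hB h3 h4 ⊢
      exact h.full hμ (by rintro rfl; simp at hB; omega)
        (fun Gs' h' => ih _ (by omega) _ rfl) h3 h4 h5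
    | cons p A ihA =>
      intro B hB h3 h4 h5
      obtain ⟨u, w, m⟩ := p
      have hB' : (A.append B).length + 1 = k := hB
      have e : ∀ u w m, ((u, w, m) :: (A ++ B)).Perm (A ++ (u, w, m) :: B) := fun u w m =>
        List.perm_middle.symm
      have h6 : ∀ w, ON (u :: w :: frame (A ++ B) [] []) →
          DL (gv (u, w, !₂[1, 1, 0]) ++ vecs (A ++ B) [] []) μ 0 = 0 := fun w' hw' => by
        rw [← ihA ((u, w', !₂[1, 1, 0]) :: B) (by rw [← (e _ _ _).length_eq]; exact hB')
          (ON.perm hw' (frame_perm (e u w' !₂[1, 1, 0]) [] []))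
          (by
            rw [← (frame_perm (e u w' !₂[1, 1, 0]) [] []).length_eq]
            exact h4) (List.forall_mem_cons.2 ⟨rfl, h5⟩), ← DL_perm (vecs_perm (e _ _ _) [] [])]
        rfl
      refine hμ.slot_reduce h3 (ih (A.append B).length (by omega) _ rfl) (h6 w h3) ?_ m
      rw [gv_conj]
      apply h6
      obtain ⟨hu, h7, h8⟩ := on_cons.1 (show ON (u :: w :: frame (A ++ B) [] []) from h3)
      obtain ⟨hw, h9, h10⟩ := on_cons.1 h8
      rw [List.forall_mem_cons] at h7
      refine on_cons.2 ⟨hu, List.forall_mem_cons.2 ⟨?_, h7.2⟩, on_cons.2 ⟨?_, fun x hx => ?_, h10⟩⟩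
      · rw [inner_smul_right, h7.1, mul_zero]
      · rw [norm_smul, hw, norm_neg, Complex.norm_I, one_mul]
      · rw [inner_smul_left, h9 x hx, mul_zero]
  have := key ((u, w, m) :: Gs) [] (by simpa using hk) (by simpa using hf) (by simpa using hl)
    (by simp)
  simpa using this

theorem IsSU.even (hn : Even n) (hμ : IsSU μ) (K : ConvexBody (Cn n)) : μ (rev K) = μ K := by
  have h1 : (-1 : Matrix (Fin n) (Fin n) ℂ) ∈ Matrix.specialUnitaryGroup (Fin n) ℂ := by
    rw [Matrix.mem_specialUnitaryGroup_iff, Matrix.mem_unitaryGroup_iff]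
    constructor
    · simp
    · rw [Matrix.det_neg, Matrix.det_one, Fintype.card_fin, hn.neg_one_pow, one_mul]
  rw [← hμ.inv _ h1 K]
  congr 1
  apply congrArg (fun f => lmap f K)
  ext x : 1
  rw [act_apply, Matrix.toLpLin_apply, Matrix.neg_mulVec, Matrix.one_mulVec]
  rfl

theorem IsSU.eq_zero (hμ : IsSU μ) (h2 : 2 ≤ n) (hn : Even n) (h : TestZero μ) : μ = 0 :=
  hμ.val.eq_zero_of_DL (hμ.even hn)
    (hμ.val.DL_eq_zero_of_vecs fun Gs Cs Rs hf => h.vanish hμ h2 _ Gs rfl Cs Rs hf)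

end Vanishing

section

section Oblique

variable {E : Type*} [NormedAddCommGroup E] [InnerProductSpace ℝ E]

/-- `p` is the point of `K` solving the variational inequality `u - B p ∈ N(K, p)`. -/
def IsProj (B : E →L[ℝ] E) (K : ConvexBody E) (u p : E) : Prop :=
  p ∈ K ∧ ∀ q ∈ K, inner ℝ (u - B p) (q - p) ≤ 0

/-- Coercivity of an operator with constant `c`. -/
def Coer (B : E →L[ℝ] E) (c : ℝ) : Prop := 0 < c ∧ ∀ v, c * ‖v‖ ^ 2 ≤ inner ℝ (B v) v

theorem coer_of_norm_lt {B : E →L[ℝ] E} (hB : ‖1 - B‖ < 1) : Coer B (1 - ‖1 - B‖) := by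
  refine ⟨by linarith, fun v => ?_⟩
  have h1 : inner ℝ (B v) v = ‖v‖ ^ 2 - inner ℝ ((1 - B) v) v := by
    simp [inner_sub_left]
  have h2 : inner ℝ ((1 - B) v) v ≤ ‖1 - B‖ * ‖v‖ * ‖v‖ :=
    (real_inner_le_norm _ _).trans (by gcongr; exact (1 - B).le_opNorm v)
  rw [h1]; nlinarith

theorem Coer.norm_le {B : E →L[ℝ] E} {c : ℝ} (h : Coer B c) (v : E) {w : E}
    (hw : inner ℝ (B v) v ≤ inner ℝ w v) : c * ‖v‖ ≤ ‖w‖ := by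
  have h1 := (h.2 v).trans (hw.trans (real_inner_le_norm _ _))
  rcases eq_or_ne v 0 with rfl | hv
  · simp
  · have := norm_pos_iff.2 hv
    nlinarith

theorem IsProj.norm_sq_le {B : E →L[ℝ] E} {c : ℝ} (h : Coer B c) {K L : ConvexBody E}
    {u p q : E} (hp : IsProj B K u p) (hq : IsProj B L u q) :
    c * ‖q - p‖ ^ 2 ≤ (‖u - B p‖ + ‖u - B q‖) * dist K L := by
  obtain ⟨q', hq', hq1⟩ := exists_norm_sub_le K L hp.1
  obtain ⟨p', hp', hp1⟩ := exists_norm_sub_le L K hq.1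
  rw [dist_comm] at hp1
  have e1 : inner ℝ (u - B p) (q - p) ≤ ‖u - B p‖ * dist K L := by
    have : inner ℝ (u - B p) (q - p) = inner ℝ (u - B p) (q - p') + inner ℝ (u - B p) (p' - p) := by
      rw [← inner_add_right]; congr 1; abel
    have := hp.2 p' hp'
    have := (real_inner_le_norm (u - B p) (q - p')).trans
      (mul_le_mul_of_nonneg_left hp1 (norm_nonneg _))
    linarith
  have e2 : inner ℝ (u - B q) (p - q) ≤ ‖u - B q‖ * dist K L := by
    have : inner ℝ (u - B q) (p - q) = inner ℝ (u - B q) (p - q') + inner ℝ (u - B q) (q' - q) := by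
      rw [← inner_add_right]; congr 1; abel
    have := hq.2 q' hq'
    have := (real_inner_le_norm (u - B q) (p - q')).trans
      (mul_le_mul_of_nonneg_left hq1 (norm_nonneg _))
    linarith
  have e3 : inner ℝ (B (q - p)) (q - p)
      = inner ℝ (u - B p) (q - p) + inner ℝ (u - B q) (p - q) := by
    rw [← neg_sub q p, inner_neg_right, ← sub_eq_add_neg, ← inner_sub_left, map_sub]
    congr 1; abel
  have := h.2 (q - p)
  linarith

theorem IsProj.unique {B : E →L[ℝ] E} {c : ℝ} (h : Coer B c) {K : ConvexBody E}
    {u p q : E} (hp : IsProj B K u p) (hq : IsProj B K u q) : q = p := by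
  have := hp.norm_sq_le h hq
  rw [dist_self, mul_zero] at this
  have h2 : ‖q - p‖ ^ 2 = 0 := by have := h.1; have := sq_nonneg ‖q - p‖; nlinarith
  exact sub_eq_zero.1 (norm_eq_zero.1 (by simpa using h2))

theorem Coer.lipschitz {B : E →L[ℝ] E} {c : ℝ} (h : Coer B c) {u v p q : E}
    (e1 : inner ℝ (u - B p) (q - p) ≤ 0) (e2 : inner ℝ (v - B q) (p - q) ≤ 0) :
    c * ‖q - p‖ ≤ ‖v - u‖ := by
  refine h.norm_le _ ?_
  have e3 : inner ℝ (v - u) (q - p) - inner ℝ (B (q - p)) (q - p)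
      = - inner ℝ (u - B p) (q - p) - inner ℝ (v - B q) (p - q) := by
    rw [← neg_sub q p, inner_neg_right, map_sub]
    simp only [inner_sub_left]; ring
  linarith

theorem IsProj.lipschitz {B : E →L[ℝ] E} {c : ℝ} (h : Coer B c) {K : ConvexBody E}
    {u v p q : E} (hp : IsProj B K u p) (hq : IsProj B K v q) : c * ‖q - p‖ ≤ ‖v - u‖ :=
  h.lipschitz (hp.2 q hq.1) (hq.2 p hp.1)

theorem IsProj.of_union {B : E →L[ℝ] E} {c : ℝ} (h : Coer B c) {K L U I : ConvexBody E}
    (hU : (U : Set E) = (K : Set E) ∪ L) (hI : (I : Set E) = (K : Set E) ∩ L) {u p a : E}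
    (hp : IsProj B U u p) (hpK : p ∈ K) (ha : IsProj B L u a) :
    IsProj B K u p ∧ IsProj B I u a := by
  have hKU : ∀ q, q ∈ K ∨ q ∈ L → q ∈ U := fun q hq => by
    change q ∈ (U : Set E); rw [hU]; exact hq
  have hIm : ∀ q, q ∈ I ↔ q ∈ K ∧ q ∈ L := fun q => by
    change q ∈ (I : Set E) ↔ _; rw [hI]; rfl
  refine ⟨⟨hpK, fun q hq => hp.2 q (hKU q (.inl hq))⟩, (hIm a).2 ⟨?_, ha.1⟩,
    fun q hq => ha.2 q ((hIm q).1 hq).2⟩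
  by_contra hn
  obtain ⟨t, -, ht1, hmK, hmL⟩ := exists_mem_inter hU hpK ha.1
  have ht : t < 1 := lt_of_le_of_ne ht1 fun e => hn (by simpa [e] using hmK)
  have h1 := ha.2 _ hmL
  have h2 : (1 - t) • p + t • a - a = (1 - t) • (p - a) := by module
  rw [h2, real_inner_smul_right] at h1
  have h3 := h.lipschitz (hp.2 a (hKU a (.inr ha.1)))
    (nonpos_of_mul_nonpos_right h1 (by linarith))
  rw [sub_self, norm_zero] at h3
  have h4 : ‖a - p‖ = 0 := by have := h.1; have := norm_nonneg (a - p); nlinarith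
  rw [sub_eq_zero.1 (norm_eq_zero.1 h4)] at hn
  exact hn hpK

theorem exists_metric_proj [CompleteSpace E] (K : ConvexBody E) (u : E) :
    ∃ p ∈ K, ∀ q ∈ K, inner ℝ (u - p) (q - p) ≤ 0 := by
  obtain ⟨p, hp, h⟩ := exists_norm_eq_iInf_of_complete_convex K.nonempty
    K.isCompact.isComplete K.convex u
  exact ⟨p, hp, (norm_eq_iInf_iff_real_inner_le_zero K.convex hp).1 h⟩

theorem exists_isProj [CompleteSpace E] {B : E →L[ℝ] E} (hB : ‖1 - B‖ < 1) (K : ConvexBody E)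
    (u : E) : ∃ p, IsProj B K u p := by
  choose P hP hP' using exists_metric_proj K
  have h1 : ∀ x y, ‖P x - P y‖ ≤ ‖x - y‖ := fun x y => by
    have := IsProj.lipschitz (B := 1) (c := 1) ⟨one_pos, fun v => by
      simp⟩ (p := P y) (q := P x) (u := y) (v := x)
      ⟨hP y, hP' y⟩ ⟨hP x, hP' x⟩
    simpa using this
  have hc : ContractingWith ‖1 - B‖₊ fun p => P (p + u - B p) := by
    refine ⟨by exact_mod_cast hB, LipschitzWith.of_dist_le_mul fun x y => ?_⟩
    rw [dist_eq_norm, dist_eq_norm, coe_nnnorm]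
    refine (h1 _ _).trans ?_
    have : x + u - B x - (y + u - B y) = (1 - B) (x - y) := by simp; abel
    rw [this]; exact (1 - B).le_opNorm _
  have := hc.fixedPoint_isFixedPt
  set p := ContractingWith.fixedPoint _ hc
  refine ⟨p, this ▸ hP _, fun q hq => ?_⟩
  have h2 := hP' (p + u - B p) q hq
  rw [show P (p + u - B p) = p from this] at h2
  convert h2 using 2; abel

open Classical in
/-- The solution of the variational inequality. -/
def oproj (B : E →L[ℝ] E) (K : ConvexBody E) (u : E) : E :=
  if h : ∃ p, IsProj B K u p then h.choose else 0

section
variable [CompleteSpace E] {B : E →L[ℝ] E} (hB : ‖1 - B‖ < 1)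
include hB

theorem isProj_proj (K : ConvexBody E) (u : E) : IsProj B K u (oproj B K u) := by
  have h := exists_isProj hB K u
  rw [oproj, dif_pos h]; exact h.choose_spec

theorem IsProj.eq {K : ConvexBody E} {u p : E} (h : IsProj B K u p) : oproj B K u = p :=
  h.unique (coer_of_norm_lt hB) (isProj_proj hB K u)

theorem proj_add_pt (K : ConvexBody E) (x u : E) :
    oproj B (K + pt x) (u + B x) = oproj B K u + x := by
  obtain ⟨h1, h2⟩ := isProj_proj hB K u
  refine IsProj.eq hB ⟨mem_add_pt.2 (by simpa using h1), fun q hq => ?_⟩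
  have := h2 _ (mem_add_pt.1 hq)
  convert this using 2
  · rw [map_add]; abel
  · abel

theorem proj_rev (K : ConvexBody E) (u : E) : oproj B (rev K) (-u) = -oproj B K u := by
  obtain ⟨h1, h2⟩ := isProj_proj hB K u
  refine IsProj.eq hB ⟨mem_rev.2 (by simpa using h1), fun q hq => ?_⟩
  have := h2 _ (mem_rev.1 hq)
  rw [← inner_neg_neg]
  convert this using 2
  · rw [map_neg]; abel
  · abel

theorem proj_union {K L U I : ConvexBody E} (hU : (U : Set E) = (K : Set E) ∪ L)
    (hI : (I : Set E) = (K : Set E) ∩ L) (u : E) (F : E → ℝ) :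
    F (oproj B U u) + F (oproj B I u) = F (oproj B K u) + F (oproj B L u) := by
  have hc := coer_of_norm_lt hB
  have hp := isProj_proj hB U u
  have hm : oproj B U u ∈ (K : Set E) ∪ L := hU ▸ hp.1
  rcases hm with hm | hm
  · obtain ⟨h1, h2⟩ := hp.of_union hc hU hI hm (isProj_proj hB L u)
    rw [h1.eq hB, h2.eq hB]
  · obtain ⟨h1, h2⟩ := hp.of_union hc (hU.trans (union_comm _ _)) (hI.trans (inter_comm _ _)) hm
      (isProj_proj hB K u)
    rw [h1.eq hB, h2.eq hB, add_comm]

theorem continuous_proj (K : ConvexBody E) : Continuous (oproj B K) := by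
  have hc := coer_of_norm_lt hB
  refine (LipschitzWith.of_dist_le_mul (K := (1 - ‖1 - B‖)⁻¹.toNNReal)
    fun u v => ?_).continuous
  have := (isProj_proj hB K v).lipschitz hc (isProj_proj hB K u)
  rw [dist_eq_norm, dist_eq_norm, Real.coe_toNNReal _ (inv_nonneg.2 hc.1.le), inv_mul_eq_div,
    le_div_iff₀ hc.1, mul_comm]
  exact this

theorem continuous_proj_body (u : E) : Continuous fun K : ConvexBody E => oproj B K u := by
  have hc := coer_of_norm_lt hB
  have hc1 := hc.1
  refine continuous_iff_continuousAt.2 fun K => ?_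
  obtain ⟨R, hR, hK⟩ := exists_bound K
  set C := ‖u - B (oproj B K u)‖ + (‖u‖ + ‖B‖ * (R + 1))
  have hb : ∀ᶠ L in 𝓝 K, ‖oproj B L u - oproj B K u‖ ^ 2 ≤ C * dist L K / (1 - ‖1 - B‖) := by
    filter_upwards [Metric.ball_mem_nhds K one_pos] with L hL
    rw [le_div_iff₀ hc.1, mul_comm, dist_comm]
    refine ((isProj_proj hB K u).norm_sq_le hc (isProj_proj hB L u)).trans ?_
    refine mul_le_mul_of_nonneg_right ?_ dist_nonneg
    obtain ⟨y, hy, hy1⟩ := exists_norm_sub_le L K (isProj_proj hB L u).1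
    have h1 : ‖oproj B L u‖ ≤ R + 1 := by
      have := hK y hy
      have h3 := norm_add_le (oproj B L u - y) y
      rw [sub_add_cancel] at h3
      have := Metric.mem_ball.1 hL
      linarith
    have h2 := norm_sub_le u (B (oproj B L u))
    have h3 := B.le_opNorm (oproj B L u)
    have h4 := mul_le_mul_of_nonneg_left h1 (norm_nonneg B)
    simp only [C]; linarith
  have ht : Tendsto (fun L => C * dist L K / (1 - ‖1 - B‖)) (𝓝 K) (𝓝 0) := by
    have : Continuous fun L => C * dist L K / (1 - ‖1 - B‖) := by fun_prop
    simpa using this.tendsto K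
  have h2 := squeeze_zero' (.of_forall fun L => sq_nonneg _) hb ht
  refine tendsto_iff_norm_sub_tendsto_zero.2 ?_
  have := h2.sqrt
  simpa using this

end

/-- A cone shaped bump function. -/
def bump (s : ℝ) (w : E) : ℝ := max 0 (s - ‖w‖)

omit [InnerProductSpace ℝ E] in
theorem continuous_bump (s : ℝ) : Continuous (bump s : E → ℝ) := by
  unfold bump; fun_prop

omit [InnerProductSpace ℝ E] in
theorem bump_nonneg (s : ℝ) (w : E) : 0 ≤ bump s w := le_max_left _ _

omit [InnerProductSpace ℝ E] in
theorem bump_le {s : ℝ} (hs : 0 ≤ s) (w : E) : bump s w ≤ s :=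
  max_le hs (by linarith [norm_nonneg w])

omit [InnerProductSpace ℝ E] in
theorem bump_eq_zero {s : ℝ} {w : E} (h : s ≤ ‖w‖) : bump s w = 0 := max_eq_left (by linarith)

theorem bump_smul {s : ℝ} (hs : 0 ≤ s) (w : E) : bump s (s • w) = s * bump 1 w := by
  rw [bump, bump, norm_smul, Real.norm_of_nonneg hs, mul_max_of_nonneg _ _ hs]; ring_nf

variable [FiniteDimensional ℝ E] [MeasurableSpace E] [BorelSpace E]

/-- The valuation obtained by integrating a bump function over the normal directions. -/
def oval (B : E →L[ℝ] E) (s : ℝ) (K : ConvexBody E) : ℂ :=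
  ((∫ u, bump s (u - B (oproj B K u)) : ℝ) : ℂ)

section
variable {B : E →L[ℝ] E} (hB : ‖1 - B‖ < 1) {s : ℝ} (hs : 0 ≤ s)
include hB hs

omit [MeasurableSpace E] [BorelSpace E] in
theorem bump_proj_le {K : ConvexBody E} {R : ℝ} (hK : ∀ x ∈ K, ‖x‖ ≤ R) (u : E) :
    bump s (u - B (oproj B K u)) ≤ (Metric.closedBall 0 (s + ‖B‖ * R)).indicator (fun _ => s) u := by
  by_cases hu : u ∈ Metric.closedBall (0 : E) (s + ‖B‖ * R)
  · rw [indicator_of_mem hu]; exact bump_le hs _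
  · rw [indicator_of_notMem hu, bump_eq_zero]
    have h2 := norm_sub_norm_le u (B (oproj B K u))
    have h3 := B.le_opNorm (oproj B K u)
    have h4 := mul_le_mul_of_nonneg_left (hK _ (isProj_proj hB K u).1) (norm_nonneg B)
    rw [mem_closedBall_zero_iff, not_le] at hu
    linarith

omit hB hs in
theorem integrable_indicator_ball (R : ℝ) :
    Integrable ((Metric.closedBall (0 : E) R).indicator (fun _ => s)) :=
  (integrable_indicator_iff Metric.isClosed_closedBall.measurableSet).2
    (integrableOn_const (isCompact_closedBall 0 R).measure_lt_top.ne)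

omit hs in
theorem aestronglyMeasurable_bump_proj (K : ConvexBody E) :
    AEStronglyMeasurable fun u => bump s (u - B (oproj B K u)) :=
  ((continuous_bump s).comp
    (continuous_id.sub (B.continuous.comp (continuous_proj hB K)))).aestronglyMeasurable

theorem integrable_bump_proj (K : ConvexBody E) :
    Integrable fun u => bump s (u - B (oproj B K u)) := by
  obtain ⟨R, hR, hK⟩ := exists_bound K
  refine (integrable_indicator_ball (s := s) (s + ‖B‖ * R)).mono'
    (aestronglyMeasurable_bump_proj hB K) (.of_forall fun u => ?_)
  rw [Real.norm_of_nonneg (bump_nonneg _ _)]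
  exact bump_proj_le hB hs hK u

theorem isVal_oval : IsVal (oval B s : ConvexBody E → ℂ) where
  union K L U I hU hI := by
    simp only [oval, ← Complex.ofReal_add]
    rw [← integral_add (integrable_bump_proj hB hs _) (integrable_bump_proj hB hs _),
      ← integral_add (integrable_bump_proj hB hs _) (integrable_bump_proj hB hs _)]
    congr 2; ext u
    exact proj_union hB hU hI u fun p => bump s (u - B p)
  cont := by
    refine Complex.continuous_ofReal.comp (continuous_iff_continuousAt.2 fun K => ?_)
    obtain ⟨R, hR, hK⟩ := exists_bound K
    refine tendsto_integral_filter_of_dominated_convergence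
      ((Metric.closedBall 0 (s + ‖B‖ * (R + 1))).indicator (fun _ => s))
      (.of_forall fun L => aestronglyMeasurable_bump_proj hB L) ?_
      (integrable_indicator_ball _) (.of_forall fun u => ?_)
    · filter_upwards [Metric.ball_mem_nhds K one_pos] with L hL
      refine .of_forall fun u => ?_
      rw [Real.norm_of_nonneg (bump_nonneg _ _)]
      refine bump_proj_le hB hs (fun x hx => ?_) u
      obtain ⟨y, hy, hy1⟩ := exists_norm_sub_le L K hx
      have := hK y hy
      have h3 := norm_add_le (x - y) y
      rw [sub_add_cancel] at h3
      have := Metric.mem_ball.1 hL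
      linarith
    · exact ((continuous_bump s).comp (continuous_const.sub
        (B.continuous.comp (continuous_proj_body hB u)))).tendsto K
  trans x K := by
    simp only [oval]
    rw [← integral_add_right_eq_self _ (B x)]
    simp only [proj_add_pt hB, map_add, add_sub_add_right_eq_sub]

omit hs in
theorem oval_rev (K : ConvexBody E) : oval B s (rev K) = oval B s K := by
  simp only [oval]
  rw [← integral_neg_eq_self]
  simp only [proj_rev hB, map_neg, bump, neg_sub_neg]
  simp only [norm_sub_rev]

end

end Oblique

end

section ObliqueKlain

variable {E : Type*} [NormedAddCommGroup E] [InnerProductSpace ℝ E]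

theorem mem_zon_ofFn {k : ℕ} (y : Fin k → E) (p : E) : p ∈ zon (List.ofFn y) ↔
    ∃ a : Fin k → ℝ, (∀ i, 0 ≤ a i ∧ a i ≤ 1) ∧ ∑ i, a i • y i = p := by
  induction k generalizing p with
  | zero =>
    rw [List.ofFn_zero, zon_nil, ← pt_zero, mem_pt]
    exact ⟨fun h => ⟨0, fun i => i.elim0, by simpa [eq_comm] using h⟩,
      fun ⟨a, _, h⟩ => by simpa [eq_comm] using h⟩
  | succ k ih =>
    rw [List.ofFn_succ, zon_cons, mem_add]
    simp only [mem_seg, ih]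
    constructor
    · rintro ⟨_, ⟨t, ht, rfl⟩, _, ⟨a, ha, rfl⟩, rfl⟩
      exact ⟨Fin.cons t a, Fin.cases ht ha, by simp [Fin.sum_univ_succ]⟩
    · rintro ⟨a, ha, rfl⟩
      exact ⟨_, ⟨a 0, ha 0, rfl⟩, _, ⟨fun i => a i.succ, fun i => ha i.succ, rfl⟩,
        (Fin.sum_univ_succ fun i => a i • y i).symm⟩

theorem IsVal.tendsto_zon {μ : ConvexBody E → ℂ} (hμ : IsVal μ) (l : List E) (K : ConvexBody E) :
    Tendsto (fun t : ℝ => ((t : ℂ) ^ l.length)⁻¹ * μ (K + zon (l.map (t • ·)))) atTop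
      (𝓝 (CVal.DL l μ K)) := by
  induction l generalizing μ K with
  | nil => simp [DL_nil, zon_nil]
  | cons v l ih =>
    have hv : CVal.DL (v :: l) μ = CVal.DL l (CVal.D v μ) := by
      rw [← DL_perm (List.perm_append_singleton v l), DL_append, DL_cons, DL_nil]
    have h0 : Tendsto (fun t : ℝ => ((t : ℂ))⁻¹) atTop (𝓝 0) := by
      have := (Complex.continuous_ofReal.tendsto 0).comp tendsto_inv_atTop_zero
      simpa [Function.comp_def] using this
    have h1 := (h0.mul (ih hμ K)).add (ih (hμ.diff v) K)
    rw [zero_mul, zero_add, ← hv] at h1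
    refine h1.congr' ?_
    filter_upwards [eventually_gt_atTop 0] with t ht
    have h2 := congrFun (hμ.D_smul_of_nonneg v ht.le) (K + zon (l.map (t • ·)))
    have ht' : (t : ℂ) ≠ 0 := by exact_mod_cast ht.ne'
    rw [List.map_cons, zon_cons, add_left_comm, add_comm (seg _),
      ← sub_add_cancel (μ (K + zon (l.map (t • ·)) + seg (t • v)))
        (μ (K + zon (l.map (t • ·))))]
    rw [show μ (K + zon (l.map (t • ·)) + seg (t • v)) - μ (K + zon (l.map (t • ·))) = _ from h2,
      List.length_cons, pow_succ]
    field_simp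
    ring

/-- The orthogonal projection to the span of an orthonormal family. -/
def onp {k : ℕ} (x : Fin k → E) : E →L[ℝ] E := ∑ i, (innerSL ℝ (x i)).smulRight (x i)

theorem onp_apply {k : ℕ} (x : Fin k → E) (u : E) : onp x u = ∑ i, inner ℝ (x i) u • x i := by
  simp [onp]

variable {k : ℕ} {x : Fin k → E} (hx : Orthonormal ℝ x)
include hx

theorem inner_onp (i : Fin k) (u : E) : inner ℝ (x i) (onp x u) = inner ℝ (x i) u := by
  rw [onp_apply, hx.inner_right_fintype]

theorem inner_sum_sub_onp (a : Fin k → ℝ) (u : E) : inner ℝ (u - onp x u) (∑ i, a i • x i) = 0 := by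
  rw [inner_sum]
  refine Finset.sum_eq_zero fun i _ => ?_
  rw [real_inner_smul_right, real_inner_comm, inner_sub_right, inner_onp hx, sub_self, mul_zero]

theorem onp_self (i : Fin k) : onp x (x i) = x i := by
  rw [onp_apply, Finset.sum_eq_single i]
  · simp [hx.1 i]
  · intro j _ hj; rw [hx.2 hj, zero_smul]
  · simp

/-- The map `(ξ, y) ↦ t B ξ + s y` for `ξ` in the span of `x`, and `y` orthogonal to it. -/
def skew {k : ℕ} (B : E →L[ℝ] E) (x : Fin k → E) (t s : ℝ) : E →L[ℝ] E :=
  t • B.comp (onp x) + s • (1 - onp x)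

omit hx in
theorem skew_apply (B : E →L[ℝ] E) (x : Fin k → E) (t s : ℝ) (u : E) :
    skew B x t s u = B (t • onp x u) + s • (u - onp x u) := by
  simp [skew]

theorem bump_skew_of_mem {B : E →L[ℝ] E} [CompleteSpace E] (hB : ‖1 - B‖ < 1) {s t : ℝ}
    (hs : 0 ≤ s) {u : E} (hu : ∀ i, inner ℝ (x i) u ∈ Icc (0 : ℝ) 1) :
    bump s (skew B x t s u - B (oproj B (zon (List.ofFn fun i => t • x i)) (skew B x t s u)))
      = s * bump 1 (u - onp x u) := by
  rw [← bump_smul hs]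
  have : IsProj B (zon (List.ofFn fun i => t • x i)) (skew B x t s u) (t • onp x u) := by
    refine ⟨(mem_zon_ofFn _ _).2 ⟨fun i => inner ℝ (x i) u, hu, ?_⟩, fun q hq => ?_⟩
    · rw [onp_apply, Finset.smul_sum]
      exact Finset.sum_congr rfl fun i _ => smul_comm _ _ _
    · obtain ⟨a, -, rfl⟩ := (mem_zon_ofFn _ _).1 hq
      rw [skew_apply, add_sub_cancel_left, real_inner_smul_left]
      have : ∑ i, a i • t • x i - t • onp x u = ∑ i, (a i * t - t * inner ℝ (x i) u) • x i := by
        simp only [onp_apply, Finset.smul_sum, sub_smul, Finset.sum_sub_distrib, mul_smul]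
      rw [this, inner_sum_sub_onp hx, mul_zero]
  rw [this.eq hB, skew_apply, add_sub_cancel_left]

theorem skew_bounds {B : E →L[ℝ] E} {c : ℝ} (hc : Coer B c) {s t : ℝ}
    (hs : 0 ≤ s) (ht : 0 ≤ t) (u : E) {p : E} (hp : p ∈ zon (List.ofFn fun i => t • x i)) :
    (∀ i, ∃ a, (0 ≤ a ∧ a ≤ 1) ∧ c * (t * abs (inner ℝ (x i) u - a)) ≤ ‖skew B x t s u - B p‖) ∧
      s * ‖u - onp x u‖ ≤ ‖skew B x t s u - B p‖ * (1 + ‖B‖ / c) := by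
  obtain ⟨a, ha, rfl⟩ := (mem_zon_ofFn _ _).1 hp
  have hv : t • onp x u - ∑ i, a i • t • x i = ∑ i, (t * (inner ℝ (x i) u - a i)) • x i := by
    simp only [onp_apply, Finset.smul_sum, mul_sub, sub_smul, Finset.sum_sub_distrib, mul_smul]
    congr 1; exact Finset.sum_congr rfl fun i _ => smul_comm _ _ _
  set v := t • onp x u - ∑ i, a i • t • x i
  have hw : skew B x t s u - B (∑ i, a i • t • x i) = B v + s • (u - onp x u) := by
    rw [skew_apply, map_sub]; abel
  rw [hw]
  have h1 : c * ‖v‖ ≤ ‖B v + s • (u - onp x u)‖ := by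
    refine hc.norm_le v ?_
    rw [inner_add_left, real_inner_smul_left, hv, inner_sum_sub_onp hx, mul_zero, add_zero]
  refine ⟨fun i => ⟨a i, ha i, (mul_le_mul_of_nonneg_left ?_ hc.1.le).trans h1⟩, ?_⟩
  · have h2 : inner ℝ (x i) v = t * (inner ℝ (x i) u - a i) := by rw [hv, hx.inner_right_fintype]
    have h3 := abs_real_inner_le_norm (x i) v
    rwa [h2, hx.1 i, one_mul, abs_mul, abs_of_nonneg ht] at h3
  · have h4 := norm_sub_le (B v + s • (u - onp x u)) (B v)
    rw [add_sub_cancel_left, norm_smul, Real.norm_of_nonneg hs] at h4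
    have h5 := B.le_opNorm v
    have h6 : ‖B‖ * ‖v‖ ≤ ‖B‖ * (‖B v + s • (u - onp x u)‖ / c) :=
      mul_le_mul_of_nonneg_left ((le_div_iff₀ hc.1).2 (by linarith)) (norm_nonneg _)
    rw [mul_add, mul_one, mul_comm _ (‖B‖ / c), div_mul_eq_mul_div]
    rw [mul_div_assoc'] at h6
    linarith

variable [FiniteDimensional ℝ E]

theorem exists_orthonormalBasis_extension : k ≤ Module.finrank ℝ E ∧
    ∃ b : OrthonormalBasis (Fin k ⊕ Fin (Module.finrank ℝ E - k)) ℝ E,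
      ∀ i, b (Sum.inl i) = x i := by
  have hk : k ≤ Module.finrank ℝ E := by
    simpa using hx.linearIndependent.fintype_card_le_finrank
  obtain ⟨b, hb⟩ := Orthonormal.exists_orthonormalBasis_extension_of_card_eq
    (𝕜 := ℝ) (E := E) (ι := Fin k ⊕ Fin (Module.finrank ℝ E - k)) (by simp [hk])
    (v := Sum.elim x fun _ => 0) (s := range Sum.inl) (by
      have : Orthonormal ℝ fun i : range (Sum.inl : Fin k → Fin k ⊕ Fin (Module.finrank ℝ E - k)) =>
          x ((Equiv.ofInjective _ Sum.inl_injective).symm i) :=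
        hx.comp _ (Equiv.injective _)
      convert this with i
      obtain ⟨_, i, rfl⟩ := i
      simp [Set.domRestrict, Equiv.ofInjective_symm_apply])
  exact ⟨hk, b, fun i => hb _ ⟨i, rfl⟩⟩

theorem det_skew (B : E →L[ℝ] E) (t s : ℝ) : LinearMap.det (skew B x t s : E →ₗ[ℝ] E)
    = t ^ k * s ^ (Module.finrank ℝ E - k) * (Matrix.of fun i j => inner ℝ (x i) (B (x j))).det := by
  obtain ⟨hk, b, hb1⟩ := exists_orthonormalBasis_extension hx
  have hb2 : ∀ j, onp x (b (Sum.inr j)) = 0 := fun j => by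
    rw [onp_apply]
    refine Finset.sum_eq_zero fun i _ => ?_
    rw [← hb1, b.orthonormal.2 (by simp), zero_smul]
  rw [← LinearMap.det_toMatrix b.toBasis]
  have : LinearMap.toMatrix b.toBasis b.toBasis (skew B x t s : E →ₗ[ℝ] E)
      = Matrix.fromBlocks (t • Matrix.of fun i j => inner ℝ (x i) (B (x j))) 0
        (Matrix.of fun i j => t * inner ℝ (b (Sum.inr i)) (B (x j))) (s • 1) := by
    ext i j
    rw [LinearMap.toMatrix_apply, OrthonormalBasis.coe_toBasis, OrthonormalBasis.coe_toBasis_repr_apply,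
      OrthonormalBasis.repr_apply_apply, ContinuousLinearMap.coe_coe, skew_apply]
    rcases j with j | j
    · rw [hb1, onp_self hx, sub_self, smul_zero, add_zero, map_smul, real_inner_smul_right]
      rcases i with i | i
      · simp [hb1]
      · simp
    · rw [hb2, smul_zero, map_zero, zero_add, sub_zero, real_inner_smul_right]
      rcases i with i | i
      · simp
      · simp [orthonormal_iff_ite.1 b.orthonormal, Matrix.one_apply]
  rw [this, Matrix.det_fromBlocks_zero₁₂, Matrix.det_smul, Matrix.det_smul, Matrix.det_one]
  simp
  ring

variable [MeasurableSpace E] [BorelSpace E]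

omit hx in
theorem integral_comp_clm {T : E →L[ℝ] E} (hT : LinearMap.det (T : E →ₗ[ℝ] E) ≠ 0)
    {f : E → ℝ} (hf : Continuous f) :
    ∫ u, f u = abs (LinearMap.det (T : E →ₗ[ℝ] E)) * ∫ u, f (T u) := by
  have h := Measure.map_linearMap_addHaar_eq_smul_addHaar (volume : Measure E) hT
  have h2 := integral_map (μ := (volume : Measure E)) T.continuous.measurable.aemeasurable
    (f := f) hf.aestronglyMeasurable
  rw [← h2, ← ContinuousLinearMap.coe_coe, h, integral_smul_measure, smul_eq_mul,
    ENNReal.toReal_ofReal (abs_nonneg _), abs_inv, mul_inv_cancel_left₀ (abs_ne_zero.2 hT)]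

/-- The mass of the cone bump over the unit cube spanned by `x`. -/
def mass {k : ℕ} (x : Fin k → E) : ℝ :=
  ∫ u, {u | ∀ i, inner ℝ (x i) u ∈ Icc (0 : ℝ) 1}.indicator (fun u => bump 1 (u - onp x u)) u

omit [FiniteDimensional ℝ E] [MeasurableSpace E] [BorelSpace E] in
theorem norm_le_of_skew {u : E} {a b : ℝ} (h1 : ∀ i, abs (inner ℝ (x i) u) ≤ a)
    (h2 : ‖u - onp x u‖ ≤ b) : ‖u‖ ≤ k * a + b := by
  have h3 : ‖onp x u‖ ≤ k * a := by
    rw [onp_apply]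
    refine (norm_sum_le _ _).trans ((Finset.sum_le_card_nsmul _ _ a fun i _ => ?_).trans ?_)
    · rw [norm_smul, hx.1 i, mul_one]; exact h1 i
    · simp
  have := norm_add_le (onp x u) (u - onp x u)
  rw [add_sub_cancel] at this
  linarith

theorem tendsto_oval {B : E →L[ℝ] E} (hB : ‖1 - B‖ < 1) {s : ℝ} (hs : 0 < s) :
    Tendsto (fun t : ℝ => ∫ u, bump s (skew B x t s u -
      B (oproj B (zon (List.ofFn fun i => t • x i)) (skew B x t s u)))) atTop
      (𝓝 (s * mass x)) := by
  have hc := coer_of_norm_lt hB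
  set c := 1 - ‖1 - B‖
  have hc1 := hc.1
  rw [mass, ← integral_const_mul]
  refine tendsto_integral_filter_of_dominated_convergence
    ((Metric.closedBall 0 (k * (1 + s / c) + (1 + ‖B‖ / c))).indicator (fun _ => s))
    (.of_forall fun t => ?_) ?_ (integrable_indicator_ball _) (.of_forall fun u => ?_)
  · exact ((continuous_bump s).comp ((skew B x t s).continuous.sub (B.continuous.comp
      ((continuous_proj hB _).comp (skew B x t s).continuous)))).aestronglyMeasurable
  · filter_upwards [eventually_ge_atTop 1] with t ht
    refine .of_forall fun u => ?_
    rw [Real.norm_of_nonneg (bump_nonneg _ _)]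
    obtain ⟨h1, h2⟩ := skew_bounds hx hc hs.le (zero_le_one.trans ht) u
      (isProj_proj hB (zon (List.ofFn fun i => t • x i)) (skew B x t s u)).1
    by_cases hu : u ∈ Metric.closedBall (0 : E) (k * (1 + s / c) + (1 + ‖B‖ / c))
    · rw [indicator_of_mem hu]; exact bump_le hs.le _
    · rw [indicator_of_notMem hu, bump_eq_zero]
      by_contra! hw
      refine hu (mem_closedBall_zero_iff.2 (norm_le_of_skew hx (fun i => ?_) ?_))
      · obtain ⟨a, ha, h3⟩ := h1 i
        have h4 : abs (inner ℝ (x i) u - a) ≤ s / c := by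
          rw [le_div_iff₀ hc1]
          have := mul_le_mul_of_nonneg_right ht (abs_nonneg (inner ℝ (x i) u - a))
          nlinarith
        have := abs_le.1 h4
        refine abs_le.2 ⟨by linarith, by linarith⟩
      · have h3 : ‖u - onp x u‖ * s ≤ (1 + ‖B‖ / c) * s := by
          have : 0 ≤ 1 + ‖B‖ / c := by positivity
          nlinarith
        exact le_of_mul_le_mul_right h3 hs
  · by_cases hu : ∀ i, inner ℝ (x i) u ∈ Icc (0 : ℝ) 1
    · rw [indicator_of_mem (by exact hu)]
      exact tendsto_const_nhds.congr fun t => (bump_skew_of_mem hx hB hs.le hu).symm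
    · rw [indicator_of_notMem (by exact hu), mul_zero]
      refine tendsto_const_nhds.congr' ?_
      push Not at hu
      obtain ⟨i, hi⟩ := hu
      obtain ⟨d, hd, hd'⟩ : ∃ d > 0, ∀ a : ℝ, 0 ≤ a ∧ a ≤ 1 → d ≤ abs (inner ℝ (x i) u - a) := by
        rw [mem_Icc, not_and_or, not_le, not_le] at hi
        rcases hi with hi | hi
        · exact ⟨-inner ℝ (x i) u, by linarith, fun a ha => le_abs.2 (.inr (by linarith))⟩
        · exact ⟨inner ℝ (x i) u - 1, by linarith, fun a ha => le_abs.2 (.inl (by linarith))⟩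
      filter_upwards [eventually_ge_atTop (s / (c * d))] with t ht
      rw [div_le_iff₀ (by positivity)] at ht
      have ht0 : 0 ≤ t := by
        by_contra! h
        have := mul_pos hc1 hd
        nlinarith
      obtain ⟨h1, -⟩ := skew_bounds hx hc hs.le ht0 u
        (isProj_proj hB (zon (List.ofFn fun i => t • x i)) (skew B x t s u)).1
      obtain ⟨a, ha, h3⟩ := h1 i
      refine (bump_eq_zero (le_trans ?_ h3)).symm
      have := mul_le_mul_of_nonneg_left (hd' a ha) (mul_nonneg hc1.le ht0)
      linarith

theorem DL_oval {B : E →L[ℝ] E} (hB : ‖1 - B‖ < 1) {s : ℝ} (hs : 0 < s)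
    (hdet : (Matrix.of fun i j => inner ℝ (x i) (B (x j))).det ≠ 0) :
    DL (List.ofFn x) (oval B s) 0 = ((s ^ (Module.finrank ℝ E - k + 1) *
      abs (Matrix.of fun i j => inner ℝ (x i) (B (x j))).det * mass x : ℝ) : ℂ) := by
  have h1 := (isVal_oval hB hs.le).tendsto_zon (List.ofFn x) 0
  have h2 := (tendsto_oval hx hB hs).const_mul (s ^ (Module.finrank ℝ E - k) *
      abs (Matrix.of fun i j => inner ℝ (x i) (B (x j))).det)
  have h3 := (Complex.continuous_ofReal.tendsto _).comp h2
  refine tendsto_nhds_unique h1 ((h3.congr' ?_).trans (le_of_eq ?_))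
  · filter_upwards [eventually_gt_atTop 0] with t ht
    have hd := det_skew hx B t s
    have hd0 : LinearMap.det (skew B x t s : E →ₗ[ℝ] E) ≠ 0 := by rw [hd]; positivity
    have := integral_comp_clm hd0
      (f := fun u => bump s (u - B (oproj B (zon (List.ofFn fun i => t • x i)) u)))
      ((continuous_bump s).comp
        (continuous_id.sub (B.continuous.comp (continuous_proj hB _))))
    rw [Function.comp_apply, zero_add, List.map_ofFn, List.length_ofFn, oval,
      show (List.ofFn ((fun v => t • v) ∘ x)) = List.ofFn fun i => t • x i from rfl, this, hd,
      abs_mul, abs_of_pos (show 0 < t ^ k * s ^ (Module.finrank ℝ E - k) by positivity)]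
    push_cast
    have : (t : ℂ) ≠ 0 := by exact_mod_cast ht.ne'
    field_simp
  · congr 2; rw [pow_succ]; ring

theorem mass_pos : 0 < mass x := by
  rw [mass]
  have hcl : IsClosed {u | ∀ i, inner ℝ (x i) u ∈ Icc (0 : ℝ) 1} := by
    simp only [Set.ofPred_forall]
    exact isClosed_iInter fun i => isClosed_Icc.preimage (by fun_prop)
  have hcont : Continuous fun u : E => bump 1 (u - onp x u) :=
    (continuous_bump 1).comp (by fun_prop)
  have hnn : ∀ u, 0 ≤ {u | ∀ i, inner ℝ (x i) u ∈ Icc (0 : ℝ) 1}.indicator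
      (fun u => bump 1 (u - onp x u)) u := fun u => indicator_nonneg (fun _ _ => bump_nonneg _ _) _
  rw [integral_pos_iff_support_of_nonneg hnn]
  · let O : Set E := (⋂ i, (fun u => inner ℝ (x i) u) ⁻¹' Ioo 0 1) ∩ {u | ‖u - onp x u‖ < 1}
    have hO : IsOpen O := (isOpen_iInter_of_finite fun i => isOpen_Ioo.preimage (by fun_prop)).inter
      (isOpen_lt (by fun_prop) continuous_const)
    have hne : O.Nonempty := by
      refine ⟨∑ i, (1 / 2 : ℝ) • x i, mem_iInter.2 fun i => ?_, ?_⟩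
      · rw [mem_preimage, hx.inner_right_fintype]; norm_num
      · have : onp x (∑ i, (1 / 2 : ℝ) • x i) = ∑ i, (1 / 2 : ℝ) • x i := by
          rw [map_sum]; exact Finset.sum_congr rfl fun i _ => by rw [map_smul, onp_self hx]
        rw [Set.mem_ofPred_eq, this, sub_self, norm_zero]; exact one_pos
    refine (hO.measure_pos volume hne).trans_le (measure_mono fun u hu => ?_)
    rw [Function.mem_support, indicator_of_mem]
    · have : ‖u - onp x u‖ < 1 := hu.2
      exact (lt_max_of_lt_right (by linarith)).ne'
    · exact fun i => Ioo_subset_Icc_self (mem_iInter.1 hu.1 i)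
  · refine (integrable_indicator_ball (s := 1) (k * 1 + 1)).mono'
      (hcont.aestronglyMeasurable.indicator hcl.measurableSet) (.of_forall fun u => ?_)
    rw [Real.norm_of_nonneg (hnn u)]
    by_cases hu : u ∈ Metric.closedBall (0 : E) (k * 1 + 1)
    · rw [indicator_of_mem hu]
      exact indicator_le_self' (fun _ _ => bump_nonneg _ _) u |>.trans (bump_le zero_le_one _)
    · rw [indicator_of_notMem hu]
      refine indicator_apply_le' (fun hm => ?_) fun _ => le_rfl
      refine (bump_eq_zero ?_).le
      by_contra! hw
      exact hu (mem_closedBall_zero_iff.2 (norm_le_of_skew hx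
        (fun i => abs_le.2 ⟨by linarith [(hm i).1], (hm i).2⟩) hw.le))

theorem mass_eq {y : Fin k → E} (hy : Orthonormal ℝ y) : mass y = mass x := by
  obtain ⟨g, hg⟩ : ∃ g : E ≃ₗᵢ[ℝ] E, ∀ i, g (x i) = y i := by
    obtain ⟨-, b, hb⟩ := exists_orthonormalBasis_extension hx
    obtain ⟨-, b', hb'⟩ := exists_orthonormalBasis_extension hy
    exact ⟨b.equiv b' (Equiv.refl _), fun i => by simp [← hb, ← hb']⟩
  have h1 : ∀ i u, inner ℝ (y i) (g u) = inner ℝ (x i) u := fun i u => by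
    rw [← hg, g.inner_map_map]
  rw [mass, ← g.measurePreserving.integral_comp g.toHomeomorph.measurableEmbedding, mass]
  congr 1; ext u
  have h2 : onp y (g u) = g (onp x u) := by
    simp only [onp_apply, h1, map_sum, map_smul, hg]
  simp only [indicator, Set.mem_ofPred_eq, h1, h2, ← map_sub, bump, g.norm_map]
  split_ifs <;> rfl

end ObliqueKlain

section Realize

variable {E : Type*} [NormedAddCommGroup E] [InnerProductSpace ℝ E]

/-- The matrix of `B` compressed to the span of an orthonormal family. -/
def gram {k : ℕ} (x : Fin k → E) (B : E →L[ℝ] E) : Matrix (Fin k) (Fin k) ℝ :=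
  Matrix.of fun i j => inner ℝ (x i) (B (x j))

theorem gram_one {k : ℕ} {x : Fin k → E} (hx : Orthonormal ℝ x) : gram x 1 = 1 := by
  ext i j
  simp [gram, orthonormal_iff_ite.1 hx, Matrix.one_apply]

theorem gram_add {k : ℕ} (x : Fin k → E) (A B : E →L[ℝ] E) :
    gram x (A + B) = gram x A + gram x B := by
  ext i j; simp [gram, inner_add_right]

theorem gram_smul {k : ℕ} (x : Fin k → E) (t : ℝ) (B : E →L[ℝ] E) :
    gram x (t • B) = t • gram x B := by
  ext i j; simp [gram, real_inner_smul_right]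

theorem det_gram_ne_zero {k : ℕ} {x : Fin k → E} (hx : Orthonormal ℝ x) {B : E →L[ℝ] E}
    (hB : ‖1 - B‖ < 1) : (gram x B).det ≠ 0 := by
  intro h0
  obtain ⟨v, hv, h⟩ := Matrix.exists_mulVec_eq_zero_iff.2 h0
  have h1 : inner ℝ (B (∑ i, v i • x i)) (∑ i, v i • x i) = 0 := by
    rw [inner_sum]
    refine Finset.sum_eq_zero fun i _ => ?_
    rw [real_inner_smul_right, real_inner_comm, map_sum, inner_sum]
    have := congrFun h i
    simp only [Matrix.mulVec, dotProduct, gram, Matrix.of_apply, Pi.zero_apply] at this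
    simp only [map_smul, real_inner_smul_right, mul_comm (v _)]
    rw [this, zero_mul]
  have hc := coer_of_norm_lt hB
  have h2 := hc.2 (∑ i, v i • x i)
  rw [h1] at h2
  have h3 : ‖∑ i, v i • x i‖ ^ 2 = 0 := by
    have := hc.1; have := sq_nonneg ‖∑ i, v i • x i‖; nlinarith
  refine hv (funext fun i => ?_)
  exact Fintype.linearIndependent_iff.1 hx.linearIndependent v
    (norm_eq_zero.1 (by simpa using h3)) i

theorem det_gram_pos {k : ℕ} {x : Fin k → E} (hx : Orthonormal ℝ x) {B : E →L[ℝ] E}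
    (hB : ‖1 - B‖ < 1) : 0 < (gram x B).det := by
  by_contra! h
  have hf : Continuous fun t : ℝ => (gram x (1 + t • (B - 1))).det := by
    simp only [gram_add, gram_smul]; fun_prop
  have h0 : (gram x (1 + (0 : ℝ) • (B - 1))).det = 1 := by simp [gram_one hx]
  have h1 : (gram x (1 + (1 : ℝ) • (B - 1))).det ≤ 0 := by simpa using h
  obtain ⟨t, ht, hz⟩ := intermediate_value_Icc' zero_le_one hf.continuousOn
    (show (0 : ℝ) ∈ Icc _ _ from ⟨h1, h0.symm ▸ zero_le_one⟩)
  refine det_gram_ne_zero hx ?_ hz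
  have : 1 - (1 + t • (B - 1)) = t • (1 - B) := by module
  rw [this, norm_smul, Real.norm_of_nonneg ht.1]
  nlinarith [ht.1, ht.2, norm_nonneg (1 - B)]

/-- Functions on orthonormal families arising as mixed differences of even valuations. -/
def Realized (Q : ∀ k, (Fin k → E) → ℂ) : Prop :=
  ∃ μ : ConvexBody E → ℂ, IsVal μ ∧ (∀ K, μ (rev K) = μ K) ∧
    ∀ k x, Orthonormal ℝ x → DL (List.ofFn x) μ 0 = Q k x

theorem Realized.sum {ι : Type*} (s : Finset ι) (c : ι → ℂ) {Q : ι → ∀ k, (Fin k → E) → ℂ}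
    (h : ∀ i ∈ s, Realized (Q i)) : Realized fun k x => ∑ i ∈ s, c i * Q i k x := by
  choose! μ h1 h2 h3 using h
  refine ⟨fun K => ∑ i ∈ s, c i * μ i K, IsVal.sum s fun i hi => (h1 i hi).const_mul _,
    fun K => Finset.sum_congr rfl fun i hi => by rw [h2 i hi], fun k x hx => ?_⟩
  rw [DL_sum s (List.ofFn x) fun i K => c i * μ i K]
  refine Finset.sum_congr rfl fun i hi => ?_
  rw [DL_const_mul, ← h3 i hi k x hx]

theorem Realized.congr {P Q : ∀ k, (Fin k → E) → ℂ} (h : Realized P)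
    (hPQ : ∀ k x, Orthonormal ℝ x → P k x = Q k x) : Realized Q := by
  obtain ⟨μ, h1, h2, h3⟩ := h
  exact ⟨μ, h1, h2, fun k x hx => (h3 k x hx).trans (hPQ k x hx)⟩

theorem Realized.coeff {d : ℕ} {c : Fin d → ∀ k, (Fin k → E) → ℂ} {t : Fin d → ℂ}
    (ht : Function.Injective t)
    (h : ∀ i, Realized fun k x => ∑ j : Fin d, t i ^ (j : ℕ) * c j k x) (j : Fin d) :
    Realized (c j) := by
  have hV : IsUnit (Matrix.vandermonde t).det :=
    isUnit_iff_ne_zero.2 (Matrix.det_vandermonde_ne_zero_iff.2 ht)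
  refine (Realized.sum Finset.univ (fun i => (Matrix.vandermonde t)⁻¹ j i) fun i _ => h i).congr
    fun k x _ => ?_
  have h1 : (Matrix.vandermonde t).mulVec (fun j => c j k x)
      = fun i => ∑ j : Fin d, t i ^ (j : ℕ) * c j k x := by
    ext i; simp [Matrix.mulVec, dotProduct, Matrix.vandermonde_apply]
  have h2 := congrArg (fun v => (Matrix.vandermonde t)⁻¹.mulVec v j) h1
  simp only [Matrix.mulVec_mulVec, Matrix.nonsing_inv_mul _ hV, Matrix.one_mulVec] at h2
  rw [h2]; rfl

open Polynomial in
theorem Realized.det_poly {k : ℕ} {A B : (Fin k → E) → Matrix (Fin k) (Fin k) ℂ}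
    {Q : ℂ → ∀ k, (Fin k → E) → ℂ} (hQ : ∀ ζ x, Q ζ k x = (ζ • A x + B x).det)
    (hQ0 : ∀ ζ k' x, k' ≠ k → Q ζ k' x = 0)
    {δ : ℝ} (hδ : 0 < δ) (h : ∀ t : ℝ, 0 < t → t < δ → Realized (Q t)) :
    (∀ ζ, Realized (Q ζ)) ∧ ∀ P : ∀ k, (Fin k → E) → ℂ, (∀ x, P k x = (A x).det) →
      (∀ k' x, k' ≠ k → P k' x = 0) → Realized P := by
  let p : (Fin k → E) → ℂ[X] := fun x => ((X : ℂ[X]) • (A x).map C + (B x).map C).det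
  have hd : ∀ x, (p x).natDegree < k + 1 := fun x => by
    have := natDegree_det_X_add_C_le (A x) (B x)
    simp only [Fintype.card_fin] at this
    exact Nat.lt_succ_of_le this
  have he : ∀ x ζ, ∑ j : Fin (k + 1), ζ ^ (j : ℕ) * (p x).coeff j = (ζ • A x + B x).det := by
    intro x ζ
    rw [Fin.sum_univ_eq_sum_range (fun j => ζ ^ j * (p x).coeff j) (k + 1)]
    have h1 := eval_eq_sum_range' (hd x) ζ
    simp only [mul_comm (_ ^ _)]
    rw [← h1, ← coe_evalRingHom, RingHom.map_det]
    congr 1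
    ext i j; simp; ring
  let c : Fin (k + 1) → ∀ k, (Fin k → E) → ℂ := fun j k' x =>
    if e : k' = k then (p (x ∘ Fin.cast e.symm)).coeff j else 0
  have hc : ∀ ζ, (fun k' x => ∑ j : Fin (k + 1), ζ ^ (j : ℕ) * c j k' x) = Q ζ := fun ζ => by
    funext k' x
    by_cases e : k' = k
    · subst e
      simp only [c, dif_pos]
      rw [hQ, ← he]; rfl
    · simp [c, e, hQ0 ζ k' x e]
  have hr := Realized.coeff (c := c) (t := fun i => ((δ * ((i + 1 : ℕ) / (k + 2 : ℕ)) : ℝ) : ℂ))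
    (fun i j hij => by
      have h1 := Complex.ofReal_injective hij
      have h2 := mul_left_cancel₀ hδ.ne' h1
      rw [div_left_inj' (by positivity)] at h2
      exact Fin.ext (by simpa using h2)) fun i => by
    rw [hc]
    refine h _ (by positivity) (mul_lt_of_lt_one_right hδ ?_)
    rw [div_lt_one (by positivity)]
    exact_mod_cast by omega
  refine ⟨fun ζ => (Realized.sum Finset.univ (fun j : Fin (k + 1) => ζ ^ (j : ℕ))
    fun j _ => hr j).congr fun k' x _ => congrFun (congrFun (hc ζ) k') x, fun P h1 h2 =>
      (hr (Fin.last k)).congr fun k' x _ => ?_⟩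
  by_cases e : k' = k
  · subst e
    have := coeff_det_X_add_C_card (A x) (B x)
    rw [Fintype.card_fin] at this
    rw [h1, ← this]
    simp only [c, dif_pos]; rfl
  · simp [c, e, h2 k' x e]

variable [FiniteDimensional ℝ E] [MeasurableSpace E] [BorelSpace E]

theorem realized_det_gram {B : E →L[ℝ] E} (hB : ‖1 - B‖ < 1) (k : ℕ) :
    Realized fun k' (x : Fin k' → E) => if k' = k then (((gram x B).det : ℝ) : ℂ) else 0 := by
  set N := Module.finrank ℝ E
  by_cases hk : ∃ x₀ : Fin k → E, Orthonormal ℝ x₀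
  swap
  · refine ⟨fun _ => 0, ⟨by simp, continuous_const, by simp⟩, by simp, fun k' x hx => ?_⟩
    have : k' ≠ k := by rintro rfl; exact hk ⟨x, hx⟩
    simp only [if_neg this]
    have := DL_const_mul (List.ofFn x) 0 fun _ : ConvexBody E => (0 : ℂ)
    simp only [mul_zero, zero_mul] at this
    rw [this]
  obtain ⟨x₀, hx₀⟩ := hk
  have hkN := (exists_orthonormalBasis_extension hx₀).1
  let c : Fin (N + 2) → ∀ k', (Fin k' → E) → ℂ := fun j k' x =>
    if N - k' + 1 = j then ((((gram x B).det * mass x : ℝ)) : ℂ) else 0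
  have hr := Realized.coeff (c := c) (t := fun i => ((i + 1 : ℕ) : ℂ))
    (fun i j hij => Fin.ext (by simpa using hij)) (fun i => by
      refine ⟨oval B ((i + 1 : ℕ) : ℝ), isVal_oval hB (by positivity), oval_rev hB,
        fun k' x hx => ?_⟩
      have hp := det_gram_pos hx hB
      rw [DL_oval hx hB (by positivity) hp.ne']
      beta_reduce
      rw [Finset.sum_eq_single ⟨N - k' + 1, by omega⟩]
      · have : abs (Matrix.of fun i j => inner ℝ (x i) (B (x j))).det = (gram x B).det :=
          abs_of_pos hp
        rw [this]
        simp [c]; ring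
      · intro j _ hj
        have : N - k' + 1 ≠ j := fun e => hj (Fin.ext e.symm)
        simp [c, this]
      · simp) ⟨N - k + 1, by omega⟩
  refine (Realized.sum {()} (fun _ => ((mass x₀ : ℝ) : ℂ)⁻¹) fun _ _ => hr).congr
    fun k' x hx => ?_
  have hk' := (exists_orthonormalBasis_extension hx).1
  rw [Finset.sum_singleton]
  by_cases e : k' = k
  · subst e
    have h0 : ((mass x : ℝ) : ℂ) ≠ 0 := by exact_mod_cast (mass_pos hx).ne'
    simp only [c, if_true]
    rw [mass_eq hx hx₀]
    push_cast
    field_simp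
  · have : N - k' + 1 ≠ N - k + 1 := by omega
    simp only [c, if_neg this, e, if_false, mul_zero]

theorem realized_det (M₁ M₂ : E →L[ℝ] E) (k : ℕ) (ζ : ℂ) :
    Realized fun k' (x : Fin k' → E) => if k' = k then
      (ζ • (gram x M₁).map ((↑) : ℝ → ℂ) + (gram x M₂).map ((↑) : ℝ → ℂ)).det else 0 := by
  have hreal : ∀ (M : E →L[ℝ] E), Realized fun k' (x : Fin k' → E) =>
      if k' = k then ((gram x M).map ((↑) : ℝ → ℂ)).det else 0 := by
    intro M
    refine (Realized.det_poly (k := k) (A := fun x => (gram x M).map ((↑) : ℝ → ℂ))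
      (B := fun _ => 1) (Q := fun ζ k' x => if k' = k then
        (ζ • (gram x M).map ((↑) : ℝ → ℂ) + 1).det else 0) (fun ζ x => by simp)
      (fun ζ k' x e => by simp [e]) (δ := (‖M‖ + 1)⁻¹) (by positivity) fun t ht ht' => ?_).2 _
      (fun x => by simp) (fun k' x e => by simp [e])
    refine (realized_det_gram (B := 1 + t • M) ?_ k).congr fun k' x hx => ?_
    · rw [sub_add_cancel_left, norm_neg, norm_smul, Real.norm_of_nonneg ht.le]
      rw [lt_inv_comm₀ ht (by positivity), lt_inv_comm₀ (by positivity) ht] at ht'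
      have h1 : t * (‖M‖ + 1) < (‖M‖ + 1)⁻¹ * (‖M‖ + 1) := by gcongr
      rw [inv_mul_cancel₀ (by positivity)] at h1
      linarith
    · split_ifs
      · rw [← Complex.ofRealHom_eq_coe, RingHom.map_det, gram_add, gram_smul, gram_one hx, add_comm]
        congr 1
        ext i j; simp [Matrix.one_apply]; split_ifs <;> simp
      · rfl
  refine (Realized.det_poly (k := k) (A := fun x => (gram x M₁).map ((↑) : ℝ → ℂ))
      (B := fun x => (gram x M₂).map ((↑) : ℝ → ℂ)) (Q := fun ζ k' x => if k' = k then
        (ζ • (gram x M₁).map ((↑) : ℝ → ℂ) + (gram x M₂).map ((↑) : ℝ → ℂ)).det else 0)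
      (fun ζ x => by simp) (fun ζ k' x e => by simp [e]) one_pos fun t _ _ => ?_).1 ζ
  refine (hreal (t • M₁ + M₂)).congr fun k' x hx => ?_
  congr 2
  ext i j; simp [gram_add, gram_smul]

theorem realized_bilin (β : E →ₗ[ℝ] E →ₗ[ℝ] ℂ) (k : ℕ) :
    Realized fun k' (x : Fin k' → E) => if k' = k then
      (Matrix.of fun i j => β (x i) (x j)).det else 0 := by
  have hM : ∀ L : ℂ →ₗ[ℝ] ℝ, ∃ M : E →L[ℝ] E, ∀ x y, inner ℝ x (M y) = L (β x y) := fun L => by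
    let b := stdOrthonormalBasis ℝ E
    refine ⟨LinearMap.toContinuousLinearMap
      (∑ i, (L.comp (β (b i))).smulRight (b i) : E →ₗ[ℝ] E), fun x y => ?_⟩
    have e : L (β x y) = ∑ i, inner ℝ x (b i) * L (β (b i) y) := by
      conv_lhs => rw [← b.sum_repr' x]
      simp only [map_sum, map_smul, LinearMap.sum_apply, LinearMap.smul_apply, smul_eq_mul,
        real_inner_comm]
    rw [e]
    rw [LinearMap.coe_toContinuousLinearMap', LinearMap.sum_apply, inner_sum]
    refine Finset.sum_congr rfl fun i _ => ?_
    rw [LinearMap.smulRight_apply, real_inner_smul_right, mul_comm, LinearMap.comp_apply]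
  obtain ⟨M₁, h1⟩ := hM Complex.imLm
  obtain ⟨M₂, h2⟩ := hM Complex.reLm
  refine (realized_det M₁ M₂ k Complex.I).congr fun k' x _ => ?_
  congr 2
  ext i j
  simp only [gram, Matrix.add_apply, Matrix.smul_apply, Matrix.map_apply, Matrix.of_apply, h1, h2,
    smul_eq_mul]
  apply Complex.ext <;> simp

end Realize

section Equivariance

variable {n : ℕ}

theorem IsVal.eq_zero_of_orthonormal {E : Type*} [NormedAddCommGroup E] [InnerProductSpace ℝ E]
    [FiniteDimensional ℝ E] [MeasurableSpace E] [BorelSpace E] {μ : ConvexBody E → ℂ} (hμ : IsVal μ)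
    (he : ∀ K, μ (rev K) = μ K)
    (h : ∀ k (x : Fin k → E), Orthonormal ℝ x → CVal.DL (List.ofFn x) μ 0 = 0) : μ = 0 := by
  refine hμ.eq_zero_of_DL he fun l => ?_
  have hle : Module.finrank ℝ (spanL l) ≤ l.length := by
    classical
    have := finrank_span_finset_le_card (R := ℝ) l.toFinset
    rw [List.coe_toFinset] at this
    exact this.trans l.toFinset_card_le
  rcases hle.lt_or_eq with hl | hl
  · rw [hμ.DL_eq_zero_of_finrank_lt hl]
    rfl
  let b := stdOrthonormalBasis ℝ (spanL l)
  have hb : Orthonormal ℝ fun i => (b i : E) := b.orthonormal.comp_linearIsometry (spanL l).subtypeₗᵢ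
  obtain ⟨c, hc⟩ := hμ.exchange l.length l (List.ofFn fun i => (b i : E)) rfl (by simp [hl])
    fun x hx => by
      have hx' : x ∈ spanL l := Submodule.subset_span hx
      have := congrArg (fun y : spanL l => (y : E)) (b.sum_repr ⟨x, hx'⟩)
      simp only [Submodule.coe_sum, Submodule.coe_smul] at this
      rw [← this]
      exact Submodule.sum_mem _ fun i _ => Submodule.smul_mem _ _
        (Submodule.subset_span ((List.mem_ofFn' _ _).2 ⟨i, rfl⟩))
  rw [hc]
  beta_reduce
  rw [h _ _ hb, mul_zero]

/-- `μ` transforms under the unitary group by the function `χ` of the determinant. -/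
def Equivariant (χ : ℂ → ℂ) (μ : ConvexBody (Cn n) → ℂ) : Prop :=
  ∀ g ∈ Matrix.unitaryGroup (Fin n) ℂ, ∀ K, μ (lmap (act g) K) = χ g.det * μ K

theorem Equivariant.isSU {χ : ℂ → ℂ} {μ : ConvexBody (Cn n) → ℂ} (h : Equivariant χ μ)
    (hμ : IsVal μ) (hχ : χ 1 = 1) : IsSU μ :=
  ⟨hμ, fun g hg K => by
    obtain ⟨h1, h2⟩ := Matrix.mem_specialUnitaryGroup_iff.1 hg
    rw [h g h1, h2, hχ, one_mul]⟩

theorem inner_act {g : Matrix (Fin n) (Fin n) ℂ} (hg : g ∈ Matrix.unitaryGroup (Fin n) ℂ)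
    (x y : Cn n) : inner ℂ (act g x) (act g y) = inner ℂ x y := by
  rw [act_apply, act_apply, Matrix.toLpLin_apply, Matrix.toLpLin_apply,
    EuclideanSpace.inner_eq_star_dotProduct, EuclideanSpace.inner_eq_star_dotProduct,
    Matrix.star_mulVec, dotProduct_comm, ← Matrix.dotProduct_mulVec, Matrix.mulVec_mulVec,
    ← Matrix.star_eq_conjTranspose, Matrix.mem_unitaryGroup_iff'.1 hg, Matrix.one_mulVec,
    dotProduct_comm]

theorem orthonormal_act {g : Matrix (Fin n) (Fin n) ℂ} (hg : g ∈ Matrix.unitaryGroup (Fin n) ℂ)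
    {k : ℕ} {x : Fin k → Cn n} (hx : Orthonormal ℝ x) : Orthonormal ℝ fun i => act g (x i) := by
  rw [orthonormal_iff_ite] at hx ⊢
  intro i j
  rw [← hx i j, real_inner_Cn, real_inner_Cn, inner_act hg]

theorem Realized.exists_equivariant {Q : ∀ k, (Fin k → Cn n) → ℂ} (hr : Realized Q) {χ : ℂ → ℂ}
    (hQ : ∀ g ∈ Matrix.unitaryGroup (Fin n) ℂ, ∀ k (x : Fin k → Cn n), Orthonormal ℝ x →
      Q k (fun i => act g (x i)) = χ g.det * Q k x) :
    ∃ μ, IsVal μ ∧ Equivariant χ μ ∧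
      ∀ k x, Orthonormal ℝ x → DL (List.ofFn x) μ 0 = Q k x := by
  obtain ⟨μ, h1, h2, h3⟩ := hr
  refine ⟨μ, h1, fun g hg K => ?_, h3⟩
  have hv := (h1.comp_lmap (act g)).sub (h1.const_mul (χ g.det))
  refine sub_eq_zero.1 (congrFun (hv.eq_zero_of_orthonormal (fun K => ?_) fun k x hx => ?_) K)
  · have : lmap (act g) (rev K) = rev (lmap (act g) K) := by
      rw [rev, rev, lmap_lmap, lmap_lmap]
      congr 1
      ext x : 1
      simp
    rw [this, h2, h2]
  · rw [DL_sub]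
    beta_reduce
    rw [DL_lmap, DL_const_mul, lmap_zero, List.map_ofFn]
    beta_reduce
    rw [h3 k x hx]
    exact sub_eq_zero.2 ((h3 k _ (orthonormal_act hg hx)).trans (hQ g hg k x hx))

/-- The matrix whose rows are the coordinates of the given vectors. -/
def coords {k : ℕ} (x : Fin k → Cn n) : Matrix (Fin k) (Fin n) ℂ := Matrix.of fun i c => x i c

theorem coords_act (g : Matrix (Fin n) (Fin n) ℂ) {k : ℕ} (x : Fin k → Cn n) :
    coords (fun i => act g (x i)) = coords x * g.transpose := by
  ext i c
  simp [coords, act_apply, Matrix.toLpLin_apply, Matrix.mulVec, dotProduct, Matrix.mul_apply,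
    mul_comm]

theorem det_cons_cons {k : ℕ} (M : Matrix (Fin (k + 2)) (Fin (k + 2)) ℂ)
    (h0 : ∀ j : Fin k, M 0 j.succ.succ = 0) (h1 : ∀ j : Fin k, M 1 j.succ.succ = 0) :
    M.det = (M 0 0 * M 1 1 - M 0 1 * M 1 0) *
      (M.submatrix (fun i : Fin k => i.succ.succ) fun i : Fin k => i.succ.succ).det := by
  have h1' : ∀ j : Fin k, M (Fin.succ 0) j.succ.succ = 0 := h1
  rw [Matrix.det_succ_row_zero, Fin.sum_univ_succ, Fin.sum_univ_succ, Finset.sum_eq_zero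
    (fun j _ => by rw [h0]; ring), Matrix.det_succ_row_zero, Matrix.det_succ_row_zero,
    Fin.sum_univ_succ, Fin.sum_univ_succ, Finset.sum_eq_zero, Finset.sum_eq_zero]
  · simp [Matrix.submatrix_submatrix, Function.comp_def]
    ring
  · intro j _
    simp [h1]
  · intro j _
    simp [h1]

/-- The real part plus `κ` times the imaginary part of the Hermitian product. -/
def hermForm (κ : ℝ) : Cn n →ₗ[ℝ] Cn n →ₗ[ℝ] ℂ :=
  LinearMap.mk₂ ℝ (fun x y => (((inner ℂ x y).re + κ * (inner ℂ x y).im : ℝ) : ℂ))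
    (fun x y z => by simp only [inner_add_left, Complex.add_re, Complex.add_im]; push_cast; ring)
    (fun c x y => by
      rw [← Complex.coe_smul c x, inner_smul_left]
      simp; ring)
    (fun x y z => by simp only [inner_add_right, Complex.add_re, Complex.add_im]; push_cast; ring)
    (fun c x y => by
      rw [← Complex.coe_smul c y, inner_smul_right]
      simp; ring)

theorem hermForm_apply (κ : ℝ) (x y : Cn n) :
    hermForm κ x y = (((inner ℂ x y).re + κ * (inner ℂ x y).im : ℝ) : ℂ) := rfl

theorem hermForm_vecs (κ : ℝ) {Cs Rs : List (Cn n)} (h : ON (Cs ++ Rs)) :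
    Orthonormal ℝ (vecs [] Cs Rs).get ∧ (Matrix.of fun i j => hermForm κ
      ((vecs [] Cs Rs).get i) ((vecs [] Cs Rs).get j)).det = (1 + κ ^ 2 : ℂ) ^ Cs.length := by
  suffices H : ((∀ x ∈ vecs [] Cs Rs, ‖x‖ = 1) ∧
      (vecs [] Cs Rs).Pairwise fun x y => inner ℝ x y = 0) ∧ (Matrix.of fun i j => hermForm κ
      ((vecs [] Cs Rs).get i) ((vecs [] Cs Rs).get j)).det = (1 + κ ^ 2 : ℂ) ^ Cs.length by
    obtain ⟨⟨h1, h2⟩, h3⟩ := H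
    refine ⟨⟨fun i => h1 _ (List.get_mem _ i), fun i j hij => ?_⟩, h3⟩
    rcases lt_or_gt_of_ne hij with hlt | hlt
    · exact List.pairwise_iff_get.1 h2 i j hlt
    · exact inner_eq_zero_symm.1 (List.pairwise_iff_get.1 h2 j i hlt)
  induction Cs with
  | nil =>
    have h' : ON Rs := h
    refine ⟨⟨h'.1, h'.2.imp fun {x y} hxy => by rw [real_inner_Cn, hxy]; rfl⟩, ?_⟩
    have : (Matrix.of fun i j => hermForm κ (Rs.get i) (Rs.get j)) = 1 := by
      ext i j
      rw [Matrix.of_apply, hermForm_apply, orthonormal_iff_ite.1 h'.orthonormal i j,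
        Matrix.one_apply]
      split_ifs <;> simp
    exact (congrArg Matrix.det this).trans (Matrix.det_one.trans (pow_zero _).symm)
  | cons u Cs ih =>
    obtain ⟨hu, ho, h'⟩ := on_cons.1 h
    obtain ⟨⟨h1, h2⟩, h3⟩ := ih h'
    have hx : ∀ x ∈ vecs [] Cs Rs, inner ℂ u x = 0 := orth_vecs ho
    have huu : inner ℂ u u = 1 := by rw [inner_self_eq_norm_sq_to_K, hu]; simp
    have hs : vecs [] (u :: Cs) Rs = Complex.I • u :: u :: vecs [] Cs Rs := rfl
    rw [hs]
    refine ⟨⟨?_, ?_⟩, ?_⟩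
    · simp only [List.forall_mem_cons]
      exact ⟨by rw [norm_smul, hu]; simp, hu, h1⟩
    · simp only [List.pairwise_cons, List.forall_mem_cons]
      refine ⟨⟨?_, fun x hx' => ?_⟩, fun x hx' => ?_, h2⟩
      · rw [real_inner_I_smul, huu]; simp
      · rw [real_inner_I_smul, hx x hx']; simp
      · rw [real_inner_Cn, hx x hx']; simp
    · refine (det_cons_cons _ (fun j => ?_) fun j => ?_).trans ?_
      · have := hx _ (List.get_mem _ j)
        change hermForm κ (Complex.I • u) ((vecs [] Cs Rs).get j) = 0
        rw [hermForm_apply, inner_smul_left, this]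
        simp
      · have := hx _ (List.get_mem _ j)
        change hermForm κ u ((vecs [] Cs Rs).get j) = 0
        rw [hermForm_apply, this]
        simp
      · refine (congrArg₂ (· * ·) ?_ h3).trans (pow_succ' _ _).symm
        change hermForm κ (Complex.I • u) (Complex.I • u) * hermForm κ u u -
          hermForm κ (Complex.I • u) u * hermForm κ u (Complex.I • u) = _
        simp only [hermForm_apply, inner_smul_left, inner_smul_right, huu]
        simp
        ring

theorem exists_unitary_val (κ : ℝ) (k : ℕ) : ∃ μ : ConvexBody (Cn n) → ℂ, IsVal μ ∧
    Equivariant (fun _ => 1) μ ∧ ∀ q r, q + r ≤ n →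
      DL (cfg q r (std n)) μ 0 = if 2 * q + r = k then (1 + κ ^ 2 : ℂ) ^ q else 0 := by
  obtain ⟨μ, h1, h2, h3⟩ := (realized_bilin (hermForm (n := n) κ) k).exists_equivariant
    (χ := fun _ => 1) fun g hg k' x hx => by simp only [hermForm_apply, inner_act hg, one_mul]
  refine ⟨μ, h1, h2, fun q r hqr => ?_⟩
  have hON : ON ((std n).take q ++ ((std n).drop q).take r) := by
    rw [← List.take_add]
    exact ⟨fun x hx => on_std.1 x (List.mem_of_mem_take hx), on_std.2.sublist (List.take_sublist _ _)⟩
  obtain ⟨h4, h5⟩ := hermForm_vecs κ hON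
  have h6 := h3 _ _ h4
  rw [List.ofFn_get] at h6
  have hl : (vecs [] ((std n).take q) (((std n).drop q).take r)).length = 2 * q + r := by
    simp [vecs, cv, length_std]
    omega
  rw [cfg, h6, h5, hl, List.length_take, length_std, min_eq_left (by omega)]

end Equivariance

section Weights

variable {n : ℕ}

theorem ne_zero_of_DL {E : Type*} [NormedAddCommGroup E] [NormedSpace ℝ E] {μ : ConvexBody E → ℂ}
    {l : List E} (h : DL l μ 0 ≠ 0) : μ ≠ 0 := by
  rintro rfl
  have := congrFun (DL_const_mul l 0 (0 : ConvexBody E → ℂ)) 0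
  simp only [zero_mul] at this
  exact h this

theorem IsVal.star {E : Type*} [NormedAddCommGroup E] [NormedSpace ℝ E] {μ : ConvexBody E → ℂ}
    (hμ : IsVal μ) : IsVal fun K => star (μ K) where
  union K L U I h1 h2 := by rw [← star_add, hμ.union K L U I h1 h2, star_add]
  cont := hμ.cont.star
  trans x K := by rw [hμ.trans]

theorem Equivariant.star {χ : ℂ → ℂ} {μ : ConvexBody (Cn n) → ℂ} (h : Equivariant χ μ) :
    Equivariant (fun z => star (χ z)) fun K => star (μ K) :=
  fun g hg K => by
    beta_reduce
    rw [h g hg, star_mul']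

/-- The complex bilinear extension of the Euclidean product of `ℝⁿ`. -/
def bilinForm : Cn n →ₗ[ℝ] Cn n →ₗ[ℝ] ℂ :=
  LinearMap.mk₂ ℝ (fun x y => ∑ c, x c * y c)
    (fun x y z => by simp [add_mul, Finset.sum_add_distrib])
    (fun c x y => by simp [Finset.mul_sum, mul_assoc])
    (fun x y z => by simp [mul_add, Finset.sum_add_distrib])
    (fun c x y => by simp [Finset.mul_sum, mul_left_comm])

theorem det_bilinForm (x : Fin n → Cn n) :
    (Matrix.of fun i j => bilinForm (x i) (x j)).det = (coords x).det ^ 2 := by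
  rw [show (Matrix.of fun i j => bilinForm (x i) (x j)) = coords x * (coords x).transpose from rfl,
    Matrix.det_mul, Matrix.det_transpose, sq]

theorem exists_weight_two : ∃ μ : ConvexBody (Cn n) → ℂ, IsVal μ ∧ Equivariant (· ^ 2) μ ∧
    μ ≠ 0 := by
  obtain ⟨μ, h1, h2, h3⟩ := (realized_bilin (bilinForm (n := n)) n).exists_equivariant
    (χ := (· ^ 2)) fun g hg k x hx => by
      split_ifs with hk
      · subst hk
        rw [det_bilinForm, det_bilinForm, coords_act, Matrix.det_mul, Matrix.det_transpose]
        ring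
      · rw [mul_zero]
  let x : Fin n → Cn n := fun i => EuclideanSpace.single i 1
  have hx : Orthonormal ℝ x := by
    rw [orthonormal_iff_ite]
    intro i j
    rw [real_inner_Cn, EuclideanSpace.inner_single_left]
    split_ifs with h <;> simp [x, h]
  refine ⟨μ, h1, h2, ne_zero_of_DL (l := List.ofFn x) ?_⟩
  rw [h3 n x hx, if_pos rfl, det_bilinForm]
  have : coords x = 1 := by
    ext i j
    simp [coords, x, Matrix.one_apply, eq_comm]
  rw [this, Matrix.det_one]
  simp

variable {m : ℕ} (e : Fin 2 × Fin m ≃ Fin n)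

/-- A coordinate of a vector, or its complex conjugate. -/
def rowFun (l : Fin m → Fin n) (p : Fin 2 × Fin m) : Cn n →ₗ[ℝ] ℂ where
  toFun y := if p.1 = 0 then y (l p.2) else star (y (l p.2))
  map_add' y z := by split_ifs <;> simp
  map_smul' c y := by split_ifs <;> simp

def pairForm (l : Fin m → Fin n) : Cn n →ₗ[ℝ] Cn n →ₗ[ℝ] ℂ :=
  LinearMap.mk₂ ℝ (fun x y => ∑ c, x c * rowFun l (e.symm c) y)
    (fun x y z => by simp [add_mul, Finset.sum_add_distrib])
    (fun c x y => by simp [Finset.mul_sum, mul_assoc])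
    (fun x y z => by simp [mul_add, Finset.sum_add_distrib])
    (fun c x y => by simp [Finset.mul_sum, mul_left_comm])

/-- The sum of the determinants of the matrices of the functionals `rowFun`. -/
def rowDet (y : Fin 2 × Fin m → Cn n) : ℂ :=
  ∑ l : Fin m → Fin n, (Matrix.of fun p p' => rowFun l p (y p')).det

theorem rowDet_eq (y : Fin 2 × Fin m → Cn n) : rowDet y =
    ∑ σ : Equiv.Perm (Fin 2 × Fin m), (Equiv.Perm.sign σ : ℂ) *
      ∏ a, inner ℂ (y (σ (1, a))) (y (σ (0, a))) := by
  have h : ∀ l : Fin m → Fin n, (Matrix.of fun p p' => rowFun l p (y p')).det =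
      ∑ σ : Equiv.Perm (Fin 2 × Fin m), (Equiv.Perm.sign σ : ℂ) *
        ∏ a, y (σ (0, a)) (l a) * star (y (σ (1, a)) (l a)) := fun l => by
    rw [← Matrix.det_transpose, Matrix.det_apply']
    refine Finset.sum_congr rfl fun σ _ => ?_
    rw [Fintype.prod_prod_type_right]
    simp [rowFun, Fin.prod_univ_two]
  rw [rowDet, Finset.sum_congr rfl fun l _ => h l, Finset.sum_comm]
  refine Finset.sum_congr rfl fun σ _ => ?_
  rw [← Finset.mul_sum]
  congr 1
  simp only [PiLp.inner_apply]
  rw [Finset.prod_univ_sum, Fintype.piFinset_univ]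
  rfl

theorem rowDet_act {g : Matrix (Fin n) (Fin n) ℂ} (hg : g ∈ Matrix.unitaryGroup (Fin n) ℂ)
    (y : Fin 2 × Fin m → Cn n) : rowDet (fun p => act g (y p)) = rowDet y := by
  simp only [rowDet_eq, inner_act hg]

theorem sum_det_pairForm (x : Fin n → Cn n) :
    ∑ l, (Matrix.of fun i j => pairForm e l (x i) (x j)).det =
      (coords x).det * rowDet (x ∘ e) := by
  rw [rowDet, Finset.mul_sum]
  refine Finset.sum_congr rfl fun l _ => ?_
  rw [show (Matrix.of fun i j => pairForm e l (x i) (x j)) = coords x *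
    Matrix.of fun c j => rowFun l (e.symm c) (x j) from rfl, Matrix.det_mul,
    ← Matrix.det_submatrix_equiv_self e (Matrix.of fun c j => rowFun l (e.symm c) (x j))]
  congr 2
  ext p p'
  simp

/-- The coordinates of a real orthonormal basis of a real subspace of `ℂ²`. -/
def blk : Matrix (Fin 2) (Fin 2) ℂ :=
  !![1, 0; (√2)⁻¹ * Complex.I, (√2)⁻¹]

def sample (p : Fin 2 × Fin m) : Cn n :=
  WithLp.toLp 2 fun c => Matrix.blockDiagonal (fun _ : Fin m => blk) p (e.symm c)

theorem sample_apply (p q : Fin 2 × Fin m) :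
    sample e p (e q) = if p.2 = q.2 then blk p.1 q.1 else 0 := by
  simp [sample, Matrix.blockDiagonal_apply]

theorem orthonormal_sample : Orthonormal ℝ (sample e ∘ e.symm) := by
  suffices H : Orthonormal ℝ (sample e) from H.comp _ e.symm.injective
  rw [orthonormal_iff_ite]
  intro p q
  have h : inner ℂ (sample e p) (sample e q) =
      Matrix.blockDiagonal (fun _ : Fin m => blk * blk.conjTranspose) q p := by
    rw [Matrix.blockDiagonal_mul, ← Matrix.blockDiagonal_conjTranspose, PiLp.inner_apply,
      ← e.sum_comp, Matrix.mul_apply]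
    simp [sample, mul_comm]
  rw [real_inner_Cn, h, Matrix.blockDiagonal_apply]
  obtain ⟨i, a⟩ := p
  obtain ⟨j, b⟩ := q
  by_cases hab : b = a
  · fin_cases i <;> fin_cases j <;>
      simp [blk, hab, Matrix.mul_apply, Fin.sum_univ_two, Matrix.conjTranspose_apply]
    linear_combination (1 / 2 : ℝ) * Real.mul_self_sqrt (zero_le_two (α := ℝ))
  · simp [hab, Ne.symm hab]

theorem det_sample : (coords (sample e ∘ e.symm)).det ≠ 0 := by
  have : coords (sample e ∘ e.symm) =
      (Matrix.blockDiagonal fun _ : Fin m => blk).submatrix e.symm e.symm := rfl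
  rw [this, Matrix.det_submatrix_equiv_self, Matrix.det_blockDiagonal]
  exact Finset.prod_ne_zero_iff.2 fun _ _ => by simp [blk, Matrix.det_fin_two]

def blk' : Matrix (Fin 2) (Fin 2) ℂ :=
  !![1, (√2)⁻¹ * Complex.I; 1, -((√2)⁻¹ * Complex.I)]

theorem rowFun_sample (t : Fin m → Fin m) (p p' : Fin 2 × Fin m) :
    rowFun (fun a => e (0, t a)) p (sample e p') =
      Matrix.blockDiagonal (fun _ : Fin m => blk') (p.1, t p.2) p' := by
  obtain ⟨i, a⟩ := p
  obtain ⟨j, b⟩ := p'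
  simp only [rowFun, LinearMap.coe_mk, AddHom.coe_mk, sample_apply, Matrix.blockDiagonal_apply,
    eq_comm (a := b)]
  split_ifs <;> fin_cases i <;> fin_cases j <;> simp_all [blk, blk']

theorem det_rowFun_perm (τ : Equiv.Perm (Fin m)) :
    (Matrix.of fun p p' => rowFun (fun a => e (0, τ a)) p (sample e p')).det = blk'.det ^ m := by
  rw [show (Matrix.of fun p p' => rowFun (fun a => e (0, τ a)) p (sample e p')) =
    (Matrix.blockDiagonal fun _ : Fin m => blk').submatrix
      (Equiv.prodCongrRight fun _ : Fin 2 => τ) id from Matrix.ext (rowFun_sample e τ),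
    Matrix.det_permute, Equiv.Perm.sign_prodCongrRight, Matrix.det_blockDiagonal]
  simp

theorem det_rowFun_sample (l : Fin m → Fin n) :
    (Matrix.of fun p p' => rowFun l p (sample e p')).det = 0 ∨
      (Matrix.of fun p p' => rowFun l p (sample e p')).det = blk'.det ^ m := by
  by_cases h1 : ∃ a, (e.symm (l a)).1 = 1
  · obtain ⟨a, ha⟩ := h1
    refine Or.inl (Matrix.det_zero_of_row_eq (i := (0, a)) (j := (1, a)) (by simp) ?_)
    ext p
    obtain ⟨q, hq⟩ : ∃ q, l a = e (1, q) := ⟨(e.symm (l a)).2, by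
      rw [← ha, Prod.mk.eta, Equiv.apply_symm_apply]⟩
    simp only [rowFun, Matrix.of_apply, LinearMap.coe_mk, AddHom.coe_mk, hq, sample_apply]
    obtain ⟨i, b⟩ := p
    fin_cases i <;> simp [blk]
    split_ifs <;> simp
  have h2 : ∀ a, ∃ b, l a = e (0, b) := fun a =>
    ⟨(e.symm (l a)).2, by
      have : (e.symm (l a)).1 = 0 := by
        have := not_exists.1 h1 a
        omega
      rw [← this, Prod.mk.eta, Equiv.apply_symm_apply]⟩
  choose t ht using h2
  obtain rfl : l = fun a => e (0, t a) := funext ht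
  by_cases h3 : Function.Injective t
  · exact Or.inr (det_rowFun_perm e (Equiv.ofBijective t (Finite.injective_iff_bijective.1 h3)))
  · obtain ⟨a, b, hab, hne⟩ := Function.not_injective_iff.1 h3
    refine Or.inl (Matrix.det_zero_of_row_eq (i := (0, a)) (j := (0, b)) (by simpa using hne) ?_)
    ext p
    simp only [Matrix.of_apply, rowFun_sample, hab]

theorem rowDet_sample : rowDet (sample e) ≠ 0 := by
  classical
  have hD : (blk'.det ^ m : ℂ) ≠ 0 := by
    refine pow_ne_zero _ ?_
    rw [blk', Matrix.det_fin_two_of, mul_one, one_mul, ← neg_add', neg_ne_zero, ← two_mul]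
    simp
  have h : rowDet (sample e) = ∑ l : Fin m → Fin n,
      if (Matrix.of fun p p' => rowFun l p (sample e p')).det = blk'.det ^ m then
        blk'.det ^ m else 0 := Finset.sum_congr rfl fun l _ => by
    rcases det_rowFun_sample e l with h | h
    · rw [h, if_neg hD.symm]
    · rw [h, if_pos rfl]
  rw [h, ← Finset.sum_filter, Finset.sum_const, nsmul_eq_mul]
  refine mul_ne_zero (Nat.cast_ne_zero.2 (Finset.card_ne_zero_of_mem
    (a := fun a => e (0, a)) (Finset.mem_filter.2 ⟨Finset.mem_univ _, det_rowFun_perm e 1⟩))) hD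

theorem exists_weight_one (e : Fin 2 × Fin m ≃ Fin n) :
    ∃ μ : ConvexBody (Cn n) → ℂ, IsVal μ ∧ Equivariant (· ^ 1) μ ∧ μ ≠ 0 := by
  obtain ⟨μ, h1, h2, h3⟩ := (Realized.sum Finset.univ (fun _ => 1) fun l _ =>
    realized_bilin (pairForm e l) n).exists_equivariant (χ := (· ^ 1)) fun g hg k x hx => by
      simp only [one_mul, pow_one]
      split_ifs with hk
      · subst hk
        rw [sum_det_pairForm, sum_det_pairForm, coords_act, Matrix.det_mul, Matrix.det_transpose,
          ← rowDet_act hg (x ∘ e)]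
        simp only [Function.comp_def]
        ring
      · simp
  refine ⟨μ, h1, h2, ne_zero_of_DL (l := List.ofFn (sample e ∘ e.symm)) ?_⟩
  rw [h3 n _ (orthonormal_sample e)]
  simp only [one_mul, if_true]
  rw [sum_det_pairForm]
  refine mul_ne_zero (det_sample e) ?_
  simpa [Function.comp_def] using rowDet_sample e

end Weights

section Dimension

variable {n : ℕ}

theorem exists_dual {q₀ r₀ : ℕ} (h : q₀ + r₀ ≤ n) : ∃ μ : ConvexBody (Cn n) → ℂ, IsVal μ ∧
    Equivariant (fun _ => 1) μ ∧ ∀ q r, q + r ≤ n →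
      DL (cfg q r (std n)) μ 0 = if q = q₀ ∧ r = r₀ then 1 else 0 := by
  choose ν h1 h2 h3 using fun i : Fin (n + 1) => exists_unitary_val (n := n) (i : ℕ) (2 * q₀ + r₀)
  let t : Fin (n + 1) → ℂ := fun i => 1 + ((i : ℕ) : ℂ) ^ 2
  have ht : Function.Injective t := fun i j hij => by
    have h' : ((i : ℕ) : ℂ) ^ 2 = ((j : ℕ) : ℂ) ^ 2 := add_left_cancel hij
    exact Fin.ext (Nat.pow_left_injective two_ne_zero (by exact_mod_cast h'))
  have hV : IsUnit (Matrix.vandermonde t).det :=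
    (Matrix.det_vandermonde_ne_zero_iff.2 ht).isUnit
  let c : Fin (n + 1) → ℂ := fun i => (Matrix.vandermonde t)⁻¹ ⟨q₀, by omega⟩ i
  refine ⟨fun K => ∑ i, c i * ν i K, IsVal.sum _ fun i _ => (h1 i).const_mul _, fun g hg K => ?_,
    fun q r hqr => ?_⟩
  · beta_reduce
    rw [one_mul]
    exact Finset.sum_congr rfl fun i _ => by rw [h2 i g hg, one_mul]
  · have := congrFun (congrFun (Matrix.nonsing_inv_mul _ hV) ⟨q₀, by omega⟩) ⟨q, by omega⟩
    rw [Matrix.mul_apply, Matrix.one_apply] at this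
    rw [DL_sum _ _ fun i K => c i * ν i K]
    simp only [DL_const_mul, h3 _ q r hqr]
    by_cases hk : 2 * q + r = 2 * q₀ + r₀
    · have hiff : q = q₀ ∧ r = r₀ ↔ (⟨q₀, by omega⟩ : Fin (n + 1)) = ⟨q, by omega⟩ := by
        rw [Fin.mk.injEq]
        omega
      simp only [hk, if_true, hiff, ← this]
      simp [c, t, Matrix.vandermonde_apply]
    · rw [if_neg (by omega)]
      simp [hk]

theorem exists_weights (hn : Even n) : ∃ W : Fin 4 → ConvexBody (Cn n) → ℂ,
    ∀ j, IsSU (W j) ∧ W j ≠ 0 ∧ ∀ g ∈ Matrix.unitaryGroup (Fin n) ℂ, g.det ^ 5 = 1 →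
      ∀ K, W j (lmap (act g) K) = g.det ^ (j + 1 : ℕ) * W j K := by
  obtain ⟨m, rfl⟩ := even_iff_two_dvd.1 hn
  obtain ⟨μ, h1, h2, h3⟩ := exists_weight_one (finProdFinEquiv : Fin 2 × Fin m ≃ Fin (2 * m))
  obtain ⟨ν, k1, k2, k3⟩ := exists_weight_two (n := 2 * m)
  have hstar : ∀ {ξ : ConvexBody (Cn (2 * m)) → ℂ}, ξ ≠ 0 → (fun K => star (ξ K)) ≠ 0 :=
    fun h h0 => h (funext fun K => star_eq_zero.1 (congrFun h0 K))
  have hdet : ∀ g ∈ Matrix.unitaryGroup (Fin (2 * m)) ℂ, g.det ^ 5 = 1 → star g.det = g.det ^ 4 :=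
    fun g hg h5 => by
      have h := (Matrix.det_of_mem_unitary hg).1
      linear_combination g.det ^ 4 * h - star g.det * h5
  refine ⟨![μ, ν, fun K => star (ν K), fun K => star (μ K)], fun j => ?_⟩
  fin_cases j
  · exact ⟨h2.isSU h1 (by simp), h3, fun g hg _ K => h2 g hg K⟩
  · exact ⟨k2.isSU k1 (by simp), k3, fun g hg _ K => k2 g hg K⟩
  · refine ⟨k2.star.isSU k1.star (by simp), hstar k3, fun g hg h5 K => (k2.star g hg K).trans ?_⟩
    congr 1
    change star (g.det ^ 2) = g.det ^ 3
    rw [star_pow, hdet g hg h5]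
    linear_combination g.det ^ 3 * h5
  · refine ⟨h2.star.isSU h1.star (by simp), hstar h3, fun g hg h5 K => (h2.star g hg K).trans ?_⟩
    congr 1
    change star (g.det ^ 1) = g.det ^ 4
    rw [star_pow, hdet g hg h5]
    ring

theorem exists_unitary_det (hn : 2 ≤ n) {θ : ℂ} (h : ‖θ‖ = 1) :
    ∃ g ∈ Matrix.unitaryGroup (Fin n) ℂ, g.det = θ := by
  let i₀ : Fin n := ⟨0, by omega⟩
  refine ⟨Matrix.diagonal (Function.update 1 i₀ θ), ?_, ?_⟩
  · rw [Matrix.mem_unitaryGroup_iff, Matrix.star_eq_conjTranspose, Matrix.diagonal_conjTranspose,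
      Matrix.diagonal_mul_diagonal, ← Matrix.diagonal_one]
    congr 1
    funext i
    by_cases hi : i = i₀
    · subst hi
      simp [Complex.mul_conj, Complex.normSq_eq_norm_sq, h]
    · simp [hi]
  · rw [Matrix.det_diagonal, Finset.prod_update_of_mem (Finset.mem_univ _)]
    simp

theorem eq_zero_of_weights (hn : 2 ≤ n) {F : Fin 5 → ConvexBody (Cn n) → ℂ}
    (hF : ∀ j, ∀ g ∈ Matrix.unitaryGroup (Fin n) ℂ, g.det ^ 5 = 1 →
      ∀ K, F j (lmap (act g) K) = g.det ^ (j : ℕ) * F j K)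
    (h : ∀ K, ∑ j, F j K = 0) (j : Fin 5) : F j = 0 := by
  obtain ⟨θ, hθ⟩ : ∃ θ : ℂ, IsPrimitiveRoot θ 5 := ⟨_, Complex.isPrimitiveRoot_exp 5 (by norm_num)⟩
  have hinj : Function.Injective fun j : Fin 5 => θ ^ (j : ℕ) := fun i j hij =>
    Fin.ext (hθ.pow_inj i.2 j.2 hij)
  funext K
  refine congrFun (Matrix.eq_zero_of_forall_pow_sum_mul_pow_eq_zero hinj
    (v := fun j => F j K) fun s => ?_) j
  obtain ⟨g, hg, hd⟩ := exists_unitary_det hn (θ := θ ^ (s : ℕ))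
    (by rw [norm_pow, hθ.norm'_eq_one (by norm_num), one_pow])
  rw [← h (lmap (act g) K)]
  refine Finset.sum_congr rfl fun i _ => ?_
  rw [hF i g hg (by rw [hd, pow_right_comm, hθ.pow_eq_one, one_pow]), hd, pow_right_comm, mul_comm]

/-- The indices of the `U(n)`-invariant valuations. -/
abbrev Idx (n : ℕ) := Σ q : Fin (n + 1), Fin (n + 1 - q)

theorem card_idx : 2 * Fintype.card (Idx n) = (n + 1) * (n + 2) := by
  rw [Fintype.card_sigma]
  simp only [Fintype.card_fin]
  rw [Fin.sum_univ_eq_sum_range fun q => n + 1 - q]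
  induction n with
  | zero => rfl
  | succ n ih =>
    rw [Finset.sum_range_succ', mul_add]
    simp only [Nat.add_sub_add_right] at ih ⊢
    rw [ih]
    simp
    ring

/-- Evaluation of iterated differences as a linear functional. -/
def DLlin {E : Type*} [NormedAddCommGroup E] [NormedSpace ℝ E] (l : List E) :
    (ConvexBody E → ℂ) →ₗ[ℂ] ℂ where
  toFun μ := DL l μ 0
  map_add' μ ν := congrFun (DL_add l μ ν) 0
  map_smul' c μ := congrFun (DL_const_mul l c μ) 0

/-- The configurations which detect `SU(n)`-invariant valuations. -/
def testList (n : ℕ) : Idx n ⊕ Fin 4 → List (Cn n) :=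
  Sum.elim (fun i => cfg i.1 i.2 (std n)) ![lagr !₂[0, 0, 1] (std n), lagr !₂[0, 1, 1] (std n),
    quads !₂[1, 1, 0] (std n), quads !₂[1, 0, 1] (std n)]

def evalMap (n : ℕ) : SUValuations n →ₗ[ℂ] (Idx n ⊕ Fin 4 → ℂ) :=
  LinearMap.pi fun i => (DLlin (testList n i)).comp (SUValuations n).subtype

theorem evalMap_injective (h2 : 2 ≤ n) (hn : Even n) : Function.Injective (evalMap n) := by
  rw [← LinearMap.ker_eq_bot, LinearMap.ker_eq_bot']
  rintro ⟨μ, hμ⟩ h0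
  have h : ∀ i, DL (testList n i) μ 0 = 0 := congrFun h0
  refine Subtype.ext ((mem_suValuations.1 hμ).eq_zero h2 hn ⟨fun q r hqr => ?_, ?_, ?_, ?_, ?_⟩)
  · exact h (Sum.inl ⟨⟨q, by omega⟩, ⟨r, by simp; omega⟩⟩)
  · exact h (Sum.inr 0)
  · exact h (Sum.inr 1)
  · exact h (Sum.inr 2)
  · exact h (Sum.inr 3)

theorem exists_independent (h2 : 2 ≤ n) (hn : Even n) :
    ∃ v : Idx n ⊕ Fin 4 → SUValuations n, LinearIndependent ℂ v := by
  have hq : ∀ i : Idx n, (i.1 : ℕ) + i.2 ≤ n := fun i => by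
    have := i.2.2
    omega
  choose μ h1 h2' h3 using fun i : Idx n => exists_dual (hq i)
  obtain ⟨W, hW⟩ := exists_weights hn
  let v : Idx n ⊕ Fin 4 → SUValuations n := Sum.elim
    (fun i => ⟨μ i, mem_suValuations.2 ((h2' i).isSU (h1 i) rfl)⟩)
    fun j => ⟨W j, mem_suValuations.2 (hW j).1⟩
  refine ⟨v, Fintype.linearIndependent_iff.2 fun a ha => ?_⟩
  let w : ConvexBody (Cn n) → ℂ := fun K => ∑ i, a (Sum.inl i) * μ i K
  let F : Fin 5 → ConvexBody (Cn n) → ℂ := Fin.cons w fun j K => a (Sum.inr j) * W j K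
  have hF0 : ∀ K, ∑ j, F j K = 0 := fun K => by
    have := congrFun (congrArg Subtype.val ha) K
    simpa [F, w, v, Fin.sum_univ_succ] using this
  have hF := eq_zero_of_weights h2 (F := F) (fun j g hg h5 K => by
    refine Fin.cases ?_ (fun j => ?_) j
    · simp only [F, w, Fin.cons_zero, Fin.val_zero, pow_zero, one_mul]
      exact Finset.sum_congr rfl fun i _ => by rw [h2' i g hg, one_mul]
    · simp only [F, Fin.cons_succ, Fin.val_succ]
      rw [(hW j).2.2 g hg h5]
      ring) hF0
  rintro (i | j)
  · have h := congrArg (DLlin (cfg i.1 i.2 (std n))) (hF 0)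
    have h' : DL (cfg i.1 i.2 (std n)) w 0 = 0 := h.trans (map_zero _)
    rw [DL_sum _ _ fun i K => a (Sum.inl i) * μ i K] at h'
    simp only [DL_const_mul, h3 _ _ _ (hq i)] at h'
    rw [Finset.sum_eq_single i] at h'
    · simpa using h'
    · intro i' _ hi
      rw [if_neg, mul_zero]
      rintro ⟨e1, e2⟩
      refine hi ?_
      obtain ⟨q, r⟩ := i
      obtain ⟨q', r'⟩ := i'
      obtain rfl := Fin.ext e1
      obtain rfl := Fin.ext e2
      rfl
    · simp
  · obtain ⟨K, hK⟩ := Function.ne_iff.1 (hW j).2.1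
    exact (mul_eq_zero.1 (congrFun (hF j.succ) K)).resolve_right hK

end Dimension

end CVal

/-- For even `n ≥ 2`, the space of continuous, translation invariant, `SU(n)`-invariant
valuations on `ℂⁿ` is finite-dimensional of dimension `(n² + 3n + 10)/2`. -/
theorem dim_suValuations_even (n : ℕ) (hn : 2 ≤ n) (heven : Even n) :
    FiniteDimensional ℂ ↥(SUValuations n) ∧
      2 * Module.finrank ℂ ↥(SUValuations n) = n ^ 2 + 3 * n + 10 := by
  have hinj := CVal.evalMap_injective hn heven
  have hfin : FiniteDimensional ℂ ↥(SUValuations n) := FiniteDimensional.of_injective _ hinj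
  obtain ⟨v, hv⟩ := CVal.exists_independent hn heven
  have h1 := LinearMap.finrank_le_finrank_of_injective hinj
  have h2 := hv.fintype_card_le_finrank
  have h3 := CVal.card_idx (n := n)
  rw [Module.finrank_fintype_fun_eq_card] at h1
  rw [Fintype.card_sum, Fintype.card_fin] at h1 h2
  refine ⟨hfin, ?_⟩
  nlinarith

end
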